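/- Let a,b > 0 be constants such that a + b < 1/2. Then there is a constant ε = ε(a,b) > 0 such that the following holds. Suppose that, as n → ∞, d_j − d̄ = O(n^{1/2+ε}) and x_j = O(n^{1/2+ε}) uniformly for 1 ≤ j ≤ n, that X = O(n^{1+2ε}), and that min{d̄, n − d̄ − 1} ≥ n/(3a log n) for sufficiently large n. Then, as n → ∞, G(d,X) = √2 · Ĝ(d,X) · exp( 1/4 − R²/(16A²n⁴) + λX²/((1−λ)n²) − D/(2An²) + O(n^{−b}) ). -/

import Mathlib

open Filter Finset Asymptotics MeasureTheory
open scoped Classical Topology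

noncomputable section

/-- The number of simple graphs on `Fin n` with degree sequence `d` having
no edge in common with the graph `X`. -/
def gCount {n : ℕ} (d : Fin n → ℕ) (X : SimpleGraph (Fin n)) : ℕ :=
  Nat.card {H : SimpleGraph (Fin n) //
    (∀ v, Nat.card (H.neighborSet v) = d v) ∧ Disjoint H.edgeSet X.edgeSet}

/-- The degree `x_j` of vertex `j` in the graph `X`. -/
def xDeg {n : ℕ} (X : SimpleGraph (Fin n)) (j : Fin n) : ℕ :=
  Nat.card (X.neighborSet j)

/-- The number of edges of `X`. -/
def xEdges {n : ℕ} (X : SimpleGraph (Fin n)) : ℕ := Nat.card X.edgeSet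

/-- The average degree `d̄ = 2E/n`. -/
def dBar {n : ℕ} (d : Fin n → ℕ) : ℝ := (∑ j, (d j : ℝ)) / n

/-- The density `λ = d̄/(n-1)`. -/
def lamb {n : ℕ} (d : Fin n → ℕ) : ℝ := dBar d / ((n : ℝ) - 1)

/-- `A = λ(1-λ)/2`. -/
def aPar {n : ℕ} (d : Fin n → ℕ) : ℝ := lamb d * (1 - lamb d) / 2

/-- `δ_j = d_j - d̄ + λ x_j`. -/
def deltaPar {n : ℕ} (d : Fin n → ℕ) (X : SimpleGraph (Fin n)) (j : Fin n) : ℝ :=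
  (d j : ℝ) - dBar d + lamb d * (xDeg X j : ℝ)

/-- The sum over unordered pairs `{j,k}` with `X.Adj j k` of `f j * f k`. -/
def pairSum {n : ℕ} (X : SimpleGraph (Fin n)) (f : Fin n → ℝ) : ℝ :=
  (∑ j, ∑ k, if X.Adj j k then f j * f k else 0) / 2

/-- `R = Σ_j (d_j - d̄)²`. -/
def rPar {n : ℕ} (d : Fin n → ℕ) : ℝ := ∑ j, ((d j : ℝ) - dBar d)^2

/-- The naive estimate `Ĝ(d,X)`. -/
def gHat {n : ℕ} (d : Fin n → ℕ) (X : SimpleGraph (Fin n)) : ℝ :=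
  (1 - lamb d) ^ (-(xEdges X : ℝ)) *
  (lamb d ^ lamb d * (1 - lamb d) ^ (1 - lamb d)) ^ n.choose 2 *
  ∏ j, ((n - 1 - xDeg X j).choose (d j) : ℝ)

/-- The real-valued adjacency indicator. -/
def ad {n : ℕ} (H : SimpleGraph (Fin n)) (v w : Fin n) : ℝ := if H.Adj v w then 1 else 0

lemma ad_comm {n : ℕ} (H : SimpleGraph (Fin n)) (v w : Fin n) : ad H v w = ad H w v := by
  simp [ad, H.adj_comm]

lemma ad_self {n : ℕ} (H : SimpleGraph (Fin n)) (v : Fin n) : ad H v v = 0 := by simp [ad]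

lemma ad_nonneg {n : ℕ} (H : SimpleGraph (Fin n)) (v w : Fin n) : 0 ≤ ad H v w := by
  unfold ad; split_ifs <;> norm_num

lemma ad_le_one {n : ℕ} (H : SimpleGraph (Fin n)) (v w : Fin n) : ad H v w ≤ 1 := by
  unfold ad; split_ifs <;> norm_num

lemma ad_one {n : ℕ} {H : SimpleGraph (Fin n)} {v w : Fin n} (h : H.Adj v w) : ad H v w = 1 := by
  simp [ad, h]

lemma ad_zero {n : ℕ} {H : SimpleGraph (Fin n)} {v w : Fin n} (h : ¬ H.Adj v w) :
    ad H v w = 0 := by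
  simp [ad, h]

/-- A degree sequence together with a graph of forbidden edges. -/
structure Inst (n : ℕ) where
  /-- the degree sequence -/
  d : Fin n → ℕ
  /-- the forbidden graph -/
  X : SimpleGraph (Fin n)

namespace Inst

/-- The graphs with the given degrees that avoid the forbidden graph. -/
def gs {n : ℕ} (I : Inst n) : Finset (SimpleGraph (Fin n)) :=
  univ.filter fun H => (∀ v, ∑ w, ad H v w = (I.d v : ℝ)) ∧ ∀ v w, I.X.Adj v w → ¬ H.Adj v w

/-- Expectation over the uniform distribution on `I.gs`. -/
def E {n : ℕ} (I : Inst n) (f : SimpleGraph (Fin n) → ℝ) : ℝ := (∑ H ∈ I.gs, f H) / (I.gs.card : ℝ)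

/-- Edge probability. -/
def Pr {n : ℕ} (I : Inst n) (v w : Fin n) : ℝ := I.E fun H => ad H v w

/-- Degrees in the forbidden graph. -/
def x {n : ℕ} (I : Inst n) (v : Fin n) : ℝ := ∑ w, ad I.X v w

lemma mem_gs {n : ℕ} {I : Inst n} {H : SimpleGraph (Fin n)} :
    H ∈ I.gs ↔ (∀ v, ∑ w, ad H v w = (I.d v : ℝ)) ∧ ∀ v w, I.X.Adj v w → ¬ H.Adj v w := by
  simp [gs]

lemma E_add {n : ℕ} (I : Inst n) (f g : SimpleGraph (Fin n) → ℝ) :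
    I.E (fun H => f H + g H) = I.E f + I.E g := by
  simp [E, sum_add_distrib, add_div]

lemma E_sub {n : ℕ} (I : Inst n) (f g : SimpleGraph (Fin n) → ℝ) :
    I.E (fun H => f H - g H) = I.E f - I.E g := by
  simp [E, sum_sub_distrib, sub_div]

lemma E_mul_left {n : ℕ} (I : Inst n) (c : ℝ) (f : SimpleGraph (Fin n) → ℝ) :
    I.E (fun H => c * f H) = c * I.E f := by
  simp [E, ← mul_sum, mul_div_assoc]

lemma E_mul_right {n : ℕ} (I : Inst n) (c : ℝ) (f : SimpleGraph (Fin n) → ℝ) :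
    I.E (fun H => f H * c) = I.E f * c := by
  simp only [mul_comm _ c, E_mul_left]

lemma E_sum {n : ℕ} {ι : Type*} (I : Inst n) (s : Finset ι) (f : ι → SimpleGraph (Fin n) → ℝ) :
    I.E (fun H => ∑ i ∈ s, f i H) = ∑ i ∈ s, I.E (f i) := by
  simp only [E, ← sum_div]; rw [sum_comm]

lemma E_const {n : ℕ} {I : Inst n} (h : I.gs.Nonempty) (c : ℝ) : I.E (fun _ => c) = c := by
  have : (I.gs.card : ℝ) ≠ 0 := by exact_mod_cast h.card_pos.ne'
  simp only [E, sum_const, nsmul_eq_mul]; field_simp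

lemma E_congr {n : ℕ} {I : Inst n} {f g : SimpleGraph (Fin n) → ℝ} (h : ∀ H ∈ I.gs, f H = g H) :
    I.E f = I.E g := by
  unfold E; rw [sum_congr rfl h]

lemma E_mono {n : ℕ} {I : Inst n} {f g : SimpleGraph (Fin n) → ℝ} (h : ∀ H ∈ I.gs, f H ≤ g H) :
    I.E f ≤ I.E g := by
  unfold E; gcongr with H hH; exact h H hH

lemma E_nonneg {n : ℕ} {I : Inst n} {f : SimpleGraph (Fin n) → ℝ} (h : ∀ H ∈ I.gs, 0 ≤ f H) :
    0 ≤ I.E f := by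
  unfold E; have := sum_nonneg h; positivity

lemma abs_E_le_E_abs {n : ℕ} (I : Inst n) (f : SimpleGraph (Fin n) → ℝ) :
    |I.E f| ≤ I.E fun H => |f H| := by
  unfold E; rw [abs_div, Nat.abs_cast]; gcongr; exact abs_sum_le_sum_abs _ _

lemma abs_E_le {n : ℕ} {I : Inst n} {f : SimpleGraph (Fin n) → ℝ} {c : ℝ} (hc : 0 ≤ c)
    (h : ∀ H ∈ I.gs, |f H| ≤ c) : |I.E f| ≤ c := by
  by_cases hI : I.gs.Nonempty
  · exact (abs_E_le_E_abs I f).trans ((E_mono h).trans (E_const hI c).le)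
  · simp [E, not_nonempty_iff_eq_empty.1 hI, hc]

/-- A bound valid off a rare event, together with a crude bound on that event. -/
lemma abs_E_le_bad {n : ℕ} {I : Inst n} {f : SimpleGraph (Fin n) → ℝ}
    (bad : SimpleGraph (Fin n) → Prop) {c₁ c₂ : ℝ} (hc₁ : 0 ≤ c₁)
    (h₁ : ∀ H ∈ I.gs, ¬ bad H → |f H| ≤ c₁) (h₂ : ∀ H ∈ I.gs, |f H| ≤ c₂) :
    |I.E f| ≤ c₁ + c₂ * I.E (fun H => if bad H then 1 else 0) := by
  by_cases hI : I.gs.Nonempty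
  · rw [← E_mul_left]
    conv_rhs => rw [← E_const hI c₁]
    rw [← E_add]
    refine (abs_E_le_E_abs I f).trans (E_mono fun H hH => ?_)
    by_cases hb : bad H
    · simpa [hb] using (h₂ H hH).trans (by linarith)
    · simpa [hb] using h₁ H hH hb
  · simp [E, not_nonempty_iff_eq_empty.1 hI, hc₁]

lemma Pr_comm {n : ℕ} (I : Inst n) (v w : Fin n) : I.Pr v w = I.Pr w v := by
  unfold Pr; simp_rw [ad_comm _ v w]

lemma Pr_nonneg {n : ℕ} (I : Inst n) (v w : Fin n) : 0 ≤ I.Pr v w :=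
  E_nonneg fun _ _ => ad_nonneg _ _ _

lemma Pr_le_one {n : ℕ} (I : Inst n) (v w : Fin n) : I.Pr v w ≤ 1 :=
  (abs_le.1 (abs_E_le zero_le_one fun H _ => by
    rw [abs_of_nonneg (ad_nonneg _ _ _)]; exact ad_le_one _ _ _)).2

lemma Pr_self {n : ℕ} (I : Inst n) (v : Fin n) : I.Pr v v = 0 := by
  simp [Pr, ad_self, E]

lemma Pr_forbidden {n : ℕ} {I : Inst n} {v w : Fin n} (h : I.X.Adj v w) : I.Pr v w = 0 := by
  unfold Pr
  rw [E_congr (g := fun _ => 0) fun H hH => ad_zero ((mem_gs.1 hH).2 v w h)]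
  simp [E]

lemma sum_Pr {n : ℕ} {I : Inst n} (h : I.gs.Nonempty) (v : Fin n) :
    ∑ w, I.Pr v w = I.d v := by
  unfold Pr
  rw [← E_sum, ← E_const h (I.d v : ℝ)]
  exact E_congr fun H hH => (mem_gs.1 hH).1 v

end Inst

/-- Exchange the adjacencies of `a` and `b` to the vertices of `W`. -/
def sw {n : ℕ} (H : SimpleGraph (Fin n)) (a b : Fin n) (W : Finset (Fin n)) :
    SimpleGraph (Fin n) where
  Adj x y := if (y ∈ W ∧ (x = a ∨ x = b)) ∨ (x ∈ W ∧ (y = a ∨ y = b)) then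
    H.Adj (Equiv.swap a b x) (Equiv.swap a b y) else H.Adj x y
  symm := ⟨by
    intro x y h
    split_ifs at h ⊢ with h1 h2 h2
    · exact h.symm
    · tauto
    · tauto
    · exact h.symm⟩
  loopless := ⟨by intro x h; split_ifs at h <;> simp at h⟩

section sw

variable {n : ℕ} {H : SimpleGraph (Fin n)} {a b : Fin n} {W : Finset (Fin n)}

lemma sw_adj_left (ha : a ∉ W) (hb : b ∉ W) (v : Fin n) :
    (sw H a b W).Adj a v ↔ if v ∈ W then H.Adj b v else H.Adj a v := by
  by_cases hv : v ∈ W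
  · have h1 : v ≠ a := fun h => ha (h ▸ hv)
    have h2 : v ≠ b := fun h => hb (h ▸ hv)
    simp [sw, hv, Equiv.swap_apply_of_ne_of_ne h1 h2]
  · simp [sw, hv, ha]

lemma sw_adj_right (ha : a ∉ W) (hb : b ∉ W) (v : Fin n) :
    (sw H a b W).Adj b v ↔ if v ∈ W then H.Adj a v else H.Adj b v := by
  by_cases hv : v ∈ W
  · have h1 : v ≠ a := fun h => ha (h ▸ hv)
    have h2 : v ≠ b := fun h => hb (h ▸ hv)
    simp [sw, hv, Equiv.swap_apply_of_ne_of_ne h1 h2]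
  · simp [sw, hv, hb]

lemma sw_adj_of_mem (ha : a ∉ W) (hb : b ∉ W) {v : Fin n} (hv : v ∈ W) (w : Fin n) :
    (sw H a b W).Adj v w ↔ H.Adj v (Equiv.swap a b w) := by
  have h1 : v ≠ a := fun h => ha (h ▸ hv)
  have h2 : v ≠ b := fun h => hb (h ▸ hv)
  by_cases hw : w = a ∨ w = b
  · simp [sw, hv, hw, Equiv.swap_apply_of_ne_of_ne h1 h2]
  · push Not at hw
    simp [sw, h1, h2, hw.1, hw.2, Equiv.swap_apply_of_ne_of_ne hw.1 hw.2]

lemma sw_adj_of_notMem {v : Fin n} (hva : v ≠ a) (hvb : v ≠ b) (hv : v ∉ W) (w : Fin n) :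
    (sw H a b W).Adj v w ↔ H.Adj v w := by
  simp [sw, hv, hva, hvb]

lemma sw_sw (ha : a ∉ W) (hb : b ∉ W) : sw (sw H a b W) a b W = H := by
  ext x y
  by_cases hxa : x = a
  · subst hxa
    rw [sw_adj_left ha hb]; split_ifs with h
    · simp [sw_adj_right ha hb, h]
    · simp [sw_adj_left ha hb, h]
  by_cases hxb : x = b
  · subst hxb
    rw [sw_adj_right ha hb]; split_ifs with h
    · simp [sw_adj_left ha hb, h]
    · simp [sw_adj_right ha hb, h]
  by_cases hx : x ∈ W
  · simp [sw_adj_of_mem ha hb hx]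
  · simp [sw_adj_of_notMem hxa hxb hx]

lemma ad_sw_left (ha : a ∉ W) (hb : b ∉ W) (v : Fin n) :
    ad (sw H a b W) a v = if v ∈ W then ad H b v else ad H a v := by
  unfold ad; simp only [sw_adj_left ha hb]; split_ifs <;> rfl

lemma ad_sw_right (ha : a ∉ W) (hb : b ∉ W) (v : Fin n) :
    ad (sw H a b W) b v = if v ∈ W then ad H a v else ad H b v := by
  unfold ad; simp only [sw_adj_right ha hb]; split_ifs <;> rfl

lemma ad_sw_of_notMem {v : Fin n} (hva : v ≠ a) (hvb : v ≠ b) (hv : v ∉ W) (w : Fin n) :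
    ad (sw H a b W) v w = ad H v w := by
  unfold ad; simp only [sw_adj_of_notMem hva hvb hv]

lemma sum_ad_sw_left (ha : a ∉ W) (hb : b ∉ W) :
    ∑ w, ad (sw H a b W) a w = ∑ w, ad H a w + ∑ w ∈ W, (ad H b w - ad H a w) := by
  simp_rw [ad_sw_left ha hb]
  rw [show ∑ w ∈ W, (ad H b w - ad H a w) = ∑ w, if w ∈ W then ad H b w - ad H a w else 0 by
    simp [sum_ite_mem], ← sum_add_distrib]
  exact sum_congr rfl fun w _ => by split_ifs <;> ring

lemma sum_ad_sw_right (ha : a ∉ W) (hb : b ∉ W) :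
    ∑ w, ad (sw H a b W) b w = ∑ w, ad H b w - ∑ w ∈ W, (ad H b w - ad H a w) := by
  simp_rw [ad_sw_right ha hb]
  rw [show ∑ w ∈ W, (ad H b w - ad H a w) = ∑ w, if w ∈ W then ad H b w - ad H a w else 0 by
    simp [sum_ite_mem], ← sum_sub_distrib]
  exact sum_congr rfl fun w _ => by split_ifs <;> ring

lemma sum_ad_sw_other (ha : a ∉ W) (hb : b ∉ W) {v : Fin n} (hva : v ≠ a) (hvb : v ≠ b) :
    ∑ w, ad (sw H a b W) v w = ∑ w, ad H v w := by
  by_cases hv : v ∈ W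
  · rw [← Equiv.sum_comp (Equiv.swap a b) (fun w => ad H v w)]
    unfold ad; simp only [sw_adj_of_mem ha hb hv]
  · simp_rw [ad_sw_of_notMem hva hvb hv]

lemma sw_mem_gs {I J : Inst n} (ha : a ∉ W) (hb : b ∉ W) (hH : H ∈ I.gs) (hX : J.X = I.X)
    (hW : ∀ w ∈ W, ¬ I.X.Adj a w ∧ ¬ I.X.Adj b w)
    (hda : (J.d a : ℝ) = I.d a + ∑ w ∈ W, (ad H b w - ad H a w))
    (hdb : (J.d b : ℝ) = I.d b - ∑ w ∈ W, (ad H b w - ad H a w))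
    (hd : ∀ v, v ≠ a → v ≠ b → J.d v = I.d v) : sw H a b W ∈ J.gs := by
  obtain ⟨h1, h2⟩ := Inst.mem_gs.1 hH
  refine Inst.mem_gs.2 ⟨fun v => ?_, fun v w hvw => ?_⟩
  · by_cases hva : v = a
    · rw [hva, sum_ad_sw_left ha hb, h1, hda]
    by_cases hvb : v = b
    · rw [hvb, sum_ad_sw_right ha hb, h1, hdb]
    · rw [sum_ad_sw_other ha hb hva hvb, h1, hd v hva hvb]
  · rw [hX] at hvw
    by_cases hva : v = a
    · subst hva
      rw [sw_adj_left ha hb, if_neg fun h => (hW w h).1 hvw]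
      exact h2 _ _ hvw
    by_cases hvb : v = b
    · subst hvb
      rw [sw_adj_right ha hb, if_neg fun h => (hW w h).2 hvw]
      exact h2 _ _ hvw
    by_cases hv : v ∈ W
    · rw [sw_adj_of_mem ha hb hv]
      by_cases hw : w = a ∨ w = b
      · exfalso
        rcases hw with rfl | rfl
        · exact (hW v hv).1 hvw.symm
        · exact (hW v hv).2 hvw.symm
      · push Not at hw
        rw [Equiv.swap_apply_of_ne_of_ne hw.1 hw.2]; exact h2 _ _ hvw
    · rw [sw_adj_of_notMem hva hvb hv]; exact h2 _ _ hvw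

end sw

lemma sum_gs_sw {n : ℕ} {I J : Inst n} {a b : Fin n} {W : Finset (Fin n)} (ha : a ∉ W) (hb : b ∉ W)
    {F G : SimpleGraph (Fin n) → ℝ}
    (h₁ : ∀ H ∈ I.gs, F H ≠ 0 → sw H a b W ∈ J.gs ∧ G (sw H a b W) = F H)
    (h₂ : ∀ H ∈ J.gs, G H ≠ 0 → sw H a b W ∈ I.gs ∧ F (sw H a b W) = G H) :
    ∑ H ∈ I.gs, F H = ∑ H ∈ J.gs, G H := by
  refine sum_bij_ne_zero (fun H _ _ => sw H a b W) (fun H hH hF => (h₁ H hH hF).1) ?_ ?_ ?_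
  · intro H₁ _ _ H₂ _ _ h
    rw [← sw_sw (H := H₁) ha hb, h, sw_sw ha hb]
  · intro H hH hG
    exact ⟨sw H a b W, (h₂ H hH hG).1, by rw [(h₂ H hH hG).2]; exact hG, sw_sw ha hb⟩
  · intro H hH hF
    exact (h₁ H hH hF).2.symm

/-- Number of neighbours of `a` in `S` that are not neighbours of `b`. -/
def ua {n : ℕ} (S : Finset (Fin n)) (a b : Fin n) (H : SimpleGraph (Fin n)) : ℝ :=
  ∑ v ∈ S, ad H a v * (1 - ad H b v)

lemma ua_nonneg {n : ℕ} (S : Finset (Fin n)) (a b : Fin n) (H : SimpleGraph (Fin n)) :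
    0 ≤ ua S a b H :=
  sum_nonneg fun _ _ => mul_nonneg (ad_nonneg _ _ _) (sub_nonneg.2 (ad_le_one _ _ _))

lemma ua_le {n : ℕ} (S : Finset (Fin n)) (a b : Fin n) (H : SimpleGraph (Fin n)) :
    ua S a b H ≤ n := by
  refine (sum_le_sum (g := fun _ => (1 : ℝ)) fun v _ => ?_).trans ?_
  · have h1 := ad_nonneg H a v; have h2 := ad_le_one H a v
    have h3 := ad_nonneg H b v; have h4 := ad_le_one H b v
    nlinarith
  · simpa using card_le_univ S

lemma ua_sub_ua {n : ℕ} (S : Finset (Fin n)) (a b : Fin n) (H : SimpleGraph (Fin n)) :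
    ua S a b H - ua S b a H = ∑ v ∈ S, (ad H a v - ad H b v) := by
  unfold ua; rw [← sum_sub_distrib]; exact sum_congr rfl fun v _ => by ring

lemma ua_pos_of_mem {n : ℕ} {S : Finset (Fin n)} {a b v : Fin n} {H : SimpleGraph (Fin n)}
    (hv : v ∈ S) (h : ad H a v * (1 - ad H b v) ≠ 0) : 0 < ua S a b H := by
  have hnn : ∀ w ∈ S, 0 ≤ ad H a w * (1 - ad H b w) := fun w _ =>
    mul_nonneg (ad_nonneg _ _ _) (sub_nonneg.2 (ad_le_one _ _ _))
  exact ((hnn v hv).lt_of_ne' h).trans_le (single_le_sum hnn hv)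

namespace Inst

/-- The vertices whose edges to `a` and `b` are both unconstrained. -/
def S {n : ℕ} (I : Inst n) (a b : Fin n) : Finset (Fin n) :=
  univ.filter fun v => v ≠ a ∧ v ≠ b ∧ ¬ I.X.Adj a v ∧ ¬ I.X.Adj b v

lemma mem_S {n : ℕ} {I : Inst n} {a b v : Fin n} :
    v ∈ I.S a b ↔ v ≠ a ∧ v ≠ b ∧ ¬ I.X.Adj a v ∧ ¬ I.X.Adj b v := by simp [S]

lemma S_comm {n : ℕ} (I : Inst n) (a b : Fin n) : I.S a b = I.S b a := by
  ext v; simp only [mem_S]; tauto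

lemma sum_swap_pair {n : ℕ} {I : Inst n} {a b v w : Fin n} (hv : v ∈ I.S a b) (hw : w ∈ I.S a b)
    (g : SimpleGraph (Fin n) → ℝ) (hg : ∀ H, ad H a v = ad H b w → ad H b v = ad H a w →
      g (sw H a b {v, w}) = g H) :
    ∑ H ∈ I.gs, (ad H a v * (1 - ad H b v)) * (ad H b w * (1 - ad H a w)) * g H =
      ∑ H ∈ I.gs, (ad H b v * (1 - ad H a v)) * (ad H a w * (1 - ad H b w)) * g H := by
  obtain ⟨hva, hvb, hv1, hv2⟩ := mem_S.1 hv
  obtain ⟨hwa, hwb, hw1, hw2⟩ := mem_S.1 hw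
  have haW : a ∉ ({v, w} : Finset (Fin n)) := by simp [hva.symm, hwa.symm]
  have hbW : b ∉ ({v, w} : Finset (Fin n)) := by simp [hvb.symm, hwb.symm]
  have hW : ∀ y ∈ ({v, w} : Finset (Fin n)), ¬ I.X.Adj a y ∧ ¬ I.X.Adj b y := by
    simp [hv1, hv2, hw1, hw2]
  have key : ∀ x y : ℝ, (x = 0 ∨ x = 1) → (y = 0 ∨ y = 1) → x * (1 - y) ≠ 0 → x = 1 ∧ y = 0 := by
    rintro x y (rfl | rfl) (rfl | rfl) <;> norm_num
  have had : ∀ (H : SimpleGraph (Fin n)) x y, ad H x y = 0 ∨ ad H x y = 1 := by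
    intro H x y; unfold ad; split_ifs <;> simp
  have hmem : ∀ H ∈ I.gs, v ≠ w → ad H a v + ad H a w = ad H b v + ad H b w →
      sw H a b {v, w} ∈ I.gs := by
    intro H hH hvw h
    have h0 : ∑ y ∈ ({v, w} : Finset (Fin n)), (ad H b y - ad H a y) = 0 := by
      rw [sum_pair hvw]; linarith
    exact sw_mem_gs haW hbW hH rfl hW (by rw [h0]; ring) (by rw [h0]; ring) fun _ _ _ => rfl
  refine sum_gs_sw haW hbW ?_ ?_
  · intro H hH hF
    have h1 := key _ _ (had H a v) (had H b v) (left_ne_zero_of_mul (left_ne_zero_of_mul hF))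
    have h2 := key _ _ (had H b w) (had H a w) (right_ne_zero_of_mul (left_ne_zero_of_mul hF))
    refine ⟨hmem H hH ?_ ?_, ?_⟩
    · rintro rfl; rw [h1.1] at h2; norm_num at h2
    · rw [h1.1, h1.2, h2.1, h2.2]; ring
    · rw [hg H (by rw [h1.1, h2.1]) (by rw [h1.2, h2.2])]
      simp [ad_sw_left haW hbW, ad_sw_right haW hbW]
  · intro H hH hF
    have h1 := key _ _ (had H b v) (had H a v) (left_ne_zero_of_mul (left_ne_zero_of_mul hF))
    have h2 := key _ _ (had H a w) (had H b w) (right_ne_zero_of_mul (left_ne_zero_of_mul hF))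
    refine ⟨hmem H hH ?_ ?_, ?_⟩
    · rintro rfl; rw [h1.1] at h2; norm_num at h2
    · rw [h1.1, h1.2, h2.1, h2.2]; ring
    · rw [hg H (by rw [h1.2, h2.2]) (by rw [h1.1, h2.1])]
      simp [ad_sw_left haW hbW, ad_sw_right haW hbW]

/-- The basic switching identity. -/
lemma Pr_sub_Pr {n : ℕ} {I : Inst n} {a b v : Fin n} (hv : v ∈ I.S a b) :
    I.Pr a v - I.Pr b v = I.E fun H =>
      (ad H a v * (1 - ad H b v) + ad H b v * (1 - ad H a v)) *
        ((ua (I.S a b) a b H - ua (I.S a b) b a H) /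
          (ua (I.S a b) a b H + ua (I.S a b) b a H)) := by
  set S := I.S a b with hS
  set g : SimpleGraph (Fin n) → ℝ := fun H => (ua S a b H + ua S b a H)⁻¹ with hg
  have h0 : ∑ H ∈ I.gs, (ad H a v * (1 - ad H b v)) * ua S b a H * g H =
      ∑ H ∈ I.gs, (ad H b v * (1 - ad H a v)) * ua S a b H * g H := by
    unfold ua; simp_rw [mul_sum, sum_mul]
    rw [sum_comm]; conv_rhs => rw [sum_comm]
    refine sum_congr rfl fun w hw => ?_
    refine sum_swap_pair hv hw g ?_
    intro H h1 h2
    obtain ⟨hva, hvb, -, -⟩ := mem_S.1 hv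
    obtain ⟨hwa, hwb, -, -⟩ := mem_S.1 hw
    have haW : a ∉ ({v, w} : Finset (Fin n)) := by simp [hva.symm, hwa.symm]
    have hbW : b ∉ ({v, w} : Finset (Fin n)) := by simp [hvb.symm, hwb.symm]
    simp only [hg]; congr 1
    unfold ua
    rw [← sum_add_distrib, ← sum_add_distrib]
    refine sum_congr rfl fun y _ => ?_
    rw [ad_sw_left haW hbW, ad_sw_right haW hbW]
    split_ifs <;> ring
  have h1 : I.E (fun H => (ad H a v * (1 - ad H b v)) * ua S b a H * g H) =
      I.E (fun H => (ad H b v * (1 - ad H a v)) * ua S a b H * g H) := by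
    unfold E; rw [h0]
  have h2 : I.Pr a v - I.Pr b v = I.E (fun H => (ad H a v * (1 - ad H b v) -
      ad H b v * (1 - ad H a v)) * ((ua S a b H + ua S b a H) * g H)) := by
    unfold Pr; rw [← E_sub]
    refine E_congr fun H _ => ?_
    by_cases hz : ua S a b H + ua S b a H = 0
    · have ha := ua_nonneg S a b H
      have hb := ua_nonneg S b a H
      have e1 : ad H a v * (1 - ad H b v) = 0 := by
        by_contra h; have := ua_pos_of_mem hv h; linarith
      have e2 : ad H b v * (1 - ad H a v) = 0 := by
        by_contra h; have := ua_pos_of_mem (S := S) (a := b) (b := a) hv h; linarith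
      rw [hz]; linarith
    · rw [hg]; field_simp; ring
  rw [h2]
  have h3 : ∀ F G A B : SimpleGraph (Fin n) → ℝ, I.E A = I.E B → (∀ H, F H - G H = A H - B H) →
      I.E F = I.E G := by
    intro F G A B hAB h
    have := E_sub I F G
    rw [E_congr (fun H _ => h H), E_sub, hAB, sub_self] at this
    linarith
  refine h3 _ _ (fun H => 2 * ((ad H a v * (1 - ad H b v)) * ua S b a H * g H))
    (fun H => 2 * ((ad H b v * (1 - ad H a v)) * ua S a b H * g H)) (by
      rw [E_mul_left, E_mul_left, h1]) fun H => ?_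
  simp only [hg, div_eq_mul_inv]; ring

/-- Condition on the edge `av` being present. -/
def add {n : ℕ} (I : Inst n) (a v : Fin n) : Inst n :=
  ⟨fun j => if j = a ∨ j = v then I.d j - 1 else I.d j, I.X ⊔ SimpleGraph.edge a v⟩

/-- Condition on the edge `av` being absent. -/
def del {n : ℕ} (I : Inst n) (a v : Fin n) : Inst n :=
  ⟨I.d, I.X ⊔ SimpleGraph.edge a v⟩

lemma ad_sup_edge {n : ℕ} {H : SimpleGraph (Fin n)} {a v : Fin n} (hav : a ≠ v)
    (hH : ¬ H.Adj a v) (x y : Fin n) :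
    ad (H ⊔ SimpleGraph.edge a v) x y =
      ad H x y + (if x = a ∧ y = v ∨ x = v ∧ y = a then 1 else 0) := by
  by_cases h : x = a ∧ y = v ∨ x = v ∧ y = a
  · rcases h with ⟨rfl, rfl⟩ | ⟨rfl, rfl⟩
    · simp [ad, SimpleGraph.sup_adj, SimpleGraph.edge_adj, hH, hav]
    · have : ¬ H.Adj x y := fun h => hH h.symm
      simp [ad, SimpleGraph.sup_adj, SimpleGraph.edge_adj, this, hav, hav.symm]
  · have : ¬ (SimpleGraph.edge a v).Adj x y := by
      rw [SimpleGraph.edge_adj]; tauto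
    simp [ad, SimpleGraph.sup_adj, this, h]

lemma sum_ad_sup_edge {n : ℕ} {H : SimpleGraph (Fin n)} {a v : Fin n} (hav : a ≠ v)
    (hH : ¬ H.Adj a v) (x : Fin n) :
    ∑ y, ad (H ⊔ SimpleGraph.edge a v) x y =
      ∑ y, ad H x y + (if x = a ∨ x = v then 1 else 0) := by
  simp_rw [ad_sup_edge hav hH, sum_add_distrib]
  congr 1
  by_cases hxa : x = a
  · subst hxa; simp [hav]
  · by_cases hxv : x = v
    · subst hxv; simp [hxa]
    · simp [hxa, hxv]

lemma gs_del {n : ℕ} (I : Inst n) {a v : Fin n} (hav : a ≠ v) :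
    (I.del a v).gs = I.gs.filter fun H => ¬ H.Adj a v := by
  ext H
  simp only [mem_gs, mem_filter, del, SimpleGraph.sup_adj, SimpleGraph.edge_adj]
  constructor
  · rintro ⟨h1, h2⟩
    exact ⟨⟨h1, fun x y h => h2 x y (Or.inl h)⟩, h2 a v (Or.inr ⟨Or.inl ⟨rfl, rfl⟩, hav⟩)⟩
  · rintro ⟨⟨h1, h2⟩, h3⟩
    refine ⟨h1, fun x y h => ?_⟩
    rcases h with h | ⟨⟨rfl, rfl⟩ | ⟨rfl, rfl⟩, -⟩
    · exact h2 x y h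
    · exact h3
    · exact fun h => h3 h.symm

lemma sum_gs_add {n : ℕ} (I : Inst n) {a v : Fin n} (hav : a ≠ v) (hX : ¬ I.X.Adj a v)
    (hda : 1 ≤ I.d a) (hdv : 1 ≤ I.d v) (f : SimpleGraph (Fin n) → ℝ) :
    ∑ H ∈ I.gs, ad H a v * f H = ∑ H ∈ (I.add a v).gs, f (H ⊔ SimpleGraph.edge a v) := by
  have h1 : ∑ H ∈ I.gs, ad H a v * f H = ∑ H ∈ I.gs.filter (fun H => H.Adj a v), f H := by
    rw [sum_filter]; exact sum_congr rfl fun H _ => by simp [ad]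
  rw [h1]
  have hsup : ∀ H : SimpleGraph (Fin n), H.Adj a v →
      H \ SimpleGraph.edge a v ⊔ SimpleGraph.edge a v = H := by
    intro H hH
    rw [sdiff_sup_self, sup_eq_left, SimpleGraph.edge_le_iff]
    exact Or.inr hH
  have hnot : ∀ H : SimpleGraph (Fin n), ¬ (H \ SimpleGraph.edge a v).Adj a v := by
    intro H; simp [SimpleGraph.sdiff_adj, SimpleGraph.edge_adj, hav]
  have hav' : (I.add a v).X.Adj a v := by
    simp [add, SimpleGraph.edge_adj, hav]
  refine sum_bij' (fun H _ => H \ SimpleGraph.edge a v) (fun H _ => H ⊔ SimpleGraph.edge a v)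
    ?_ ?_ ?_ ?_ ?_
  · intro H hH
    obtain ⟨hH, hA⟩ := mem_filter.1 hH
    obtain ⟨h2, h3⟩ := mem_gs.1 hH
    refine mem_gs.2 ⟨fun x => ?_, fun x y h => ?_⟩
    · have := sum_ad_sup_edge hav (hnot H) x
      rw [hsup H hA, h2] at this
      simp only [add]
      split_ifs at this ⊢ with hx
      · have h0 : 0 ≤ ∑ y, ad (H \ SimpleGraph.edge a v) x y :=
          sum_nonneg fun _ _ => ad_nonneg _ _ _
        have : 1 ≤ I.d x := by
          have : (1 : ℝ) ≤ I.d x := by linarith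
          exact_mod_cast this
        push_cast [this]; linarith
      · linarith
    · rw [SimpleGraph.sdiff_adj]
      rintro ⟨h4, h5⟩
      simp only [add, SimpleGraph.sup_adj] at h
      rcases h with h | h
      · exact h3 x y h h4
      · exact h5 h
  · intro H hH
    obtain ⟨h2, h3⟩ := mem_gs.1 hH
    refine mem_filter.2 ⟨mem_gs.2 ⟨fun x => ?_, fun x y h => ?_⟩, ?_⟩
    · have := sum_ad_sup_edge hav (h3 a v hav') x
      rw [this, h2]
      simp only [add]
      split_ifs with hx
      · have : 1 ≤ I.d x := by
          rcases hx with rfl | rfl <;> assumption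
        push_cast [this]; ring
      · ring
    · simp only [SimpleGraph.sup_adj, SimpleGraph.edge_adj]
      rintro (h4 | ⟨⟨rfl, rfl⟩ | ⟨rfl, rfl⟩, -⟩)
      · exact h3 x y (by simp [add, h]) h4
      · exact hX h
      · exact hX h.symm
    · simp [SimpleGraph.edge_adj, hav]
  · intro H hH
    exact hsup H (mem_filter.1 hH).2
  · intro H hH
    have := (mem_gs.1 hH).2 a v hav'
    ext x y
    simp only [SimpleGraph.sdiff_adj, SimpleGraph.sup_adj]
    constructor
    · tauto
    · intro h
      refine ⟨Or.inl h, fun h' => ?_⟩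
      rw [SimpleGraph.edge_adj] at h'
      rcases h' with ⟨⟨rfl, rfl⟩ | ⟨rfl, rfl⟩, -⟩
      · exact this h
      · exact this h.symm
  · intro H hH
    rw [hsup H (mem_filter.1 hH).2]

lemma card_gs_add {n : ℕ} (I : Inst n) {a v : Fin n} (hav : a ≠ v) (hX : ¬ I.X.Adj a v)
    (hda : 1 ≤ I.d a) (hdv : 1 ≤ I.d v) :
    ((I.add a v).gs.card : ℝ) = I.Pr a v * I.gs.card := by
  have h := sum_gs_add I hav hX hda hdv fun _ => 1
  simp only [mul_one, sum_const, nsmul_eq_mul] at h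
  rw [← h, Pr, E]
  by_cases h0 : (I.gs.card : ℝ) = 0
  · have : I.gs = ∅ := card_eq_zero.1 (by exact_mod_cast h0)
    simp [this]
  · field_simp

lemma card_gs_del {n : ℕ} (I : Inst n) {a v : Fin n} (hav : a ≠ v) :
    ((I.del a v).gs.card : ℝ) = (1 - I.Pr a v) * I.gs.card := by
  by_cases h0 : (I.gs.card : ℝ) = 0
  · have : I.gs = ∅ := card_eq_zero.1 (by exact_mod_cast h0)
    rw [gs_del I hav, this]; simp
  · have : ((I.del a v).gs.card : ℝ) = ∑ H ∈ I.gs, (1 - ad H a v) := by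
      rw [gs_del I hav, card_filter]
      push_cast
      exact sum_congr rfl fun H _ => by simp only [ad]; split_ifs <;> simp_all
    rw [this, sum_sub_distrib, Pr, E]
    simp only [sum_const, nsmul_eq_mul]
    field_simp

/-- Chain rule for a present edge. -/
lemma E_ad_mul {n : ℕ} (I : Inst n) {a v : Fin n} (hav : a ≠ v) (hX : ¬ I.X.Adj a v)
    (hda : 1 ≤ I.d a) (hdv : 1 ≤ I.d v) (f : SimpleGraph (Fin n) → ℝ) :
    I.E (fun H => ad H a v * f H) =
      I.Pr a v * (I.add a v).E fun H => f (H ⊔ SimpleGraph.edge a v) := by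
  have hc := card_gs_add I hav hX hda hdv
  unfold E
  rw [sum_gs_add I hav hX hda hdv]
  by_cases h0 : (I.gs.card : ℝ) = 0
  · rw [h0, mul_zero] at hc
    simp [h0, hc]
  by_cases h1 : I.Pr a v = 0
  · rw [h1, zero_mul] at hc
    have : (I.add a v).gs = ∅ := card_eq_zero.1 (by exact_mod_cast hc)
    simp [this]
  · rw [hc]; field_simp

/-- Chain rule for an absent edge. -/
lemma E_one_sub_ad_mul {n : ℕ} (I : Inst n) {a v : Fin n} (hav : a ≠ v)
    (f : SimpleGraph (Fin n) → ℝ) :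
    I.E (fun H => (1 - ad H a v) * f H) = (1 - I.Pr a v) * (I.del a v).E f := by
  have hc := card_gs_del I hav
  have hs : ∑ H ∈ I.gs, (1 - ad H a v) * f H = ∑ H ∈ (I.del a v).gs, f H := by
    rw [gs_del I hav, sum_filter]
    exact sum_congr rfl fun H _ => by simp only [ad]; split_ifs <;> simp_all
  unfold E
  rw [hs]
  by_cases h0 : (I.gs.card : ℝ) = 0
  · rw [h0, mul_zero] at hc
    simp [h0, hc]
  by_cases h1 : 1 - I.Pr a v = 0
  · rw [h1, zero_mul] at hc
    have : (I.del a v).gs = ∅ := card_eq_zero.1 (by exact_mod_cast hc)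
    simp [this]
  · rw [hc]; field_simp

end Inst

lemma binom_mode_nat {m u k : ℕ} (hu : u ≤ m) (hk : k ≤ m) :
    m.choose k * u ^ k * (m - u) ^ (m - k) ≤ m.choose u * u ^ u * (m - u) ^ (m - u) := by
  obtain ⟨w, rfl⟩ := Nat.exists_eq_add_of_le hu
  simp only [Nat.add_sub_cancel_left]
  have up : ∀ j, j + 1 ≤ u → (u + w).choose j * u ^ j * w ^ (u + w - j) ≤
      (u + w).choose (j + 1) * u ^ (j + 1) * w ^ (u + w - (j + 1)) := by
    intro j hj
    have e := Nat.choose_succ_right_eq (u + w) j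
    obtain ⟨r, hr⟩ := Nat.exists_eq_add_of_le (show j + 1 ≤ u + w by omega)
    have h1 : u + w - j = r + 1 := by omega
    have h2 : u + w - (j + 1) = r := by omega
    rw [h1] at e
    rw [h1, h2, pow_succ, pow_succ]
    have h3 : (j + 1) * w ≤ (r + 1) * u := by
      have : (j + 1) * (u + w) ≤ u * (j + 1 + r) := by rw [← hr]; gcongr
      nlinarith
    have h4 : (u + w).choose j * w ≤ (u + w).choose (j + 1) * u := by
      refine Nat.le_of_mul_le_mul_left ?_ (by omega : 0 < j + 1)
      calc (j + 1) * ((u + w).choose j * w) = (u + w).choose j * ((j + 1) * w) := by ring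
        _ ≤ (u + w).choose j * ((r + 1) * u) := by gcongr
        _ = (u + w).choose (j + 1) * (j + 1) * u := by rw [e]; ring
        _ = _ := by ring
    calc (u + w).choose j * u ^ j * (w ^ r * w) = (u + w).choose j * w * (u ^ j * w ^ r) := by ring
      _ ≤ (u + w).choose (j + 1) * u * (u ^ j * w ^ r) := by gcongr
      _ = _ := by ring
  have down : ∀ j, u ≤ j → j + 1 ≤ u + w → (u + w).choose (j + 1) * u ^ (j + 1) *
      w ^ (u + w - (j + 1)) ≤ (u + w).choose j * u ^ j * w ^ (u + w - j) := by
    intro j hj hj'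
    have e := Nat.choose_succ_right_eq (u + w) j
    obtain ⟨r, hr⟩ := Nat.exists_eq_add_of_le hj'
    have h1 : u + w - j = r + 1 := by omega
    have h2 : u + w - (j + 1) = r := by omega
    rw [h1] at e
    rw [h1, h2, pow_succ, pow_succ]
    have h3 : (r + 1) * u ≤ (j + 1) * w := by
      have : u * (j + 1 + r) ≤ j * (u + w) := by rw [← hr]; gcongr
      nlinarith
    have h4 : (u + w).choose (j + 1) * u ≤ (u + w).choose j * w := by
      refine Nat.le_of_mul_le_mul_left ?_ (by omega : 0 < j + 1)
      calc (j + 1) * ((u + w).choose (j + 1) * u)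
          = (u + w).choose (j + 1) * (j + 1) * u := by ring
        _ = (u + w).choose j * ((r + 1) * u) := by rw [e]; ring
        _ ≤ (u + w).choose j * ((j + 1) * w) := by gcongr
        _ = _ := by ring
    calc (u + w).choose (j + 1) * (u ^ j * u) * w ^ r
        = (u + w).choose (j + 1) * u * (u ^ j * w ^ r) := by ring
      _ ≤ (u + w).choose j * w * (u ^ j * w ^ r) := by gcongr
      _ = _ := by ring
  have hw : w = u + w - u := by omega
  conv_rhs => rw [show w ^ w = w ^ (u + w - u) by rw [← hw]]
  rcases le_total k u with h | h
  · induction h using Nat.decreasingInduction with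
    | self => exact le_rfl
    | of_succ j hj ih => exact (up j hj).trans (ih (by omega))
  · induction k, h using Nat.le_induction with
    | base => exact le_rfl
    | succ j hj ih => exact (down j hj hk).trans (ih (by omega))

lemma binom_mode {m u : ℕ} (hu : u ≤ m) :
    1 ≤ (m + 1 : ℝ) * (m.choose u * ((u : ℝ) / m) ^ u * (1 - (u : ℝ) / m) ^ (m - u)) := by
  rcases Nat.eq_zero_or_pos m with rfl | hm
  · obtain rfl : u = 0 := by omega
    simp
  have hm' : (0 : ℝ) < m := by exact_mod_cast hm
  have key : ∀ k ∈ range (m + 1), ((u : ℝ) / m) ^ k * (1 - (u : ℝ) / m) ^ (m - k) * m.choose k ≤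
      m.choose u * ((u : ℝ) / m) ^ u * (1 - (u : ℝ) / m) ^ (m - u) := by
    intro k hk
    have hk : k ≤ m := by simpa [Nat.lt_succ_iff] using hk
    have h := binom_mode_nat hu hk
    have h' : (m.choose k * (u : ℝ) ^ k * ((m : ℝ) - u) ^ (m - k)) ≤
        m.choose u * (u : ℝ) ^ u * ((m : ℝ) - u) ^ (m - u) := by
      have := (Nat.cast_le (α := ℝ)).2 h
      push_cast [hu] at this
      exact this
    have e : ∀ j, j ≤ m → (m.choose j : ℝ) * (u : ℝ) ^ j * ((m : ℝ) - u) ^ (m - j) =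
        (m.choose j * ((u : ℝ) / m) ^ j * (1 - (u : ℝ) / m) ^ (m - j)) * (m : ℝ) ^ m := by
      intro j hj
      rw [one_sub_div hm'.ne', div_pow, div_pow]
      have : (m : ℝ) ^ m = (m : ℝ) ^ j * (m : ℝ) ^ (m - j) := by rw [← pow_add]; congr 1; omega
      rw [this]; field_simp
    rw [e k hk, e u hu] at h'
    have := le_of_mul_le_mul_right h' (by positivity)
    linarith
  have h1 := sum_le_sum key
  rw [← add_pow] at h1
  simpa using h1

/-- Exponential moments of the hypergeometric distribution. -/
lemma hyper_mgf {α : Type*} [DecidableEq α] (Δ T : Finset α) {u : ℕ} (hu : u ≤ #Δ) {θ : ℝ}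
    (hθ : |θ| ≤ 1) :
    ∑ U ∈ powersetCard u Δ, Real.exp (θ * (#(U ∩ T) - (u : ℝ) / #Δ * #(Δ ∩ T))) ≤
      (#Δ + 1) * (#Δ).choose u * Real.exp (#(Δ ∩ T) * θ ^ 2) := by
  set m := #Δ with hm
  set q : ℝ := (u : ℝ) / m with hq
  have hq0 : 0 ≤ q := by positivity
  have hq1 : q ≤ 1 := div_le_one_of_le₀ (by exact_mod_cast hu) (by positivity)
  set w : ℝ := q ^ u * (1 - q) ^ (m - u) with hw
  have hw0 : 0 ≤ w := mul_nonneg (pow_nonneg hq0 _) (pow_nonneg (by linarith) _)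
  have hmode := binom_mode hu
  rw [← hq, mul_assoc, ← hw] at hmode
  have hwpos : 0 < w := by
    rcases hw0.eq_or_lt with h | h
    · rw [← h] at hmode; norm_num at hmode
    · exact h
  have hexp : ∀ U : Finset α, U ⊆ Δ → ∏ v ∈ U, Real.exp (if v ∈ T then θ else 0) =
      Real.exp (θ * #(U ∩ T)) := by
    intro U _
    rw [← Real.exp_sum, ← sum_filter, sum_const, filter_mem_eq_inter]; simp [mul_comm]
  have h1 : ∑ U ∈ powersetCard u Δ, w * Real.exp (θ * #(U ∩ T)) ≤
      ∏ v ∈ Δ, (q * Real.exp (if v ∈ T then θ else 0) + (1 - q)) := by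
    rw [prod_add]
    calc ∑ U ∈ powersetCard u Δ, w * Real.exp (θ * #(U ∩ T))
        = ∑ U ∈ powersetCard u Δ, (∏ v ∈ U, q * Real.exp (if v ∈ T then θ else 0)) *
            ∏ v ∈ Δ \ U, (1 - q) := by
          refine sum_congr rfl fun U hU => ?_
          obtain ⟨hU, hc⟩ := mem_powersetCard.1 hU
          rw [prod_mul_distrib, hexp U hU, prod_const, prod_const, hc, card_sdiff_of_subset hU,
            hc, ← hm, hw]; ring
      _ ≤ _ := by
          refine sum_le_sum_of_subset_of_nonneg (fun U hU => ?_) fun U _ _ => ?_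
          · exact mem_powerset.2 (mem_powersetCard.1 hU).1
          · exact mul_nonneg (prod_nonneg fun v _ => by positivity)
              (prod_nonneg fun v _ => by linarith)
  have h2 : ∏ v ∈ Δ, (q * Real.exp (if v ∈ T then θ else 0) + (1 - q)) ≤
      Real.exp (#(Δ ∩ T) * (q * θ + θ ^ 2)) := by
    have : Real.exp (#(Δ ∩ T) * (q * θ + θ ^ 2)) =
        ∏ v ∈ Δ, Real.exp (if v ∈ T then q * θ + θ ^ 2 else 0) := by
      rw [← Real.exp_sum, ← sum_filter, sum_const, filter_mem_eq_inter]; simp [mul_add]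
    rw [this]
    refine prod_le_prod (fun v _ => ?_) fun v _ => ?_
    · have := Real.exp_pos (if v ∈ T then θ else 0); nlinarith
    · split_ifs
      · have h3 : Real.exp θ ≤ 1 + θ + θ ^ 2 := by
          have := (abs_le.1 (Real.abs_exp_sub_one_sub_id_le hθ)).2; linarith
        have h4 := Real.add_one_le_exp (q * θ + θ ^ 2)
        nlinarith [sq_nonneg θ]
      · simp
  calc ∑ U ∈ powersetCard u Δ, Real.exp (θ * (#(U ∩ T) - q * #(Δ ∩ T)))
      = (∑ U ∈ powersetCard u Δ, w * Real.exp (θ * #(U ∩ T))) *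
          Real.exp (-(θ * q * #(Δ ∩ T))) / w := by
        rw [sum_mul, sum_div]
        refine sum_congr rfl fun U _ => ?_
        rw [mul_sub, sub_eq_add_neg, Real.exp_add, ← mul_assoc θ q]; field_simp
    _ ≤ Real.exp (#(Δ ∩ T) * (q * θ + θ ^ 2)) * Real.exp (-(θ * q * #(Δ ∩ T))) / w := by
        gcongr; exact h1.trans h2
    _ = Real.exp (#(Δ ∩ T) * θ ^ 2) * (1 / w) := by
        rw [← Real.exp_add, mul_one_div]; congr 2; ring
    _ ≤ Real.exp (#(Δ ∩ T) * θ ^ 2) * ((m + 1) * m.choose u) := by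
        gcongr
        rw [div_le_iff₀ hwpos]; linarith
    _ = _ := by ring

/-- Tail bound for the hypergeometric distribution. -/
lemma hyper_tail {α : Type*} [DecidableEq α] (Δ T : Finset α) {u : ℕ} (hu : u ≤ #Δ) {θ s : ℝ}
    (hθ₀ : 0 ≤ θ) (hθ : θ ≤ 1) :
    ∑ U ∈ powersetCard u Δ,
        (if s < |(#(U ∩ T) : ℝ) - (u : ℝ) / #Δ * #(Δ ∩ T)| then (1 : ℝ) else 0) ≤
      2 * (#Δ + 1) * (#Δ).choose u * Real.exp (#(Δ ∩ T) * θ ^ 2 - θ * s) := by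
  have h1 := hyper_mgf Δ T hu (θ := θ) (by rwa [abs_of_nonneg hθ₀])
  have h2 := hyper_mgf Δ T hu (θ := -θ) (by rwa [abs_neg, abs_of_nonneg hθ₀])
  rw [neg_sq] at h2
  calc _ ≤ ∑ U ∈ powersetCard u Δ,
        (Real.exp (θ * (#(U ∩ T) - (u : ℝ) / #Δ * #(Δ ∩ T))) +
          Real.exp (-θ * (#(U ∩ T) - (u : ℝ) / #Δ * #(Δ ∩ T)))) * Real.exp (-(θ * s)) := by
        refine sum_le_sum fun U _ => ?_
        set y : ℝ := #(U ∩ T) - (u : ℝ) / #Δ * #(Δ ∩ T)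
        rw [add_mul, ← Real.exp_add, ← Real.exp_add]
        split_ifs with h
        · rcases lt_abs.1 h with h | h
          · have := Real.exp_pos (-θ * y + -(θ * s))
            have h3 : 1 ≤ Real.exp (θ * y + -(θ * s)) := Real.one_le_exp (by nlinarith)
            linarith
          · have := Real.exp_pos (θ * y + -(θ * s))
            have h3 : 1 ≤ Real.exp (-θ * y + -(θ * s)) := Real.one_le_exp (by nlinarith)
            linarith
        · positivity
    _ ≤ ((#Δ + 1) * (#Δ).choose u * Real.exp (#(Δ ∩ T) * θ ^ 2) +
          (#Δ + 1) * (#Δ).choose u * Real.exp (#(Δ ∩ T) * θ ^ 2)) * Real.exp (-(θ * s)) := by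
        rw [← sum_mul, sum_add_distrib]; gcongr
    _ = _ := by rw [sub_eq_add_neg, Real.exp_add]; ring

/-- Vertices of `S` adjacent to `a` but not to `b`. -/
def Da {n : ℕ} (S : Finset (Fin n)) (a b : Fin n) (H : SimpleGraph (Fin n)) : Finset (Fin n) :=
  S.filter fun v => H.Adj a v ∧ ¬ H.Adj b v

/-- Vertices of `S` adjacent to exactly one of `a` and `b`. -/
def Dl {n : ℕ} (S : Finset (Fin n)) (a b : Fin n) (H : SimpleGraph (Fin n)) : Finset (Fin n) :=
  S.filter fun v => (H.Adj a v ∧ ¬ H.Adj b v) ∨ (H.Adj b v ∧ ¬ H.Adj a v)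

/-- Redistribute the switchable neighbours so that `a` gets exactly those in `U`. -/
def reSw {n : ℕ} (S : Finset (Fin n)) (a b : Fin n) (H : SimpleGraph (Fin n))
    (U : Finset (Fin n)) : SimpleGraph (Fin n) :=
  sw H a b (symmDiff (Da S a b H) U)

section reSw

variable {n : ℕ} {S U : Finset (Fin n)} {a b : Fin n} {H : SimpleGraph (Fin n)}

lemma Da_subset_Dl : Da S a b H ⊆ Dl S a b H := by
  intro v; simp only [Da, Dl, mem_filter]; tauto

lemma card_Da : (#(Da S a b H) : ℝ) = ua S a b H := by
  unfold Da ua; rw [card_filter]; push_cast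
  exact sum_congr rfl fun v _ => by unfold ad; split_ifs <;> simp_all

lemma card_Dl : (#(Dl S a b H) : ℝ) = ua S a b H + ua S b a H := by
  unfold Dl ua; rw [card_filter]; push_cast
  rw [← sum_add_distrib]
  exact sum_congr rfl fun v _ => by unfold ad; split_ifs <;> simp_all

lemma symmDiff_subset_S (hU : U ⊆ Dl S a b H) : symmDiff (Da S a b H) U ⊆ S := by
  intro v hv
  rcases mem_symmDiff.1 hv with ⟨h, -⟩ | ⟨h, -⟩
  · exact (mem_filter.1 h).1
  · exact (mem_filter.1 (hU h)).1

lemma Dl_reSw (ha : a ∉ S) (hb : b ∉ S) (hU : U ⊆ Dl S a b H) :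
    Dl S a b (reSw S a b H U) = Dl S a b H := by
  have hW := symmDiff_subset_S hU
  ext v
  simp only [Dl, reSw, mem_filter, sw_adj_left (fun h => ha (hW h)) (fun h => hb (hW h)),
    sw_adj_right (fun h => ha (hW h)) (fun h => hb (hW h))]
  split_ifs <;> tauto

lemma Da_reSw (ha : a ∉ S) (hb : b ∉ S) (hU : U ⊆ Dl S a b H) :
    Da S a b (reSw S a b H U) = U := by
  have hW := symmDiff_subset_S hU
  ext v
  have h1 : v ∈ U → v ∈ S ∧ ((H.Adj a v ∧ ¬ H.Adj b v) ∨ (H.Adj b v ∧ ¬ H.Adj a v)) := fun h => by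
    simpa [Dl] using hU h
  rw [Da, mem_filter, reSw, sw_adj_left (fun h => ha (hW h)) (fun h => hb (hW h)),
    sw_adj_right (fun h => ha (hW h)) (fun h => hb (hW h))]
  simp only [mem_symmDiff, Da, mem_filter]
  split_ifs with h <;> tauto

lemma reSw_reSw (ha : a ∉ S) (hb : b ∉ S) (hU : U ⊆ Dl S a b H) :
    reSw S a b (reSw S a b H U) (Da S a b H) = H := by
  have hW := symmDiff_subset_S hU
  have h : reSw S a b (reSw S a b H U) (Da S a b H) =
      sw (reSw S a b H U) a b (symmDiff (Da S a b H) U) := by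
    rw [reSw, Da_reSw ha hb hU, symmDiff_comm]
  rw [h]
  exact sw_sw (fun h => ha (hW h)) (fun h => hb (hW h))

lemma reSw_mem_gs {I : Inst n} (hU : U ⊆ Dl (I.S a b) a b H)
    (hc : #U = #(Da (I.S a b) a b H)) (hH : H ∈ I.gs) : reSw (I.S a b) a b H U ∈ I.gs := by
  have ha : a ∉ I.S a b := by simp [Inst.mem_S]
  have hb : b ∉ I.S a b := by simp [Inst.mem_S]
  have hW := symmDiff_subset_S hU
  have h0 : ∑ w ∈ symmDiff (Da (I.S a b) a b H) U, (ad H b w - ad H a w) = 0 := by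
    rw [symmDiff_def, sup_eq_union, sum_union disjoint_sdiff_sdiff]
    have e1 : ∑ w ∈ Da (I.S a b) a b H \ U, (ad H b w - ad H a w) =
        -(#(Da (I.S a b) a b H \ U) : ℝ) := by
      rw [sum_congr rfl (g := fun _ => (-1 : ℝ))]
      · simp
      · intro v hv
        obtain ⟨-, h1, h2⟩ := mem_filter.1 (mem_sdiff.1 hv).1
        rw [ad_one h1, ad_zero h2]; ring
    have e2 : ∑ w ∈ U \ Da (I.S a b) a b H, (ad H b w - ad H a w) =
        (#(U \ Da (I.S a b) a b H) : ℝ) := by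
      rw [sum_congr rfl (g := fun _ => (1 : ℝ))]
      · simp
      · intro v hv
        obtain ⟨hv1, hv2⟩ := mem_sdiff.1 hv
        obtain ⟨h3, h | h⟩ := mem_filter.1 (hU hv1)
        · exact absurd (mem_filter.2 ⟨h3, h⟩) hv2
        · rw [ad_one h.1, ad_zero h.2]; ring
    rw [e1, e2, card_sdiff_comm hc]; ring
  exact sw_mem_gs (fun h => ha (hW h)) (fun h => hb (hW h)) hH rfl
    (fun w hw => (Inst.mem_S.1 (hW hw)).2.2) (by rw [h0]; ring) (by rw [h0]; ring) fun _ _ _ => rfl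

/-- Resampling the switchable neighbours of `a` and `b` preserves the uniform distribution. -/
lemma sum_gs_resample (I : Inst n) (a b : Fin n) (F : SimpleGraph (Fin n) → ℝ) :
    ∑ H ∈ I.gs, F H = ∑ H ∈ I.gs,
      (∑ U ∈ powersetCard #(Da (I.S a b) a b H) (Dl (I.S a b) a b H), F (reSw (I.S a b) a b H U)) /
        ((#(Dl (I.S a b) a b H)).choose #(Da (I.S a b) a b H) : ℝ) := by
  have ha : a ∉ I.S a b := by simp [Inst.mem_S]
  have hb : b ∉ I.S a b := by simp [Inst.mem_S]
  set S := I.S a b with hS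
  have h1 : ∀ H ∈ I.gs, F H = ∑ U ∈ powersetCard #(Da S a b H) (Dl S a b H),
      F H / ((#(Dl S a b H)).choose #(Da S a b H) : ℝ) := by
    intro H _
    rw [sum_const, card_powersetCard, nsmul_eq_mul]
    have : ((#(Dl S a b H)).choose #(Da S a b H) : ℝ) ≠ 0 := by
      exact_mod_cast (Nat.choose_pos (card_le_card Da_subset_Dl)).ne'
    field_simp
  rw [sum_congr rfl h1]
  simp_rw [sum_div]
  rw [sum_sigma', sum_sigma']
  have hin : ∀ p : (_ : SimpleGraph (Fin n)) × Finset (Fin n),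
      p ∈ I.gs.sigma (fun H => powersetCard #(Da S a b H) (Dl S a b H)) ↔
        p.1 ∈ I.gs ∧ p.2 ⊆ Dl S a b p.1 ∧ #p.2 = #(Da S a b p.1) := by
    intro p; rw [mem_sigma, mem_powersetCard]
  refine sum_bij' (fun p _ => ⟨reSw S a b p.1 p.2, Da S a b p.1⟩)
    (fun p _ => ⟨reSw S a b p.1 p.2, Da S a b p.1⟩) ?_ ?_ ?_ ?_ ?_
  · intro p hp
    obtain ⟨h1, h2, h3⟩ := (hin p).1 hp
    exact (hin _).2 ⟨reSw_mem_gs h2 h3 h1, by rw [Dl_reSw ha hb h2]; exact Da_subset_Dl,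
      by rw [Da_reSw ha hb h2, h3]⟩
  · intro p hp
    obtain ⟨h1, h2, h3⟩ := (hin p).1 hp
    exact (hin _).2 ⟨reSw_mem_gs h2 h3 h1, by rw [Dl_reSw ha hb h2]; exact Da_subset_Dl,
      by rw [Da_reSw ha hb h2, h3]⟩
  · intro p hp
    obtain ⟨h1, h2, h3⟩ := (hin p).1 hp
    simp only
    rw [reSw_reSw ha hb h2, Da_reSw ha hb h2]
  · intro p hp
    obtain ⟨h1, h2, h3⟩ := (hin p).1 hp
    simp only
    rw [reSw_reSw ha hb h2, Da_reSw ha hb h2]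
  · intro p hp
    obtain ⟨h1, h2, h3⟩ := (hin p).1 hp
    simp only
    rw [reSw_reSw ha hb h2, Dl_reSw ha hb h2, Da_reSw ha hb h2, h3]

end reSw

/-- The imbalance of switchable neighbours is determined by the forbidden graph. -/
lemma ua_sub_ua_eq {n : ℕ} {I : Inst n} {a b : Fin n} {H : SimpleGraph (Fin n)} (hH : H ∈ I.gs) :
    ua (I.S a b) a b H - ua (I.S a b) b a H =
      (I.d a : ℝ) - I.d b - ∑ w, ad I.X b w * ad H a w + ∑ w, ad I.X a w * ad H b w := by
  obtain ⟨h1, h2⟩ := Inst.mem_gs.1 hH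
  have h3 : ∑ w, ad H a b * ((if w = b then 1 else 0) - (if w = a then (1 : ℝ) else 0)) = 0 := by
    rw [← mul_sum, sum_sub_distrib]; simp
  rw [ua_sub_ua, ← h1 a, ← h1 b, ← sum_sub_distrib, ← sum_sub_distrib, ← sum_add_distrib,
    ← sub_zero (∑ v, _), ← h3, ← sum_sub_distrib, sum_congr rfl (g := fun v =>
      if v ∈ I.S a b then ad H a v - ad H b v else 0) (s₂ := univ)]
  · rw [← sum_filter]; simp
  · intro v _
    by_cases hS : v ∈ I.S a b
    · obtain ⟨n1, n2, n3, n4⟩ := Inst.mem_S.1 hS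
      simp [hS, n1, n2, ad_zero n3, ad_zero n4]
    rw [if_neg hS]
    by_cases hva : v = a
    · subst hva
      by_cases hvb : v = b
      · subst hvb; simp
      · simp [hvb, ad_self, ad_comm H b v]
    by_cases hvb : v = b
    · subst hvb; simp [hva, ad_self]
    have : I.X.Adj a v ∨ I.X.Adj b v := by rw [Inst.mem_S] at hS; tauto
    simp only [if_neg hva, if_neg hvb]
    rcases this with h | h
    · rw [ad_zero (h2 _ _ h), ad_one h]; ring
    · rw [ad_zero (h2 _ _ h), ad_one h]; ring

/-- The codegree of two vertices. -/
def cod {n : ℕ} (H : SimpleGraph (Fin n)) (a z : Fin n) : ℝ := ∑ v, ad H a v * ad H z v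

lemma abs_cod_reSw {n : ℕ} {I : Inst n} {a b z : Fin n} {U : Finset (Fin n)}
    {H : SimpleGraph (Fin n)} (hza : z ≠ a) (hzb : z ≠ b) (hU : U ⊆ Dl (I.S a b) a b H) :
    |cod (reSw (I.S a b) a b H U) a z - cod (reSw (I.S a b) a b H U) b z -
      (2 * #(U ∩ univ.filter (H.Adj z)) - #(Dl (I.S a b) a b H ∩ univ.filter (H.Adj z)))| ≤
      2 + I.x a + I.x b := by
  have ha : a ∉ I.S a b := by simp [Inst.mem_S]
  have hb : b ∉ I.S a b := by simp [Inst.mem_S]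
  have hW := symmDiff_subset_S hU
  have haW : a ∉ symmDiff (Da (I.S a b) a b H) U := fun h => ha (hW h)
  have hbW : b ∉ symmDiff (Da (I.S a b) a b H) U := fun h => hb (hW h)
  have e1 : ∀ V : Finset (Fin n), (#(V ∩ univ.filter (H.Adj z)) : ℝ) =
      ∑ v, if v ∈ V then ad H z v else 0 := by
    intro V
    rw [← filter_mem_eq_inter, card_filter]
    push_cast
    simp only [mem_filter, mem_univ, true_and, ad]
    rw [← sum_filter]; simp
  have e2 : 2 + I.x a + I.x b = ∑ v, ((if v = a then 1 else 0) + (if v = b then 1 else 0) +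
      ad I.X a v + ad I.X b v) := by
    simp only [sum_add_distrib, Inst.x]; simp; ring
  rw [e1, e1, e2, cod, cod, ← sum_sub_distrib, mul_sum, ← sum_sub_distrib, ← sum_sub_distrib]
  refine (abs_sum_le_sum_abs _ _).trans (sum_le_sum fun v _ => ?_)
  have n1 := ad_nonneg I.X a v
  have n2 := ad_nonneg I.X b v
  have had : ∀ (H : SimpleGraph (Fin n)) x y, ad H x y = 0 ∨ ad H x y = 1 := by
    intro H x y; unfold ad; split_ifs <;> simp
  by_cases hva : v = a
  · subst hva
    have hU' : v ∉ U := fun h => ha ((mem_filter.1 (hU h)).1)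
    have hD' : v ∉ Dl (I.S v b) v b H := fun h => ha ((mem_filter.1 h).1)
    simp only [if_neg hU', if_neg hD', if_true]
    rcases had (reSw (I.S v b) v b H U) v v with h1 | h1 <;>
    rcases had (reSw (I.S v b) v b H U) b v with h2 | h2 <;>
    rcases had (reSw (I.S v b) v b H U) z v with h3 | h3 <;> rw [h1, h2, h3] <;> norm_num <;>
      split_ifs <;> linarith
  by_cases hvb : v = b
  · subst hvb
    have hU' : v ∉ U := fun h => hb ((mem_filter.1 (hU h)).1)
    have hD' : v ∉ Dl (I.S a v) a v H := fun h => hb ((mem_filter.1 h).1)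
    simp only [if_neg hU', if_neg hD', if_true]
    rcases had (reSw (I.S a v) a v H U) a v with h1 | h1 <;>
    rcases had (reSw (I.S a v) a v H U) v v with h2 | h2 <;>
    rcases had (reSw (I.S a v) a v H U) z v with h3 | h3 <;> rw [h1, h2, h3] <;> norm_num <;>
      split_ifs <;> linarith
  have hz : ad (reSw (I.S a b) a b H U) z v = ad H z v := by
    rw [ad_comm, ad_comm H]
    unfold ad reSw
    by_cases hv : v ∈ symmDiff (Da (I.S a b) a b H) U
    · simp only [sw_adj_of_mem haW hbW hv, Equiv.swap_apply_of_ne_of_ne hza hzb]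
    · simp only [sw_adj_of_notMem hva hvb hv]
  rw [hz, reSw, ad_sw_left haW hbW, ad_sw_right haW hbW]
  simp only [if_neg hva, if_neg hvb, mem_symmDiff]
  by_cases hS : v ∈ I.S a b
  · have h1 : v ∈ U → v ∈ Dl (I.S a b) a b H := fun h => hU h
    have z0 : 0 + 0 + ad I.X a v + ad I.X b v = 0 := by
      obtain ⟨-, -, h1, h2⟩ := Inst.mem_S.1 hS
      simp [ad, h1, h2]
    rw [z0]
    simp only [Da, Dl, mem_filter, hS, true_and] at h1 ⊢
    by_cases hUv : v ∈ U <;> by_cases c1 : H.Adj a v <;> by_cases c2 : H.Adj b v <;>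
      simp [hUv, c1, c2] at h1 ⊢ <;> simp [ad, c1, c2] <;> split_ifs <;> norm_num
  · have hU' : v ∉ U := fun h => hS ((mem_filter.1 (hU h)).1)
    have hD' : v ∉ Dl (I.S a b) a b H := fun h => hS ((mem_filter.1 h).1)
    have hDa : v ∉ Da (I.S a b) a b H := fun h => hS ((mem_filter.1 h).1)
    have h1 : 1 ≤ ad I.X a v + ad I.X b v := by
      rw [Inst.mem_S] at hS
      by_cases c1 : I.X.Adj a v
      · rw [ad_one c1]; linarith
      · have c2 : I.X.Adj b v := by tauto
        rw [ad_one c2]; linarith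
    simp only [hU', hDa, hD', false_and, or_self, if_false]
    have t : |ad H a v * ad H z v - ad H b v * ad H z v - (2 * 0 - 0)| ≤ 1 := by
      rcases had H a v with h1 | h1 <;> rcases had H b v with h2 | h2 <;>
        rcases had H z v with h3 | h3 <;> rw [h1, h2, h3] <;> norm_num
    linarith

/-- Codegrees of two vertices with a third vertex concentrate around each other. -/
lemma cod_tail {n : ℕ} (I : Inst n) {a b z : Fin n} (hza : z ≠ a) (hzb : z ≠ b)
    {θ s : ℝ} (hθ₀ : 0 ≤ θ) (hθ : θ ≤ 1) :
    I.E (fun H => if 2 + 2 * (I.x a + I.x b) + |(I.d a : ℝ) - I.d b| + 2 * s <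
      |cod H a z - cod H b z| then 1 else 0) ≤ 2 * (n + 1) * Real.exp (n * θ ^ 2 - θ * s) := by
  by_cases hI : I.gs.Nonempty
  swap
  · rw [not_nonempty_iff_eq_empty.1 hI |> fun h => (by simp [Inst.E, h] : I.E _ = 0)]
    positivity
  have hx : ∀ v, 0 ≤ I.x v := fun v => sum_nonneg fun _ _ => ad_nonneg _ _ _
  have hcard : (0 : ℝ) < I.gs.card := by exact_mod_cast hI.card_pos
  unfold Inst.E
  rw [sum_gs_resample I a b, div_le_iff₀ hcard]
  have key : ∀ H ∈ I.gs, (∑ U ∈ powersetCard #(Da (I.S a b) a b H) (Dl (I.S a b) a b H),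
      (if 2 + 2 * (I.x a + I.x b) + |(I.d a : ℝ) - I.d b| + 2 * s <
        |cod (reSw (I.S a b) a b H U) a z - cod (reSw (I.S a b) a b H U) b z| then
            (1 : ℝ) else 0)) /
        ((#(Dl (I.S a b) a b H)).choose #(Da (I.S a b) a b H) : ℝ) ≤
      2 * (n + 1) * Real.exp (n * θ ^ 2 - θ * s) := by
    intro H hH
    set Δ := Dl (I.S a b) a b H with hΔ
    set u := #(Da (I.S a b) a b H) with hu
    set T := univ.filter (H.Adj z) with hT
    have hule : u ≤ #Δ := card_le_card Da_subset_Dl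
    have hC : (0 : ℝ) < (#Δ).choose u := by exact_mod_cast Nat.choose_pos hule
    have hΔn : (#Δ : ℝ) ≤ n := by
      have := card_le_univ Δ; rw [Fintype.card_fin] at this; exact_mod_cast this
    have hTn : (#(Δ ∩ T) : ℝ) ≤ n := le_trans (by exact_mod_cast card_le_card inter_subset_left) hΔn
    rw [div_le_iff₀ hC]
    refine ((sum_le_sum fun U hU => ?_).trans (hyper_tail Δ T hule hθ₀ hθ (s := s))).trans ?_
    · obtain ⟨hU1, hU2⟩ := mem_powersetCard.1 hU
      by_cases hs : s < |(#(U ∩ T) : ℝ) - (u : ℝ) / #Δ * #(Δ ∩ T)|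
      · rw [if_pos hs]; split_ifs <;> norm_num
      · rw [if_neg hs, if_neg]
        rw [not_lt] at hs ⊢
        have h1 := abs_cod_reSw hza hzb hU1
        have h2 : |2 * (#(U ∩ T) : ℝ) - #(Δ ∩ T)| ≤ 2 * s + |2 * (u : ℝ) - #Δ| := by
          rcases Nat.eq_zero_or_pos #Δ with h0 | h0
          · have : #(Δ ∩ T) = 0 := Nat.le_zero.1 (h0 ▸ card_le_card inter_subset_left)
            have h' : #(U ∩ T) = 0 :=
              Nat.le_zero.1 (this ▸ card_le_card (inter_subset_inter_right hU1))
            rw [this, h'] at hs ⊢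
            have : 0 ≤ s := (abs_nonneg _).trans hs
            simp; positivity
          · have h0' : (0 : ℝ) < #Δ := by exact_mod_cast h0
            have hT' : (#(Δ ∩ T) : ℝ) / #Δ ≤ 1 := by
              rw [div_le_one h0']; exact_mod_cast card_le_card inter_subset_left
            have e : 2 * (#(U ∩ T) : ℝ) - #(Δ ∩ T) =
                2 * (#(U ∩ T) - (u : ℝ) / #Δ * #(Δ ∩ T)) +
                  (2 * (u : ℝ) - #Δ) * (#(Δ ∩ T) / #Δ) := by field_simp; ring
            rw [e]
            refine (abs_add_le _ _).trans ?_
            rw [abs_mul, abs_mul, abs_of_pos (zero_lt_two' ℝ),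
              abs_of_nonneg (show (0 : ℝ) ≤ #(Δ ∩ T) / #Δ by positivity)]
            gcongr
            exact mul_le_of_le_one_right (abs_nonneg _) hT'
        have h3 : |2 * (u : ℝ) - #Δ| ≤ |(I.d a : ℝ) - I.d b| + (I.x a + I.x b) := by
          rw [hΔ, hu, card_Da, card_Dl,
            show ∀ x y : ℝ, 2 * x - (x + y) = x - y by intros; ring, ua_sub_ua_eq hH]
          have b1 : ∀ c e, |∑ w, ad I.X c w * ad H e w| ≤ I.x c := by
            intro c e
            rw [abs_of_nonneg
                (sum_nonneg fun w _ => mul_nonneg (ad_nonneg _ _ _) (ad_nonneg _ _ _))]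
            exact sum_le_sum fun w _ => mul_le_of_le_one_right (ad_nonneg _ _ _) (ad_le_one _ _ _)
          have b2 := b1 a b
          have b3 := b1 b a
          have b4 := abs_add_le ((I.d a : ℝ) - I.d b - ∑ w, ad I.X b w * ad H a w)
            (∑ w, ad I.X a w * ad H b w)
          have b5 := abs_sub ((I.d a : ℝ) - I.d b) (∑ w, ad I.X b w * ad H a w)
          linarith
        have h5 := abs_sub_abs_le_abs_sub (cod (reSw (I.S a b) a b H U) a z -
          cod (reSw (I.S a b) a b H U) b z) (2 * #(U ∩ T) - #(Δ ∩ T))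
        linarith
    · have : Real.exp (#(Δ ∩ T) * θ ^ 2 - θ * s) ≤ Real.exp (n * θ ^ 2 - θ * s) := by
        rw [Real.exp_le_exp]; gcongr
      calc _ ≤ 2 * ((n : ℝ) + 1) * (#Δ).choose u * Real.exp (n * θ ^ 2 - θ * s) := by gcongr
        _ = _ := by ring
  calc _ ≤ ∑ H ∈ I.gs, 2 * (n + 1) * Real.exp (n * θ ^ 2 - θ * s) := sum_le_sum key
    _ = _ := by rw [sum_const, nsmul_eq_mul]; ring

/-- Asymptotic context: `n` large compared to `L`, density `p` bounded away from `0` and `1`. -/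
structure Ctx (n : ℕ) where
  /-- a slowly growing parameter -/
  L : ℝ
  /-- the density -/
  p : ℝ
  hL : 1000 ≤ L
  hn : L ^ 1000 ≤ n
  hexp : (n : ℝ) ^ 20 ≤ Real.exp L
  hp : 1 / L ≤ p * (1 - p)
  hp0 : 0 < p
  hp1 : p < 1

namespace Ctx

variable {n : ℕ} (c : Ctx n)

/-- The square root of the number of vertices. -/
def σ (_ : Ctx n) : ℝ := Real.sqrt n

lemma one_le_L : 1 ≤ c.L := by have := c.hL; linarith

lemma L_pos : 0 < c.L := by have := c.hL; linarith

lemma one_le_n (c : Ctx n) : (1 : ℝ) ≤ n := (one_le_pow₀ c.one_le_L).trans c.hn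

lemma n_pos (c : Ctx n) : (0 : ℝ) < n := by have := c.one_le_n; linarith

lemma σ_sq : c.σ ^ 2 = n := Real.sq_sqrt c.n_pos.le

lemma σ_zsq : c.σ ^ (2 : ℤ) = n := by exact_mod_cast c.σ_sq

lemma σ_pos : 0 < c.σ := Real.sqrt_pos.2 c.n_pos

lemma L_pow_le_σ : c.L ^ 500 ≤ c.σ := by
  refine Real.le_sqrt_of_sq_le ?_
  rw [← pow_mul]; exact c.hn

lemma one_le_σ : 1 ≤ c.σ := (one_le_pow₀ c.one_le_L).trans c.L_pow_le_σ

/-- `|x| ≤ L ^ k * n ^ (m / 2)`. -/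
def Bd (k : ℕ) (m : ℤ) (x : ℝ) : Prop := |x| ≤ c.L ^ k * c.σ ^ m

variable {c}

lemma bd_nonneg (c : Ctx n) (k : ℕ) (m : ℤ) : 0 ≤ c.L ^ k * c.σ ^ m :=
  mul_nonneg (pow_nonneg c.L_pos.le _) (zpow_nonneg c.σ_pos.le _)

lemma Bd.mono {k k' : ℕ} {m m' : ℤ} {x : ℝ} (h : c.Bd k m x) (hk : k ≤ k') (hm : m ≤ m') :
    c.Bd k' m' x := by
  refine h.trans (mul_le_mul (pow_le_pow_right₀ c.one_le_L hk)
    (zpow_le_zpow_right₀ c.one_le_σ hm) (zpow_nonneg c.σ_pos.le _) (pow_nonneg c.L_pos.le _))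

lemma Bd.up {k k' : ℕ} {m m' : ℤ} {x : ℝ} (h : c.Bd k m x) (hk : k ≤ k' + 500)
    (hm : m + 1 ≤ m') : c.Bd k' m' x := by
  have h1 : c.Bd (k' + 500) m x := h.mono hk le_rfl
  have h2 : c.Bd k' (m + 1) x := by
    refine h1.trans ?_
    rw [pow_add, zpow_add_one₀ c.σ_pos.ne', mul_assoc, mul_comm (c.σ ^ m)]
    have := c.L_pow_le_σ
    have h3 := zpow_nonneg c.σ_pos.le m
    have h4 := pow_nonneg c.L_pos.le k'
    gcongr
  exact h2.mono le_rfl hm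

lemma Bd.of_abs_le {k : ℕ} {m : ℤ} {x y : ℝ} (h : c.Bd k m x) (hy : |y| ≤ |x|) : c.Bd k m y :=
  hy.trans h

lemma Bd.neg {k : ℕ} {m : ℤ} {x : ℝ} (h : c.Bd k m x) : c.Bd k m (-x) := by
  unfold Bd; rwa [abs_neg]

lemma Bd.abs {k : ℕ} {m : ℤ} {x : ℝ} (h : c.Bd k m x) : c.Bd k m |x| := by
  unfold Bd; rwa [abs_abs]

lemma Bd.add {k : ℕ} {m : ℤ} {x y : ℝ} (hx : c.Bd k m x) (hy : c.Bd k m y) :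
    c.Bd (k + 1) m (x + y) := by
  have h := c.bd_nonneg k m
  calc |x + y| ≤ c.L ^ k * c.σ ^ m + c.L ^ k * c.σ ^ m := (abs_add_le _ _).trans (add_le_add hx hy)
    _ ≤ c.L * (c.L ^ k * c.σ ^ m) := by have := c.hL; nlinarith
    _ = _ := by ring

lemma Bd.sub {k : ℕ} {m : ℤ} {x y : ℝ} (hx : c.Bd k m x) (hy : c.Bd k m y) :
    c.Bd (k + 1) m (x - y) := by
  rw [sub_eq_add_neg]; exact hx.add hy.neg

lemma Bd.mul {k k' : ℕ} {m m' : ℤ} {x y : ℝ} (hx : c.Bd k m x) (hy : c.Bd k' m' y) :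
    c.Bd (k + k') (m + m') (x * y) := by
  unfold Bd at *
  rw [abs_mul, pow_add, zpow_add₀ c.σ_pos.ne']
  calc |x| * |y| ≤ (c.L ^ k * c.σ ^ m) * (c.L ^ k' * c.σ ^ m') :=
        mul_le_mul hx hy (abs_nonneg _) (c.bd_nonneg _ _)
    _ = _ := by ring

lemma Bd.zero {k : ℕ} {m : ℤ} : c.Bd k m 0 := by
  unfold Bd; rw [abs_zero]; exact c.bd_nonneg _ _

lemma Bd.const {x : ℝ} (h : |x| ≤ 1000) : c.Bd 1 0 x := by
  unfold Bd; have := c.hL; simp; linarith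

lemma Bd.one {x : ℝ} (h : |x| ≤ 1) : c.Bd 0 0 x := by
  unfold Bd; simpa

lemma bd_n (c : Ctx n) : c.Bd 0 2 (n : ℝ) := by
  unfold Bd; rw [c.σ_zsq]; simp

lemma bd_inv_n (c : Ctx n) : c.Bd 0 (-2) (n : ℝ)⁻¹ := by
  unfold Bd; rw [zpow_neg, c.σ_zsq]; simp

lemma Bd.div_n {k : ℕ} {m : ℤ} {x : ℝ} (h : c.Bd k m x) : c.Bd k (m - 2) (x / n) := by
  have := h.mul c.bd_inv_n
  simpa [div_eq_mul_inv, sub_eq_add_neg] using this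

lemma Bd.sum {ι : Type*} {s : Finset ι} {k k' : ℕ} {m m' : ℤ} {f : ι → ℝ}
    (h : ∀ i ∈ s, c.Bd k m (f i)) (hs : c.Bd k' m' (#s : ℝ)) :
    c.Bd (k' + k) (m' + m) (∑ i ∈ s, f i) := by
  have h1 : |∑ i ∈ s, f i| ≤ #s * (c.L ^ k * c.σ ^ m) := by
    refine (abs_sum_le_sum_abs _ _).trans ((sum_le_sum h).trans ?_)
    rw [sum_const, nsmul_eq_mul]
  refine h1.trans ?_
  unfold Bd at hs
  rw [Nat.abs_cast] at hs
  rw [pow_add, zpow_add₀ c.σ_pos.ne']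
  calc _ ≤ c.L ^ k' * c.σ ^ m' * (c.L ^ k * c.σ ^ m) := by
        gcongr; exact c.bd_nonneg _ _
    _ = _ := by ring

lemma bd_card (c : Ctx n) (s : Finset (Fin n)) : c.Bd 0 2 (#s : ℝ) := by
  refine c.bd_n.of_abs_le ?_
  rw [Nat.abs_cast, Nat.abs_cast]
  have := card_le_univ s; rw [Fintype.card_fin] at this; exact_mod_cast this

lemma Bd.sum_fin {s : Finset (Fin n)} {k : ℕ} {m : ℤ} {f : Fin n → ℝ}
    (h : ∀ i ∈ s, c.Bd k m (f i)) : c.Bd k (m + 2) (∑ i ∈ s, f i) := by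
  have := Bd.sum h (c.bd_card s)
  rwa [zero_add, add_comm] at this

/-- Weighted sums with nonnegative weights. -/
lemma Bd.sum_weight {s : Finset (Fin n)} {k k' : ℕ} {m m' : ℤ} {f w : Fin n → ℝ}
    (hw : ∀ i ∈ s, 0 ≤ w i)
    (h : ∀ i ∈ s, c.Bd k m (f i)) (hs : c.Bd k' m' (∑ i ∈ s, w i)) :
    c.Bd (k' + k) (m' + m) (∑ i ∈ s, w i * f i) := by
  have h1 : |∑ i ∈ s, w i * f i| ≤ (∑ i ∈ s, w i) * (c.L ^ k * c.σ ^ m) := by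
    refine (abs_sum_le_sum_abs _ _).trans ?_
    rw [sum_mul]
    refine sum_le_sum fun i hi => ?_
    rw [abs_mul, abs_of_nonneg (hw i hi)]
    exact mul_le_mul_of_nonneg_left (h i hi) (hw i hi)
  refine h1.trans ?_
  unfold Bd at hs
  rw [abs_of_nonneg (sum_nonneg hw)] at hs
  rw [pow_add, zpow_add₀ c.σ_pos.ne']
  calc _ ≤ c.L ^ k' * c.σ ^ m' * (c.L ^ k * c.σ ^ m) := by
        gcongr; exact c.bd_nonneg _ _
    _ = _ := by ring

lemma bd_p (c : Ctx n) : c.Bd 0 0 c.p := .one (abs_le.2 ⟨by linarith [c.hp0], c.hp1.le⟩)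

lemma bd_inv {k : ℕ} {m : ℤ} {x : ℝ} (h : c.L ^ (-(k : ℤ)) * c.σ ^ (-m) ≤ |x|) :
    c.Bd k m x⁻¹ := by
  unfold Bd
  have h0 : 0 < c.L ^ (-(k : ℤ)) * c.σ ^ (-m) :=
    mul_pos (zpow_pos c.L_pos _) (zpow_pos c.σ_pos _)
  rw [abs_inv, inv_le_comm₀ (h0.trans_le h) (mul_pos (pow_pos c.L_pos _) (zpow_pos c.σ_pos _))]
  refine le_trans (le_of_eq ?_) h
  rw [mul_inv, zpow_neg, zpow_neg, zpow_natCast]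

lemma var_pos (c : Ctx n) : 0 < c.p * (1 - c.p) := mul_pos c.hp0 (by linarith [c.hp1])

lemma bd_inv_var (c : Ctx n) : c.Bd 1 0 (c.p * (1 - c.p))⁻¹ := by
  refine bd_inv ?_
  rw [abs_of_pos c.var_pos]
  have := c.hp
  simpa using this

lemma bd_inv_p (c : Ctx n) : c.Bd 1 0 c.p⁻¹ := by
  have : c.p⁻¹ = (1 - c.p) * (c.p * (1 - c.p))⁻¹ := by
    have := c.hp0.ne'; have : (1 - c.p) ≠ 0 := by linarith [c.hp1]
    field_simp
  rw [this]
  have h : c.Bd 0 0 (1 - c.p) := .one (abs_le.2 ⟨by linarith [c.hp1], by linarith [c.hp0]⟩)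
  exact h.mul c.bd_inv_var

lemma bd_one_sub_p (c : Ctx n) : c.Bd 0 0 (1 - c.p) :=
  .one (abs_le.2 ⟨by linarith [c.hp1], by linarith [c.hp0]⟩)

lemma bd_inv_one_sub_p (c : Ctx n) : c.Bd 1 0 (1 - c.p)⁻¹ := by
  have : (1 - c.p)⁻¹ = c.p * (c.p * (1 - c.p))⁻¹ := by
    have := c.hp0.ne'; have : (1 - c.p) ≠ 0 := by linarith [c.hp1]
    field_simp
  rw [this]
  exact c.bd_p.mul c.bd_inv_var

lemma p_ge (c : Ctx n) : 1 / c.L ≤ c.p := by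
  have := c.hp; have := c.hp0; have := c.hp1; nlinarith

lemma one_sub_p_ge (c : Ctx n) : 1 / c.L ≤ 1 - c.p := by
  have := c.hp; have := c.hp0; have := c.hp1; nlinarith

/-- Small quantities are at most any fixed power of `1 / L`. -/
lemma Bd.le_pow {k j : ℕ} {m : ℤ} {x : ℝ} (h : c.Bd k m x) (hm : m ≤ -1) (hk : k + j ≤ 500) :
    |x| ≤ 1 / c.L ^ j := by
  have h1 : c.Bd k (-1) x := h.mono le_rfl hm
  refine h1.trans ?_
  rw [zpow_neg_one, ← div_eq_mul_inv, div_le_div_iff₀ c.σ_pos (pow_pos c.L_pos _), ← pow_add,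
    one_mul]
  exact (pow_le_pow_right₀ c.one_le_L hk).trans c.L_pow_le_σ

end Ctx

/-- Numerical conditions on an instance; `s` counts modifications. -/
structure Good {n : ℕ} (c : Ctx n) (s : ℕ) (I : Inst n) : Prop where
  deg : ∀ v, |(I.d v : ℝ) - c.p * (n - 1)| ≤ c.L * c.σ + s
  xdeg : ∀ v, I.x v ≤ c.L * c.σ + s
  sumd : |∑ v, ((I.d v : ℝ) - c.p * (n - 1))| ≤ c.L + 2 * s
  sumx : ∑ v, I.x v ≤ c.L * n + 2 * s

namespace Inst

lemma x_nonneg {n : ℕ} (I : Inst n) (v : Fin n) : 0 ≤ I.x v := sum_nonneg fun _ _ => ad_nonneg _ _ _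

lemma x_add {n : ℕ} (I : Inst n) {a v : Fin n} (hav : a ≠ v) (h : ¬ I.X.Adj a v) (w : Fin n) :
    (I.add a v).x w = I.x w + (if w = a ∨ w = v then 1 else 0) := sum_ad_sup_edge hav h w

lemma x_del {n : ℕ} (I : Inst n) {a v : Fin n} (hav : a ≠ v) (h : ¬ I.X.Adj a v) (w : Fin n) :
    (I.del a v).x w = I.x w + (if w = a ∨ w = v then 1 else 0) := sum_ad_sup_edge hav h w

end Inst

namespace Good

open Ctx

variable {n : ℕ} {c : Ctx n} {s : ℕ} {I : Inst n}

lemma sum_pair_ind {a v : Fin n} (hav : a ≠ v) :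
    ∑ w, (if w = a ∨ w = v then (1 : ℝ) else 0) = 2 := by
  have : (univ.filter fun w => w = a ∨ w = v) = {a, v} := by ext; simp
  rw [← sum_filter, this, sum_pair hav]; norm_num

lemma s_le (c : Ctx n) (hs : s ≤ 40) : (s : ℝ) ≤ c.L := by
  have : (s : ℝ) ≤ 40 := by exact_mod_cast hs
  have := c.hL; linarith

lemma L_σ_add (c : Ctx n) {t : ℝ} (ht : t ≤ c.L) : c.L * c.σ + t ≤ c.L ^ 2 * c.σ := by
  have h2 := c.hL
  have h3 := c.one_le_σ
  have h4 : c.L * 1 ≤ c.L * c.σ := by gcongr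
  have h5 : 1000 * (c.L * c.σ) ≤ c.L * (c.L * c.σ) := by gcongr
  nlinarith

lemma bd_deg (h : Good c s I) (hs : s ≤ 40) (v : Fin n) :
    c.Bd 2 1 ((I.d v : ℝ) - c.p * (n - 1)) := by
  refine (h.deg v).trans ?_
  rw [zpow_one]; exact L_σ_add c (s_le c hs)

lemma bd_x (h : Good c s I) (hs : s ≤ 40) (v : Fin n) : c.Bd 2 1 (I.x v) := by
  unfold Bd; rw [abs_of_nonneg (I.x_nonneg v)]
  refine (h.xdeg v).trans ?_
  rw [zpow_one]; exact L_σ_add c (s_le c hs)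

lemma bd_sumd (h : Good c s I) (hs : s ≤ 40) :
    c.Bd 2 0 (∑ v, ((I.d v : ℝ) - c.p * (n - 1))) := by
  refine h.sumd.trans ?_
  have := s_le c hs; have := c.hL; rw [zpow_zero]; nlinarith

lemma bd_sumx (h : Good c s I) (hs : s ≤ 40) : c.Bd 2 2 (∑ v, I.x v) := by
  unfold Bd; rw [abs_of_nonneg (sum_nonneg fun v _ => I.x_nonneg v), c.σ_zsq]
  refine h.sumx.trans ?_
  have h1 := s_le c hs; have h2 := c.hL; have h3 := c.one_le_n
  have h4 : c.L * 1 ≤ c.L * n := by gcongr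
  have h5 : 1000 * (c.L * n) ≤ c.L * (c.L * n) := by gcongr
  nlinarith

lemma L_pow_le_n (c : Ctx n) {k : ℕ} (hk : k ≤ 1000) : c.L ^ k ≤ n :=
  (pow_le_pow_right₀ c.one_le_L hk).trans c.hn

lemma L_mul_σ_le (c : Ctx n) {k : ℕ} (hk : k ≤ 500) : c.L ^ k * c.σ ≤ n := by
  rw [← c.σ_sq, sq]
  have := (pow_le_pow_right₀ c.one_le_L hk).trans c.L_pow_le_σ
  have := c.σ_pos
  gcongr

lemma two_le_d (h : Good c s I) (hs : s ≤ 40) (v : Fin n) : 2 ≤ I.d v := by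
  have h1 := (abs_le.1 (h.bd_deg hs v)).1
  rw [zpow_one] at h1
  have h2 : c.L ^ 4 * c.σ ≤ n := L_mul_σ_le c (by norm_num)
  have h3 := c.p_ge
  have hL := c.hL
  have hLp := c.L_pos
  have h4 : c.L ^ 3 * c.σ ≤ c.p * n := by
    calc c.L ^ 3 * c.σ = 1 / c.L * (c.L ^ 4 * c.σ) := by field_simp
      _ ≤ c.p * n := mul_le_mul h3 h2 (mul_nonneg (by positivity) c.σ_pos.le) c.hp0.le
  have h5 : 1 ≤ c.σ := c.one_le_σ
  have h6 : c.L ^ 2 * c.σ * 1000 ≤ c.L ^ 3 * c.σ := by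
    have : 0 ≤ c.L ^ 2 * c.σ := by positivity
    nlinarith
  have h7 : 1 ≤ c.L ^ 2 * c.σ := by nlinarith
  have : (1 : ℝ) < I.d v := by nlinarith [c.hp1]
  exact_mod_cast this

lemma one_le_d (h : Good c s I) (hs : s ≤ 40) (v : Fin n) : 1 ≤ I.d v :=
  one_le_two.trans (h.two_le_d hs v)

lemma add (h : Good c s I) (hs : s ≤ 40) {a v : Fin n} (hav : a ≠ v) (hX : ¬ I.X.Adj a v) :
    Good c (s + 1) (I.add a v) := by
  have e : ∀ w, ((I.add a v).d w : ℝ) = I.d w - (if w = a ∨ w = v then 1 else 0) := by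
    intro w
    simp only [Inst.add]
    split_ifs
    · rw [Nat.cast_sub (h.one_le_d hs w)]; simp
    · simp
  refine ⟨fun w => ?_, fun w => ?_, ?_, ?_⟩
  · rw [e, sub_right_comm]
    refine (abs_sub _ _).trans ?_
    have := h.deg w
    push_cast
    split_ifs <;> norm_num <;> linarith
  · rw [I.x_add hav hX]
    have := h.xdeg w
    push_cast
    split_ifs <;> linarith
  · simp_rw [e, sub_right_comm _ (ite _ _ _)]
    rw [sum_sub_distrib, sum_pair_ind hav]
    refine (abs_sub _ _).trans ?_
    have := h.sumd
    push_cast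
    rw [abs_two]; linarith
  · simp_rw [I.x_add hav hX]
    rw [sum_add_distrib, sum_pair_ind hav]
    have := h.sumx
    push_cast; linarith

lemma del (h : Good c s I) {a v : Fin n} (hav : a ≠ v) (hX : ¬ I.X.Adj a v) :
    Good c (s + 1) (I.del a v) := by
  refine ⟨fun w => ?_, fun w => ?_, ?_, ?_⟩
  · have := h.deg w
    simp only [Inst.del]; push_cast; linarith
  · rw [I.x_del hav hX]
    have := h.xdeg w
    push_cast
    split_ifs <;> linarith
  · have := h.sumd
    simp only [Inst.del]; push_cast; linarith
  · simp_rw [I.x_del hav hX]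
    rw [sum_add_distrib, sum_pair_ind hav]
    have := h.sumx
    push_cast; linarith

lemma exp_bound (c : Ctx n) : 2 * ((n : ℝ) + 1) * Real.exp (1 - c.L ^ 2) * n ≤
    c.L ^ 0 * c.σ ^ (-40 : ℤ) := by
  have h1 : (n : ℝ) ^ 40 ≤ Real.exp (2 * c.L) := by
    calc (n : ℝ) ^ 40 = ((n : ℝ) ^ 20) ^ 2 := by ring
      _ ≤ (Real.exp c.L) ^ 2 := by gcongr; exact c.hexp
      _ = _ := by rw [← Real.exp_nat_mul]; norm_num
  have h2 : Real.exp (1 - c.L ^ 2) ≤ Real.exp (-(2 * c.L)) := by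
    rw [Real.exp_le_exp]; have := c.hL; nlinarith
  have hn := c.one_le_n
  have hn4 : 4 ≤ (n : ℝ) := by
    have := L_pow_le_n c (k := 1) (by norm_num); have := c.hL; linarith [pow_one c.L]
  have h3 : Real.exp (1 - c.L ^ 2) ≤ ((n : ℝ) ^ 40)⁻¹ := by
    refine h2.trans ?_
    rw [Real.exp_neg]
    exact inv_anti₀ (by positivity) h1
  have h4 : c.σ ^ (-40 : ℤ) = ((n : ℝ) ^ 20)⁻¹ := by
    rw [show (-40 : ℤ) = -(2 * 20) by norm_num, zpow_neg, zpow_mul, c.σ_zsq]; norm_cast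
  rw [h4, pow_zero, one_mul]
  calc _ ≤ 2 * ((n : ℝ) + n) * ((n : ℝ) ^ 40)⁻¹ * n := by gcongr
    _ = 4 * n ^ 2 * ((n : ℝ) ^ 40)⁻¹ := by ring
    _ ≤ (n : ℝ) ^ 20 * ((n : ℝ) ^ 40)⁻¹ := by
        gcongr
        calc 4 * (n : ℝ) ^ 2 ≤ (n : ℝ) * (n : ℝ) ^ 2 := by gcongr
          _ = (n : ℝ) ^ 3 := by ring
          _ ≤ (n : ℝ) ^ 20 := pow_le_pow_right₀ hn (by norm_num)
    _ = _ := by field_simp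

lemma cod_conc (h : Good c s I) (hs : s ≤ 40) {a z : Fin n} (haz : a ≠ z) :
    c.Bd 0 (-40) (I.E fun H => if ¬ c.Bd 4 1 (cod H a z - c.p ^ 2 * n) then 1 else 0) := by
  set K : Fin n → ℝ := fun b => 2 + 2 * (I.x a + I.x b) + |(I.d a : ℝ) - I.d b| +
    2 * (c.L ^ 2 * c.σ) with hK
  have hL := c.hL
  have hσ := c.one_le_σ
  have hsL := s_le c hs
  have hn := c.one_le_n
  have hLσ : 1 ≤ c.L * c.σ := by nlinarith
  have hKle : ∀ b, K b ≤ 3 * (c.L ^ 2 * c.σ) := by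
    intro b
    have h1 := h.xdeg a; have h2 := h.xdeg b
    have h3 : |(I.d a : ℝ) - I.d b| ≤ 2 * (c.L * c.σ + s) := by
      have := abs_sub ((I.d a : ℝ) - c.p * (n - 1)) ((I.d b : ℝ) - c.p * (n - 1))
      have h4 := h.deg a; have h5 := h.deg b
      rw [sub_sub_sub_cancel_right] at this; linarith
    simp only [hK]
    nlinarith
  have main : ∀ H ∈ I.gs, (∀ b, b ≠ z → |cod H a z - cod H b z| ≤ 3 * (c.L ^ 2 * c.σ)) →
      c.Bd 4 1 (cod H a z - c.p ^ 2 * n) := by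
    intro H hH hb
    have hd := (Inst.mem_gs.1 hH).1
    have ad0 : ∀ x y, 0 ≤ ad H x y := ad_nonneg H
    have hcodn : ∀ b, 0 ≤ cod H b z ∧ cod H b z ≤ n := by
      intro b
      refine ⟨sum_nonneg fun v _ => mul_nonneg (ad0 _ _) (ad0 _ _), ?_⟩
      refine (sum_le_sum (g := fun _ => (1 : ℝ)) fun v _ =>
        mul_le_one₀ (ad_le_one _ _ _) (ad0 _ _) (ad_le_one _ _ _)).trans (by simp)
    have e1 : ∑ b, cod H b z = ∑ v, ad H z v * I.d v := by
      unfold cod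
      rw [sum_comm]
      refine sum_congr rfl fun v _ => ?_
      rw [← sum_mul, mul_comm, ← hd v]
      simp_rw [ad_comm H v]
    have e2 : |n * cod H a z - ∑ b, cod H b z| ≤ n * (3 * (c.L ^ 2 * c.σ)) + n := by
      have : n * cod H a z - ∑ b, cod H b z = ∑ b, (cod H a z - cod H b z) := by
        rw [sum_sub_distrib]; simp
      rw [this]
      refine (abs_sum_le_sum_abs _ _).trans ?_
      calc ∑ b, |cod H a z - cod H b z| ≤
          ∑ b, (3 * (c.L ^ 2 * c.σ) + if b = z then (n : ℝ) else 0) := by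
            refine sum_le_sum fun b _ => ?_
            by_cases hbz : b = z
            · rw [if_pos hbz, abs_le]
              have h1 := hcodn a; have h2 := hcodn b
              have : 0 ≤ c.L ^ 2 * c.σ := by positivity
              constructor <;> linarith
            · rw [if_neg hbz, add_zero]; exact hb b hbz
        _ = _ := by rw [sum_add_distrib]; simp
    have e3 : |∑ v, ad H z v * I.d v - I.d z * (c.p * (n - 1))| ≤ n * (c.L * c.σ + s) := by
      have : ∑ v, ad H z v * I.d v - I.d z * (c.p * (n - 1)) =
          ∑ v, ad H z v * (I.d v - c.p * (n - 1)) := by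
        rw [← hd z, sum_mul, ← sum_sub_distrib]
        exact sum_congr rfl fun v _ => by ring
      rw [this]
      refine (abs_sum_le_sum_abs _ _).trans ?_
      calc _ ≤ ∑ v : Fin n, (c.L * c.σ + s) := by
            refine sum_le_sum fun v _ => ?_
            rw [abs_mul, abs_of_nonneg (ad0 _ _)]
            exact (mul_le_of_le_one_left (abs_nonneg _) (ad_le_one _ _ _)).trans (h.deg v)
        _ = _ := by rw [sum_const, card_univ, Fintype.card_fin, nsmul_eq_mul]
    have e4 : |I.d z * (c.p * (n - 1)) - n * (c.p ^ 2 * n)| ≤ n * (c.L * c.σ + s) + 2 * n := by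
      have : I.d z * (c.p * (n - 1)) - n * (c.p ^ 2 * n) =
          (I.d z - c.p * (n - 1)) * (c.p * (n - 1)) - c.p ^ 2 * (2 * n - 1) := by ring
      rw [this]
      refine (abs_sub _ _).trans ?_
      have p0 := c.hp0
      have p1 := c.hp1
      rw [abs_mul, abs_of_nonneg (show 0 ≤ c.p * ((n : ℝ) - 1) from
        mul_nonneg p0.le (by linarith)), abs_of_nonneg (show 0 ≤ c.p ^ 2 * (2 * (n : ℝ) - 1) from
        mul_nonneg (by positivity) (by linarith))]
      have f1 : c.p * ((n : ℝ) - 1) ≤ n := by nlinarith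
      have f2 : c.p ^ 2 ≤ 1 := by nlinarith
      have f3 : |(I.d z : ℝ) - c.p * (n - 1)| * (c.p * (n - 1)) ≤ (c.L * c.σ + s) * n :=
        mul_le_mul (h.deg z) f1 (mul_nonneg p0.le (by linarith)) (by positivity)
      have f4 : c.p ^ 2 * (2 * (n : ℝ) - 1) ≤ 1 * (2 * n) := mul_le_mul f2 (by linarith)
          (by linarith) (by norm_num)
      linarith
    have e5 : n * |cod H a z - c.p ^ 2 * n| ≤ n * (c.L ^ 4 * c.σ) := by
      have : (n : ℝ) * |cod H a z - c.p ^ 2 * n| =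
          |(n * cod H a z - ∑ b, cod H b z) + ((∑ v, ad H z v * I.d v - I.d z * (c.p * (n - 1))) +
            (I.d z * (c.p * (n - 1)) - n * (c.p ^ 2 * n)))| := by
        rw [e1, ← abs_of_pos c.n_pos, ← abs_mul, abs_of_pos c.n_pos]; congr 1; ring
      rw [this]
      have g1 := abs_add_le (n * cod H a z - ∑ b, cod H b z)
        ((∑ v, ad H z v * I.d v - I.d z * (c.p * (n - 1))) +
            (I.d z * (c.p * (n - 1)) - n * (c.p ^ 2 * n)))
      have g2 := abs_add_le (∑ v, ad H z v * I.d v - I.d z * (c.p * (n - 1)))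
            (I.d z * (c.p * (n - 1)) - n * (c.p ^ 2 * n))
      have g3 : 3 * (c.L ^ 2 * c.σ) + 1 + 2 * (c.L * c.σ + s) + 2 ≤ c.L ^ 4 * c.σ := by
        have : c.L * c.σ * 1000 ≤ c.L ^ 2 * c.σ := by nlinarith
        have : c.L ^ 2 * c.σ * 1000 ≤ c.L ^ 3 * c.σ := by
          have : 0 ≤ c.L ^ 2 * c.σ := by positivity
          nlinarith
        have : c.L ^ 3 * c.σ * 1000 ≤ c.L ^ 4 * c.σ := by
          have : 0 ≤ c.L ^ 3 * c.σ := by positivity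
          nlinarith
        nlinarith
      have := mul_le_mul_of_nonneg_left g3 c.n_pos.le
      linarith
    have := le_of_mul_le_mul_left e5 c.n_pos
    unfold Bd; rwa [zpow_one]
  have hub : I.E (fun H => if ¬ c.Bd 4 1 (cod H a z - c.p ^ 2 * n) then 1 else 0) ≤
      I.E (fun H => ∑ b ∈ univ.filter (· ≠ z),
        (if K b < |cod H a z - cod H b z| then (1 : ℝ) else 0)) := by
    refine Inst.E_mono fun H hH => ?_
    have nn : ∀ b ∈ univ.filter (· ≠ z),
        (0 : ℝ) ≤ if K b < |cod H a z - cod H b z| then (1 : ℝ) else 0 := fun b _ => by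
      split_ifs <;> norm_num
    split_ifs with hb
    · exact sum_nonneg nn
    · have : ∃ b, b ≠ z ∧ 3 * (c.L ^ 2 * c.σ) < |cod H a z - cod H b z| := by
        by_contra! hcon
        exact hb (main H hH hcon)
      obtain ⟨b, hbz, hb⟩ := this
      refine le_trans ?_ (single_le_sum nn (mem_filter.2 ⟨mem_univ b, hbz⟩))
      rw [if_pos ((hKle b).trans_lt hb)]
  have h0 : 0 ≤ I.E (fun H => if ¬ c.Bd 4 1 (cod H a z - c.p ^ 2 * n) then 1 else 0) :=
    Inst.E_nonneg fun H _ => by split_ifs <;> norm_num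
  unfold Bd at h0 hub ⊢
  rw [abs_of_nonneg h0]
  refine hub.trans ?_
  rw [Inst.E_sum]
  refine le_trans ?_ (exp_bound c)
  calc _ ≤ ∑ b ∈ univ.filter (· ≠ z), 2 * ((n : ℝ) + 1) * Real.exp (1 - c.L ^ 2) := by
        refine sum_le_sum fun b hb => ?_
        have hbz := (mem_filter.1 hb).2
        have := cod_tail I (a := a) (b := b) (z := z) haz.symm hbz.symm (θ := c.σ⁻¹)
          (s := c.L ^ 2 * c.σ) (inv_nonneg.2 c.σ_pos.le) (inv_le_one_of_one_le₀ c.one_le_σ)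
        rw [← c.σ_sq] at this
        have hσ0 := c.σ_pos.ne'
        rw [show c.σ ^ 2 * c.σ⁻¹ ^ 2 - c.σ⁻¹ * (c.L ^ 2 * c.σ) = 1 - c.L ^ 2 by field_simp,
          c.σ_sq] at this
        exact this
    _ ≤ _ := by
        rw [sum_const, nsmul_eq_mul, mul_comm]
        gcongr
        have := card_le_univ (univ.filter (· ≠ z)); rw [Fintype.card_fin] at this
        exact_mod_cast this

end Good

namespace Ctx

variable {n : ℕ} {c : Ctx n} {k k₁ k₂ : ℕ} {m m₁ m₂ : ℤ} {x y : ℝ}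

lemma Bd.add' (hx : c.Bd k₁ m₁ x) (hy : c.Bd k₂ m₂ y) (h₁ : k₁ + 1 ≤ k := by norm_num)
    (h₂ : k₂ + 1 ≤ k := by norm_num) (h₃ : m₁ ≤ m := by norm_num) (h₄ : m₂ ≤ m := by norm_num) :
    c.Bd k m (x + y) :=
  ((hx.mono (Nat.le_sub_of_add_le h₁) h₃).add (hy.mono (Nat.le_sub_of_add_le h₂) h₄)).mono
    (by omega) le_rfl

lemma Bd.sub' (hx : c.Bd k₁ m₁ x) (hy : c.Bd k₂ m₂ y) (h₁ : k₁ + 1 ≤ k := by norm_num)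
    (h₂ : k₂ + 1 ≤ k := by norm_num) (h₃ : m₁ ≤ m := by norm_num) (h₄ : m₂ ≤ m := by norm_num) :
    c.Bd k m (x - y) := by
  rw [sub_eq_add_neg]; exact hx.add' hy.neg h₁ h₂ h₃ h₄

lemma Bd.mul' (hx : c.Bd k₁ m₁ x) (hy : c.Bd k₂ m₂ y) (h₁ : k₁ + k₂ ≤ k := by norm_num)
    (h₃ : m₁ + m₂ ≤ m := by norm_num) : c.Bd k m (x * y) :=
  (hx.mul hy).mono h₁ h₃

lemma Bd.mono' (hx : c.Bd k₁ m₁ x) (h₁ : k₁ ≤ k := by norm_num)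
    (h₃ : m₁ ≤ m := by norm_num) : c.Bd k m x := hx.mono h₁ h₃

/-- Expectations inherit pointwise bounds off a negligible event. -/
lemma Bd.E {I : Inst n} {f : SimpleGraph (Fin n) → ℝ} {bad : SimpleGraph (Fin n) → Prop}
    (h₁ : ∀ H ∈ I.gs, ¬ bad H → c.Bd k m (f H)) (h₂ : ∀ H ∈ I.gs, c.Bd 0 20 (f H))
    (h₃ : c.Bd 0 (-40) (I.E fun H => if bad H then 1 else 0)) (hm : -20 ≤ m := by norm_num) :
    c.Bd (k + 1) m (I.E f) := by
  have h := Inst.abs_E_le_bad bad (c.bd_nonneg k m) h₁ h₂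
  have h0 : 0 ≤ I.E fun H => if bad H then 1 else 0 :=
    Inst.E_nonneg fun H _ => by split_ifs <;> norm_num
  have h4 : c.L ^ 0 * c.σ ^ (20 : ℤ) * I.E (fun H => if bad H then 1 else 0) ≤
      c.L ^ k * c.σ ^ m := by
    unfold Bd at h₃
    rw [abs_of_nonneg h0] at h₃
    calc _ ≤ c.L ^ 0 * c.σ ^ (20 : ℤ) * (c.L ^ 0 * c.σ ^ (-40 : ℤ)) :=
          mul_le_mul_of_nonneg_left h₃ (c.bd_nonneg _ _)
      _ = c.L ^ 0 * c.σ ^ (-20 : ℤ) := by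
          rw [show (-20 : ℤ) = 20 + -40 by norm_num, zpow_add₀ c.σ_pos.ne']; ring
      _ ≤ _ := mul_le_mul (pow_le_pow_right₀ c.one_le_L (Nat.zero_le _))
          (zpow_le_zpow_right₀ c.one_le_σ hm) (zpow_nonneg c.σ_pos.le _) (pow_nonneg c.L_pos.le _)
  have h5 := c.bd_nonneg k m
  refine h.trans ((add_le_add_right h4 _).trans ?_)
  rw [pow_succ]
  have := c.hL
  nlinarith

lemma bd_nat (c : Ctx n) {i : ℕ} (h : i ≤ 1000) : c.Bd 1 0 (i : ℝ) :=
  .const (by rw [Nat.abs_cast]; exact_mod_cast h)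

end Ctx

namespace Inst

variable {n : ℕ} (I : Inst n)

/-- Summing over `I.S a b` instead of all vertices changes little. -/
lemma abs_sum_sub_sum_S (a b : Fin n) {f : Fin n → ℝ} {M : ℝ} (hM : ∀ v, |f v| ≤ M) :
    |∑ v, f v - ∑ v ∈ I.S a b, f v| ≤ M * (2 + I.x a + I.x b) := by
  have h1 : ∑ v, f v - ∑ v ∈ I.S a b, f v = ∑ v, if v ∈ I.S a b then 0 else f v := by
    rw [show ∑ v ∈ I.S a b, f v = ∑ v, if v ∈ I.S a b then f v else 0 by simp [sum_ite_mem],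
      ← sum_sub_distrib]
    exact sum_congr rfl fun v _ => by split_ifs <;> simp
  rw [h1]
  refine (abs_sum_le_sum_abs _ _).trans ?_
  have h2 : M * (2 + I.x a + I.x b) = ∑ v, M * ((if v = a then 1 else 0) +
      (if v = b then 1 else 0) + ad I.X a v + ad I.X b v) := by
    rw [← mul_sum]; simp only [sum_add_distrib, x]
    simp only [sum_ite_eq', mem_univ, if_true]; ring
  rw [h2]
  refine sum_le_sum fun v _ => ?_
  have hM0 := (abs_nonneg _).trans (hM v)
  have h3 : (0 : ℝ) ≤ if v = a then 1 else 0 := by split_ifs <;> norm_num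
  have h4 : (0 : ℝ) ≤ if v = b then 1 else 0 := by split_ifs <;> norm_num
  have h5 := ad_nonneg I.X a v
  have h6 := ad_nonneg I.X b v
  by_cases h : v ∈ I.S a b
  · rw [if_pos h, abs_zero]; positivity
  · rw [if_neg h]
    refine (hM v).trans (le_mul_of_one_le_right hM0 ?_)
    rw [mem_S] at h
    by_cases ha : v = a
    · rw [if_pos ha]; linarith
    by_cases hb : v = b
    · rw [if_pos hb]; linarith
    by_cases hXa : I.X.Adj a v
    · rw [ad_one hXa]; linarith
    by_cases hXb : I.X.Adj b v
    · rw [ad_one hXb]; linarith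
    exact absurd ⟨ha, hb, hXa, hXb⟩ h

end Inst


namespace Good

open Ctx

variable {n : ℕ} {c : Ctx n} {s : ℕ} {I : Inst n}

lemma bd_deg_sub (h : Good c s I) (hs : s ≤ 40) (a b : Fin n) :
    c.Bd 3 1 ((I.d a : ℝ) - I.d b) := by
  have := (h.bd_deg hs a).sub (h.bd_deg hs b)
  rwa [sub_sub_sub_cancel_right] at this

lemma bd_sum_ad (h : Good c s I) (hs : s ≤ 40) (a : Fin n) {f : Fin n → ℝ} {k : ℕ} {m : ℤ}
    (hf : ∀ w, I.X.Adj a w → c.Bd k m (f w)) : c.Bd (2 + k) (1 + m) (∑ w, ad I.X a w * f w) := by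
  have h1 : ∑ w, ad I.X a w * f w = ∑ w, ad I.X a w * (if I.X.Adj a w then f w else 0) :=
    sum_congr rfl fun w _ => by unfold ad; split_ifs <;> simp
  rw [h1]
  refine Bd.sum_weight (fun w _ => ad_nonneg _ _ _) (fun w _ => ?_) (h.bd_x hs a)
  split_ifs with hw
  · exact hf w hw
  · exact .zero

lemma bd_ad (c : Ctx n) (H : SimpleGraph (Fin n)) (a w : Fin n) : c.Bd 0 0 (ad H a w) :=
  .one (by rw [abs_of_nonneg (ad_nonneg _ _ _)]; exact ad_le_one _ _ _)

/-- Difference of the switchable neighbourhoods. -/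
lemma bd_ua_sub (h : Good c s I) (hs : s ≤ 40) (a b : Fin n) {H : SimpleGraph (Fin n)}
    (hH : H ∈ I.gs) : c.Bd 5 1 (ua (I.S a b) a b H - ua (I.S a b) b a H) := by
  rw [ua_sub_ua_eq hH]
  have h1 := h.bd_sum_ad hs b fun w _ => bd_ad c H a w
  have h2 := h.bd_sum_ad hs a fun w _ => bd_ad c H b w
  have h3 : c.Bd 4 1 ((I.d a : ℝ) - I.d b - ∑ w, ad I.X b w * ad H a w) :=
    (h.bd_deg_sub hs a b).sub' h1
  exact h3.add' h2

lemma bd_ua_add (h : Good c s I) (hs : s ≤ 40) {a b : Fin n} {H : SimpleGraph (Fin n)}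
    (hH : H ∈ I.gs) (hc : c.Bd 4 1 (cod H a b - c.p ^ 2 * n)) :
    c.Bd 7 1 (ua (I.S a b) a b H + ua (I.S a b) b a H - 2 * (c.p * (1 - c.p)) * n) := by
  have hd := (Inst.mem_gs.1 hH).1
  have h1 := I.abs_sum_sub_sum_S a b (f := fun v => ad H a v + ad H b v - 2 * (ad H a v * ad H b v))
    (M := 1) (fun v => by unfold ad; split_ifs <;> norm_num)
  have h2 : ua (I.S a b) a b H + ua (I.S a b) b a H =
      ∑ v ∈ I.S a b, (ad H a v + ad H b v - 2 * (ad H a v * ad H b v)) := by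
    unfold ua; rw [← sum_add_distrib]; exact sum_congr rfl fun v _ => by ring
  rw [← h2, sum_sub_distrib, sum_add_distrib, hd, hd, ← mul_sum] at h1
  change |(I.d a : ℝ) + I.d b - 2 * cod H a b - _| ≤ _ at h1
  have h3 : c.Bd 4 1 (2 + I.x a + I.x b) := by
    have h4 : c.Bd 3 1 (2 + I.x a) := (Bd.const (x := 2) (by norm_num)).add' (h.bd_x hs a)
    exact h4.add' (h.bd_x hs b)
  have h5 : c.Bd 4 1 ((I.d a : ℝ) + I.d b - 2 * cod H a b -
      (ua (I.S a b) a b H + ua (I.S a b) b a H)) := by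
    refine h3.of_abs_le (h1.trans ?_)
    rw [one_mul]; exact le_abs_self _
  have h6 : c.Bd 5 1 (2 * (cod H a b - c.p ^ 2 * n)) :=
    (Bd.const (x := 2) (by norm_num)).mul' hc
  have h7 : c.Bd 3 1 (((I.d a : ℝ) - c.p * (n - 1)) + (I.d b - c.p * (n - 1)) ) :=
    (h.bd_deg hs a).add' (h.bd_deg hs b)
  have h8 : c.Bd 1 0 (2 * c.p) := (Bd.const (x := 2) (by norm_num)).mul' c.bd_p
  have h9 : c.Bd 4 1 (((I.d a : ℝ) - c.p * (n - 1)) + (I.d b - c.p * (n - 1)) - 2 * c.p) :=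
    h7.sub' h8
  have h10 : c.Bd 5 1 (((I.d a : ℝ) - c.p * (n - 1)) + (I.d b - c.p * (n - 1)) - 2 * c.p -
     ((I.d a : ℝ) + I.d b - 2 * cod H a b -
      (ua (I.S a b) a b H + ua (I.S a b) b a H))) := h9.sub' h5
  have h11 : c.Bd 7 1 ((((I.d a : ℝ) - c.p * (n - 1)) + (I.d b - c.p * (n - 1)) - 2 * c.p -
     ((I.d a : ℝ) + I.d b - 2 * cod H a b -
      (ua (I.S a b) a b H + ua (I.S a b) b a H))) - (2 * (cod H a b - c.p ^ 2 * n))) := h10.sub' h6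
  convert h11 using 1
  ring

lemma ua_add_ge (c : Ctx n) {g : ℝ} (hg : c.Bd 7 1 (g - 2 * (c.p * (1 - c.p)) * n)) :
    n / c.L ≤ g := by
  have h1 := (abs_le.1 hg).1
  rw [zpow_one] at h1
  have h2 : c.L ^ 8 * c.σ ≤ n := L_mul_σ_le c (by norm_num)
  have h3 : 1 / c.L * n ≤ c.p * (1 - c.p) * n := mul_le_mul_of_nonneg_right c.hp c.n_pos.le
  have h4 : c.L ^ 7 * c.σ ≤ 1 / c.L * n := by
    have := c.L_pos
    calc c.L ^ 7 * c.σ = 1 / c.L * (c.L ^ 8 * c.σ) := by field_simp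
      _ ≤ _ := by gcongr
  have h5 : (n : ℝ) / c.L = 1 / c.L * n := by ring
  linarith

lemma bd_inv_ge (c : Ctx n) {g : ℝ} (hg : n / c.L ≤ g) : c.Bd 1 (-2) g⁻¹ := by
  refine bd_inv ?_
  have : 0 < (n : ℝ) / c.L := div_pos c.n_pos c.L_pos
  rw [abs_of_pos (this.trans_le hg), neg_neg, c.σ_zsq]
  refine le_trans (le_of_eq ?_) hg
  norm_num; ring

/-- The codegree of `a` and `b` is far from typical. -/
def BadCod (c : Ctx n) (a b : Fin n) (H : SimpleGraph (Fin n)) : Prop :=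
  ¬ c.Bd 4 1 (cod H a b - c.p ^ 2 * n)

lemma bd_badCod (h : Good c s I) (hs : s ≤ 40) {a b : Fin n} (hab : a ≠ b) :
    c.Bd 0 (-40) (I.E fun H => if BadCod c a b H then 1 else 0) := by
  refine (h.cod_conc hs hab).of_abs_le (le_of_eq ?_)
  congr 2
  funext H
  by_cases hb : c.Bd 4 1 (cod H a b - c.p ^ 2 * n)
  · rw [if_neg (not_not.2 hb), if_neg (show ¬ BadCod c a b H from not_not.2 hb)]
  · rw [if_pos hb, if_pos (show BadCod c a b H from hb)]

/-- First estimate of differences of edge probabilities. -/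
lemma bd_Pr_sub (h : Good c s I) (hs : s ≤ 40) {a b v : Fin n} (hv : v ∈ I.S a b) :
    c.Bd 8 (-1) (I.Pr a v - I.Pr b v) := by
  by_cases hab : a = b
  · rw [hab, sub_self]; exact .zero
  rw [Inst.Pr_sub_Pr hv]
  have h01 : ∀ H : SimpleGraph (Fin n),
      |ad H a v * (1 - ad H b v) + ad H b v * (1 - ad H a v)| ≤ 1 := fun H => by
    unfold ad; split_ifs <;> norm_num
  have key : c.Bd (6 + 1) (-1) (I.E fun H =>
      (ad H a v * (1 - ad H b v) + ad H b v * (1 - ad H a v)) *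
        ((ua (I.S a b) a b H - ua (I.S a b) b a H) /
          (ua (I.S a b) a b H + ua (I.S a b) b a H))) := by
    refine Bd.E (bad := BadCod c a b) ?_ ?_ (h.bd_badCod hs hab)
    · intro H hH hb
      rw [BadCod, not_not] at hb
      have h1 := bd_inv_ge c (ua_add_ge c (h.bd_ua_add hs hH hb))
      have h2 := (h.bd_ua_sub hs a b hH).mul h1
      rw [← div_eq_mul_inv] at h2
      exact (Bd.one (c := c) (h01 H)).mul' h2
    · intro H hH
      have : c.Bd 0 0 ((ad H a v * (1 - ad H b v) + ad H b v * (1 - ad H a v)) *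
        ((ua (I.S a b) a b H - ua (I.S a b) b a H) /
          (ua (I.S a b) a b H + ua (I.S a b) b a H))) := by
        refine Bd.one ?_
        rw [abs_mul]
        refine mul_le_one₀ (h01 H) (abs_nonneg _) ?_
        rw [abs_div]
        have h1 := ua_nonneg (I.S a b) a b H
        have h2 := ua_nonneg (I.S a b) b a H
        refine div_le_one_of_le₀ ?_ (abs_nonneg _)
        rw [abs_of_nonneg (add_nonneg h1 h2), abs_le]
        constructor <;> linarith
      exact this.mono'
  exact key.mono (by norm_num) le_rfl

end Good

namespace Inst

variable {n : ℕ} (I : Inst n)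

/-- The vertices that may be joined to `v`. -/
def Vn (v : Fin n) : Finset (Fin n) := univ.filter fun b => b ≠ v ∧ ¬ I.X.Adj v b

variable {I}

lemma mem_Vn {v b : Fin n} : b ∈ I.Vn v ↔ b ≠ v ∧ ¬ I.X.Adj v b := by simp [Vn]

lemma mem_S_of_mem_Vn {a b v : Fin n} (ha : a ∈ I.Vn v) (hb : b ∈ I.Vn v) : v ∈ I.S a b := by
  rw [mem_Vn] at ha hb
  rw [mem_S, I.X.adj_comm a, I.X.adj_comm b]
  exact ⟨ha.1.symm, hb.1.symm, ha.2, hb.2⟩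

variable (I) in
lemma sum_Vn (v : Fin n) (f : Fin n → ℝ) :
    ∑ b ∈ I.Vn v, f b = ∑ b, f b - f v - ∑ b, ad I.X v b * f b := by
  have h1 : f v = ∑ b, if b = v then f b else 0 := by simp
  have h2 : ∑ b ∈ I.Vn v, f b = ∑ b, if b ∈ I.Vn v then f b else 0 := by simp [sum_ite_mem]
  rw [h1, h2, ← sum_sub_distrib, ← sum_sub_distrib]
  refine sum_congr rfl fun b _ => ?_
  by_cases hb : b = v
  · subst hb; simp [mem_Vn, ad]
  · by_cases hX : I.X.Adj v b <;> simp [mem_Vn, hb, hX, ad]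

variable (I) in
lemma card_Vn (v : Fin n) : (#(I.Vn v) : ℝ) = n - 1 - I.x v := by
  have := I.sum_Vn v fun _ => 1
  simpa [x] using this

lemma mul_Pr (hI : I.gs.Nonempty) (a v : Fin n) :
    (n - 1 - I.x v) * I.Pr a v = I.d v + ∑ b ∈ I.Vn v, (I.Pr a v - I.Pr b v) := by
  have h1 : ∑ b ∈ I.Vn v, I.Pr b v = I.d v := by
    rw [I.sum_Vn v, Pr_self, sub_zero, ← sum_Pr hI v]
    have : ∑ b, ad I.X v b * I.Pr b v = 0 := sum_eq_zero fun b _ => by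
      by_cases hX : I.X.Adj v b
      · rw [Pr_forbidden hX.symm, mul_zero]
      · rw [ad_zero hX, zero_mul]
    rw [this, sub_zero]
    exact sum_congr rfl fun b _ => I.Pr_comm b v
  rw [sum_sub_distrib, h1, sum_const, nsmul_eq_mul, card_Vn]; ring

end Inst

namespace Good

open Ctx

variable {n : ℕ} {c : Ctx n} {s : ℕ} {I : Inst n}

lemma bd_inv_card_Vn (h : Good c s I) (hs : s ≤ 40) (v : Fin n) :
    c.Bd 1 (-2) ((n : ℝ) - 1 - I.x v)⁻¹ := by
  refine bd_inv_ge c ?_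
  have h1 := h.bd_x hs v
  unfold Bd at h1
  rw [abs_of_nonneg (I.x_nonneg v), zpow_one] at h1
  have h2 : c.L ^ 3 * c.σ ≤ n := L_mul_σ_le c (by norm_num)
  have hL := c.hL
  have hσ := c.one_le_σ
  have h3 : 1000 * (c.L ^ 2 * c.σ) ≤ c.L * (c.L ^ 2 * c.σ) := by gcongr
  have h4 : 1 ≤ c.L ^ 2 * c.σ := by nlinarith
  have h5 : (n : ℝ) / c.L ≤ n / 1000 := by have := c.n_pos; gcongr
  nlinarith

lemma bd_Pr (h : Good c s I) (hs : s ≤ 40) (hI : I.gs.Nonempty) {a v : Fin n} (hav : a ≠ v)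
    (hX : ¬ I.X.Adj a v) : c.Bd 10 (-1) (I.Pr a v - c.p) := by
  have ha : a ∈ I.Vn v := Inst.mem_Vn.2 ⟨hav, fun h => hX h.symm⟩
  have h1 : c.Bd 8 1 (∑ b ∈ I.Vn v, (I.Pr a v - I.Pr b v)) :=
    Bd.sum_fin fun b hb => h.bd_Pr_sub hs (Inst.mem_S_of_mem_Vn ha hb)
  have h2 : c.Bd 3 1 ((I.d v : ℝ) - c.p * (n - 1) + c.p * I.x v) :=
    (h.bd_deg hs v).add' (c.bd_p.mul (h.bd_x hs v))
  have h3 : c.Bd 9 1 ((I.d v : ℝ) - c.p * (n - 1) + c.p * I.x v +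
    ∑ b ∈ I.Vn v, (I.Pr a v - I.Pr b v)) := h2.add' h1
  have hinv := h.bd_inv_card_Vn hs v
  have h4 : c.Bd 10 (-1) (((I.d v : ℝ) - c.p * (n - 1) + c.p * I.x v +
    ∑ b ∈ I.Vn v, (I.Pr a v - I.Pr b v)) * ((n : ℝ) - 1 - I.x v)⁻¹) := h3.mul' hinv
  have hne : (n : ℝ) - 1 - I.x v ≠ 0 := by
    rw [← I.card_Vn]; exact_mod_cast (card_pos.2 ⟨a, ha⟩).ne'
  convert h4 using 1
  rw [← div_eq_mul_inv, eq_div_iff hne]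
  have := Inst.mul_Pr hI a v
  linear_combination this

lemma Pr_pos_lt (h : Good c s I) (hs : s ≤ 40) (hI : I.gs.Nonempty) {a v : Fin n} (hav : a ≠ v)
    (hX : ¬ I.X.Adj a v) : 0 < I.Pr a v ∧ I.Pr a v < 1 := by
  have h1 := abs_le.1 ((h.bd_Pr hs hI hav hX).le_pow (j := 2) le_rfl (by norm_num))
  have h2 := c.p_ge
  have h3 := c.one_sub_p_ge
  have h4 : 1 / c.L ^ 2 < 1 / c.L := by
    have := c.hL
    have := c.L_pos
    gcongr
    nlinarith
  constructor <;> linarith [h1.1, h1.2]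

lemma add_nonempty (h : Good c s I) (hs : s ≤ 40) (hI : I.gs.Nonempty) {a v : Fin n} (hav : a ≠ v)
    (hX : ¬ I.X.Adj a v) : (I.add a v).gs.Nonempty := by
  have h1 := I.card_gs_add hav hX (h.one_le_d hs a) (h.one_le_d hs v)
  have h2 : (0 : ℝ) < #(I.add a v).gs := by
    rw [h1]; exact mul_pos (h.Pr_pos_lt hs hI hav hX).1 (by exact_mod_cast hI.card_pos)
  exact card_pos.1 (by exact_mod_cast h2)

lemma del_nonempty (h : Good c s I) (hs : s ≤ 40) (hI : I.gs.Nonempty) {a v : Fin n} (hav : a ≠ v)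
    (hX : ¬ I.X.Adj a v) : (I.del a v).gs.Nonempty := by
  have h1 := I.card_gs_del hav
  have h2 : (0 : ℝ) < #(I.del a v).gs := by
    rw [h1]
    exact mul_pos (by linarith [(h.Pr_pos_lt hs hI hav hX).2]) (by exact_mod_cast hI.card_pos)
  exact card_pos.1 (by exact_mod_cast h2)

end Good

/-- Decision trees querying edges. -/
inductive ETree (n : ℕ) where
  | leaf (x : ℝ) : ETree n
  | node (a v : Fin n) (yes no : ETree n) : ETree n

namespace ETree

variable {n : ℕ}

/-- Value of the tree on a graph. -/
def eval (H : SimpleGraph (Fin n)) : ETree n → ℝ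
  | leaf x => x
  | node a v y z => ad H a v * eval H y + (1 - ad H a v) * eval H z

/-- Expected value when edges are independent with probabilities `φ`. -/
def val (φ : Fin n → Fin n → ℝ) : ETree n → ℝ
  | leaf x => x
  | node a v y z => φ a v * val φ y + (1 - φ a v) * val φ z

/-- Every query is an admissible pair that was not queried before. -/
def Valid : SimpleGraph (Fin n) → ETree n → Prop
  | _, leaf _ => True
  | X, node a v y z => a ≠ v ∧ ¬ X.Adj a v ∧ Valid (X ⊔ SimpleGraph.edge a v) y ∧
      Valid (X ⊔ SimpleGraph.edge a v) z

/-- Bounds on depth and leaves. -/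
def Small (M : ℝ) : ℕ → ETree n → Prop
  | _, leaf x => |x| ≤ M
  | 0, node _ _ _ _ => False
  | r + 1, node _ _ y z => Small M r y ∧ Small M r z

/-- The value `T` if exactly one of `av`, `bv` is an edge, `0` otherwise. -/
def one (a b v : Fin n) (T : ETree n) : ETree n :=
  node a v (node b v (leaf 0) T) (node b v T (leaf 0))

/-- The value `T` if `av` is an edge, `0` otherwise. -/
def edge (a v : Fin n) (T : ETree n) : ETree n := node a v T (leaf 0)

lemma eval_one (H : SimpleGraph (Fin n)) (a b v : Fin n) (T : ETree n) :
    (one a b v T).eval H =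
      (ad H a v * (1 - ad H b v) + ad H b v * (1 - ad H a v)) * T.eval H := by
  simp only [one, eval]; ring

lemma val_one (φ : Fin n → Fin n → ℝ) (a b v : Fin n) (T : ETree n) :
    (one a b v T).val φ = (φ a v * (1 - φ b v) + φ b v * (1 - φ a v)) * T.val φ := by
  simp only [one, val]; ring

lemma eval_edge (H : SimpleGraph (Fin n)) (a v : Fin n) (T : ETree n) :
    (edge a v T).eval H = ad H a v * T.eval H := by
  simp only [edge, eval]; ring

lemma val_edge (φ : Fin n → Fin n → ℝ) (a v : Fin n) (T : ETree n) :
    (edge a v T).val φ = φ a v * T.val φ := by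
  simp only [edge, val]; ring

lemma valid_one {X : SimpleGraph (Fin n)} {a b v : Fin n} {T : ETree n} (hab : a ≠ b)
    (hva : v ≠ a) (hvb : v ≠ b) (h1 : ¬ X.Adj a v) (h2 : ¬ X.Adj b v)
    (hT : Valid (X ⊔ SimpleGraph.edge a v ⊔ SimpleGraph.edge b v) T) : Valid X (one a b v T) := by
  have h3 : ¬ (X ⊔ SimpleGraph.edge a v).Adj b v := by
    simp [SimpleGraph.sup_adj, SimpleGraph.edge_adj, h2, hab.symm, hvb.symm]
  exact ⟨hva.symm, h1, ⟨hvb.symm, h3, trivial, hT⟩, ⟨hvb.symm, h3, hT, trivial⟩⟩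

lemma small_one {M : ℝ} {r : ℕ} {T : ETree n} (hM : 0 ≤ M) (hT : Small M r T) (a b v : Fin n) :
    Small M (r + 2) (one a b v T) := by
  have h : ∀ r, Small M r (leaf 0 : ETree n) := fun r => by
    cases r <;> simpa [Small] using hM
  exact ⟨⟨h _, hT⟩, ⟨hT, h _⟩⟩

lemma small_edge {M : ℝ} {r : ℕ} {T : ETree n} (hM : 0 ≤ M) (hT : Small M r T) (a v : Fin n) :
    Small M (r + 1) (edge a v T) := by
  have h : ∀ r, Small M r (leaf 0 : ETree n) := fun r => by
    cases r <;> simpa [Small] using hM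
  exact ⟨hT, h _⟩

lemma eval_sup_edge {H : SimpleGraph (Fin n)} {a v : Fin n} (hav : a ≠ v) (hH : ¬ H.Adj a v) :
    ∀ {X : SimpleGraph (Fin n)} {T : ETree n}, X.Adj a v → Valid X T →
      T.eval (H ⊔ SimpleGraph.edge a v) = T.eval H
  | _, leaf _, _, _ => rfl
  | X, node b w y z, hX, ⟨h1, h2, h3, h4⟩ => by
    have h5 : (X ⊔ SimpleGraph.edge b w).Adj a v := Or.inl hX
    simp only [eval, eval_sup_edge hav hH h5 h3, eval_sup_edge hav hH h5 h4]
    have : ad (H ⊔ SimpleGraph.edge a v) b w = ad H b w := by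
      rw [Inst.ad_sup_edge hav hH, if_neg, add_zero]
      rintro (⟨rfl, rfl⟩ | ⟨rfl, rfl⟩)
      · exact h2 hX
      · exact h2 hX.symm
    rw [this]

lemma abs_val_le {φ : Fin n → Fin n → ℝ} (hφ : ∀ u w, 0 ≤ φ u w ∧ φ u w ≤ 1) {M : ℝ} :
    ∀ {r : ℕ} {T : ETree n}, Small M r T → |T.val φ| ≤ M
  | 0, leaf _, h => h
  | _ + 1, leaf _, h => h
  | r + 1, node a v y z, ⟨h1, h2⟩ => by
    have h3 := abs_le.1 (abs_val_le hφ h1)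
    have h4 := abs_le.1 (abs_val_le hφ h2)
    obtain ⟨h5, h6⟩ := hφ a v
    simp only [val]
    rw [abs_le]
    constructor <;> nlinarith

end ETree

/-- Edge probabilities are within `e` of `φ`, also after conditioning on fewer than `r` edges. -/
def Close {n : ℕ} (φ : Fin n → Fin n → ℝ) (e : ℝ) : ℕ → Inst n → Prop
  | 0, I => I.gs.Nonempty
  | r + 1, I => I.gs.Nonempty ∧ (∀ v, 1 ≤ I.d v) ∧
      (∀ u w, u ≠ w → ¬ I.X.Adj u w → |I.Pr u w - φ u w| ≤ e) ∧
      ∀ u w, u ≠ w → ¬ I.X.Adj u w → Close φ e r (I.add u w) ∧ Close φ e r (I.del u w)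

lemma Close.abs_E_eval {n : ℕ} {φ : Fin n → Fin n → ℝ} (hφ : ∀ u w, 0 ≤ φ u w ∧ φ u w ≤ 1)
    {e M : ℝ} (he : 0 ≤ e) : ∀ {r : ℕ} {I : Inst n} {T : ETree n}, Close φ e r I →
      T.Valid I.X → T.Small M r → |I.E (fun H => T.eval H) - T.val φ| ≤ 2 * r * M * e
  | 0, I, .leaf x, h, _, hT => by
    simp [ETree.eval, ETree.val, Inst.E_const h]
  | r + 1, I, .leaf x, h, _, hT => by
    have hM : 0 ≤ M := (abs_nonneg x).trans hT
    simp only [ETree.eval, ETree.val, Inst.E_const h.1, sub_self, abs_zero]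
    positivity
  | r + 1, I, .node a v y z, ⟨hI, hd, h1, h2⟩, ⟨hav, hX, hy, hz⟩, ⟨hy', hz'⟩ => by
    obtain ⟨h3, h4⟩ := h2 a v hav hX
    have ey := Close.abs_E_eval hφ he h3 (T := y) hy hy'
    have ez := Close.abs_E_eval hφ he h4 (T := z) hz hz'
    have e1 : I.E (fun H => ad H a v * y.eval H) = I.Pr a v * (I.add a v).E fun H => y.eval H := by
      rw [I.E_ad_mul hav hX (hd a) (hd v)]
      congr 1
      refine Inst.E_congr fun H hH => ETree.eval_sup_edge hav ?_ (X := I.X ⊔ SimpleGraph.edge a v)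
        (by simp [SimpleGraph.edge_adj, hav]) hy
      exact (Inst.mem_gs.1 hH).2 a v (by simp [Inst.add, SimpleGraph.edge_adj, hav])
    have e2 := I.E_one_sub_ad_mul hav fun H => z.eval H
    simp only [ETree.eval, ETree.val]
    rw [I.E_add, e1, e2]
    set P := I.Pr a v
    set Ey := (I.add a v).E fun H => y.eval H
    set Ez := (I.del a v).E fun H => z.eval H
    have hP0 : 0 ≤ P := I.Pr_nonneg a v
    have hP1 : P ≤ 1 := I.Pr_le_one a v
    have hv : |y.val φ - z.val φ| ≤ 2 * M := by
      have := ETree.abs_val_le hφ hy'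
      have := ETree.abs_val_le hφ hz'
      exact (abs_sub _ _).trans (by linarith)
    have hs : P * Ey + (1 - P) * Ez - (φ a v * y.val φ + (1 - φ a v) * z.val φ) =
        P * (Ey - y.val φ) + (1 - P) * (Ez - z.val φ) + (P - φ a v) * (y.val φ - z.val φ) := by
      ring
    rw [hs]
    calc _ ≤ P * |Ey - y.val φ| + (1 - P) * |Ez - z.val φ| +
          |P - φ a v| * |y.val φ - z.val φ| := by
          refine (abs_add_three _ _ _).trans (le_of_eq ?_)
          rw [abs_mul, abs_mul, abs_mul, abs_of_nonneg hP0, abs_of_nonneg (sub_nonneg.2 hP1)]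
      _ ≤ P * (2 * r * M * e) + (1 - P) * (2 * r * M * e) + e * (2 * M) := by
          have := sub_nonneg.2 hP1
          have := h1 a v hav hX
          gcongr
      _ = _ := by push_cast; ring

/-- Expected value of the indicator that exactly one of `av`, `bv` is an edge. -/
def psi {n : ℕ} (φ : Fin n → Fin n → ℝ) (a b v : Fin n) : ℝ :=
  φ a v * (1 - φ b v) + φ b v * (1 - φ a v)

/-- Indicator that exactly one of `av`, `bv` is an edge. -/
def yi {n : ℕ} (H : SimpleGraph (Fin n)) (a b v : Fin n) : ℝ :=
  ad H a v * (1 - ad H b v) + ad H b v * (1 - ad H a v)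

lemma abs_yi_le {n : ℕ} (H : SimpleGraph (Fin n)) (a b v : Fin n) : |yi H a b v| ≤ 1 := by
  unfold yi ad; split_ifs <;> norm_num

lemma ua_add_ua {n : ℕ} (S : Finset (Fin n)) (a b : Fin n) (H : SimpleGraph (Fin n)) :
    ua S a b H + ua S b a H = ∑ v ∈ S, yi H a b v := by
  unfold ua; rw [← sum_add_distrib]; rfl

namespace Inst

variable {n : ℕ} (I : Inst n)

/-- Indicator of admissible pairs. -/
def al (u w : Fin n) : ℝ := if u ≠ w ∧ ¬ I.X.Adj u w then 1 else 0

/-- Approximate expectation of the difference of switchable neighbourhoods. -/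
def fhat (φ : Fin n → Fin n → ℝ) (a b : Fin n) : ℝ :=
  (I.d a : ℝ) - I.d b - ∑ w, ad I.X b w * (I.al a w * φ a w) +
    ∑ w, ad I.X a w * (I.al b w * φ b w)

/-- Approximate expectation of the number of switchable vertices. -/
def mzero (φ : Fin n → Fin n → ℝ) (a b : Fin n) : ℝ := ∑ w ∈ I.S a b, psi φ a b w

variable {I}

lemma abs_sum_ad_mul_le (a : Fin n) {f : Fin n → ℝ} {ε : ℝ} (h : ∀ w, I.X.Adj a w → |f w| ≤ ε) :
    |∑ w, ad I.X a w * f w| ≤ ε * I.x a := by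
  unfold x
  rw [mul_sum]
  refine (abs_sum_le_sum_abs _ _).trans (sum_le_sum fun w _ => ?_)
  by_cases hw : I.X.Adj a w
  · simp [ad_one hw, h w hw]
  · simp [ad_zero hw]

lemma abs_E_mul_sub {a b : Fin n} {φ : Fin n → Fin n → ℝ} {G : SimpleGraph (Fin n) → ℝ}
    {γ ε : ℝ} (h0 : |I.E G - γ| ≤ ε)
    (h1 : ∀ w, I.X.Adj b w → a ≠ w → ¬ I.X.Adj a w →
      |I.E (fun H => G H * ad H a w) - γ * φ a w| ≤ ε)
    (h2 : ∀ w, I.X.Adj a w → b ≠ w → ¬ I.X.Adj b w →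
      |I.E (fun H => G H * ad H b w) - γ * φ b w| ≤ ε) :
    |I.E (fun H => G H * (ua (I.S a b) a b H - ua (I.S a b) b a H)) - γ * I.fhat φ a b| ≤
      ε * (|(I.d a : ℝ) - I.d b| + I.x a + I.x b) := by
  have hε : 0 ≤ ε := (abs_nonneg _).trans h0
  have key : ∀ u w, (u ≠ w → ¬ I.X.Adj u w → |I.E (fun H => G H * ad H u w) - γ * φ u w| ≤ ε) →
      |I.E (fun H => G H * ad H u w) - γ * (I.al u w * φ u w)| ≤ ε := by
    intro u w h
    by_cases hw : u ≠ w ∧ ¬ I.X.Adj u w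
    · rw [al, if_pos hw, one_mul]; exact h hw.1 hw.2
    · rw [al, if_neg hw]
      have : ∀ H ∈ I.gs, G H * ad H u w = 0 := fun H hH => by
        rw [not_and_or, not_not, not_not] at hw
        rcases hw with rfl | hw
        · rw [ad_self, mul_zero]
        · rw [ad_zero ((mem_gs.1 hH).2 _ _ hw), mul_zero]
      rw [E_congr this]
      simpa [E] using hε
  have e1 : I.E (fun H => G H * (ua (I.S a b) a b H - ua (I.S a b) b a H)) =
      ((I.d a : ℝ) - I.d b) * I.E G - ∑ w, ad I.X b w * I.E (fun H => G H * ad H a w) +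
        ∑ w, ad I.X a w * I.E (fun H => G H * ad H b w) := by
    simp_rw [← I.E_mul_left]
    rw [← E_sum, ← E_sum, ← E_sub, ← E_add]
    refine E_congr fun H hH => ?_
    rw [ua_sub_ua_eq hH, mul_add, mul_sub, mul_sum, mul_sum]
    congr 1
    · congr 1
      · ring
      · exact sum_congr rfl fun w _ => by ring
    · exact sum_congr rfl fun w _ => by ring
  have e2 : I.E (fun H => G H * (ua (I.S a b) a b H - ua (I.S a b) b a H)) - γ * I.fhat φ a b =
      ((I.d a : ℝ) - I.d b) * (I.E G - γ) -
        ∑ w, ad I.X b w * (I.E (fun H => G H * ad H a w) - γ * (I.al a w * φ a w)) +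
        ∑ w, ad I.X a w * (I.E (fun H => G H * ad H b w) - γ * (I.al b w * φ b w)) := by
    rw [e1, fhat]
    simp_rw [mul_sub, sum_sub_distrib, mul_add, mul_sub, mul_sum]
    rw [show ∀ f : Fin n → ℝ, ∑ w, γ * (ad I.X b w * f w) = ∑ w, ad I.X b w * (γ * f w) from
      fun f => sum_congr rfl fun w _ => by ring,
      show ∀ f : Fin n → ℝ, ∑ w, γ * (ad I.X a w * f w) = ∑ w, ad I.X a w * (γ * f w) from
      fun f => sum_congr rfl fun w _ => by ring]
    ring
  rw [e2]
  have b1 := abs_sum_ad_mul_le (I := I) b fun w hw => key a w (h1 w hw)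
  have b2 := abs_sum_ad_mul_le (I := I) a fun w hw => key b w (h2 w hw)
  have b3 : |((I.d a : ℝ) - I.d b) * (I.E G - γ)| ≤ |(I.d a : ℝ) - I.d b| * ε := by
    rw [abs_mul]; gcongr
  refine (abs_add_le _ _).trans ((add_le_add_left (abs_sub _ _) _).trans ?_)
  linarith

section Close

variable {φ : Fin n → Fin n → ℝ} (hφ : ∀ u w, 0 ≤ φ u w ∧ φ u w ≤ 1) {e : ℝ} (he : 0 ≤ e)
  (hc : Close φ e 5 I) {a b v : Fin n} (hab : a ≠ b) (hv : v ∈ I.S a b)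

include hφ he hc hab hv

lemma abs_E_yi_sub : |I.E (fun H => yi H a b v) - psi φ a b v| ≤ 10 * e := by
  obtain ⟨h1, h2, h3, h4⟩ := mem_S.1 hv
  have := hc.abs_E_eval hφ he (T := .one a b v (.leaf 1)) (M := 1)
    (ETree.valid_one hab h1 h2 h3 h4 trivial)
        (ETree.small_one (by norm_num) (by simp [ETree.Small]) _ _ _)
  simp only [ETree.eval_one, ETree.val_one, ETree.eval, ETree.val, mul_one] at this
  refine this.trans (le_of_eq ?_)
  norm_num

lemma abs_E_yi_ad_sub {w : Fin n} (hw : w ≠ v) (haw : a ≠ w) (hX : ¬ I.X.Adj a w) :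
    |I.E (fun H => yi H a b v * ad H a w) - psi φ a b v * φ a w| ≤ 10 * e := by
  obtain ⟨h1, h2, h3, h4⟩ := mem_S.1 hv
  have h5 : ¬ (I.X ⊔ SimpleGraph.edge a v ⊔ SimpleGraph.edge b v).Adj a w := by
    simp [SimpleGraph.edge_adj, hX, hw, h1.symm, hab]
  have := hc.abs_E_eval hφ he (T := .one a b v (.edge a w (.leaf 1))) (M := 1)
    (ETree.valid_one hab h1 h2 h3 h4 ⟨haw, h5, trivial, trivial⟩)
    (ETree.small_one (by norm_num)
        (ETree.small_edge (r := 2) (by norm_num) (by simp [ETree.Small]) _ _) _ _ _)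
  simp only [ETree.eval_one, ETree.val_one, ETree.eval_edge, ETree.val_edge, ETree.eval,
    ETree.val, mul_one] at this
  refine this.trans (le_of_eq ?_)
  norm_num

lemma abs_E_yi_yi_sub {u : Fin n} (hu : u ∈ I.S a b) (huv : u ≠ v) :
    |I.E (fun H => yi H a b v * yi H a b u) - psi φ a b v * psi φ a b u| ≤ 10 * e := by
  obtain ⟨h1, h2, h3, h4⟩ := mem_S.1 hv
  obtain ⟨h5, h6, h7, h8⟩ := mem_S.1 hu
  have h9 : ¬ (I.X ⊔ SimpleGraph.edge a v ⊔ SimpleGraph.edge b v).Adj a u := by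
    simp [SimpleGraph.edge_adj, h7, huv, h1.symm, hab]
  have h10 : ¬ (I.X ⊔ SimpleGraph.edge a v ⊔ SimpleGraph.edge b v).Adj b u := by
    simp [SimpleGraph.edge_adj, h8, huv, h2.symm, hab.symm]
  have := hc.abs_E_eval hφ he (T := .one a b v (.one a b u (.leaf 1))) (M := 1)
    (ETree.valid_one hab h1 h2 h3 h4 (ETree.valid_one hab h5 h6 h9 h10 trivial))
    (ETree.small_one (by norm_num)
        (ETree.small_one (r := 1) (by norm_num) (by simp [ETree.Small]) _ _ _) _ _ _)
  simp only [ETree.eval_one, ETree.val_one, ETree.eval, ETree.val, mul_one] at this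
  refine this.trans (le_of_eq ?_)
  norm_num

lemma abs_E_yi_yi_ad_sub {u : Fin n} (hu : u ∈ I.S a b) (huv : u ≠ v) {w : Fin n} (hw : w ≠ v)
    (hwu : w ≠ u) (haw : a ≠ w) (hX : ¬ I.X.Adj a w) :
    |I.E (fun H => yi H a b v * yi H a b u * ad H a w) - psi φ a b v * psi φ a b u * φ a w| ≤
      10 * e := by
  obtain ⟨h1, h2, h3, h4⟩ := mem_S.1 hv
  obtain ⟨h5, h6, h7, h8⟩ := mem_S.1 hu
  have h9 : ¬ (I.X ⊔ SimpleGraph.edge a v ⊔ SimpleGraph.edge b v).Adj a u := by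
    simp [SimpleGraph.edge_adj, h7, huv, h1.symm, hab]
  have h10 : ¬ (I.X ⊔ SimpleGraph.edge a v ⊔ SimpleGraph.edge b v).Adj b u := by
    simp [SimpleGraph.edge_adj, h8, huv, h2.symm, hab.symm]
  have h11 : ¬ (I.X ⊔ SimpleGraph.edge a v ⊔ SimpleGraph.edge b v ⊔ SimpleGraph.edge a u ⊔
      SimpleGraph.edge b u).Adj a w := by
    simp [SimpleGraph.edge_adj, hX, hw, hwu, h1.symm, h5.symm, hab]
  have := hc.abs_E_eval hφ he (T := .one a b v (.one a b u (.edge a w (.leaf 1)))) (M := 1)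
    (ETree.valid_one hab h1 h2 h3 h4 (ETree.valid_one hab h5 h6 h9 h10
      ⟨haw, h11, trivial, trivial⟩))
    (ETree.small_one (by norm_num) (ETree.small_one (by norm_num)
      (ETree.small_edge (r := 0) (by norm_num) (by simp [ETree.Small]) _ _) _ _ _) _ _ _)
  simp only [ETree.eval_one, ETree.val_one, ETree.eval_edge, ETree.val_edge, ETree.eval,
    ETree.val, mul_one, ← mul_assoc] at this
  refine this.trans (le_of_eq ?_)
  norm_num

end Close

lemma yi_comm (H : SimpleGraph (Fin n)) (a b v : Fin n) : yi H a b v = yi H b a v := by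
  unfold yi; ring

lemma psi_comm (φ : Fin n → Fin n → ℝ) (a b v : Fin n) : psi φ a b v = psi φ b a v := by
  unfold psi; ring

section Close

variable {φ : Fin n → Fin n → ℝ} (hφ : ∀ u w, 0 ≤ φ u w ∧ φ u w ≤ 1) {e : ℝ} (he : 0 ≤ e)
  (hc : Close φ e 5 I) {a b v : Fin n} (hab : a ≠ b) (hv : v ∈ I.S a b)

include hφ he hc hab hv

lemma abs_E_yi_f_sub :
    |I.E (fun H => yi H a b v * (ua (I.S a b) a b H - ua (I.S a b) b a H)) -
      psi φ a b v * I.fhat φ a b| ≤ 10 * e * (|(I.d a : ℝ) - I.d b| + I.x a + I.x b) := by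
  obtain ⟨h1, h2, h3, h4⟩ := mem_S.1 hv
  refine abs_E_mul_sub (abs_E_yi_sub hφ he hc hab hv) (fun w hw haw hX => ?_) fun w hw hbw hX => ?_
  · exact abs_E_yi_ad_sub hφ he hc hab hv (fun h => h4 (h ▸ hw)) haw hX
  · rw [psi_comm]; simp_rw [yi_comm _ a b]
    exact abs_E_yi_ad_sub hφ he hc hab.symm (I.S_comm a b ▸ hv) (fun h => h3 (h ▸ hw)) hbw hX

lemma abs_E_yi_yi_f_sub {u : Fin n} (hu : u ∈ I.S a b) (huv : u ≠ v) :
    |I.E (fun H => yi H a b v * yi H a b u * (ua (I.S a b) a b H - ua (I.S a b) b a H)) -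
      psi φ a b v * psi φ a b u * I.fhat φ a b| ≤
        10 * e * (|(I.d a : ℝ) - I.d b| + I.x a + I.x b) := by
  obtain ⟨h1, h2, h3, h4⟩ := mem_S.1 hv
  obtain ⟨h5, h6, h7, h8⟩ := mem_S.1 hu
  refine abs_E_mul_sub (abs_E_yi_yi_sub hφ he hc hab hv hu huv) (fun w hw haw hX => ?_)
    fun w hw hbw hX => ?_
  · exact abs_E_yi_yi_ad_sub hφ he hc hab hv hu huv (fun h => h4 (h ▸ hw)) (fun h => h8 (h ▸ hw))
      haw hX
  · rw [psi_comm, psi_comm φ a b u]; simp_rw [yi_comm _ a b]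
    exact abs_E_yi_yi_ad_sub hφ he hc hab.symm (I.S_comm a b ▸ hv) (I.S_comm a b ▸ hu) huv
      (fun h => h3 (h ▸ hw)) (fun h => h7 (h ▸ hw)) hbw hX

end Close

end Inst


namespace Good

open Ctx

variable {n : ℕ} {c : Ctx n} {s : ℕ} {I : Inst n} {φ : Fin n → Fin n → ℝ}

lemma bd_psi (hφp : ∀ u w, c.Bd 11 (-1) (φ u w - c.p)) (a b w : Fin n) :
    c.Bd 13 (-1) (psi φ a b w - 2 * (c.p * (1 - c.p))) := by
  have h1 : c.Bd 12 (-1) ((φ a w - c.p) + (φ b w - c.p)) := (hφp a w).add' (hφp b w)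
  have h2 : c.Bd 12 (-1) (((φ a w - c.p) + (φ b w - c.p)) * (1 - 2 * c.p)) :=
    h1.mul' (Bd.one (abs_le.2 ⟨by linarith [c.hp1], by linarith [c.hp0]⟩))
  have h3 : c.Bd 23 (-2) (2 * (φ a w - c.p) * (φ b w - c.p)) :=
    ((Bd.const (x := 2) (by norm_num)).mul' (k := 12) (m := -1) (hφp a w)).mul' (hφp b w)
  have h4 : c.Bd 12 (-1) (2 * (φ a w - c.p) * (φ b w - c.p)) := h3.up (by norm_num) (by norm_num)
  have h5 : c.Bd 13 (-1) (((φ a w - c.p) + (φ b w - c.p)) * (1 - 2 * c.p) -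
    2 * (φ a w - c.p) * (φ b w - c.p)) := h2.sub' h4
  convert h5 using 1
  unfold psi; ring

lemma bd_card_S (h : Good c s I) (hs : s ≤ 40) (a b : Fin n) :
    c.Bd 4 1 ((n : ℝ) - #(I.S a b)) := by
  have h1 := I.abs_sum_sub_sum_S a b (f := fun _ => 1) (M := 1) (fun v => by simp)
  have h3 : c.Bd 4 1 (2 + I.x a + I.x b) := by
    have h4 : c.Bd 3 1 (2 + I.x a) := (Bd.const (x := 2) (by norm_num)).add' (h.bd_x hs a)
    exact h4.add' (h.bd_x hs b)
  refine h3.of_abs_le ?_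
  rw [one_mul] at h1
  simp only [sum_const, card_univ, Fintype.card_fin, nsmul_eq_mul, mul_one] at h1
  exact h1.trans (le_abs_self _)

lemma bd_mzero (h : Good c s I) (hs : s ≤ 40) (hφp : ∀ u w, c.Bd 11 (-1) (φ u w - c.p))
    (a b : Fin n) : c.Bd 15 1 (I.mzero φ a b - 2 * (c.p * (1 - c.p)) * n) := by
  have h1 : c.Bd 13 1 (∑ w ∈ I.S a b, (psi φ a b w - 2 * (c.p * (1 - c.p)))) :=
    Bd.sum_fin fun w _ => bd_psi hφp a b w
  have h2 : c.Bd 5 1 (2 * (c.p * (1 - c.p)) * (n - #(I.S a b))) :=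
    ((Bd.const (x := 2) (by norm_num)).mul' (k := 1) (m := 0)
      (c.bd_p.mul c.bd_one_sub_p)).mul' (h.bd_card_S hs a b)
  have h3 : c.Bd 15 1 (∑ w ∈ I.S a b, (psi φ a b w - 2 * (c.p * (1 - c.p))) -
    2 * (c.p * (1 - c.p)) * (n - #(I.S a b))) := h1.sub' h2
  convert h3 using 1
  rw [sum_sub_distrib, sum_const, nsmul_eq_mul, Inst.mzero]; ring

lemma ge_of_bd (c : Ctx n) {g : ℝ} {k : ℕ} (hk : k ≤ 400)
    (hg : c.Bd k 1 (g - 2 * (c.p * (1 - c.p)) * n)) : n / c.L ≤ g := by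
  have h1 := (abs_le.1 hg).1
  rw [zpow_one] at h1
  have h2 : c.L ^ (k + 1) * c.σ ≤ n := L_mul_σ_le c (by omega)
  have h3 : 1 / c.L * n ≤ c.p * (1 - c.p) * n := mul_le_mul_of_nonneg_right c.hp c.n_pos.le
  have h4 : c.L ^ k * c.σ ≤ 1 / c.L * n := by
    have := c.L_pos
    calc c.L ^ k * c.σ = 1 / c.L * (c.L ^ (k + 1) * c.σ) := by rw [pow_succ]; field_simp
      _ ≤ _ := by gcongr
  have h5 : (n : ℝ) / c.L = 1 / c.L * n := by ring
  linarith

lemma bd_t (h : Good c s I) (hs : s ≤ 40) (a b : Fin n) :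
    c.Bd 5 1 (|(I.d a : ℝ) - I.d b| + I.x a + I.x b) := by
  have h4 : c.Bd 4 1 (|(I.d a : ℝ) - I.d b| + I.x a) := (h.bd_deg_sub hs a b).abs.add' (h.bd_x hs a)
  exact h4.add' (h.bd_x hs b)

/-- Differences of edge probabilities in terms of approximate edge probabilities. -/
lemma bd_Pr_sub_fhat (h : Good c s I) (hs : s ≤ 40) (hφ : ∀ u w, 0 ≤ φ u w ∧ φ u w ≤ 1)
    (hφp : ∀ u w, c.Bd 11 (-1) (φ u w - c.p)) {e : ℝ} (he : 0 ≤ e) (hc : Close φ e 5 I)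
    {K : ℕ} {μ : ℤ} (heB : c.Bd K μ e) (hμ : -2 ≤ μ) {a b v : Fin n} (hab : a ≠ b)
    (hv : v ∈ I.S a b) :
    c.Bd (K + 50) (μ - 1)
      (I.Pr a v - I.Pr b v - psi φ a b v * I.fhat φ a b / I.mzero φ a b) := by
  set m0 := I.mzero φ a b with hm0
  set F := I.fhat φ a b with hF
  set f : SimpleGraph (Fin n) → ℝ := fun H => ua (I.S a b) a b H - ua (I.S a b) b a H with hf
  set g : SimpleGraph (Fin n) → ℝ := fun H => ua (I.S a b) a b H + ua (I.S a b) b a H with hg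
  have hm0B := h.bd_mzero hs hφp a b
  have hm0ge := ge_of_bd c (by norm_num) hm0B
  have hm0i : c.Bd 1 (-2) m0⁻¹ := bd_inv_ge c hm0ge
  have hm0pos : 0 < m0 := (div_pos c.n_pos c.L_pos).trans_le hm0ge
  have het : c.Bd (K + 6) (μ + 1) (10 * e * (|(I.d a : ℝ) - I.d b| + I.x a + I.x b)) :=
    ((Bd.const (x := 10) (by norm_num)).mul heB).mul' (h.bd_t hs a b) (by omega) (by omega)
  have hψ : ∀ u, |psi φ a b u| ≤ 1 := fun u => by
    have h1 := hφ a u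
    have h2 := hφ b u
    unfold psi; rw [abs_le]; constructor <;> nlinarith
  -- the first order term
  have hA : c.Bd (K + 6) (μ + 1) (I.E (fun H => yi H a b v * f H) - psi φ a b v * F) :=
    het.of_abs_le ((Inst.abs_E_yi_f_sub hφ he hc hab hv).trans (le_abs_self _))
  -- the second order term
  have hB : ∀ u ∈ I.S a b, u ≠ v →
      c.Bd (K + 7) (μ + 1) (I.E (fun H => yi H a b v * f H * (yi H a b u - psi φ a b u))) := by
    intro u hu huv
    have h1 : c.Bd (K + 6) (μ + 1) (I.E (fun H => yi H a b v * yi H a b u * f H) -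
      psi φ a b v * psi φ a b u * F) :=
      het.of_abs_le ((Inst.abs_E_yi_yi_f_sub hφ he hc hab hv hu huv).trans (le_abs_self _))
    have h2 : c.Bd (K + 6) (μ + 1) (psi φ a b u *
      (I.E (fun H => yi H a b v * f H) - psi φ a b v * F)) :=
      (Bd.one (hψ u)).mul' hA (by omega) (by omega)
    refine (h1.sub h2).of_abs_le (le_of_eq ?_)
    congr 1
    rw [mul_sub, ← I.E_mul_left, show ∀ x y z w : ℝ, x - y - (z - w) = x - z - (y - w) from
      fun _ _ _ _ => by ring, ← Inst.E_sub, show psi φ a b v * psi φ a b u * F -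
        psi φ a b u * (psi φ a b v * F) = 0 by ring, sub_zero]
    exact Inst.E_congr fun H _ => by ring
  have hBv : c.Bd (K + 7) (μ + 3)
      (I.E (fun H => yi H a b v * f H * (yi H a b v - psi φ a b v))) := by
    have h0 : c.Bd (6 + 1) 1 (I.E (fun H => yi H a b v * f H * (yi H a b v - psi φ a b v))) := by
      have key : ∀ H ∈ I.gs, c.Bd 6 1 (yi H a b v * f H * (yi H a b v - psi φ a b v)) := by
        intro H hH
        have h1 : c.Bd 5 1 (yi H a b v * f H) :=
          (Bd.one (abs_yi_le H a b v)).mul' (h.bd_ua_sub hs a b hH)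
        refine h1.mul' (Bd.const (x := yi H a b v - psi φ a b v) ?_)
        have := abs_sub (yi H a b v) (psi φ a b v)
        have := abs_yi_le H a b v
        have := hψ v
        linarith
      refine Bd.E (bad := BadCod c a b) (fun H hH _ => key H hH) (fun H hH => ?_)
        (h.bd_badCod hs hab)
      exact (key H hH).up (by norm_num) (by norm_num)
    exact h0.mono (by omega) (by omega)
  have hBs : c.Bd (K + 9) (μ + 3) (I.E (fun H => yi H a b v * f H * (g H - m0))) := by
    have e1 : I.E (fun H => yi H a b v * f H * (g H - m0)) =
        ∑ u ∈ (I.S a b).erase v, I.E (fun H => yi H a b v * f H * (yi H a b u - psi φ a b u)) +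
          I.E (fun H => yi H a b v * f H * (yi H a b v - psi φ a b v)) := by
      rw [sum_erase_add _ _ hv, ← Inst.E_sum]
      refine Inst.E_congr fun H _ => ?_
      rw [← mul_sum, sum_sub_distrib, ← ua_add_ua]; rfl
    rw [e1]
    have h1 := Bd.sum_fin (s := (I.S a b).erase v) fun u hu =>
      hB u (mem_of_mem_erase hu) (ne_of_mem_erase hu)
    exact h1.add' hBv (by omega) (by omega) (by omega) (by omega)
  -- the remainder
  have hC : c.Bd 41 (-3)
      (I.E (fun H => yi H a b v * (f H / g H) * (g H - m0) ^ 2 * (m0⁻¹) ^ 2)) := by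
    have hm02 : c.Bd 2 (-4) (m0⁻¹ ^ 2) := by rw [sq]; exact hm0i.mul hm0i
    refine Bd.E (k := 40) (bad := BadCod c a b) ?_ ?_ (h.bd_badCod hs hab)
    · intro H hH hb
      rw [BadCod, not_not] at hb
      have hgB := h.bd_ua_add hs hH hb
      have h1 := bd_inv_ge c (ge_of_bd c (by norm_num) hgB)
      have h2 : c.Bd 6 (-1) (f H / g H) := by
        rw [div_eq_mul_inv]; exact (h.bd_ua_sub hs a b hH).mul h1
      have h3 : c.Bd 6 (-1) (yi H a b v * (f H / g H)) := (Bd.one (abs_yi_le H a b v)).mul' h2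
      have h4 : c.Bd 15 1 (g H - 2 * (c.p * (1 - c.p)) * n) := hgB.mono'
      have h5 : c.Bd 16 1 (g H - m0) := by
        have := h4.sub hm0B
        rwa [sub_sub_sub_cancel_right] at this
      have h6 : c.Bd 32 2 ((g H - m0) ^ 2) := by rw [sq]; exact h5.mul h5
      exact (h3.mul' (k := 38) (m := 1) h6).mul' hm02 (by norm_num) (by norm_num)
    · intro H hH
      have hu1 := ua_nonneg (I.S a b) a b H
      have hu2 := ua_nonneg (I.S a b) b a H
      have h1 : c.Bd 0 0 (yi H a b v * (f H / g H)) := by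
        refine Bd.one ?_
        rw [abs_mul]
        refine mul_le_one₀ (abs_yi_le H a b v) (abs_nonneg _) ?_
        rw [abs_div]
        refine div_le_one_of_le₀ ?_ (abs_nonneg _)
        simp only [hf, hg]
        rw [abs_of_nonneg (add_nonneg hu1 hu2), abs_le]
        constructor <;> linarith
      have h2 : c.Bd 1 2 (g H) := by
        have h3 : c.Bd 0 2 (ua (I.S a b) a b H) :=
          c.bd_n.of_abs_le (by rw [abs_of_nonneg hu1, Nat.abs_cast]; exact ua_le _ _ _ _)
        have h4 : c.Bd 0 2 (ua (I.S a b) b a H) :=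
          c.bd_n.of_abs_le (by rw [abs_of_nonneg hu2, Nat.abs_cast]; exact ua_le _ _ _ _)
        exact h3.add' h4
      have h3 : c.Bd 1 2 m0 := by
        refine Bd.mono (k := 0) (m := 2) ?_ (by norm_num) le_rfl
        refine c.bd_n.of_abs_le ?_
        rw [Nat.abs_cast, hm0, Inst.mzero]
        refine (abs_sum_le_sum_abs _ _).trans ((sum_le_sum fun u _ => hψ u).trans ?_)
        rw [sum_const, nsmul_eq_mul, mul_one]
        have := card_le_univ (I.S a b)
        rw [Fintype.card_fin] at this
        exact_mod_cast this
      have h4 : c.Bd 2 2 (g H - m0) := h2.sub h3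
      have h5 : c.Bd 4 4 ((g H - m0) ^ 2) := by rw [sq]; exact h4.mul h4
      have h6 : c.Bd 6 0 (yi H a b v * (f H / g H) * (g H - m0) ^ 2 * m0⁻¹ ^ 2) :=
        (h1.mul' (k := 4) (m := 4) h5).mul' hm02
      exact h6.up (by norm_num) (by norm_num)
  have main : I.Pr a v - I.Pr b v - psi φ a b v * F / m0 =
      m0⁻¹ * (I.E (fun H => yi H a b v * f H) - psi φ a b v * F) -
        m0⁻¹ * m0⁻¹ * I.E (fun H => yi H a b v * f H * (g H - m0)) +
        I.E (fun H => yi H a b v * (f H / g H) * (g H - m0) ^ 2 * (m0⁻¹) ^ 2) := by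
    rw [Inst.Pr_sub_Pr hv, mul_sub, ← I.E_mul_left, ← I.E_mul_left,
      show m0⁻¹ * (psi φ a b v * F) = psi φ a b v * F / m0 by rw [div_eq_mul_inv]; ring,
      sub_right_comm, ← Inst.E_sub, sub_add_eq_add_sub, ← Inst.E_add]
    congr 1
    refine Inst.E_congr fun H _ => ?_
    change yi H a b v * (f H / g H) = _
    by_cases hg0 : g H = 0
    · have hu1 := ua_nonneg (I.S a b) a b H
      have hu2 := ua_nonneg (I.S a b) b a H
      have hf0 : f H = 0 := by
        simp only [hg] at hg0; simp only [hf]; linarith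
      rw [hf0]; ring
    · field_simp
      ring
  rw [main]
  have t1 : c.Bd (K + 20) (μ - 1) (m0⁻¹ * (I.E (fun H => yi H a b v * f H) - psi φ a b v * F)) :=
    hm0i.mul' hA (by omega) (by omega)
  have t2 : c.Bd (K + 20) (μ - 1)
      (m0⁻¹ * m0⁻¹ * I.E (fun H => yi H a b v * f H * (g H - m0))) :=
    (hm0i.mul hm0i).mul' hBs (by omega) (by omega)
  exact (t1.sub t2).add' hC (by omega) (by omega) (by omega) (by omega)

end Good

namespace Inst

variable {n : ℕ} (I : Inst n)

/-- Number of common neighbours in the forbidden graph. -/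
def cn (a b : Fin n) : ℝ := ∑ w, ad I.X a w * ad I.X b w

/-- Degree excess over the typical degree given the forbidden edges. -/
def dl (c : Ctx n) (v : Fin n) : ℝ := (I.d v : ℝ) - c.p * (n - 1) + c.p * I.x v

/-- Normalised degree excess. -/
def q (c : Ctx n) (v : Fin n) : ℝ := I.dl c v / n

/-- Sum of a function over forbidden neighbours. -/
def nb (r : Fin n → ℝ) (v : Fin n) : ℝ := ∑ w, ad I.X v w * r w

variable {I}

lemma cn_nonneg (a b : Fin n) : 0 ≤ I.cn a b :=
  sum_nonneg fun _ _ => mul_nonneg (ad_nonneg _ _ _) (ad_nonneg _ _ _)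

lemma cn_le (a b : Fin n) : I.cn a b ≤ I.x a :=
  sum_le_sum fun _ _ => mul_le_of_le_one_right (ad_nonneg _ _ _) (ad_le_one _ _ _)

lemma ad_mul_al (a b w : Fin n) :
    ad I.X b w * I.al a w = ad I.X b w - (if w = a then ad I.X b a else 0) -
      ad I.X a w * ad I.X b w := by
  by_cases hw : w = a
  · subst hw; simp [al, ad_self]
  · by_cases hX : I.X.Adj a w
    · simp [al, hw, hX, ad_one hX]
    · simp [al, hw, hX, ad_zero hX, Ne.symm hw]

lemma fhat_eq (r : Fin n → ℝ) (p : ℝ) (a b : Fin n) :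
    I.fhat (fun u w => p + r u + r w) a b =
      (I.d a + p * I.x a) - (I.d b + p * I.x b) +
        (r b * I.x a - r a * I.x b + (I.nb r a - I.nb r b)) +
        (r a - r b) * (2 * ad I.X a b + I.cn a b) := by
  have key : ∀ a b : Fin n, ∑ w, ad I.X b w * (I.al a w * (p + r a + r w)) =
      (p + r a) * I.x b + I.nb r b - ad I.X a b * (p + 2 * r a) -
        ((p + r a) * I.cn a b + ∑ w, ad I.X a w * ad I.X b w * r w) := by
    intro a b
    have h1 : ∑ w, (if w = a then ad I.X b a else 0) * (p + r a + r w) =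
        ad I.X a b * (p + 2 * r a) := by
      rw [sum_eq_single a]
      · rw [if_pos rfl, ad_comm]; ring
      · intro w _ hw; rw [if_neg hw, zero_mul]
      · simp
    rw [← h1]
    simp_rw [← mul_assoc, ad_mul_al, x, nb, cn, mul_sum, ← sum_add_distrib, ← sum_sub_distrib]
    exact sum_congr rfl fun w _ => by ring
  unfold fhat
  rw [key a b, key b a]
  rw [show I.cn b a = I.cn a b from sum_congr rfl fun w _ => mul_comm _ _,
    show ∑ w, ad I.X b w * ad I.X a w * r w = ∑ w, ad I.X a w * ad I.X b w * r w from
      sum_congr rfl fun w _ => by ring, ad_comm I.X b a]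
  ring

lemma card_S {a b : Fin n} (hab : a ≠ b) :
    (#(I.S a b) : ℝ) = n - I.x a - I.x b - 2 + 2 * ad I.X a b + I.cn a b := by
  have h1 : ∀ v, (if v ∈ I.S a b then (1 : ℝ) else 0) = 1 - ad I.X a v - ad I.X b v -
      (if v = a then 1 else 0) - (if v = b then 1 else 0) + (if v = a then ad I.X a b else 0) +
      (if v = b then ad I.X a b else 0) + ad I.X a v * ad I.X b v := by
    intro v
    simp only [mem_S]
    by_cases ha : v = a
    · subst ha; simp [ad_self, hab, ad_comm I.X b v]
    by_cases hb : v = b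
    · subst hb; simp [ad_self, ha]
    by_cases hXa : I.X.Adj a v <;> by_cases hXb : I.X.Adj b v <;>
      simp [ha, hb, hXa, hXb, ad]
  have h2 : (#(I.S a b) : ℝ) = ∑ v, if v ∈ I.S a b then (1 : ℝ) else 0 := by simp
  rw [h2]
  simp_rw [h1]
  simp only [sum_add_distrib, sum_sub_distrib, x, cn, sum_ite_eq', mem_univ, if_true, sum_const,
    card_univ, Fintype.card_fin, nsmul_eq_mul, mul_one]
  ring

end Inst

namespace Ctx

variable {n : ℕ} (c : Ctx n)

/-- Relative skewness. -/
def κ : ℝ := (1 - 2 * c.p) / (c.p * (1 - c.p))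

lemma bd_one_sub_two_p : c.Bd 0 0 (1 - 2 * c.p) :=
  .one (abs_le.2 ⟨by linarith [c.hp1], by linarith [c.hp0]⟩)

lemma bd_κ : c.Bd 1 0 c.κ := by
  unfold κ; rw [div_eq_mul_inv]; exact c.bd_one_sub_two_p.mul c.bd_inv_var

end Ctx

namespace Good

open Ctx

variable {n : ℕ} {c : Ctx n} {s : ℕ} {I : Inst n} {r : Fin n → ℝ}

lemma bd_dl (h : Good c s I) (hs : s ≤ 40) (v : Fin n) : c.Bd 3 1 (I.dl c v) :=
  (h.bd_deg hs v).add' (c.bd_p.mul' (k := 2) (m := 1) (h.bd_x hs v))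

lemma bd_q (h : Good c s I) (hs : s ≤ 40) (v : Fin n) : c.Bd 3 (-1) (I.q c v) :=
  (h.bd_dl hs v).div_n

lemma sum_q (I : Inst n) (c : Ctx n) : ∑ v, I.q c v =
    (∑ v, ((I.d v : ℝ) - c.p * (n - 1))) / n + c.p * (∑ v, I.x v) / n := by
  unfold Inst.q Inst.dl
  rw [← sum_div, sum_add_distrib, mul_sum, add_div]

lemma bd_sum_q (h : Good c s I) (hs : s ≤ 40) : c.Bd 3 0 (∑ v, I.q c v) := by
  rw [sum_q]
  have h1 : c.Bd 2 (-2) ((∑ v, ((I.d v : ℝ) - c.p * (n - 1))) / n) := (h.bd_sumd hs).div_n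
  have h2 : c.Bd 2 0 (c.p * (∑ v, I.x v) / n) :=
    (c.bd_p.mul' (k := 2) (m := 2) (h.bd_sumx hs)).div_n
  exact h1.add' h2

lemma bd_sum_S (h : Good c s I) (hs : s ≤ 40) (hr : ∀ v, c.Bd 3 (-1) (r v))
    (hrs : c.Bd 3 0 (∑ v, r v)) (a b : Fin n) : c.Bd 8 0 (∑ v ∈ I.S a b, r v) := by
  have h1 := I.abs_sum_sub_sum_S a b (f := r) (M := c.L ^ 3 * c.σ ^ (-1 : ℤ)) hr
  have h3 : c.Bd 4 1 (2 + I.x a + I.x b) := by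
    have h4 : c.Bd 3 1 (2 + I.x a) := (Bd.const (x := 2) (by norm_num)).add' (h.bd_x hs a)
    exact h4.add' (h.bd_x hs b)
  have h5 : c.Bd 3 (-1) (c.L ^ 3 * c.σ ^ (-1 : ℤ)) := by
    unfold Bd; rw [abs_of_nonneg (c.bd_nonneg _ _)]
  have h6 : c.Bd 7 0 (∑ v, r v - ∑ v ∈ I.S a b, r v) :=
    (h5.mul h3).of_abs_le (h1.trans (le_abs_self _))
  have h7 : c.Bd 8 0 (∑ v, r v - (∑ v, r v - ∑ v ∈ I.S a b, r v)) := hrs.sub' h6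
  simpa using h7

/-- Expansion of the main term of the difference of edge probabilities. -/
lemma bd_psi_fhat (h : Good c s I) (hs : s ≤ 40) (hr : ∀ v, c.Bd 3 (-1) (r v))
    (hrs : c.Bd 3 0 (∑ v, r v)) {a b : Fin n} (hab : a ≠ b) (v : Fin n) :
    c.Bd 50 (-3) ((1 + I.cn a b)⁻¹ * (psi (fun u w => c.p + r u + r w) a b v *
      I.fhat (fun u w => c.p + r u + r w) a b / I.mzero (fun u w => c.p + r u + r w) a b -
      ((I.q c a - I.q c b) * (1 + c.κ * r v + (I.x a + I.x b) / n) +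
        (r b * I.x a - r a * I.x b + (I.nb r a - I.nb r b)) / n))) := by
  set φ : Fin n → Fin n → ℝ := fun u w => c.p + r u + r w with hφ
  set α := 2 * (c.p * (1 - c.p)) with hα
  set β := 1 - 2 * c.p with hβ
  set ξ := (I.x a + I.x b) / n with hξ
  set t := (1 + I.cn a b)⁻¹ with ht
  have hcn := I.cn_nonneg a b
  have ht1 : c.Bd 0 0 t := Bd.one (by
    rw [abs_of_nonneg (by positivity)]; exact inv_le_one_of_one_le₀ (by linarith))
  have htc : c.Bd 0 0 (t * I.cn a b) := Bd.one (by
    rw [abs_of_nonneg (by positivity), ht, inv_mul_le_iff₀ (by linarith)]; linarith)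
  have hn0 := c.n_pos.ne'
  have hφp : ∀ u w, c.Bd 11 (-1) (φ u w - c.p) := fun u w => by
    have h1 : c.Bd 11 (-1) (r u + r w) := (hr u).add' (hr w)
    convert h1 using 1
    simp only [hφ]; ring
  have hm0B := h.bd_mzero hs hφp a b
  have hm0ge := ge_of_bd c (by norm_num) hm0B
  have hm0i : c.Bd 1 (-2) (I.mzero φ a b)⁻¹ := bd_inv_ge c hm0ge
  have hm0pos : 0 < I.mzero φ a b := (div_pos c.n_pos c.L_pos).trans_le hm0ge
  have hαB : c.Bd 1 0 α := (Bd.const (x := 2) (by norm_num)).mul (c.bd_p.mul c.bd_one_sub_p)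
  have hβB : c.Bd 0 0 β := c.bd_one_sub_two_p
  have hαβ : α * c.κ = 2 * β := by
    have := c.var_pos.ne'
    have := c.hp0.ne'
    have : 1 - c.p ≠ 0 := by linarith [c.hp1]
    simp only [hα, κ]; field_simp; simp only [hβ]
  -- remainder of `psi`
  set ψ2 : Fin n → ℝ := fun w => - 2 * (r a + r w) * (r b + r w) with hψ2
  have hψ2B : ∀ w, c.Bd 9 (-2) (ψ2 w) := fun w => by
    have h1 : c.Bd 4 (-1) (r a + r w) := (hr a).add (hr w)
    have h2 : c.Bd 4 (-1) (r b + r w) := (hr b).add (hr w)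
    exact ((Bd.const (x := -2) (by norm_num)).mul' (k := 5) (m := -1) h1).mul' h2
  have hψ : ∀ w, psi φ a b w = α + β * (r a + r b) + 2 * β * r w + ψ2 w := fun w => by
    simp only [psi, hφ, hα, hβ, hψ2]; ring
  -- remainder of `mzero`
  set M2 := (β * (r a + r b)) * (#(I.S a b) - n) + α * (-2 + 2 * ad I.X a b + I.cn a b) +
    2 * β * ∑ w ∈ I.S a b, r w + ∑ w ∈ I.S a b, ψ2 w with hM2
  have hm0 : I.mzero φ a b = α * n + β * n * (r a + r b) - α * n * ξ + M2 := by
    have h1 : I.mzero φ a b = (α + β * (r a + r b)) * #(I.S a b) + 2 * β * ∑ w ∈ I.S a b, r w +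
        ∑ w ∈ I.S a b, ψ2 w := by
      simp only [Inst.mzero, hψ, sum_add_distrib, sum_const, nsmul_eq_mul, ← mul_sum]; ring
    have h2 : α * n * ξ = α * (I.x a + I.x b) := by rw [hξ]; field_simp
    rw [h1, h2, hM2, Inst.card_S hab]; ring
  have htM2 : c.Bd 14 0 (t * M2) := by
    have e1 : t * M2 = t * ((β * (r a + r b)) * (#(I.S a b) - n)) + t *
        (α * (-2 + 2 * ad I.X a b)) +
      α * (t * I.cn a b) + t * (2 * β * ∑ w ∈ I.S a b, r w) + t * ∑ w ∈ I.S a b, ψ2 w := by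
      rw [hM2]; ring
    rw [e1]
    have h1 : c.Bd 4 (-1) (β * (r a + r b)) := hβB.mul' ((hr a).add (hr b))
    have h2 : c.Bd 4 1 (#(I.S a b) - (n : ℝ)) := by
      have := (h.bd_card_S hs a b).neg
      rwa [neg_sub] at this
    have h3 : c.Bd 8 0 (t * ((β * (r a + r b)) * (#(I.S a b) - n))) :=
      ht1.mul' (h1.mul h2)
    have h4 : c.Bd 2 0 (α * (-2 + 2 * ad I.X a b)) := by
      refine hαB.mul' (Bd.const ?_)
      rw [abs_le]
      constructor <;> linarith [ad_nonneg I.X a b, ad_le_one I.X a b]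
    have h5 : c.Bd 2 0 (t * (α * (-2 + 2 * ad I.X a b))) := ht1.mul' h4
    have h6 : c.Bd 1 0 (α * (t * I.cn a b)) := hαB.mul' htc
    have h7 : c.Bd 9 0 (t * (2 * β * ∑ w ∈ I.S a b, r w)) :=
      ht1.mul' (((Bd.const (x := 2) (by norm_num)).mul hβB).mul (h.bd_sum_S hs hr hrs a b))
    have h8 : c.Bd 9 0 (t * ∑ w ∈ I.S a b, ψ2 w) := ht1.mul' (Bd.sum_fin fun w _ => hψ2B w)
    have g1 : c.Bd 10 0 _ := h3.add' h5
    have g2 : c.Bd 11 0 _ := g1.add' h6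
    have g3 : c.Bd 12 0 _ := g2.add' h7
    exact g3.add' h8
  have hξB : c.Bd 3 (-1) ξ := by
    have : c.Bd 3 1 (I.x a + I.x b) := (h.bd_x hs a).add (h.bd_x hs b)
    exact this.div_n
  have hκr : c.Bd 5 (-1) (c.κ * r v + ξ) := by
    have : c.Bd 4 (-1) (c.κ * r v) := c.bd_κ.mul' (hr v)
    exact this.add' hξB
  -- relative error of `psi / mzero`
  set Z := psi φ a b v * n / I.mzero φ a b - (1 + c.κ * r v + ξ) with hZ
  have hZe : Z = (I.mzero φ a b)⁻¹ *
      (n * ψ2 v - M2 - (I.mzero φ a b - α * n) * (c.κ * r v + ξ)) := by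
    have e : psi φ a b v * n - I.mzero φ a b * (1 + c.κ * r v + ξ) =
        n * ψ2 v - M2 - (I.mzero φ a b - α * n) * (c.κ * r v + ξ) +
          (2 * β - α * c.κ) * n * r v := by
      rw [hψ, hm0]; ring
    rw [hαβ, sub_self, zero_mul, zero_mul, add_zero] at e
    rw [← e, hZ]; field_simp
  have htZ : c.Bd 25 (-2) (t * Z) := by
    have e1 : t * Z = (I.mzero φ a b)⁻¹ * (t * (n * ψ2 v) - t * M2 -
      t * ((I.mzero φ a b - α * n) * (c.κ * r v + ξ))) := by rw [hZe]; ring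
    rw [e1]
    have h1 : c.Bd 9 0 (t * (n * ψ2 v)) := ht1.mul' (c.bd_n.mul (hψ2B v))
    have h2 : c.Bd 20 0 (t * ((I.mzero φ a b - α * n) * (c.κ * r v + ξ))) :=
      ht1.mul' (hm0B.mul hκr)
    have h3 : c.Bd 15 0 _ := h1.sub' htM2
    have h4 : c.Bd 21 0 _ := h3.sub' h2
    exact hm0i.mul' h4
  set F1 := r b * I.x a - r a * I.x b + (I.nb r a - I.nb r b) with hF1
  have hF1B : c.Bd 7 0 F1 := by
    have h1 : c.Bd 6 0 (r b * I.x a - r a * I.x b) :=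
      Bd.sub' (k₁ := 5) (m₁ := 0) (k₂ := 5) (m₂ := 0) ((hr b).mul' (h.bd_x hs a))
        ((hr a).mul' (h.bd_x hs b))
    have h2 : c.Bd 6 0 (I.nb r a - I.nb r b) :=
      Bd.sub' (h.bd_sum_ad hs a fun w _ => hr w) (h.bd_sum_ad hs b fun w _ => hr w)
    exact h1.add' h2
  set F2 := (r a - r b) * (2 * ad I.X a b + I.cn a b) with hF2
  have htF2 : c.Bd 6 (-1) (t * F2) := by
    have e1 : t * F2 = (r a - r b) * (t * (2 * ad I.X a b) + t * I.cn a b) := by rw [hF2]; ring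
    rw [e1]
    have h1 : c.Bd 4 (-1) (r a - r b) := (hr a).sub (hr b)
    have h2 : c.Bd 1 0 (t * (2 * ad I.X a b)) :=
      ht1.mul' ((Bd.const (x := 2) (by norm_num)).mul (bd_ad c I.X a b))
    have h3 : c.Bd 2 0 _ := h2.add' htc
    exact h1.mul' h3
  have hfe : I.fhat φ a b = n * (I.q c a - I.q c b) + F1 + F2 := by
    rw [hφ, Inst.fhat_eq]
    simp only [Inst.q, Inst.dl]
    field_simp
    ring
  have hfB : c.Bd 10 1 (n * (I.q c a - I.q c b) + F1 + F2) := by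
    have h1 : c.Bd 4 1 (n * (I.q c a - I.q c b)) := c.bd_n.mul' ((h.bd_q hs a).sub (h.bd_q hs b))
    have h2 : c.Bd 8 1 _ := h1.add' hF1B
    have h3 : c.Bd 4 (-1) (r a - r b) := (hr a).sub (hr b)
    have h4 : c.Bd 3 1 (2 * ad I.X a b + I.cn a b) := by
      refine Bd.add' ((Bd.const (x := 2) (by norm_num)).mul (bd_ad c I.X a b))
          (Bd.of_abs_le (h.bd_x hs a) ?_)
      rw [abs_of_nonneg hcn]; exact (I.cn_le a b).trans (le_abs_self _)
    have h5 : c.Bd 7 0 F2 := h3.mul' h4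
    exact h2.add' h5
  have main : psi φ a b v * I.fhat φ a b / I.mzero φ a b -
      ((I.q c a - I.q c b) * (1 + c.κ * r v + ξ) + F1 / n) =
      ((c.κ * r v + ξ) * F1 + Z * (n * (I.q c a - I.q c b) + F1 + F2) +
        (1 + (c.κ * r v + ξ)) * F2) / n := by
    rw [hfe, hZ]; field_simp; ring
  rw [main, ← mul_div_assoc]
  have e2 : t * ((c.κ * r v + ξ) * F1 + Z * (n * (I.q c a - I.q c b) + F1 + F2) +
        (1 + (c.κ * r v + ξ)) * F2) = t * ((c.κ * r v + ξ) * F1) +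
        (t * Z) * (n * (I.q c a - I.q c b) + F1 + F2) + (1 + (c.κ * r v + ξ)) * (t * F2) := by ring
  rw [e2]
  have g1 : c.Bd 12 (-1) (t * ((c.κ * r v + ξ) * F1)) := ht1.mul' (hκr.mul hF1B)
  have g2 : c.Bd 35 (-1) ((t * Z) * (n * (I.q c a - I.q c b) + F1 + F2)) := htZ.mul' hfB
  have g3 : c.Bd 6 0 (1 + (c.κ * r v + ξ)) := (Bd.const (x := 1) (by norm_num)).add' hκr
  have g4 : c.Bd 12 (-1) ((1 + (c.κ * r v + ξ)) * (t * F2)) := g3.mul' htF2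
  have g5 : c.Bd 36 (-1) _ := g1.add' g2
  have g6 : c.Bd 50 (-1) _ := g5.add' g4
  exact g6.div_n

end Good

lemma Close.of_step {n : ℕ} {P : ℕ → Inst n → Prop} {φ : Fin n → Fin n → ℝ} {e : ℝ} {N : ℕ}
    (hP : ∀ k J, k ≤ N → P k J → J.gs.Nonempty ∧ (∀ v, 1 ≤ J.d v) ∧
      ∀ u w, u ≠ w → ¬ J.X.Adj u w → |J.Pr u w - φ u w| ≤ e)
    (hst : ∀ k J u w, k ≤ N → P k J → u ≠ w → ¬ J.X.Adj u w →
      P (k + 1) (J.add u w) ∧ P (k + 1) (J.del u w)) :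
    ∀ r k J, r + k ≤ N → P k J → Close φ e r J
  | 0, k, J, hk, h => (hP k J (by omega) h).1
  | r + 1, k, J, hk, h => by
    obtain ⟨h1, h2, h3⟩ := hP k J (by omega) h
    refine ⟨h1, h2, h3, fun u w huw hX => ?_⟩
    obtain ⟨h4, h5⟩ := hst k J u w (by omega) h huw hX
    exact ⟨of_step hP hst r (k + 1) _ (by omega) h4, of_step hP hst r (k + 1) _ (by omega) h5⟩

namespace Inst

variable {n : ℕ} {I : Inst n}

lemma sub_mul_Pr_sub (hI : I.gs.Nonempty) (c : Ctx n) (a v : Fin n) :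
    (n - 1 - I.x v) * (I.Pr a v - (c.p + I.q c a + I.q c v)) =
      2 * I.q c v + I.q c v * I.x v - ∑ b, I.q c b + I.nb (I.q c) v +
        ∑ b ∈ I.Vn v, (I.Pr a v - I.Pr b v - (I.q c a - I.q c b)) := by
  have h1 := mul_Pr hI a v
  have h2 : ∑ b ∈ I.Vn v, (I.Pr a v - I.Pr b v - (I.q c a - I.q c b)) =
      ∑ b ∈ I.Vn v, (I.Pr a v - I.Pr b v) - (n - 1 - I.x v) * I.q c a +
        (∑ b, I.q c b - I.q c v - I.nb (I.q c) v) := by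
    rw [sum_sub_distrib, sum_sub_distrib (f := fun _ => I.q c a), I.sum_Vn v (I.q c), sum_const,
      nsmul_eq_mul, card_Vn, nb]
    ring
  have h3 : I.q c v * n = (I.d v : ℝ) - c.p * (n - 1) + c.p * I.x v := by
    unfold q dl; field_simp [c.n_pos.ne']
  rw [h2, mul_sub, h1]
  linear_combination -h3

end Inst

namespace Good

open Ctx

variable {n : ℕ} {c : Ctx n} {s : ℕ} {I : Inst n}

lemma bd_pow (c : Ctx n) (k : ℕ) (m : ℤ) : c.Bd k m (c.L ^ k * c.σ ^ m) := by
  unfold Bd; rw [abs_of_nonneg (c.bd_nonneg _ _)]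

lemma close_const (h : Good c s I) (hs : s ≤ 35) (hI : I.gs.Nonempty) :
    Close (fun _ _ => c.p) (c.L ^ 10 * c.σ ^ (-1 : ℤ)) 5 I := by
  refine Close.of_step (N := 5) (P := fun k J => Good c (s + k) J ∧ J.gs.Nonempty) ?_ ?_ 5 0 I
    le_rfl ⟨h, hI⟩
  · rintro k J hk ⟨h1, h2⟩
    exact ⟨h2, h1.one_le_d (by omega), fun u w huw hX => h1.bd_Pr (by omega) h2 huw hX⟩
  · rintro k J u w hk ⟨h1, h2⟩ huw hX
    exact ⟨⟨h1.add (by omega) huw hX, h1.add_nonempty (by omega) h2 huw hX⟩,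
      ⟨h1.del huw hX, h1.del_nonempty (by omega) h2 huw hX⟩⟩

lemma bd_Pr_sub_q (h : Good c s I) (hs : s ≤ 35) (hI : I.gs.Nonempty) {a b v : Fin n}
    (hv : v ∈ I.S a b) :
    c.Bd 62 (-2) (I.Pr a v - I.Pr b v - (I.q c a - I.q c b)) := by
  by_cases hab : a = b
  · subst hab; simp only [sub_self]; exact .zero
  have hs' : s ≤ 40 := by omega
  have h1 := h.bd_Pr_sub_fhat hs' (fun _ _ => ⟨c.hp0.le, c.hp1.le⟩)
    (fun _ _ => by rw [sub_self]; exact .zero) (c.bd_nonneg _ _) (h.close_const hs hI)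
    (bd_pow c 10 (-1)) (by norm_num) hab hv
  have h2 := h.bd_psi_fhat hs' (r := fun _ => 0) (fun _ => .zero) (by simpa using Bd.zero) hab v
  have h3 : c.Bd 3 1 (1 + I.cn a b) := by
    refine (Bd.const (x := 1) (by norm_num)).add' (Bd.of_abs_le (h.bd_x hs' a) ?_)
    rw [abs_of_nonneg (I.cn_nonneg a b)]; exact (I.cn_le a b).trans (le_abs_self _)
  have hne : (1 + I.cn a b) ≠ 0 := by have := I.cn_nonneg a b; positivity
  have h4 := h3.mul h2
  rw [← mul_assoc, mul_inv_cancel₀ hne, one_mul] at h4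
  have h0 : I.nb (fun _ => 0) a - I.nb (fun _ => 0) b = 0 := by simp [Inst.nb]
  simp only [h0, add_zero, zero_mul, sub_zero, mul_zero, zero_div] at h4
  have h5 : c.Bd 7 (-2) ((I.q c a - I.q c b) * ((I.x a + I.x b) / n)) := by
    have g1 : c.Bd 4 (-1) (I.q c a - I.q c b) := (h.bd_q hs' a).sub (h.bd_q hs' b)
    have g2 : c.Bd 3 (1 - 2) ((I.x a + I.x b) / n) := ((h.bd_x hs' a).add (h.bd_x hs' b)).div_n
    exact g1.mul' g2
  have h6 : c.Bd 61 (-2) _ := h1.add' h4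
  have h7 : c.Bd 62 (-2) _ := h6.add' h5
  convert h7 using 1
  ring

lemma bd_nb (h : Good c s I) (hs : s ≤ 40) (v : Fin n) : c.Bd 5 0 (I.nb (I.q c) v) :=
  h.bd_sum_ad hs v fun w _ => h.bd_q hs w

lemma bd_Pr_q (h : Good c s I) (hs : s ≤ 35) (hI : I.gs.Nonempty) {a v : Fin n} (hav : a ≠ v)
    (hX : ¬ I.X.Adj a v) : c.Bd 70 (-2) (I.Pr a v - (c.p + I.q c a + I.q c v)) := by
  have hs' : s ≤ 40 := by omega
  have ha : a ∈ I.Vn v := Inst.mem_Vn.2 ⟨hav, fun h => hX h.symm⟩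
  have h1 := Inst.sub_mul_Pr_sub hI c a v
  have h2 : c.Bd 62 0 (∑ b ∈ I.Vn v, (I.Pr a v - I.Pr b v - (I.q c a - I.q c b))) :=
    Bd.sum_fin fun b hb => h.bd_Pr_sub_q hs hI (Inst.mem_S_of_mem_Vn ha hb)
  have g1 : c.Bd 4 (-1) (2 * I.q c v) := (Bd.const (x := 2) (by norm_num)).mul' (h.bd_q hs' v)
  have g2 : c.Bd 5 0 (I.q c v * I.x v) := (h.bd_q hs' v).mul' (h.bd_x hs' v)
  have g3 : c.Bd 6 0 _ := g1.add' g2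
  have g4 : c.Bd 7 0 _ := g3.sub' (h.bd_sum_q hs')
  have g5 : c.Bd 8 0 _ := g4.add' (h.bd_nb hs' v)
  have g6 : c.Bd 63 0 _ := g5.add' h2
  rw [← h1] at g6
  have h4 := h.bd_inv_card_Vn hs' v
  have hne : (n : ℝ) - 1 - I.x v ≠ 0 := by
    rw [← I.card_Vn v]; exact_mod_cast (card_pos.2 ⟨a, ha⟩).ne'
  have h5 := h4.mul g6
  rw [← mul_assoc, inv_mul_cancel₀ hne, one_mul] at h5
  exact h5.mono'

lemma q_add (c : Ctx n) {I : Inst n} {u w : Fin n} (huw : u ≠ w) (hX : ¬ I.X.Adj u w)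
    (hd : ∀ v, 1 ≤ I.d v) (v : Fin n) :
    |(I.add u w).q c v - I.q c v| ≤ 1 / n ∧ |(I.del u w).q c v - I.q c v| ≤ 1 / n := by
  have hp0 := c.hp0
  have hp1 := c.hp1
  have hn := c.n_pos
  have e1 : (I.add u w).dl c v - I.dl c v = if v = u ∨ v = w then -1 + c.p else 0 := by
    simp only [Inst.dl, I.x_add huw hX]
    simp only [Inst.add]
    split_ifs
    · rw [Nat.cast_sub (hd v)]; push_cast; ring
    · ring
  have e2 : (I.del u w).dl c v - I.dl c v = if v = u ∨ v = w then c.p else 0 := by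
    simp only [Inst.dl, I.x_del huw hX]
    simp only [Inst.del]
    split_ifs <;> ring
  unfold Inst.q
  rw [← sub_div, ← sub_div, e1, e2, abs_div, abs_div, abs_of_pos hn]
  constructor <;> gcongr <;> split_ifs <;> rw [abs_le] <;> constructor <;> linarith

lemma close_q (h : Good c s I) (hs : s ≤ 30) (hI : I.gs.Nonempty) :
    Close (fun u w => c.p + I.q c u + I.q c w) (c.L ^ 71 * c.σ ^ (-2 : ℤ)) 5 I := by
  refine Close.of_step (N := 5) (P := fun k J => Good c (s + k) J ∧ J.gs.Nonempty ∧
    ∀ v, |J.q c v - I.q c v| ≤ k / n) ?_ ?_ 5 0 I le_rfl ⟨h, hI, by simp⟩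
  · rintro k J hk ⟨h1, h2, h3⟩
    refine ⟨h2, h1.one_le_d (by omega), fun u w huw hX => ?_⟩
    have g1 := h1.bd_Pr_q (by omega) h2 huw hX
    have g2 : ∀ v, c.Bd 1 (-2) (J.q c v - I.q c v) := fun v => by
      have : c.Bd 1 (-2) ((k : ℝ) / n) := (c.bd_nat (by omega)).div_n
      exact this.of_abs_le ((h3 v).trans (le_abs_self _))
    have g3 : c.Bd 2 (-2) (J.q c u - I.q c u + (J.q c w - I.q c w)) := (g2 u).add (g2 w)
    have g4 : c.Bd 71 (-2) _ := g1.add' g3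
    refine le_of_eq_of_le (congrArg _ ?_) g4
    ring
  · rintro k J u w hk ⟨h1, h2, h3⟩ huw hX
    have hq := q_add c huw hX (h1.one_le_d (by omega))
    refine ⟨⟨h1.add (by omega) huw hX, h1.add_nonempty (by omega) h2 huw hX, fun v => ?_⟩,
      ⟨h1.del huw hX, h1.del_nonempty (by omega) h2 huw hX, fun v => ?_⟩⟩
    · push_cast; rw [add_div]
      refine (abs_sub_le _ (J.q c v) _).trans ?_
      linarith [(hq v).1, h3 v]
    · push_cast; rw [add_div]
      refine (abs_sub_le _ (J.q c v) _).trans ?_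
      linarith [(hq v).2, h3 v]

lemma q_mem (h : Good c s I) (hs : s ≤ 40) (u w : Fin n) :
    0 ≤ c.p + I.q c u + I.q c w ∧ c.p + I.q c u + I.q c w ≤ 1 := by
  have h1 := abs_le.1 (((h.bd_q hs u).add (h.bd_q hs w)).le_pow (j := 2) le_rfl (by norm_num))
  have h2 := c.p_ge
  have h3 := c.one_sub_p_ge
  have h4 : 1 / c.L ^ 2 ≤ 1 / c.L := by
    have := c.one_le_L
    have := c.L_pos
    gcongr
    nlinarith
  constructor <;> linarith

lemma bd_Pr_sub_q' (h : Good c s I) (hs : s ≤ 30) (hI : I.gs.Nonempty) {a b v : Fin n}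
    (hv : v ∈ I.S a b) :
    c.Bd 122 (-3) ((1 + I.cn a b)⁻¹ * (I.Pr a v - I.Pr b v - (I.q c a - I.q c b) -
      ((I.q c a * I.x a - I.q c b * I.x b) / n + (I.nb (I.q c) a - I.nb (I.q c) b) / n +
        c.κ * I.q c v * (I.q c a - I.q c b)))) := by
  by_cases hab : a = b
  · subst hab; simp only [sub_self, zero_div, mul_zero, add_zero]; exact .zero
  have hs' : s ≤ 40 := by omega
  have h1 := h.bd_Pr_sub_fhat hs' (h.q_mem hs') (fun u w => by
    have h1 : c.Bd 11 (-1) (I.q c u + I.q c w) := (h.bd_q hs' u).add' (h.bd_q hs' w)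
    convert h1 using 1
    ring) (c.bd_nonneg _ _) (h.close_q hs hI)
    (bd_pow c 71 (-2)) (by norm_num) hab hv
  have h2 := h.bd_psi_fhat hs' (h.bd_q hs') (h.bd_sum_q hs') hab v
  have hcn := I.cn_nonneg a b
  have ht1 : c.Bd 0 0 (1 + I.cn a b)⁻¹ := Bd.one (by
    rw [abs_of_nonneg (by positivity)]; exact inv_le_one_of_one_le₀ (by linarith))
  have h3 : c.Bd 121 (-3) _ := ht1.mul' h1
  have h4 : c.Bd 122 (-3) _ := h3.add' h2
  convert h4 using 1
  ring

lemma sum_cn (a : Fin n) : ∑ b, I.cn a b = ∑ w, ad I.X a w * I.x w := by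
  unfold Inst.cn Inst.x
  rw [sum_comm]
  refine sum_congr rfl fun w _ => ?_
  rw [mul_sum]
  exact sum_congr rfl fun b _ => by rw [ad_comm I.X b w]

/-- Second order approximation of edge probabilities. -/
def _root_.Inst.P3 (I : Inst n) (c : Ctx n) (a v : Fin n) : ℝ :=
  c.p + I.q c a + I.q c v + (I.q c a * I.x a + I.q c v * I.x v) / n +
    (I.nb (I.q c) a + I.nb (I.q c) v) / n + c.κ * I.q c a * I.q c v -
    c.p * (∑ w, I.x w) / n ^ 2

lemma bd_Pr_P3 (h : Good c s I) (hs : s ≤ 30) (hI : I.gs.Nonempty) {a v : Fin n} (hav : a ≠ v)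
    (hX : ¬ I.X.Adj a v) : c.Bd 135 (-3) (I.Pr a v - I.P3 c a v) := by
  have hs' : s ≤ 40 := by omega
  have hn0 := c.n_pos.ne'
  have ha : a ∈ I.Vn v := Inst.mem_Vn.2 ⟨hav, fun h => hX h.symm⟩
  have h1 := Inst.sub_mul_Pr_sub hI c a v
  set M : Fin n → ℝ := fun b => (I.q c a * I.x a - I.q c b * I.x b) / n +
    (I.nb (I.q c) a - I.nb (I.q c) b) / n + c.κ * I.q c v * (I.q c a - I.q c b) with hM
  set R : Fin n → ℝ := fun b => I.Pr a v - I.Pr b v - (I.q c a - I.q c b) - M b with hR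
  have hRB : c.Bd 130 (-1) (∑ b ∈ I.Vn v, R b) := by
    have e1 : ∑ b ∈ I.Vn v, R b = ∑ b ∈ I.Vn v, (1 + I.cn a b) * ((1 + I.cn a b)⁻¹ * R b) := by
      refine sum_congr rfl fun b _ => ?_
      have := I.cn_nonneg a b
      rw [mul_inv_cancel_left₀ (by positivity)]
    rw [e1]
    have hw : c.Bd 6 2 (∑ b ∈ I.Vn v, (1 + I.cn a b)) := by
      have e2 : c.Bd 5 2 (∑ b, (1 + I.cn a b)) := by
        rw [sum_add_distrib, sum_cn]
        have e3 : c.Bd 0 2 (∑ _b : Fin n, (1 : ℝ)) := by simpa using c.bd_n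
        have e4 : c.Bd 4 2 (∑ w, ad I.X a w * I.x w) := h.bd_sum_ad hs' a fun w _ => h.bd_x hs' w
        exact e3.add' e4
      refine Bd.mono ?_ (show 5 ≤ 6 by norm_num) le_rfl
      refine e2.of_abs_le ?_
      rw [abs_of_nonneg (sum_nonneg fun b _ => by have := I.cn_nonneg a b; positivity),
        abs_of_nonneg (sum_nonneg fun b _ => by have := I.cn_nonneg a b; positivity)]
      exact sum_le_univ_sum_of_nonneg fun b => by have := I.cn_nonneg a b; positivity
    exact (Bd.sum_weight (fun b _ => by have := I.cn_nonneg a b; positivity)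
      (fun b hb => h.bd_Pr_sub_q' hs hI (Inst.mem_S_of_mem_Vn ha hb)) hw).mono'
  have hsx : c.Bd 3 2 (∑ b ∈ I.Vn v, I.x b) := by
    refine Bd.mono (Bd.of_abs_le (h.bd_sumx hs') ?_) (show 2 ≤ 3 by norm_num) le_rfl
    rw [abs_of_nonneg (sum_nonneg fun b _ => I.x_nonneg b),
      abs_of_nonneg (sum_nonneg fun b _ => I.x_nonneg b)]
    exact sum_le_univ_sum_of_nonneg fun b => I.x_nonneg b
  have hMs : ∑ b ∈ I.Vn v, M b = (n - 1 - I.x v) * ((I.q c a * I.x a) / n + I.nb (I.q c) a / n +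
      c.κ * I.q c a * I.q c v) - ((∑ b ∈ I.Vn v, I.x b * I.q c b) / n +
        (∑ b ∈ I.Vn v, I.nb (I.q c) b) / n + c.κ * I.q c v * ∑ b ∈ I.Vn v, I.q c b) := by
    rw [← I.card_Vn v, ← nsmul_eq_mul, ← sum_const, sum_div, sum_div, mul_sum, ← sum_add_distrib,
      ← sum_add_distrib, ← sum_sub_distrib]
    exact sum_congr rfl fun b _ => by simp only [hM]; ring
  have t1 : c.Bd 6 (-1) ((∑ b ∈ I.Vn v, I.x b * I.q c b) / n) := by
    have e1 : c.Bd 6 1 (∑ b ∈ I.Vn v, I.x b * I.q c b) :=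
      (Bd.sum_weight (fun b _ => I.x_nonneg b) (fun b _ => h.bd_q hs' b) hsx).mono'
    exact e1.div_n
  have t2 : c.Bd 6 (-1) ((∑ b ∈ I.Vn v, I.nb (I.q c) b) / n) := by
    have e0 : ∀ b, |I.nb (I.q c) b| ≤ (c.L ^ 3 * c.σ ^ (-1 : ℤ)) * I.x b := fun b =>
      Inst.abs_sum_ad_mul_le b fun w _ => h.bd_q hs' w
    have e1 : c.Bd 6 1 (∑ b ∈ I.Vn v, I.nb (I.q c) b) := by
      refine Bd.of_abs_le ((bd_pow c 3 (-1)).mul' hsx) ?_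
      refine (abs_sum_le_sum_abs _ _).trans ((sum_le_sum fun b _ => e0 b).trans ?_)
      rw [← mul_sum]; exact le_abs_self _
    exact e1.div_n
  have t3 : c.Bd 14 (-1) (c.κ * I.q c v * ∑ b ∈ I.Vn v, I.q c b) := by
    have e1 : c.Bd 7 0 (∑ b ∈ I.Vn v, I.q c b) := by
      rw [I.sum_Vn v (I.q c)]
      have e2 : c.Bd 4 0 (∑ b, I.q c b - I.q c v) := (h.bd_sum_q hs').sub' (h.bd_q hs' v)
      exact e2.sub' (h.bd_nb hs' v)
    exact (c.bd_κ.mul (h.bd_q hs' v)).mul' e1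
  have t4 : c.Bd 4 (-1) (2 * I.q c v) := (Bd.const (x := 2) (by norm_num)).mul' (h.bd_q hs' v)
  have t5 : c.Bd 2 (-2) ((∑ v, ((I.d v : ℝ) - c.p * (n - 1))) / n) := (h.bd_sumd hs').div_n
  set B := I.q c v * I.x v + I.nb (I.q c) v - c.p * (∑ v, I.x v) / n with hB
  have hBB : c.Bd 7 0 B := by
    have g2 : c.Bd 5 0 (I.q c v * I.x v) := (h.bd_q hs' v).mul' (h.bd_x hs' v)
    have g3 : c.Bd 6 0 _ := g2.add' (h.bd_nb hs' v)
    have g4 : c.Bd 2 0 (c.p * (∑ v, I.x v) / n) :=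
      (c.bd_p.mul' (k := 2) (m := 2) (h.bd_sumx hs')).div_n
    exact g3.sub' g4
  have hsumR : ∑ b ∈ I.Vn v, (I.Pr a v - I.Pr b v - (I.q c a - I.q c b)) =
      ∑ b ∈ I.Vn v, M b + ∑ b ∈ I.Vn v, R b := by
    rw [← sum_add_distrib]; exact sum_congr rfl fun b _ => by simp only [hR]; ring
  rw [hsumR, hMs, sum_q] at h1
  have t6' : c.Bd 10 (-1) ((1 + I.x v) * (B / n)) := by
    have e1 : c.Bd 3 1 (1 + I.x v) := (Bd.const (x := 1) (by norm_num)).add' (h.bd_x hs' v)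
    have e2 : c.Bd 7 (-2) (B / n) := hBB.div_n
    exact e1.mul' e2
  have main : (n - 1 - I.x v) * (I.Pr a v - I.P3 c a v) =
      (1 + I.x v) * (B / n) + 2 * I.q c v - (∑ v, ((I.d v : ℝ) - c.p * (n - 1))) / n -
      (∑ b ∈ I.Vn v, I.x b * I.q c b) / n - (∑ b ∈ I.Vn v, I.nb (I.q c) b) / n -
      c.κ * I.q c v * ∑ b ∈ I.Vn v, I.q c b + ∑ b ∈ I.Vn v, R b := by
    have e1 : I.P3 c a v = c.p + I.q c a + I.q c v + ((I.q c a * I.x a) / n +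
        I.nb (I.q c) a / n + c.κ * I.q c a * I.q c v) + B / n := by
      rw [hB, Inst.P3]; field_simp; ring
    have e2 : B = n * (B / n) := by field_simp
    rw [e1]
    linear_combination h1 + e2 + hB
  have g1 : c.Bd 11 (-1) _ := t6'.add' t4
  have g2 : c.Bd 12 (-1) _ := g1.sub' t5
  have g3 : c.Bd 13 (-1) _ := g2.sub' t1
  have g4 : c.Bd 14 (-1) _ := g3.sub' t2
  have g5 : c.Bd 15 (-1) _ := g4.sub' t3
  have g6 : c.Bd 131 (-1) _ := g5.add' hRB
  rw [← main] at g6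
  have h4 := h.bd_inv_card_Vn hs' v
  have hne : (n : ℝ) - 1 - I.x v ≠ 0 := by
    rw [← I.card_Vn v]; exact_mod_cast (card_pos.2 ⟨a, ha⟩).ne'
  have h5 := h4.mul g6
  rw [← mul_assoc, inv_mul_cancel₀ hne, one_mul] at h5
  exact h5.mono'

end Good

namespace Ctx

variable {n : ℕ} {c : Ctx n}

lemma Bd.log_sub {k : ℕ} {m : ℤ} {u y : ℝ} (h : c.Bd k m (u - y)) (hu : 1 / c.L ^ 2 ≤ u)
    (hk : k ≤ 400) (hm : m ≤ -1) : 0 < y ∧ c.Bd (k + 3) m (Real.log u - Real.log y) := by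
  have hL := c.L_pos
  have h1 : |u - y| ≤ 1 / c.L ^ 3 := h.le_pow hm (by omega)
  have h2 : 1 / c.L ^ 3 ≤ (1 / c.L ^ 2) / 2 := by
    rw [div_div, div_le_div_iff₀ (by positivity) (by positivity)]
    have := c.hL; have := pow_pos hL 2; nlinarith
  have hu0 : 0 < u := lt_of_lt_of_le (by positivity) hu
  have h3 := abs_le.1 h1
  have hy : u / 2 ≤ y := by linarith [h3.2]
  have hy0 : 0 < y := by linarith
  refine ⟨hy0, ?_⟩
  have h4 : |Real.log u - Real.log y| ≤ |u - y| / (u / 2) := by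
    have e1 := Real.log_le_sub_one_of_pos (div_pos hu0 hy0)
    have e2 := Real.log_le_sub_one_of_pos (div_pos hy0 hu0)
    rw [Real.log_div hu0.ne' hy0.ne'] at e1
    rw [Real.log_div hy0.ne' hu0.ne'] at e2
    have e1' : Real.log u - Real.log y ≤ |u - y| / (u / 2) :=
      e1.trans (by
        rw [show u / y - 1 = (u - y) / y by field_simp]
        exact (div_le_div_of_nonneg_right (le_abs_self _) hy0.le).trans
          (div_le_div_of_nonneg_left (abs_nonneg _) (by positivity) hy))
    have e2' : -(Real.log u - Real.log y) ≤ |u - y| / (u / 2) := by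
      rw [neg_sub]
      refine e2.trans ?_
      rw [show y / u - 1 = (y - u) / u by field_simp, abs_sub_comm]
      exact (div_le_div_of_nonneg_right (le_abs_self _) hu0.le).trans
        (div_le_div_of_nonneg_left (abs_nonneg _) (by positivity) (by linarith))
    exact abs_le'.2 ⟨e1', e2'⟩
  have h5 : |u - y| / (u / 2) ≤ c.L ^ 3 * |u - y| := by
    rw [div_eq_inv_mul]
    refine mul_le_mul_of_nonneg_right ?_ (abs_nonneg _)
    rw [inv_le_comm₀ (by positivity) (by positivity), ← one_div]
    linarith
  refine (h4.trans h5).trans ?_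
  rw [pow_add, mul_comm (c.L ^ k), mul_assoc]
  exact mul_le_mul_of_nonneg_left h (by positivity)

lemma Bd.exp_sub {k : ℕ} {m : ℤ} {z : ℝ} (h : c.Bd k m z) (hk : k ≤ 400) (hm : m ≤ -1) :
    c.Bd (k + k) (m + m) (Real.exp z - 1 - z) := by
  have h1 : |z| ≤ 1 := (h.le_pow (j := 0) hm (by omega)).trans (by simp)
  refine (h.mul h).of_abs_le ?_
  refine (Real.abs_exp_sub_one_sub_id_le h1).trans ?_
  rw [abs_mul, ← sq, sq_abs]

end Ctx

lemma log_choose_sub {N d : ℕ} (h : d < N) :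
    Real.log ((N - 1).choose d) - Real.log (N.choose d) = Real.log (((N : ℝ) - d) / N) := by
  obtain ⟨m, rfl⟩ : ∃ m, N = m + 1 := ⟨N - 1, by omega⟩
  have h1 := Nat.choose_mul_succ_eq m d
  have h2 : (m.choose d : ℝ) * (m + 1) = (m + 1).choose d * ((m + 1 : ℕ) - d) := by
    rw [← Nat.cast_sub h.le]; exact_mod_cast h1
  have h3 : (0 : ℝ) < m.choose d := by exact_mod_cast Nat.choose_pos (by omega)
  have h4 : (0 : ℝ) < (m + 1).choose d := by exact_mod_cast Nat.choose_pos (by omega)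
  rw [Nat.add_sub_cancel, ← Real.log_div h3.ne' h4.ne']
  congr 1
  push_cast at h2 ⊢
  field_simp
  linarith

namespace Inst

variable {n : ℕ} (I : Inst n)

/-- The number of forbidden edges, as a real number. -/
def ne : ℝ := (∑ v, I.x v) / 2

/-- The sum over forbidden edges of products of degree excesses. -/
def dd (c : Ctx n) : ℝ := (∑ v, I.dl c v * I.nb (I.dl c) v) / 2

variable {I}

lemma dl_del (c : Ctx n) {a v : Fin n} (hav : a ≠ v) (h : ¬ I.X.Adj a v) (w : Fin n) :
    (I.del a v).dl c w = I.dl c w + c.p * (if w = a ∨ w = v then 1 else 0) := by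
  rw [dl, dl, x_del I hav h, del]; ring

lemma ne_del {a v : Fin n} (hav : a ≠ v) (h : ¬ I.X.Adj a v) : (I.del a v).ne = I.ne + 1 := by
  rw [ne, ne, sum_congr rfl fun w _ => x_del I hav h w, sum_add_distrib, Good.sum_pair_ind hav]
  ring

lemma sum_ind_mul {a v : Fin n} (hav : a ≠ v) (f : Fin n → ℝ) :
    ∑ w, (if w = a ∨ w = v then (1 : ℝ) else 0) * f w = f a + f v := by
  have : (univ.filter fun w => w = a ∨ w = v) = {a, v} := by ext; simp
  simp_rw [ite_mul, one_mul, zero_mul]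
  rw [← sum_filter, this, sum_pair hav]

lemma nb_ind {a v : Fin n} (hav : a ≠ v) (w : Fin n) :
    I.nb (fun w => if w = a ∨ w = v then (1 : ℝ) else 0) w = ad I.X w a + ad I.X w v := by
  rw [nb, ← sum_ind_mul hav (ad I.X w)]
  exact sum_congr rfl fun _ _ => mul_comm _ _

lemma nb_add_mul (r s : Fin n → ℝ) (t : ℝ) (w : Fin n) :
    I.nb (fun w => r w + t * s w) w = I.nb r w + t * I.nb s w := by
  simp only [nb, mul_sum, ← sum_add_distrib]
  exact sum_congr rfl fun _ _ => by ring

lemma nb_del {a v : Fin n} (hav : a ≠ v) (h : ¬ I.X.Adj a v) (r : Fin n → ℝ) (w : Fin n) :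
    (I.del a v).nb r w = I.nb r w + ((if w = a then r v else 0) + if w = v then r a else 0) := by
  simp only [nb, del]
  simp_rw [ad_sup_edge hav h, add_mul, sum_add_distrib]
  congr 1
  by_cases hwa : w = a
  · subst hwa; simp [hav]
  · by_cases hwv : w = v
    · subst hwv; simp [hwa]
    · simp [hwa, hwv]

lemma dd_del (c : Ctx n) {a v : Fin n} (hav : a ≠ v) (h : ¬ I.X.Adj a v) :
    (I.del a v).dd c = I.dd c + c.p * (I.nb (I.dl c) a + I.nb (I.dl c) v) +
      (I.dl c a + c.p) * (I.dl c v + c.p) := by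
  set i : Fin n → ℝ := fun w => if w = a ∨ w = v then (1 : ℝ) else 0 with hi
  have h1 : (I.del a v).dl c = fun w => I.dl c w + c.p * i w := funext fun w => dl_del c hav h w
  have h2 : ∀ w, (I.del a v).nb ((I.del a v).dl c) w = I.nb (I.dl c) w +
      c.p * (ad I.X w a + ad I.X w v) +
      ((if w = a then I.dl c v + c.p else 0) + if w = v then I.dl c a + c.p else 0) := by
    intro w
    rw [nb_del hav h, h1, nb_add_mul, hi, nb_ind hav]
    simp
  have h3 : ∑ w, I.dl c w * (ad I.X w a + ad I.X w v) = I.nb (I.dl c) a + I.nb (I.dl c) v := by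
    simp only [nb, ← sum_add_distrib]
    exact sum_congr rfl fun w _ => by rw [ad_comm I.X w a, ad_comm I.X w v]; ring
  have h4 := sum_ind_mul hav (I.nb (I.dl c))
  have h5 := sum_ind_mul hav (fun w => ad I.X w a + ad I.X w v)
  have h6 : ad I.X a v = 0 := ad_zero h
  have h7 : ad I.X v a = 0 := by rw [ad_comm, h6]
  rw [ad_self, ad_self, h6, h7] at h5
  have h8 : ∑ w, (I.dl c w + c.p * i w) *
      ((if w = a then I.dl c v + c.p else 0) + if w = v then I.dl c a + c.p else 0) =
      2 * ((I.dl c a + c.p) * (I.dl c v + c.p)) := by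
    simp_rw [mul_add (I.dl c _ + _), sum_add_distrib, mul_ite, mul_zero, sum_ite_eq', mem_univ,
        if_true]
    simp [hi]; ring
  rw [dd, dd]
  have h9 : ∑ w, (I.del a v).dl c w * (I.del a v).nb ((I.del a v).dl c) w =
      ∑ w, I.dl c w * I.nb (I.dl c) w + c.p * (∑ w, I.dl c w * (ad I.X w a + ad I.X w v)) +
      c.p * (∑ w, i w * I.nb (I.dl c) w) + c.p ^ 2 * (∑ w, i w * (ad I.X w a + ad I.X w v)) +
      ∑ w, (I.dl c w + c.p * i w) *
      ((if w = a then I.dl c v + c.p else 0) + if w = v then I.dl c a + c.p else 0) := by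
    simp only [mul_sum, ← sum_add_distrib]
    refine sum_congr rfl fun w _ => ?_
    rw [h2, h1]; ring
  rw [h9, h3, h4, h5, h8]; ring

end Inst

namespace Inst

variable {n : ℕ} {I : Inst n}

lemma x_eq_xDeg (I : Inst n) (v : Fin n) : I.x v = xDeg I.X v := by
  unfold x xDeg ad
  rw [← sum_filter, sum_const, nsmul_eq_mul, mul_one, Nat.card_eq_fintype_card]
  congr 1
  rw [Fintype.card_subtype]
  rfl

lemma xDeg_lt (I : Inst n) (v : Fin n) : xDeg I.X v < n := by
  have h := card_Vn (I := I) v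
  rw [x_eq_xDeg] at h
  have h1 : (0 : ℝ) ≤ #(I.Vn v) := Nat.cast_nonneg _
  have : (xDeg I.X v : ℝ) < n := by linarith
  exact_mod_cast this

/-- Logarithm of the conjectured count, up to factors that do not depend on the forbidden graph. -/
def lw (c : Ctx n) (I : Inst n) : ℝ :=
  -I.ne * Real.log (1 - c.p) + ∑ v, Real.log ((n - 1 - xDeg I.X v).choose (I.d v)) +
    c.p * I.ne ^ 2 / ((1 - c.p) * n ^ 2) - I.dd c / (c.p * (1 - c.p) * n ^ 2)

end Inst

namespace Good

open Ctx

variable {n : ℕ} {c : Ctx n} {s : ℕ} {I : Inst n}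

lemma bd_dl_div (h : Good c s I) (hs : s ≤ 40) (v : Fin n) :
    c.Bd 4 (-1) (I.dl c v / (n - 1 - I.x v)) := by
  rw [div_eq_mul_inv, ← I.card_Vn v]
  have := h.bd_inv_card_Vn hs v
  rw [← I.card_Vn v] at this
  exact (h.bd_dl hs v).mul' this

lemma card_Vn_pos (h : Good c s I) (hs : s ≤ 40) (v : Fin n) : 0 < (n : ℝ) - 1 - I.x v := by
  have h1 := h.xdeg v
  have h2 := s_le c hs
  have h3 : c.L * c.σ + s ≤ c.L ^ 2 * c.σ := L_σ_add c h2
  have h4 : c.L ^ 3 * c.σ ≤ n := L_mul_σ_le c (by norm_num)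
  have h5 : 1 ≤ c.L ^ 2 * c.σ := by
    have := one_le_pow₀ (n := 2) c.one_le_L; have := c.one_le_σ; nlinarith
  have h6 := c.hL
  nlinarith

lemma ratio_eq (h : Good c s I) (hs : s ≤ 40) (v : Fin n) :
    ((n : ℝ) - 1 - I.x v - I.d v) / (n - 1 - I.x v) = 1 - c.p - I.dl c v / (n - 1 - I.x v) := by
  have := (h.card_Vn_pos hs v).ne'
  rw [Inst.dl]; field_simp; ring

lemma ratio_pos (h : Good c s I) (hs : s ≤ 40) (v : Fin n) :
    0 < ((n : ℝ) - 1 - I.x v - I.d v) / (n - 1 - I.x v) := by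
  rw [h.ratio_eq hs]
  have h1 := abs_le.1 ((h.bd_dl_div hs v).le_pow (j := 2) le_rfl (by norm_num))
  have h3 := c.one_sub_p_ge
  have h4 : 1 / c.L ^ 2 < 1 / c.L := by
    have := c.hL
    exact one_div_lt_one_div_of_lt c.L_pos (by nlinarith)
  linarith [h1.2]

lemma log_choose_del (h : Good c s I) (hs : s ≤ 40) {a v : Fin n} (hav : a ≠ v)
    (hX : ¬ I.X.Adj a v) (w : Fin n) :
    Real.log ((n - 1 - xDeg (I.del a v).X w).choose ((I.del a v).d w)) =
      Real.log ((n - 1 - xDeg I.X w).choose (I.d w)) + (if w = a ∨ w = v then (1 : ℝ) else 0) *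
        Real.log (((n : ℝ) - 1 - I.x w - I.d w) / (n - 1 - I.x w)) := by
  have h1 := I.x_del hav hX w
  rw [Inst.x_eq_xDeg, Inst.x_eq_xDeg] at h1
  have hd : (I.del a v).d = I.d := rfl
  rw [hd]
  split_ifs at h1 ⊢ with hw
  · have h2 : xDeg (I.del a v).X w = xDeg I.X w + 1 := by exact_mod_cast h1
    have h3 := I.xDeg_lt w
    have h4 : ((n - 1 - xDeg I.X w : ℕ) : ℝ) = n - 1 - I.x w := by
      rw [Inst.x_eq_xDeg, Nat.cast_sub (by omega), Nat.cast_sub (by omega)]; simp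
    have h5 : I.d w < n - 1 - xDeg I.X w := by
      have := h.ratio_pos hs w
      rw [div_pos_iff_of_pos_right (h.card_Vn_pos hs w), ← h4, sub_pos] at this
      exact_mod_cast this
    have h6 := log_choose_sub h5
    rw [h4] at h6
    rw [h2, one_mul, ← h6, Nat.sub_sub _ _ 1 |>.symm]
    ring
  · have h2 : xDeg (I.del a v).X w = xDeg I.X w := by
      rw [add_zero] at h1; exact_mod_cast h1
    rw [h2, zero_mul, add_zero]

lemma lw_del (h : Good c s I) (hs : s ≤ 40) {a v : Fin n} (hav : a ≠ v) (hX : ¬ I.X.Adj a v) :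
    (I.del a v).lw c - I.lw c = -Real.log (1 - c.p) +
      Real.log (((n : ℝ) - 1 - I.x a - I.d a) / (n - 1 - I.x a)) +
      Real.log (((n : ℝ) - 1 - I.x v - I.d v) / (n - 1 - I.x v)) +
      (c.p * (∑ v, I.x v) / ((1 - c.p) * n ^ 2) -
          (I.nb (I.q c) a + I.nb (I.q c) v) / ((1 - c.p) * n)
        - I.q c a * I.q c v / (c.p * (1 - c.p)) - (I.q c a + I.q c v) / ((1 - c.p) * n)) := by
  unfold Inst.lw
  rw [sum_congr rfl fun w _ => h.log_choose_del hs hav hX w, sum_add_distrib,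
    Inst.sum_ind_mul hav, Inst.ne_del hav hX, Inst.dd_del c hav hX]
  have h1 : ∀ w, I.nb (I.q c) w = I.nb (I.dl c) w / n := fun w => by
    simp only [Inst.nb, Inst.q, sum_div, mul_div_assoc]
  have h2 : ∑ v, I.x v = 2 * I.ne := by rw [Inst.ne]; ring
  have := c.hp0.ne'
  have : 1 - c.p ≠ 0 := by linarith [c.hp1]
  have := c.n_pos.ne'
  rw [h1, h1, h2, Inst.q, Inst.q]
  field_simp
  ring

end Good

lemma Ctx.Bd.of_eq {n : ℕ} {c : Ctx n} {k₁ k : ℕ} {m₁ m : ℤ} {x y : ℝ} (h : c.Bd k₁ m₁ x)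
    (e : x = y)
    (hk : k₁ ≤ k := by norm_num) (hm : m₁ ≤ m := by norm_num) : c.Bd k m y :=
  e ▸ h.mono hk hm

namespace Good

open Ctx

variable {n : ℕ} {c : Ctx n} {s : ℕ} {I : Inst n}

lemma bd_dl_div_sub (h : Good c s I) (hs : s ≤ 40) (v : Fin n) :
    c.Bd 10 (-3) (I.dl c v / (n - 1 - I.x v) - (I.q c v + I.q c v * I.x v / n)) := by
  have hN := h.card_Vn_pos hs v
  have h0 := c.n_pos
  have h1 := h.bd_inv_card_Vn hs v
  have h2 : c.Bd 4 (-3) (I.q c v * ((n : ℝ) - 1 - I.x v)⁻¹) := (h.bd_q hs v).mul' h1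
  have h3 : c.Bd 3 1 (1 + I.x v) := (Bd.const (x := 1) (by norm_num)).add' (h.bd_x hs v)
  have h4 : c.Bd 5 2 (I.x v * (1 + I.x v)) := (h.bd_x hs v).mul' h3
  have h5 : c.Bd 9 (-1) (I.q c v * ((n : ℝ) - 1 - I.x v)⁻¹ * (I.x v * (1 + I.x v))) := h2.mul' h4
  have h6 : c.Bd 9 (-3) (I.q c v * ((n : ℝ) - 1 - I.x v)⁻¹ * (I.x v * (1 + I.x v)) / n) := h5.div_n
  have h7 : c.Bd 10 (-3) (I.q c v * ((n : ℝ) - 1 - I.x v)⁻¹ +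
    I.q c v * ((n : ℝ) - 1 - I.x v)⁻¹ * (I.x v * (1 + I.x v)) / n) := h2.add' h6
  convert h7 using 1
  rw [Inst.q]
  field_simp
  ring

lemma bd_log_step (h : Good c s I) (hs : s ≤ 30) (hI : I.gs.Nonempty) {a v : Fin n} (hav : a ≠ v)
    (hX : ¬ I.X.Adj a v) :
    c.Bd 150 (-3) (Real.log (1 - I.Pr a v) - ((I.del a v).lw c - I.lw c)) := by
  have hs' : s ≤ 40 := by omega
  have hn0 := c.n_pos.ne'
  have hp0 := c.hp0.ne'
  have hp1 : 0 < 1 - c.p := by linarith [c.hp1]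
  have hfa := h.ratio_pos hs' a
  have hfv := h.ratio_pos hs' v
  set z := c.p * (∑ v, I.x v) / ((1 - c.p) * n ^ 2) -
    (I.nb (I.q c) a + I.nb (I.q c) v) / ((1 - c.p) * n)
        - I.q c a * I.q c v / (c.p * (1 - c.p)) - (I.q c a + I.q c v) / ((1 - c.p) * n) with hz
  set y := (1 - c.p)⁻¹ * (((n : ℝ) - 1 - I.x a - I.d a) / (n - 1 - I.x a)) *
    (((n : ℝ) - 1 - I.x v - I.d v) / (n - 1 - I.x v)) * Real.exp z with hy
  have hlog : Real.log y = (I.del a v).lw c - I.lw c := by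
    rw [h.lw_del hs' hav hX, hy, Real.log_mul (by positivity) (Real.exp_pos _).ne', Real.log_exp,
      Real.log_mul (by positivity) hfv.ne', Real.log_mul (by positivity) hfa.ne', Real.log_inv]
  rw [← hlog]
  have hu : 1 / c.L ^ 2 ≤ 1 - I.Pr a v := by
    have h1 := abs_le.1 ((h.bd_Pr hs' hI hav hX).le_pow (j := 2) le_rfl (by norm_num))
    have h3 := c.one_sub_p_ge
    have h4 : 1 / c.L ^ 2 + 1 / c.L ^ 2 ≤ 1 / c.L := by
      have := c.hL; have := c.L_pos
      rw [← add_div, div_le_div_iff₀ (by positivity) (by positivity)]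
      nlinarith
    linarith [h1.2]
  refine Bd.mono' (k₁ := 147 + 3) (m₁ := -3)
      (Bd.log_sub (k := 147) (m := -3) ?_ hu (by norm_num) (by norm_num)).2
  have hqa := h.bd_q hs' a
  have hqv := h.bd_q hs' v
  have hna := h.bd_nb hs' a
  have hnv := h.bd_nb hs' v
  have hga := h.bd_dl_div hs' a
  have hgv := h.bd_dl_div hs' v
  have hra := h.bd_dl_div_sub hs' a
  have hrv := h.bd_dl_div_sub hs' v
  rw [h.ratio_eq hs', h.ratio_eq hs'] at hy
  set ga := I.dl c a / (n - 1 - I.x a)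
  set gv := I.dl c v / (n - 1 - I.x v)
  have hi := c.bd_inv_one_sub_p
  have z1 : c.Bd 3 (-2) (c.p * (∑ v, I.x v) / ((1 - c.p) * n ^ 2)) := by
    have e1 : c.Bd 2 2 (c.p * (∑ v, I.x v)) := c.bd_p.mul' (h.bd_sumx hs')
    have e2 : c.Bd 3 2 (c.p * (∑ v, I.x v) * (1 - c.p)⁻¹) := e1.mul' hi
    have e3 : c.Bd 3 (2 - 2 - 2) (c.p * (∑ v, I.x v) * (1 - c.p)⁻¹ / n / n) := e2.div_n.div_n
    exact e3.of_eq (by field_simp)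
  have z2 : c.Bd 7 (-2) ((I.nb (I.q c) a + I.nb (I.q c) v) / ((1 - c.p) * n)) := by
    have e1 : c.Bd 6 0 (I.nb (I.q c) a + I.nb (I.q c) v) := hna.add' hnv
    have e2 : c.Bd 7 0 ((I.nb (I.q c) a + I.nb (I.q c) v) * (1 - c.p)⁻¹) := e1.mul' hi
    have e3 : c.Bd 7 (0 - 2) ((I.nb (I.q c) a + I.nb (I.q c) v) * (1 - c.p)⁻¹ / n) := e2.div_n
    exact e3.of_eq (by field_simp)
  have z3 : c.Bd 7 (-2) (I.q c a * I.q c v / (c.p * (1 - c.p))) := by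
    rw [div_eq_mul_inv]
    exact (hqa.mul hqv).mul' c.bd_inv_var
  have z4 : c.Bd 5 (-3) ((I.q c a + I.q c v) / ((1 - c.p) * n)) := by
    have e1 : c.Bd 4 (-1) (I.q c a + I.q c v) := hqa.add' hqv
    have e2 : c.Bd 5 (-1) ((I.q c a + I.q c v) * (1 - c.p)⁻¹) := e1.mul' hi
    have e3 : c.Bd 5 (-1 - 2) ((I.q c a + I.q c v) * (1 - c.p)⁻¹ / n) := e2.div_n
    exact e3.of_eq (by field_simp)
  have hzB : c.Bd 10 (-2) z := by
    have e1 : c.Bd 8 (-2) _ := z1.sub' z2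
    have e2 : c.Bd 9 (-2) _ := e1.sub' z3
    exact e2.sub' z4
  have hze := hzB.exp_sub (by norm_num) (by norm_num)
  have hP := h.bd_Pr_P3 hs hI hav hX
  have w1 : c.Bd 7 (-2) (ga - I.q c a) := by
    have e1 : c.Bd 5 0 (I.q c a * I.x a) := hqa.mul' (h.bd_x hs' a)
    have e2 : c.Bd 5 (-2) (I.q c a * I.x a / n) := e1.div_n
    have e3 : c.Bd 6 (-2) _ := (hra.up (k' := 5) (m' := -2) (by norm_num) (by norm_num)).add' e2
    exact e3.of_eq (by ring)
  have w2 : c.Bd 7 (-2) (gv - I.q c v) := by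
    have e1 : c.Bd 5 0 (I.q c v * I.x v) := hqv.mul' (h.bd_x hs' v)
    have e2 : c.Bd 5 (-2) (I.q c v * I.x v / n) := e1.div_n
    have e3 : c.Bd 6 (-2) _ := (hrv.up (k' := 5) (m' := -2) (by norm_num) (by norm_num)).add' e2
    exact e3.of_eq (by ring)
  have w3 : c.Bd 13 (-3) (((ga - I.q c a) * gv + I.q c a * (gv - I.q c v)) * (1 - c.p)⁻¹) := by
    have e1 : c.Bd 12 (-3) ((ga - I.q c a) * gv + I.q c a * (gv - I.q c v)) :=
      (w1.mul hgv).add' (hqa.mul w2)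
    exact e1.mul' hi
  have w4 : c.Bd 10 (-1) (-ga - gv + ga * gv * (1 - c.p)⁻¹) := by
    have e1 : c.Bd 5 (-1) (-ga - gv) := hga.neg.sub' hgv
    have e2 : c.Bd 9 (-2) (ga * gv * (1 - c.p)⁻¹) := (hga.mul hgv).mul' hi
    exact e1.add' e2
  have w5 : c.Bd 11 0 ((1 - c.p) + (-ga - gv + ga * gv * (1 - c.p)⁻¹)) :=
    c.bd_one_sub_p.add' w4
  have w6 : c.Bd 20 (-3) ((-ga - gv + ga * gv * (1 - c.p)⁻¹) * z) := w4.mul' hzB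
  have w7 : c.Bd 31 (-3) (((1 - c.p) + (-ga - gv + ga * gv * (1 - c.p)⁻¹)) *
      (Real.exp z - 1 - z)) := w5.mul' hze
  have w8 : c.Bd 5 (-3) ((1 - c.p) * ((I.q c a + I.q c v) / ((1 - c.p) * n))) :=
    c.bd_one_sub_p.mul' z4
  have key : 1 - I.Pr a v - y = -(I.Pr a v - I.P3 c a v) +
      (ga - (I.q c a + I.q c a * I.x a / n)) + (gv - (I.q c v + I.q c v * I.x v / n)) -
      ((ga - I.q c a) * gv + I.q c a * (gv - I.q c v)) * (1 - c.p)⁻¹ -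
      (-ga - gv + ga * gv * (1 - c.p)⁻¹) * z -
      ((1 - c.p) + (-ga - gv + ga * gv * (1 - c.p)⁻¹)) * (Real.exp z - 1 - z) +
      (1 - c.p) * ((I.q c a + I.q c v) / ((1 - c.p) * n)) := by
    have e0 : y = ((1 - c.p) + (-ga - gv + ga * gv * (1 - c.p)⁻¹)) * Real.exp z := by
      rw [hy]; field_simp; ring
    have e1 : (1 - c.p) * z = c.p * (∑ v, I.x v) / n ^ 2 -
        (I.nb (I.q c) a + I.nb (I.q c) v) / n - I.q c a * I.q c v / c.p -
        (1 - c.p) * ((I.q c a + I.q c v) / ((1 - c.p) * n)) := by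
      rw [hz]; field_simp
    have e2 : c.κ * I.q c a * I.q c v = I.q c a * I.q c v / c.p - I.q c a * I.q c v *
        (1 - c.p)⁻¹ := by
      rw [Ctx.κ]; field_simp; ring
    rw [e0, Inst.P3, e2]
    linear_combination (-1) * e1
  rw [key]
  have f1 : c.Bd 136 (-3) _ := hP.neg.add' hra
  have f2 : c.Bd 137 (-3) _ := f1.add' hrv
  have f3 : c.Bd 138 (-3) _ := f2.sub' w3
  have f4 : c.Bd 139 (-3) _ := f3.sub' w6
  have f5 : c.Bd 140 (-3) _ := f4.sub' w7
  have f6 : c.Bd 141 (-3) _ := f5.add' w8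
  exact f6.mono'

end Good

namespace Good

open Ctx

variable {n : ℕ} {c : Ctx n} {s : ℕ} {d : Fin n → ℕ}

lemma of_del {I : Inst n} {a v : Fin n} (hav : a ≠ v) (hX : ¬ I.X.Adj a v)
    (h : Good c s (I.del a v)) : Good c s I := by
  have hx : ∀ w, I.x w ≤ (I.del a v).x w := fun w => by
    rw [I.x_del hav hX]; split_ifs <;> linarith
  exact ⟨h.deg, fun w => (hx w).trans (h.xdeg w), h.sumd,
    (sum_le_sum fun w _ => hx w).trans h.sumx⟩

lemma abs_log_sub_lw_le (hd : (⟨d, ⊥⟩ : Inst n).gs.Nonempty) (X : SimpleGraph (Fin n))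
    (h : Good c 0 ⟨d, X⟩) : (⟨d, X⟩ : Inst n).gs.Nonempty ∧
      |Real.log #(⟨d, X⟩ : Inst n).gs - Real.log #(⟨d, ⊥⟩ : Inst n).gs -
        (Inst.lw c ⟨d, X⟩ - Inst.lw c ⟨d, ⊥⟩)| ≤ (⟨d, X⟩ : Inst n).ne *
            (c.L ^ 150 * c.σ ^ (-3 : ℤ)) := by
  induction X using WellFoundedLT.induction with
  | ind X ih =>
    by_cases hX : X = ⊥
    · subst hX
      refine ⟨hd, ?_⟩
      simp [Inst.ne, Inst.x, ad]
    · obtain ⟨a, v, hav⟩ : ∃ a v, X.Adj a v := by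
        by_contra! hc
        exact hX (by ext a v; simp [hc a v])
      set Y := X \ SimpleGraph.edge a v with hY
      have hYX : Y ⊔ SimpleGraph.edge a v = X := by
        rw [hY, sdiff_sup_cancel]
        exact (SimpleGraph.edge_le_iff _).2 (Or.inr hav)
      have hYa : ¬ Y.Adj a v := by
        rw [hY, SimpleGraph.sdiff_adj, SimpleGraph.edge_adj]
        have := hav.ne; tauto
      have hlt : Y < X := lt_of_le_of_ne sdiff_le fun e => hYa (e ▸ hav)
      have hdel : (⟨d, X⟩ : Inst n) = Inst.del ⟨d, Y⟩ a v := by rw [Inst.del, hYX]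
      rw [hdel] at h ⊢
      have hG := h.of_del hav.ne hYa
      obtain ⟨hne, hb⟩ := ih Y hlt hG
      have hP := (hG.Pr_pos_lt (by norm_num) hne hav.ne hYa).2
      refine ⟨hG.del_nonempty (by norm_num) hne hav.ne hYa, ?_⟩
      have hs := hG.bd_log_step (by norm_num) hne hav.ne hYa
      have hc : (0 : ℝ) < #(⟨d, Y⟩ : Inst n).gs := by exact_mod_cast card_pos.2 hne
      rw [Inst.card_gs_del _ hav.ne, Real.log_mul (by linarith) hc.ne', Inst.ne_del hav.ne hYa,
        add_mul, one_mul]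
      refine le_trans (le_of_eq ?_) ((abs_add_le _ _).trans (add_le_add hb hs))
      congr 1; ring

lemma bd_log_sub_lw (hd : (⟨d, ⊥⟩ : Inst n).gs.Nonempty) {X : SimpleGraph (Fin n)}
    (h : Good c 0 ⟨d, X⟩) : (⟨d, X⟩ : Inst n).gs.Nonempty ∧
      c.Bd 152 (-1) (Real.log #(⟨d, X⟩ : Inst n).gs - Real.log #(⟨d, ⊥⟩ : Inst n).gs -
        (Inst.lw c ⟨d, X⟩ - Inst.lw c ⟨d, ⊥⟩)) := by
  obtain ⟨h1, h2⟩ := abs_log_sub_lw_le hd X h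
  refine ⟨h1, ?_⟩
  have e1 : c.Bd 2 2 (Inst.ne ⟨d, X⟩) := by
    refine (h.bd_sumx (by norm_num)).of_abs_le ?_
    have := sum_nonneg fun v (_ : v ∈ univ) => Inst.x_nonneg ⟨d, X⟩ v
    rw [Inst.ne, abs_of_nonneg (by linarith), abs_of_nonneg this]; linarith
  have e2 : c.Bd 152 (-1) _ := e1.mul' (bd_pow c 150 (-3))
  exact e2.of_abs_le (h2.trans (le_abs_self _))

end Good

namespace Inst

variable {n : ℕ} {I : Inst n}

lemma q_add_eq (c : Ctx n) {u w : Fin n} (huw : u ≠ w) (hX : ¬ I.X.Adj u w)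
    (hd : ∀ v, 1 ≤ I.d v) (v : Fin n) :
    (I.add u w).q c v = I.q c v - (1 - c.p) / n * (if v = u ∨ v = w then 1 else 0) := by
  have h1 : (((I.add u w).d v : ℕ) : ℝ) = I.d v - (if v = u ∨ v = w then 1 else 0) := by
    unfold add; dsimp only; split_ifs
    · rw [Nat.cast_sub (hd v)]; norm_num
    · simp
  rw [q, q, dl, dl, x_add I huw hX, h1]
  split_ifs <;> ring

/-- Expectation of a function weighted by the number of common neighbours. -/
lemma E_cod_mul {a b : Fin n} (hab : a ≠ b) (hd : ∀ v, 2 ≤ I.d v)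
    (f : SimpleGraph (Fin n) → ℝ) :
    I.E (fun H => cod H a b * f H) = ∑ u ∈ I.S a b, I.Pr a u * ((I.add a u).Pr b u *
      ((I.add a u).add b u).E fun H => f (H ⊔ SimpleGraph.edge b u ⊔ SimpleGraph.edge a u)) := by
  have h0 : I.E (fun H => cod H a b * f H) =
      I.E fun H => ∑ u ∈ I.S a b, ad H a u * (ad H b u * f H) := by
    refine E_congr fun H hH => ?_
    rw [cod, sum_mul]
    refine (sum_subset (subset_univ _) fun u _ hu => ?_).symm.trans
      (sum_congr rfl fun u _ => mul_assoc _ _ _)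
    rw [mem_S] at hu
    by_cases h1 : u = a
    · rw [h1, ad_self]; ring
    by_cases h2 : u = b
    · rw [h2, ad_self]; ring
    by_cases h3 : I.X.Adj a u
    · rw [ad_zero ((mem_gs.1 hH).2 _ _ h3)]; ring
    by_cases h4 : I.X.Adj b u
    · rw [ad_zero ((mem_gs.1 hH).2 _ _ h4)]; ring
    exact absurd ⟨h1, h2, h3, h4⟩ hu
  rw [h0, E_sum]
  refine sum_congr rfl fun u hu => ?_
  obtain ⟨h1, h2, h3, h4⟩ := mem_S.1 hu
  rw [E_ad_mul I (Ne.symm h1) h3 (by linarith [hd a]) (by linarith [hd u])]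
  congr 1
  have hX : ¬ (I.add a u).X.Adj b u := by
    simp only [add, SimpleGraph.sup_adj, SimpleGraph.edge_adj, not_or]
    exact ⟨h4, by tauto⟩
  have hd' : ∀ v, 1 ≤ (I.add a u).d v := fun v => by
    unfold add; dsimp only; have := hd v; split_ifs <;> omega
  rw [← E_ad_mul (I.add a u) (Ne.symm h2) hX (hd' _) (hd' _)
    fun H => f (H ⊔ SimpleGraph.edge a u)]
  refine E_congr fun H hH => ?_
  have h5 : ¬ H.Adj a u := (mem_gs.1 hH).2 _ _ (by simp [add, SimpleGraph.edge_adj, Ne.symm h1])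
  rw [ad_sup_edge (Ne.symm h1) h5, if_neg (by tauto), add_zero]

end Inst

namespace Good

open Ctx

variable {n : ℕ} {c : Ctx n} {s : ℕ} {I : Inst n}

lemma bd_x_few (hf : ∑ v, I.x v ≤ 10) (a : Fin n) : c.Bd 1 0 (I.x a) := by
  refine .const ?_
  rw [abs_of_nonneg (I.x_nonneg a)]
  linarith [single_le_sum (fun v _ => I.x_nonneg v) (mem_univ a)]

lemma bd_Pr_few (h : Good c s I) (hs : s ≤ 30) (hI : I.gs.Nonempty) (hf : ∑ v, I.x v ≤ 10)
    {a v : Fin n} (hav : a ≠ v) (hX : ¬ I.X.Adj a v) :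
    c.Bd 137 (-3) (I.Pr a v - (c.p + I.q c a + I.q c v + c.κ * I.q c a * I.q c v)) := by
  have hs' : s ≤ 40 := by omega
  have h1 := h.bd_Pr_P3 hs hI hav hX
  have hx := fun w => bd_x_few (c := c) hf w
  have hq := h.bd_q hs'
  have hnb : ∀ w, c.Bd 4 (-1) (I.nb (I.q c) w) := fun w =>
    Bd.sum_weight (k := 3) (m := -1) (k' := 1) (m' := 0) (fun i _ => ad_nonneg _ _ _)
      (fun i _ => hq i) (hx w)
  have h2 : c.Bd 4 (-1) (I.q c a * I.x a) := (hq a).mul' (hx a)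
  have h3 : c.Bd 4 (-1) (I.q c v * I.x v) := (hq v).mul' (hx v)
  have h4 : c.Bd 5 (-3) ((I.q c a * I.x a + I.q c v * I.x v) / n) :=
    (h2.add' h3 (k := 5) (m := -1)).div_n.mono'
  have h5 : c.Bd 5 (-3) ((I.nb (I.q c) a + I.nb (I.q c) v) / n) :=
    ((hnb a).add' (hnb v) (k := 5) (m := -1)).div_n.mono'
  have h6 : c.Bd 1 0 (∑ w, I.x w) := .const (by
    rw [abs_of_nonneg (sum_nonneg fun w _ => I.x_nonneg w)]; linarith)
  have h7 : c.Bd 1 (-4) (c.p * (∑ w, I.x w) / n / n) :=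
    ((c.bd_p.mul' h6 (k := 1) (m := 0)).div_n).div_n.mono'
  have h8 : c.Bd 6 (-3) ((I.q c a * I.x a + I.q c v * I.x v) / n +
    (I.nb (I.q c) a + I.nb (I.q c) v) / n) := h4.add' h5
  have h9 : c.Bd 7 (-3) ((I.q c a * I.x a + I.q c v * I.x v) / n +
    (I.nb (I.q c) a + I.nb (I.q c) v) / n - c.p * (∑ w, I.x w) / n / n) := h8.sub' h7
  refine (h1.add' h9 (k := 137) (m := -3)).of_eq ?_
  rw [Inst.P3]
  ring

lemma bd_sum_q_few (h : Good c s I) (hs : s ≤ 40) (hf : ∑ v, I.x v ≤ 10) :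
    c.Bd 3 (-2) (∑ v, I.q c v) := by
  rw [sum_q]
  have h6 : c.Bd 1 0 (∑ w, I.x w) := .const (by
    rw [abs_of_nonneg (sum_nonneg fun w _ => I.x_nonneg w)]; linarith)
  exact ((h.bd_sumd hs).div_n.mono' (k := 2) (m := -2)).add'
    ((c.bd_p.mul' h6 (k := 1) (m := 0)).div_n.mono' (k := 1) (m := -2))

lemma bd_sum_S_few (hf : ∑ v, I.x v ≤ 10) (a b : Fin n) {f : Fin n → ℝ} {k : ℕ} {m : ℤ}
    (h : ∀ v, c.Bd k m (f v)) : c.Bd (1 + k) m (∑ v, f v - ∑ v ∈ I.S a b, f v) := by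
  have hx := fun w => single_le_sum (fun v _ => I.x_nonneg v) (mem_univ w)
  have h1 : c.Bd 1 0 (2 + I.x a + I.x b) := .const (by
    have ha := I.x_nonneg a; have hb := I.x_nonneg b
    rw [abs_of_nonneg (by linarith)]; linarith [hx a, hx b])
  have h2 := h1.mul' (bd_pow c k m) (k := 1 + k) (m := m) le_rfl (by simp)
  refine h2.of_abs_le ?_
  refine (I.abs_sum_sub_sum_S a b h).trans (le_trans (le_of_eq (mul_comm _ _)) (le_abs_self _))

end Good

namespace Inst

variable {n : ℕ} (I : Inst n)

/-- Approximate expected number of common neighbours. -/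
def codM (c : Ctx n) (a b : Fin n) : ℝ :=
  #(I.S a b) * c.p ^ 2 + c.p * n * (I.q c a + I.q c b) - c.p * (1 - c.p) +
    n * (I.q c a * I.q c b) + ∑ u, I.q c u ^ 2

end Inst

namespace Good

open Ctx

variable {n : ℕ} {c : Ctx n} {s : ℕ} {I : Inst n}

lemma E_cod {a b : Fin n} (h : Good c s I) (hs : s ≤ 29) (hI : I.gs.Nonempty) (hab : a ≠ b) :
    I.E (fun H => cod H a b) = ∑ u ∈ I.S a b, I.Pr a u * (I.add a u).Pr b u := by
  have h1 := I.E_cod_mul hab (h.two_le_d (by omega)) fun _ => 1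
  simp only [mul_one] at h1
  rw [h1]
  refine sum_congr rfl fun u hu => ?_
  obtain ⟨h2, h3, h4, h5⟩ := Inst.mem_S.1 hu
  rw [Inst.E_const, mul_one]
  refine add_nonempty (s := s + 1) (c := c) (h.add (by omega) (Ne.symm h2) h4) (by omega)
    (h.add_nonempty (by omega) hI (Ne.symm h2) h4) (Ne.symm h3) ?_
  simp only [Inst.add, SimpleGraph.sup_adj, SimpleGraph.edge_adj, not_or]
  exact ⟨h5, by tauto⟩

lemma bd_cod_term (c : Ctx n) {α₁ α₂ β₁ β₂ P₁ P₂ : ℝ} {q : ℝ}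
    (h1 : c.Bd 4 (-1) α₁) (h2 : c.Bd 4 (-1) α₂) (h3 : c.Bd 7 (-2) β₁) (h4 : c.Bd 7 (-2) β₂)
    (h5 : c.Bd 138 (-3) (P₁ - (c.p + α₁ + β₁))) (h6 : c.Bd 138 (-3) (P₂ - (c.p + α₂ + β₂ - q)))
    (h7 : c.Bd 1 (-2) q) (hP : c.Bd 0 0 P₂) :
    c.Bd 150 (-3) (P₁ * P₂ - (c.p ^ 2 + c.p * (α₁ + α₂) + c.p * (β₁ + β₂ - q) + α₁ * α₂)) := by
  have e1 : c.Bd 138 (-3) ((P₁ - (c.p + α₁ + β₁)) * P₂) := h5.mul' hP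
  have e2 : c.Bd 8 (-1) (α₁ + β₁) := h1.add' h3
  have e3 : c.Bd 9 0 (c.p + (α₁ + β₁)) := c.bd_p.add' e2
  have e4 : c.Bd 147 (-3) ((c.p + (α₁ + β₁)) * (P₂ - (c.p + α₂ + β₂ - q))) := e3.mul' h6
  have e5 : c.Bd 8 (-2) (β₂ - q) := h4.sub' h7
  have e6 : c.Bd 12 (-3) (α₁ * (β₂ - q)) := h1.mul' e5
  have e7 : c.Bd 11 (-3) (β₁ * α₂) := h3.mul' h2
  have e8 : c.Bd 15 (-3) (β₁ * (β₂ - q)) := h3.mul' e5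
  have e9 : c.Bd 148 (-3) _ := e1.add' e4
  have e10 : c.Bd 13 (-3) _ := e6.add' e7
  have e11 : c.Bd 16 (-3) _ := e10.add' e8
  refine (e9.add' e11 (k := 149) (m := -3)).of_eq ?_
  ring

lemma card_S_sub (hf : ∑ v, I.x v ≤ 10) (a b : Fin n) : c.Bd 1 0 ((n : ℝ) - #(I.S a b)) := by
  have := bd_sum_S_few (c := c) hf a b (f := fun _ => 1) (k := 0) (m := 0)
    fun _ => .one (by norm_num)
  simpa using this

lemma bd_E_cod (h : Good c s I) (hs : s ≤ 29) (hI : I.gs.Nonempty) (hf : ∑ v, I.x v ≤ 8)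
    {a b : Fin n} (hab : a ≠ b) :
    c.Bd 160 (-1) (I.E (fun H => cod H a b) - I.codM c a b) := by
  have hq := h.bd_q (by omega : s ≤ 40)
  have hf' : ∑ v, I.x v ≤ 10 := by linarith
  have hd := h.one_le_d (by omega : s ≤ 40)
  have hαu : ∀ u, c.Bd 4 (-1) (I.q c a + I.q c u) := fun u => (hq a).add' (hq u)
  have hαu' : ∀ u, c.Bd 4 (-1) (I.q c b + I.q c u) := fun u => (hq b).add' (hq u)
  have hκa : c.Bd 4 (-1) (c.κ * I.q c a) := c.bd_κ.mul' (hq a)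
  have hκb : c.Bd 4 (-1) (c.κ * I.q c b) := c.bd_κ.mul' (hq b)
  have hq1 : c.Bd 1 (-2) ((1 - c.p) / n) := (c.bd_one_sub_p.div_n (m := 0)).mono'
  rw [h.E_cod hs hI hab]
  have key : ∀ u ∈ I.S a b, c.Bd 150 (-3) (I.Pr a u * (I.add a u).Pr b u -
      (c.p ^ 2 + c.p * ((I.q c a + I.q c u) + (I.q c b + I.q c u)) +
        c.p * (c.κ * I.q c a * I.q c u + c.κ * I.q c b * I.q c u - (1 - c.p) / n) +
        (I.q c a + I.q c u) * (I.q c b + I.q c u))) := by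
    intro u hu
    obtain ⟨h2, h3, h4, h5⟩ := Inst.mem_S.1 hu
    have hJ := h.add (by omega) (Ne.symm h2) h4
    have hJn := h.add_nonempty (by omega) hI (Ne.symm h2) h4
    have hX : ¬ (I.add a u).X.Adj b u := by
      simp only [Inst.add, SimpleGraph.sup_adj, SimpleGraph.edge_adj, not_or]
      exact ⟨h5, by tauto⟩
    have hfJ : ∑ v, (I.add a u).x v ≤ 10 := by
      simp only [I.x_add (Ne.symm h2) h4, sum_add_distrib, sum_pair_ind (Ne.symm h2)]
      linarith
    refine bd_cod_term c (hαu u) (hαu' u) (hκa.mul' (hq u)) (hκb.mul' (hq u)) ?_ ?_ hq1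
      (.one (by rw [abs_of_nonneg (Inst.Pr_nonneg _ _ _)]; exact Inst.Pr_le_one _ _ _))
    · refine (h.bd_Pr_few (by omega) hI hf' (Ne.symm h2) h4).of_eq ?_
      ring
    · have e1 := hJ.bd_Pr_few (by omega) hJn hfJ (Ne.symm h3) hX
      have e2 : c.Bd 5 (-3) (c.κ * I.q c b * ((1 - c.p) / n)) := hκb.mul' hq1
      rw [Inst.q_add_eq c (Ne.symm h2) h4 hd, Inst.q_add_eq c (Ne.symm h2) h4 hd, 
        if_neg (by simp [hab.symm, h3.symm]), if_pos (by simp)] at e1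
      refine (e1.sub' e2 (k := 138) (m := -3)).of_eq ?_
      ring
  have hsum : c.Bd 150 (-1) _ := Bd.sum_fin key
  have f1 : c.Bd 4 (-1) (I.q c a + I.q c b) := (hq a).add' (hq b)
  have f2 : c.Bd 4 (-1) (c.p * (I.q c a + I.q c b)) := c.bd_p.mul' f1
  have f3 : c.Bd 1 (-2) (c.p * ((1 - c.p) / n)) := c.bd_p.mul' hq1
  have f4 : c.Bd 6 (-2) (I.q c a * I.q c b) := (hq a).mul' (hq b)
  have f5 : c.Bd 7 (-1) (c.p * (I.q c a + I.q c b) - c.p * ((1 - c.p) / n) + I.q c a * I.q c b) :=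
    (f2.sub' f3 (k := 5) (m := -1)).add' f4
  have f6 : c.Bd 8 (-1) (((n : ℝ) - #(I.S a b)) * _) := (card_S_sub hf' a b).mul' f5
  have f7 : c.Bd 5 (-1) (∑ u ∈ I.S a b, I.q c u) :=
    ((h.bd_sum_q_few (by omega) hf').sub' (bd_sum_S_few hf' a b hq) (k := 5) (m := -1)).of_eq
      (by ring)
  have f8 : c.Bd 3 0 (2 * c.p) := (Bd.const (x := 2) (by norm_num)).mul' c.bd_p
  have f9 : c.Bd 5 (-1) (c.κ * (c.p * (I.q c a + I.q c b))) := c.bd_κ.mul' f2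
  have f10 : c.Bd 7 0 (2 * c.p + c.κ * (c.p * (I.q c a + I.q c b)) + (I.q c a + I.q c b)) :=
    (f8.add' f9 (k := 6) (m := 0)).add' f1
  have f11 : c.Bd 12 (-1) (_ * ∑ u ∈ I.S a b, I.q c u) := f10.mul' f7
  have hqq : ∀ u, c.Bd 6 (-2) (I.q c u ^ 2) := fun u => by
    rw [sq]; exact (hq u).mul' (hq u)
  have f12 := bd_sum_S_few hf' a b hqq
  have f13 : c.Bd 13 (-1) _ := f11.sub' f6
  have f14 : c.Bd 14 (-1) _ := f13.sub' f12
  refine (hsum.add' f14 (k := 151) (m := -1)).of_eq ?_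
  have e1 : ∑ u ∈ I.S a b, (c.p ^ 2 + c.p * ((I.q c a + I.q c u) + (I.q c b + I.q c u)) +
        c.p * (c.κ * I.q c a * I.q c u + c.κ * I.q c b * I.q c u - (1 - c.p) / n) +
        (I.q c a + I.q c u) * (I.q c b + I.q c u)) =
      #(I.S a b) * (c.p ^ 2 + c.p * (I.q c a + I.q c b) - c.p * ((1 - c.p) / n) +
        I.q c a * I.q c b) +
      (2 * c.p + c.κ * (c.p * (I.q c a + I.q c b)) + (I.q c a + I.q c b)) *
        ∑ u ∈ I.S a b, I.q c u + ∑ u ∈ I.S a b, I.q c u ^ 2 := by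
    rw [← nsmul_eq_mul, ← sum_const, mul_sum, ← sum_add_distrib, ← sum_add_distrib]
    exact sum_congr rfl fun u _ => by ring
  rw [sum_sub_distrib, e1, Inst.codM]
  have := c.n_pos.ne'
  field_simp
  ring

end Good

namespace Inst

variable {n : ℕ} {I : Inst n}

lemma not_adj_add {a b u : Fin n} (hab : a ≠ b) (hu : u ∈ I.S a b) : ¬ (I.add a u).X.Adj b u := by
  obtain ⟨h2, h3, h4, h5⟩ := mem_S.1 hu
  simp only [add, SimpleGraph.sup_adj, SimpleGraph.edge_adj, not_or]
  exact ⟨h5, by tauto⟩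

lemma cod_sup_edge {a b u : Fin n} (hab : a ≠ b) (hu : u ∈ I.S a b) {H : SimpleGraph (Fin n)}
    (hH : H ∈ ((I.add a u).add b u).gs) :
    cod (H ⊔ SimpleGraph.edge b u ⊔ SimpleGraph.edge a u) a b = cod H a b + 1 := by
  obtain ⟨h2, h3, h4, h5⟩ := mem_S.1 hu
  have e1 : ¬ H.Adj b u := (mem_gs.1 hH).2 _ _ (by simp [add, SimpleGraph.edge_adj, Ne.symm h3])
  have e2 : ¬ H.Adj a u := (mem_gs.1 hH).2 _ _ (by simp [add, SimpleGraph.edge_adj, Ne.symm h2])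
  have e3 : ¬ (H ⊔ SimpleGraph.edge b u).Adj a u := by
    simp only [SimpleGraph.sup_adj, SimpleGraph.edge_adj, not_or]
    exact ⟨e2, by tauto⟩
  have f1 : ∀ v, ad (H ⊔ SimpleGraph.edge b u ⊔ SimpleGraph.edge a u) a v =
      ad H a v + if v = u then 1 else 0 := fun v => by
    rw [ad_sup_edge (Ne.symm h2) e3, ad_sup_edge (Ne.symm h3) e1]
    simp [hab, Ne.symm h2]
  have f2 : ∀ v, ad (H ⊔ SimpleGraph.edge b u ⊔ SimpleGraph.edge a u) b v =
      ad H b v + if v = u then 1 else 0 := fun v => by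
    rw [ad_sup_edge (Ne.symm h2) e3, ad_sup_edge (Ne.symm h3) e1]
    simp [hab.symm, Ne.symm h3]
  simp only [cod, f1, f2]
  have : ∀ v, (ad H a v + if v = u then 1 else 0) * (ad H b v + if v = u then 1 else 0) =
      ad H a v * ad H b v + if v = u then 1 else 0 := fun v => by
    split_ifs with hv
    · rw [hv, ad_zero e1, ad_zero e2]; ring
    · ring
  simp only [this, sum_add_distrib, sum_ite_eq', mem_univ, if_true]

lemma S_add_add {a b u : Fin n} (hu : u ∈ I.S a b) :
    ((I.add a u).add b u).S a b = (I.S a b).erase u := by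
  obtain ⟨h2, h3, h4, h5⟩ := mem_S.1 hu
  ext v
  simp only [mem_S, mem_erase, add, SimpleGraph.sup_adj, SimpleGraph.edge_adj]
  constructor
  · rintro ⟨e1, e2, e3, e4⟩
    exact ⟨fun e => by subst e; tauto, e1, e2, by tauto, by tauto⟩
  · rintro ⟨e1, e2, e3, e4, e5⟩
    refine ⟨e2, e3, ?_, ?_⟩ <;> grind

end Inst

namespace Good

open Ctx

variable {n : ℕ} {c : Ctx n} {s : ℕ} {I : Inst n}

lemma bd_codM_add (h : Good c s I) (hs : s ≤ 30) {a b u : Fin n} (hab : a ≠ b)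
    (hu : u ∈ I.S a b) :
    c.Bd 20 (-1) (((I.add a u).add b u).codM c a b -
      (I.codM c a b - c.p ^ 2 - 2 * c.p * (1 - c.p))) := by
  obtain ⟨h2, h3, h4, h5⟩ := Inst.mem_S.1 hu
  have hX := Inst.not_adj_add hab hu
  have hq := h.bd_q (by omega : s ≤ 40)
  have hJ := (h.add (by omega) (Ne.symm h2) h4)
  have hJ' := (hJ.add (by omega) (Ne.symm h3) hX).bd_q (by omega)
  have hqJ : ∀ w, ((I.add a u).add b u).q c w = I.q c w -
      (1 - c.p) / n * (if w = a ∨ w = u then 1 else 0) -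
      (1 - c.p) / n * (if w = b ∨ w = u then 1 else 0) := fun w => by
    rw [Inst.q_add_eq c (Ne.symm h3) hX (hJ.one_le_d (by omega)),
      Inst.q_add_eq c (Ne.symm h2) h4 (h.one_le_d (by omega))]
  have hq1 : c.Bd 1 (-2) ((1 - c.p) / n) := (c.bd_one_sub_p.div_n (m := 0)).mono'
  have hS : (#(((I.add a u).add b u).S a b) : ℝ) = #(I.S a b) - 1 := by
    rw [Inst.S_add_add hu, card_erase_of_mem hu, Nat.cast_sub (card_pos.2 ⟨u, hu⟩)]
    simp
  have hsq : ∀ w, c.Bd 7 (-3) (((I.add a u).add b u).q c w ^ 2 - I.q c w ^ 2) := fun w => by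
    have e1 : c.Bd 4 (-1) (((I.add a u).add b u).q c w + I.q c w) := (hJ' w).add' (hq w)
    have e2 : c.Bd 2 (-2) (((I.add a u).add b u).q c w - I.q c w) := by
      have e3 : ∀ P : Prop, c.Bd 1 (-2) ((1 - c.p) / n * (if P then (1 : ℝ) else 0)) := fun P => by
        split_ifs
        · rwa [mul_one]
        · rw [mul_zero]; exact .zero
      refine (((e3 (w = a ∨ w = u)).add' (e3 (w = b ∨ w = u)) (k := 2) (m := -2)).neg).of_eq ?_
      rw [hqJ]; ring_nf
    exact (e1.mul' e2 (k := 7) (m := -3)).of_eq (by ring)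
  have hsum : c.Bd 7 (-1) (∑ w, (((I.add a u).add b u).q c w ^ 2 - I.q c w ^ 2)) :=
    Bd.sum_fin fun w _ => hsq w
  have ea : ((I.add a u).add b u).q c a = I.q c a - (1 - c.p) / n := by
    rw [hqJ, if_pos (by simp), if_neg (by simp [hab, Ne.symm h2])]; ring
  have eb : ((I.add a u).add b u).q c b = I.q c b - (1 - c.p) / n := by
    rw [hqJ, if_neg (by simp [hab.symm, Ne.symm h3]), if_pos (by simp)]; ring
  have g1 : c.Bd 4 (-1) (I.q c a + I.q c b) := (hq a).add' (hq b)
  have g2 : c.Bd 4 (-1) ((1 - c.p) * (I.q c a + I.q c b)) := c.bd_one_sub_p.mul' g1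
  have g3 : c.Bd 1 (-2) ((1 - c.p) * ((1 - c.p) / n)) := c.bd_one_sub_p.mul' hq1
  have g4 : c.Bd 5 (-1) _ := g3.sub' g2
  refine (hsum.add' g4 (k := 20) (m := -1)).of_eq ?_
  rw [Inst.codM, Inst.codM, hS, ea, eb, sum_sub_distrib]
  have := c.n_pos.ne'
  field_simp
  ring

lemma bd_E_cod_sub (h : Good c s I) (hs : s ≤ 29) (hI : I.gs.Nonempty) (hf : ∑ v, I.x v ≤ 4)
    {a b : Fin n} (hab : a ≠ b) :
    c.Bd 162 1 (I.E (fun H => cod H a b) - n * c.p ^ 2) := by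
  have h1 := h.bd_E_cod hs hI (by linarith) hab
  have hq := h.bd_q (by omega : s ≤ 40)
  have f0 : c.Bd 0 0 (c.p ^ 2) := by rw [sq]; exact c.bd_p.mul' c.bd_p
  have f1 : c.Bd 1 0 (((n : ℝ) - #(I.S a b)) * c.p ^ 2) :=
    (card_S_sub (by linarith) a b).mul' f0
  have f2 : c.Bd 4 1 (c.p * n * (I.q c a + I.q c b)) :=
    (c.bd_p.mul' c.bd_n (k := 0) (m := 2)).mul' ((hq a).add' (hq b) (k := 4) (m := -1))
  have f3 : c.Bd 0 0 (c.p * (1 - c.p)) := c.bd_p.mul' c.bd_one_sub_p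
  have f4 : c.Bd 6 0 (n * (I.q c a * I.q c b)) :=
    c.bd_n.mul' ((hq a).mul' (hq b) (k := 6) (m := -2))
  have f5 : c.Bd 6 0 (∑ u, I.q c u ^ 2) := Bd.sum_fin (m := -2) fun u _ => by
    rw [sq]; exact (hq u).mul' (hq u)
  have g1 : c.Bd 5 1 _ := f2.sub' f1
  have g2 : c.Bd 6 1 _ := g1.sub' f3
  have g3 : c.Bd 7 1 _ := g2.add' f4
  have g4 : c.Bd 8 1 _ := g3.add' f5
  refine (h1.add' g4 (k := 162) (m := 1)).of_eq ?_
  rw [Inst.codM]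
  ring

lemma bd_var_cod (h : Good c s I) (hs : s ≤ 27) (hI : I.gs.Nonempty) (hf : ∑ v, I.x v ≤ 4)
    {a b : Fin n} (hab : a ≠ b) :
    c.Bd 166 1 (I.E (fun H => (cod H a b - I.E fun H => cod H a b) ^ 2) -
      n * (c.p ^ 2 * (1 - c.p) ^ 2)) := by
  have hd2 := h.two_le_d (by omega : s ≤ 40)
  have hm := h.bd_E_cod_sub (by omega) hI hf hab
  have hM := h.bd_E_cod (by omega) hI (by linarith) hab
  have hm' := h.E_cod (by omega) hI hab
  set m := I.E fun H => cod H a b with hmdef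
  have key : ∀ u ∈ I.S a b, c.Bd 163 (-1) (I.Pr a u * ((I.add a u).Pr b u *
      ((I.add a u).add b u).E fun H => cod (H ⊔ SimpleGraph.edge b u ⊔ SimpleGraph.edge a u) a b) -
      I.Pr a u * (I.add a u).Pr b u * (m + (1 - c.p) ^ 2)) := by
    intro u hu
    obtain ⟨h2, h3, h4, h5⟩ := Inst.mem_S.1 hu
    have hX := Inst.not_adj_add hab hu
    have hJ := h.add (by omega) (Ne.symm h2) h4
    have hJn := h.add_nonempty (by omega) hI (Ne.symm h2) h4
    have hJ2 := hJ.add (by omega) (Ne.symm h3) hX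
    have hJ2n := hJ.add_nonempty (by omega) hJn (Ne.symm h3) hX
    have hfJ : ∑ v, ((I.add a u).add b u).x v ≤ 8 := by
      simp only [(I.add a u).x_add (Ne.symm h3) hX, I.x_add (Ne.symm h2) h4, sum_add_distrib,
        sum_pair_ind (Ne.symm h2), sum_pair_ind (Ne.symm h3)]
      linarith
    have g1 := hJ2.bd_E_cod (by omega) hJ2n hfJ hab
    have g2 := h.bd_codM_add (by omega) hab hu
    have g3 : c.Bd 161 (-1) _ := g1.add' g2
    have g4 : c.Bd 162 (-1) _ := g3.sub' hM
    have hP : ∀ (J : Inst n) (a b : Fin n), c.Bd 0 0 (J.Pr a b) := fun J a b =>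
      .one (by rw [abs_of_nonneg (Inst.Pr_nonneg _ _ _)]; exact Inst.Pr_le_one _ _ _)
    have g5 := ((hP I a u).mul' (hP (I.add a u) b u) (k := 0) (m := 0)).mul' g4 (k := 163) (m := -1)
    refine g5.of_eq ?_
    rw [Inst.E_congr fun H hH => Inst.cod_sup_edge hab hu hH, Inst.E_add, Inst.E_const hJ2n]
    ring
  have hsum : c.Bd 163 1 _ := Bd.sum_fin key
  have g0 : c.Bd 0 0 ((1 - c.p) ^ 2) := by rw [sq]; exact c.bd_one_sub_p.mul' c.bd_one_sub_p
  have g1 : c.Bd 162 1 (_ * (1 - c.p) ^ 2) := hm.mul' g0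
  refine (hsum.add' g1 (k := 166) (m := 1)).of_eq ?_
  rw [sum_sub_distrib, ← I.E_cod_mul hab hd2 fun H => cod H a b, ← sum_mul, ← hm']
  have e1 : ∀ H, (cod H a b - m) ^ 2 = cod H a b * cod H a b - (2 * m) * cod H a b + m ^ 2 :=
    fun H => by ring
  simp only [e1]
  rw [Inst.E_add, Inst.E_sub, Inst.E_mul_left, Inst.E_const hI, ← hmdef]
  ring

end Good

/-- Move one unit of degree from `a` to `b`. -/
def mv {n : ℕ} (d : Fin n → ℕ) (a b : Fin n) : Fin n → ℕ :=
  fun v => if v = a then d a - 1 else if v = b then d b + 1 else d v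

/-- Number of vertices in the neighbourhood of `b` that cannot be switched to `a`. -/
def cc {n : ℕ} (H : SimpleGraph (Fin n)) (a b : Fin n) : ℝ := cod H a b + ad H a b

section

variable {n : ℕ} {H : SimpleGraph (Fin n)} {a b : Fin n}

lemma cc_comm : cc H a b = cc H b a := by
  rw [cc, cc, ad_comm H a b]
  congr 1
  exact sum_congr rfl fun _ _ => mul_comm _ _

lemma sum_switch (hab : a ≠ b) :
    ∑ w ∈ univ.filter (fun w => w ≠ a ∧ w ≠ b), ad H a w * (1 - ad H b w) =
      ∑ w, ad H a w - cc H a b := by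
  have h1 : ∀ w, (if w ≠ a ∧ w ≠ b then ad H a w * (1 - ad H b w) else 0) =
      ad H a w - ad H a w * ad H b w - if w = b then ad H a b else 0 := fun w => by
    by_cases hwa : w = a
    · subst hwa; rw [ad_self]; simp [hab]
    by_cases hwb : w = b
    · subst hwb; rw [ad_self]; simp
    · simp [hwa, hwb]; ring
  rw [sum_filter, sum_congr rfl fun w _ => h1 w, sum_sub_distrib, sum_sub_distrib, cc, cod]
  simp only [sum_ite_eq', mem_univ, if_true]
  ring

lemma cc_sw {w : Fin n} (hwa : w ≠ a) (hwb : w ≠ b) : cc (sw H a b {w}) a b = cc H a b := by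
  have ha : a ∉ ({w} : Finset (Fin n)) := by simpa using hwa.symm
  have hb : b ∉ ({w} : Finset (Fin n)) := by simpa using hwb.symm
  rw [cc, cc, cod, cod, ad_sw_left ha hb b, if_neg hb]
  congr 1
  refine sum_congr rfl fun v _ => ?_
  rw [ad_sw_left ha hb, ad_sw_right ha hb]
  split_ifs
  · ring
  · rfl

lemma cc_le (H : SimpleGraph (Fin n)) (hab : a ≠ b) : cc H a b ≤ ∑ w, ad H a w := by
  have h1 := sum_switch (H := H) hab
  have h2 : 0 ≤ ∑ w ∈ univ.filter (fun w => w ≠ a ∧ w ≠ b), ad H a w * (1 - ad H b w) :=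
    sum_nonneg fun w _ => mul_nonneg (ad_nonneg _ _ _) (by linarith [ad_le_one H b w])
  linarith

end

namespace Inst

variable {n : ℕ}

lemma card_mul_E (I : Inst n) (f : SimpleGraph (Fin n) → ℝ) :
    (#I.gs : ℝ) * I.E f = ∑ H ∈ I.gs, f H := by
  rcases I.gs.eq_empty_or_nonempty with h | h
  · simp [h]
  · rw [E, mul_div_cancel₀]
    exact_mod_cast (card_pos.2 h).ne'

lemma sum_switch_mv {d : Fin n → ℕ} {a b : Fin n} (hab : a ≠ b) (hda : 1 ≤ d a) (φ : ℝ → ℝ) :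
    ∑ H ∈ (⟨d, ⊥⟩ : Inst n).gs, (d a - cc H a b) * φ (cc H a b) =
      ∑ H ∈ (⟨mv d a b, ⊥⟩ : Inst n).gs, (d b + 1 - cc H a b) * φ (cc H a b) := by
  have h1 : ∀ H ∈ (⟨d, ⊥⟩ : Inst n).gs, (d a - cc H a b) * φ (cc H a b) =
      ∑ w ∈ univ.filter (fun w => w ≠ a ∧ w ≠ b),
        ad H a w * (1 - ad H b w) * φ (cc H a b) := fun H hH => by
    rw [← sum_mul, sum_switch hab, (mem_gs.1 hH).1]
  have h2 : ∀ H ∈ (⟨mv d a b, ⊥⟩ : Inst n).gs, (d b + 1 - cc H a b) * φ (cc H a b) =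
      ∑ w ∈ univ.filter (fun w => w ≠ a ∧ w ≠ b),
        ad H b w * (1 - ad H a w) * φ (cc H a b) := fun H hH => by
    have : univ.filter (fun w => w ≠ a ∧ w ≠ b) = univ.filter (fun w => w ≠ b ∧ w ≠ a) :=
      filter_congr fun w _ => and_comm
    rw [← sum_mul, this, sum_switch hab.symm, (mem_gs.1 hH).1, cc_comm (a := b)]
    simp [mv, hab.symm]
  rw [sum_congr rfl h1, sum_congr rfl h2, sum_comm, sum_comm (s := (⟨mv d a b, ⊥⟩ : Inst n).gs)]
  refine sum_congr rfl fun w hw => ?_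
  obtain ⟨hwa, hwb⟩ : w ≠ a ∧ w ≠ b := by simpa using hw
  have ha : a ∉ ({w} : Finset (Fin n)) := by simpa using hwa.symm
  have hb : b ∉ ({w} : Finset (Fin n)) := by simpa using hwb.symm
  have aux : ∀ x y : ℝ, (x = 0 ∨ x = 1) → (y = 0 ∨ y = 1) → ∀ t, x * (1 - y) * t ≠ 0 →
      x = 1 ∧ y = 0 := by
    rintro x y (rfl | rfl) (rfl | rfl) t h <;> simp_all
  have had : ∀ (H : SimpleGraph (Fin n)) u v, ad H u v = 0 ∨ ad H u v = 1 := fun H u v => by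
    unfold ad; split_ifs <;> simp
  refine sum_gs_sw ha hb (fun H hH hF => ?_) (fun H hH hF => ?_)
  · obtain ⟨e1, e2⟩ := aux _ _ (had _ _ _) (had _ _ _) _ hF
    refine ⟨sw_mem_gs ha hb hH rfl (by simp) ?_ ?_ ?_, ?_⟩
    · simp [e1, e2, mv, Nat.cast_sub hda]; ring
    · simp [e1, e2, mv, hab.symm]
    · intro v hva hvb; simp [mv, hva, hvb]
    · rw [cc_sw hwa hwb, ad_sw_left ha hb, ad_sw_right ha hb, if_pos (by simp), if_pos (by simp)]
  · obtain ⟨e1, e2⟩ := aux _ _ (had _ _ _) (had _ _ _) _ hF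
    refine ⟨sw_mem_gs ha hb hH rfl (by simp) ?_ ?_ ?_, ?_⟩
    · simp [e1, e2, mv, Nat.cast_sub hda]
    · simp [e1, e2, mv, hab.symm]
    · intro v hva hvb; simp [mv, hva, hvb]
    · rw [cc_sw hwa hwb, ad_sw_left ha hb, ad_sw_right ha hb, if_pos (by simp), if_pos (by simp)]

/-- Effect of a degree switching on the number of graphs. -/
lemma card_mv {d : Fin n → ℕ} {a b : Fin n} (hab : a ≠ b) (hda : 1 ≤ d a) :
    (#(⟨mv d a b, ⊥⟩ : Inst n).gs : ℝ) *
        (1 - (⟨mv d a b, ⊥⟩ : Inst n).E fun H => if (d b + 1 : ℝ) = cc H a b then 1 else 0) =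
      #(⟨d, ⊥⟩ : Inst n).gs * (1 + ((d a : ℝ) - d b - 1) *
        (⟨d, ⊥⟩ : Inst n).E fun H => (d b + 1 - cc H a b)⁻¹) := by
  have h := sum_switch_mv hab hda fun t => (d b + 1 - t)⁻¹
  have h1 : ∀ H ∈ (⟨mv d a b, ⊥⟩ : Inst n).gs,
      (d b + 1 - cc H a b) * (d b + 1 - cc H a b)⁻¹ =
        1 - if (d b + 1 : ℝ) = cc H a b then 1 else 0 := fun H _ => by
    split_ifs with e
    · rw [e]; simp
    · rw [mul_inv_cancel₀ (sub_ne_zero.2 e)]; simp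
  have h2 : ∀ H ∈ (⟨d, ⊥⟩ : Inst n).gs, (d a - cc H a b) * (d b + 1 - cc H a b)⁻¹ =
      1 + ((d a : ℝ) - d b - 1) * (d b + 1 - cc H a b)⁻¹ := fun H hH => by
    have := cc_le H hab.symm
    rw [(mem_gs.1 hH).1, cc_comm] at this
    have : 0 < d b + 1 - cc H a b := by linarith
    field_simp
    ring
  rw [sum_congr rfl h1, sum_congr rfl h2, sum_sub_distrib, sum_add_distrib, ← mul_sum] at h
  simp only [sum_const, nsmul_eq_mul, mul_one] at h
  rw [mul_sub, mul_add, mul_left_comm, card_mul_E, card_mul_E]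
  linarith

end Inst

namespace Ctx

variable {n : ℕ} {c : Ctx n}

lemma bd_vn (c : Ctx n) : c.Bd 0 2 (n * (c.p * (1 - c.p))) :=
  c.bd_n.mul' (c.bd_p.mul' (k := 0) (m := 0) c.bd_one_sub_p)

lemma bd_inv_vn (c : Ctx n) : c.Bd 1 (-2) (n * (c.p * (1 - c.p)))⁻¹ := by
  rw [mul_inv]; exact c.bd_inv_n.mul' c.bd_inv_var

/-- Quantities close to `p (1 - p) n` are invertible. -/
lemma Bd.inv_near {k : ℕ} {y : ℝ} (h : c.Bd k 1 (y - n * (c.p * (1 - c.p)))) (hk : k ≤ 400) :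
    0 < y ∧ c.Bd 2 (-2) y⁻¹ := by
  have h1 : |(y - n * (c.p * (1 - c.p))) / n| ≤ 1 / c.L ^ 2 :=
    h.div_n.le_pow (by norm_num) (by omega)
  rw [abs_div, Nat.abs_cast, div_le_iff₀ c.n_pos] at h1
  have h2 : n * (1 / c.L) ≤ n * (c.p * (1 - c.p)) := mul_le_mul_of_nonneg_left c.hp c.n_pos.le
  have hL := c.L_pos
  have h3 : 2 * (1 / c.L ^ 2) ≤ 1 / c.L := by
    rw [mul_one_div, div_le_div_iff₀ (by positivity) hL]
    nlinarith [c.hL]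
  have h4 : 1 / c.L ^ 2 * n ≤ y := by nlinarith [(abs_le.1 h1).1, c.n_pos]
  have h5 : 0 < 1 / c.L ^ 2 * n := mul_pos (by positivity) c.n_pos
  refine ⟨by linarith, bd_inv ?_⟩
  rw [abs_of_pos (by linarith), neg_neg, c.σ_zsq]
  refine le_trans (le_of_eq ?_) h4
  rw [zpow_neg, one_div]
  norm_cast

lemma Bd.pow_two {k : ℕ} {m : ℤ} {x : ℝ} (h : c.Bd k m x) : c.Bd (k + k) (m + m) (x ^ 2) := by
  rw [sq]; exact h.mul h

lemma bd_E_inv {I : Inst n} (hI : I.gs.Nonempty) {Y : SimpleGraph (Fin n) → ℝ}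
    {bad : SimpleGraph (Fin n) → Prop}
    (h₁ : ∀ H ∈ I.gs, ¬ bad H → c.Bd 6 1 (Y H - n * (c.p * (1 - c.p))))
    (h₂ : ∀ H ∈ I.gs, 1 ≤ Y H) (h₃ : ∀ H ∈ I.gs, c.Bd 1 2 (Y H))
    (h₄ : c.Bd 0 (-40) (I.E fun H => if bad H then 1 else 0))
    (hV : c.Bd 170 1 (I.E (fun H => (Y H - I.E Y) ^ 2) - n * (c.p ^ 2 * (1 - c.p) ^ 2))) :
    c.Bd 7 1 (I.E Y - n * (c.p * (1 - c.p))) ∧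
    c.Bd 180 (-5) (I.E (fun H => (Y H)⁻¹) - ((I.E Y)⁻¹ + (n * (n * (c.p * (1 - c.p))))⁻¹)) := by
  have hvn := c.bd_vn
  have hμ : c.Bd 7 1 (I.E Y - n * (c.p * (1 - c.p))) := by
    refine (Bd.E (k := 6) (m := 1) h₁ (fun H hH => ?_) h₄).of_eq ?_
    · exact ((h₃ H hH).sub' hvn (k := 2) (m := 2)).up (by norm_num) (by norm_num)
    · rw [I.E_sub, Inst.E_const hI]
  refine ⟨hμ, ?_⟩
  obtain ⟨hμ0, hμi⟩ := hμ.inv_near (by norm_num)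
  set μ := I.E Y with hμdef
  have hμb : c.Bd 9 2 μ := (hμ.add' hvn (k := 9) (m := 2)).of_eq (by ring)
  have hrem : c.Bd 27 1 (I.E fun H => (Y H - μ) ^ 3 * (Y H)⁻¹) := by
    refine Bd.E (k := 26) (m := 1) (bad := bad) (fun H hH hb => ?_) (fun H hH => ?_) h₄
    · have h1 := h₁ H hH hb
      have h2 := (h1.inv_near (by norm_num)).2
      have h3 : c.Bd 8 1 (Y H - μ) := (h1.sub' hμ (k := 8) (m := 1)).of_eq (by ring)
      have h4 : c.Bd 24 3 ((Y H - μ) ^ 3) :=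
          (h3.mul' (h3.mul' h3 (k := 16) (m := 2)) (k := 24) (m := 3)).of_eq (by ring)
      exact h4.mul' h2
    · have h3 : c.Bd 10 2 (Y H - μ) := (h₃ H hH).sub' hμb
      have h4 : c.Bd 30 6 ((Y H - μ) ^ 3) :=
          (h3.mul' (h3.mul' h3 (k := 20) (m := 4)) (k := 30) (m := 6)).of_eq (by ring)
      have h5 : c.Bd 0 0 (Y H)⁻¹ := by
        have := h₂ H hH
        refine .one ?_
        rw [abs_of_nonneg (by positivity)]
        exact inv_le_one_of_one_le₀ this
      exact (h4.mul h5).up (by norm_num) (by norm_num)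
  have hμ3 : c.Bd 6 (-6) (μ⁻¹ ^ 3) :=
      (hμi.mul' (hμi.mul' hμi (k := 4) (m := -4)) (k := 6) (m := -6)).of_eq (by ring)
  have hexp : I.E (fun H => (Y H)⁻¹) = μ⁻¹ + I.E (fun H => (Y H - μ) ^ 2) * μ⁻¹ ^ 3 -
      I.E (fun H => (Y H - μ) ^ 3 * (Y H)⁻¹) * μ⁻¹ ^ 3 := by
    have h0 : I.E (fun H => Y H - μ) = 0 := by rw [I.E_sub, Inst.E_const hI]; simp [hμdef]
    have h1 : ∀ H ∈ I.gs, (Y H)⁻¹ = μ⁻¹ - (Y H - μ) * μ⁻¹ ^ 2 + (Y H - μ) ^ 2 * μ⁻¹ ^ 3 -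
        (Y H - μ) ^ 3 * (Y H)⁻¹ * μ⁻¹ ^ 3 := fun H hH => by
      have := (lt_of_lt_of_le one_pos (h₂ H hH)).ne'
      have := hμ0.ne'
      field_simp
      ring
    rw [Inst.E_congr h1, I.E_sub, I.E_add, I.E_sub, Inst.E_const hI, I.E_mul_right, I.E_mul_right,
      I.E_mul_right, h0]
    ring
  have e1 : c.Bd 33 (-5) (I.E (fun H => (Y H - μ) ^ 3 * (Y H)⁻¹) * μ⁻¹ ^ 3) := hrem.mul' hμ3
  have e2 := hV.mul' hμ3 (k := 176) (m := -5)
  set N : ℝ := n * (c.p * (1 - c.p)) with hN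
  have hNi : c.Bd 1 (-2) N⁻¹ := c.bd_inv_vn
  have hN0 : 0 < N := mul_pos c.n_pos c.var_pos
  have e3 : c.Bd 20 (-7) (μ⁻¹ ^ 3 - N⁻¹ ^ 3) := by
    have hd : c.Bd 10 (-3) (μ⁻¹ - N⁻¹) := by
      refine ((hμ.neg.mul' hμi (k := 9) (m := -1)).mul' hNi (k := 10) (m := -3)).of_eq ?_
      have := hμ0.ne'; have := hN0.ne'
      field_simp
      ring
    have h1 : c.Bd 4 (-4) (μ⁻¹ ^ 2) := hμi.pow_two
    have h2 : c.Bd 3 (-4) (μ⁻¹ * N⁻¹) := hμi.mul' hNi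
    have h3 : c.Bd 2 (-4) (N⁻¹ ^ 2) := hNi.pow_two
    have h4 : c.Bd 5 (-4) _ := h1.add' h2
    have h5 : c.Bd 6 (-4) _ := h4.add' h3
    exact (hd.mul' h5 (k := 20) (m := -7)).of_eq (by ring)
  have e4 : c.Bd 0 2 (n * (c.p ^ 2 * (1 - c.p) ^ 2)) := by
    refine (c.bd_n.mul' ((c.bd_p.mul' c.bd_one_sub_p (k := 0) (m := 0)).pow_two (m := 0) (k := 0))
        (k := 0) (m := 2)).of_eq ?_
    ring
  have e5 : c.Bd 20 (-5) _ := e4.mul' e3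
  have e6 : c.Bd 177 (-5) _ := e2.add' e5
  refine (e6.sub' e1 (k := 180) (m := -5)).of_eq ?_
  rw [hexp]
  have h8 : n * (c.p ^ 2 * (1 - c.p) ^ 2) * N⁻¹ ^ 3 = (n * N)⁻¹ := by
    have h1 := c.n_pos.ne'; have h2 := c.var_pos.ne'
    have h3 : c.p ≠ 0 := fun h => h2 (by simp [h])
    have h4 : 1 - c.p ≠ 0 := fun h => h2 (by simp [h])
    rw [hN]
    field_simp
  rw [← h8]
  ring

end Ctx

namespace Good

variable {n : ℕ} {c : Ctx n} {s : ℕ} {d : Fin n → ℕ}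

open Ctx

lemma x_bot (d : Fin n → ℕ) (v : Fin n) : (⟨d, ⊥⟩ : Inst n).x v = 0 := by
  simp [Inst.x, ad]

lemma q_bot (d : Fin n → ℕ) (v : Fin n) :
    n * (⟨d, ⊥⟩ : Inst n).q c v = d v - c.p * (n - 1) := by
  rw [Inst.q, mul_div_cancel₀ _ c.n_pos.ne', Inst.dl, x_bot]; ring

lemma card_S_bot (d : Fin n → ℕ) {a b : Fin n} (hab : a ≠ b) :
    (#((⟨d, ⊥⟩ : Inst n).S a b) : ℝ) = n - 2 := by
  rw [Inst.card_S hab, x_bot, x_bot]; simp [ad, Inst.cn]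

lemma sum_x_bot (d : Fin n → ℕ) : ∑ v, (⟨d, ⊥⟩ : Inst n).x v = 0 := by simp [x_bot]

lemma bd_switch_gap (h : Good c s ⟨d, ⊥⟩) (hs : s ≤ 27) {a b : Fin n}
    {H : SimpleGraph (Fin n)} (hb : ¬ BadCod c a b H) :
    c.Bd 6 1 (((d b : ℝ) + 1 - cc H a b) - n * (c.p * (1 - c.p))) := by
  have h1 : c.Bd 4 1 (cod H a b - c.p ^ 2 * n) := not_not.1 hb
  have h2 := h.bd_deg (by omega) b
  have h3 : c.Bd 0 0 (ad H a b) := bd_ad c H a b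
  have h4 : c.Bd 3 1 _ := h2.add' c.bd_one_sub_p
  have h5 : c.Bd 5 1 _ := h1.add' h3
  refine (h4.sub' h5 (k := 6) (m := 1)).of_eq ?_
  simp only [cc]
  ring

lemma one_le_switch_gap {a b : Fin n} (hab : a ≠ b) {H : SimpleGraph (Fin n)}
    (hH : H ∈ (⟨d, ⊥⟩ : Inst n).gs) : 1 ≤ (d b : ℝ) + 1 - cc H a b := by
  have := cc_le H hab.symm
  rw [(Inst.mem_gs.1 hH).1, cc_comm] at this
  linarith

lemma cc_nonneg (H : SimpleGraph (Fin n)) (a b : Fin n) : 0 ≤ cc H a b :=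
  add_nonneg (sum_nonneg fun _ _ => mul_nonneg (ad_nonneg _ _ _) (ad_nonneg _ _ _))
    (ad_nonneg _ _ _)

lemma bd_var_cc (h : Good c s ⟨d, ⊥⟩) (hs : s ≤ 27) (hI : (⟨d, ⊥⟩ : Inst n).gs.Nonempty)
    {a b : Fin n} (hab : a ≠ b) :
    c.Bd 170 1 ((⟨d, ⊥⟩ : Inst n).E
        (fun H => (cc H a b - (⟨d, ⊥⟩ : Inst n).E fun H => cc H a b) ^ 2) -
      n * (c.p ^ 2 * (1 - c.p) ^ 2)) := by
  set I : Inst n := ⟨d, ⊥⟩ with hIdef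
  have hV := h.bd_var_cod hs hI (by rw [sum_x_bot]; norm_num) hab
  set m := I.E fun H => cod H a b with hm
  set P := I.Pr a b with hP
  have hcc : (I.E fun H => cc H a b) = m + P := I.E_add _ _
  have hP1 : c.Bd 0 0 P := .one (by
    rw [abs_of_nonneg (Inst.Pr_nonneg _ _ _)]; exact Inst.Pr_le_one _ _ _)
  have hcn : ∀ H, c.Bd 0 2 (cod H a b) := fun H => by
    have := Bd.sum_fin (c := c) (s := univ) (k := 0) (m := 0)
      (f := fun u => ad H a u * ad H b u) fun u _ => (bd_ad c H a u).mul' (bd_ad c H b u)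
    exact this
  have hw : ∀ H, c.Bd 1 0 (ad H a b - P) := fun H => (bd_ad c H a b).sub' hP1
  have hμ : c.Bd 5 1 (m - c.p ^ 2 * n) := by
    refine (Bd.E (k := 4) (m := 1) (bad := BadCod c a b) (fun H hH hb => not_not.1 hb)
      (fun H hH => ?_) (h.bd_badCod (by omega) hab)).of_eq ?_
    · have h0 : c.Bd 0 0 (c.p ^ 2) := c.bd_p.pow_two
      exact ((hcn H).sub' (h0.mul' c.bd_n (k := 0) (m := 2)) (k := 1) (m := 2)).up (by norm_num)
        (by norm_num)
    · rw [I.E_sub, Inst.E_const hI]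
  have hmb : c.Bd 6 2 m := by
    have h0 : c.Bd 0 0 (c.p ^ 2) := c.bd_p.pow_two
    exact (hμ.add' (h0.mul' c.bd_n (k := 0) (m := 2)) (k := 6) (m := 2)).of_eq (by ring)
  have hx : c.Bd 11 1 (I.E fun H => (cod H a b - m) * (ad H a b - P) +
      (cod H a b - m) * (ad H a b - P) + (ad H a b - P) ^ 2) := by
    have key : ∀ H, ∀ m' : ℤ, 1 ≤ m' → c.Bd 7 m' (cod H a b - m) → c.Bd 10 m'
        ((cod H a b - m) * (ad H a b - P) + (cod H a b - m) * (ad H a b - P) +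
            (ad H a b - P) ^ 2) := fun H m' hm' h' => by
      have h1 : c.Bd 8 m' ((cod H a b - m) * (ad H a b - P)) :=
        h'.mul' (hw H) (h₃ := by omega)
      have h2 : c.Bd 2 m' ((ad H a b - P) ^ 2) := (hw H).pow_two.mono (by norm_num) (by omega)
      have h3 : c.Bd 9 m' ((cod H a b - m) * (ad H a b - P) + (cod H a b - m) * (ad H a b - P)) :=
        h1.add h1
      exact h3.add (h2.mono (by norm_num) le_rfl)
    refine Bd.E (k := 10) (bad := BadCod c a b) (fun H hH hb => ?_) (fun H hH => ?_)
      (h.bd_badCod (by omega) hab)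
    · have h1 : c.Bd 4 1 (cod H a b - c.p ^ 2 * n) := not_not.1 hb
      exact key H 1 le_rfl ((h1.sub' hμ (k := 7) (m := 1)).of_eq (by ring))
    · exact (key H 2 (by norm_num) ((hcn H).sub' hmb)).up (by norm_num) (by norm_num)
  refine (hV.add' hx (k := 170) (m := 1)).of_eq ?_
  rw [hcc, sub_add_eq_add_sub, ← I.E_add]
  congr 2
  funext H
  simp only [cc]
  ring

end Good

namespace Good

variable {n : ℕ} {c : Ctx n} {s : ℕ} {d : Fin n → ℕ}

open Ctx

/-- The main term of the expected number of switchings. -/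
def gapM (n : ℕ) (d : Fin n → ℕ) (a b : Fin n) : ℝ := ((n : ℝ) - d a) * (d b + 1) / n

lemma bd_E_gap (h : Good c s ⟨d, ⊥⟩) (hs : s ≤ 27) (hI : (⟨d, ⊥⟩ : Inst n).gs.Nonempty)
    {a b : Fin n} (hab : a ≠ b) :
    c.Bd 165 (-1) (gapM n d a b - (⟨d, ⊥⟩ : Inst n).E (fun H => (d b : ℝ) + 1 - cc H a b) -
      (∑ u, (⟨d, ⊥⟩ : Inst n).q c u ^ 2 - c.p * (1 - c.p))) := by
  have hqa := h.bd_q (by omega) a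
  have hqb := h.bd_q (by omega) b
  have hcod := h.bd_E_cod (by omega) hI (by rw [sum_x_bot]; norm_num) hab
  have hPr := h.bd_Pr (by omega) hI hab (by simp)
  have ea := q_bot (c := c) d a
  have eb := q_bot (c := c) d b
  have hcard := card_S_bot d hab
  set I : Inst n := ⟨d, ⊥⟩ with hIdef
  have hE : I.E (fun H => (d b : ℝ) + 1 - cc H a b) =
      d b + 1 - (I.E (fun H => cod H a b) + I.Pr a b) := by
    rw [I.E_sub, Inst.E_const hI]; congr 1; exact I.E_add _ _
  rw [hE]
  rw [Inst.codM, hcard] at hcod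
  set m := I.E fun H => cod H a b
  set P := I.Pr a b
  set Q := ∑ u, I.q c u ^ 2
  set x := I.q c a
  set y := I.q c b
  have f1 : c.Bd 0 (-2) (c.p * (1 - c.p) * (n : ℝ)⁻¹) :=
    (c.bd_p.mul' c.bd_one_sub_p (k := 0) (m := 0)).mul' c.bd_inv_n
  have f2 : c.Bd 3 (-1) (c.p * y) := c.bd_p.mul' hqb
  have f3 : c.Bd 3 (-1) ((1 - c.p) * x) := c.bd_one_sub_p.mul' hqa
  have f4 : c.Bd 4 (-1) _ := f2.sub' f3
  have f5 : c.Bd 5 (-1) _ := f4.add' f1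
  have f6 : c.Bd 161 (-1) _ := hcod.add' hPr
  refine (f6.add' f5 (k := 165) (m := -1)).of_eq ?_
  have ha : (d a : ℝ) = c.p * (n - 1) + n * x := by linarith
  have hb : (d b : ℝ) = c.p * (n - 1) + n * y := by linarith
  rw [gapM, ha, hb]
  have := c.n_pos.ne'
  field_simp
  ring

lemma bd_sum_q_sq (h : Good c s ⟨d, ⊥⟩) (hs : s ≤ 27) :
    c.Bd 6 0 (∑ u, (⟨d, ⊥⟩ : Inst n).q c u ^ 2) :=
  Bd.sum_fin (m := -2) fun u _ => (h.bd_q (by omega) u).pow_two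

lemma bd_E_inv_gap (h : Good c s ⟨d, ⊥⟩) (hs : s ≤ 27) (hI : (⟨d, ⊥⟩ : Inst n).gs.Nonempty)
    {a b : Fin n} (hab : a ≠ b) :
    0 < gapM n d a b ∧ c.Bd 9 1 (gapM n d a b - n * (c.p * (1 - c.p))) ∧
    c.Bd 190 (-5) ((⟨d, ⊥⟩ : Inst n).E (fun H => ((d b : ℝ) + 1 - cc H a b)⁻¹) -
      ((gapM n d a b)⁻¹ + (∑ u, (⟨d, ⊥⟩ : Inst n).q c u ^ 2) *
        (n * (c.p * (1 - c.p)))⁻¹ ^ 2)) := by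
  have hG := h.bd_E_gap hs hI hab
  have hQ := h.bd_sum_q_sq hs
  have hv := h.bd_var_cc hs hI hab
  have hbad := h.bd_badCod (by omega) hab
  have hgap := fun H (hb : ¬ BadCod c a b H) => h.bd_switch_gap hs (b := b) hb
  have hdeg := h.bd_deg (by omega) b
  set I : Inst n := ⟨d, ⊥⟩ with hIdef
  have hY3 : ∀ H ∈ I.gs, c.Bd 1 2 ((d b : ℝ) + 1 - cc H a b) := fun H hH => by
    have h1 := one_le_switch_gap hab hH
    have h2 := cc_nonneg H a b
    have h3 : (d b : ℝ) ≤ n := by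
      rw [← (Inst.mem_gs.1 hH).1 b]
      calc ∑ w, ad H b w ≤ ∑ _w : Fin n, 1 := sum_le_sum fun _ _ => ad_le_one _ _ _
        _ = n := by simp
    unfold Bd
    rw [abs_of_pos (by linarith), c.σ_zsq, pow_one]
    have := c.hL; have := c.one_le_n
    nlinarith
  have hV : (I.E fun H => ((d b : ℝ) + 1 - cc H a b - I.E fun H => (d b : ℝ) + 1 - cc H a b) ^ 2) =
      I.E fun H => (cc H a b - I.E fun H => cc H a b) ^ 2 := by
    congr 1; funext H; rw [I.E_sub, Inst.E_const hI]; ring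
  obtain ⟨hμ, hE⟩ := bd_E_inv hI (Y := fun H => (d b : ℝ) + 1 - cc H a b) (bad := BadCod c a b)
    (fun H _ hb => hgap H hb) (fun H hH => one_le_switch_gap hab hH) hY3 hbad
    (by rw [hV]; exact hv)
  set μ := I.E fun H => (d b : ℝ) + 1 - cc H a b
  set Q := ∑ u, I.q c u ^ 2
  set g := gapM n d a b
  obtain ⟨hμ0, hμi⟩ := hμ.inv_near (by norm_num)
  have hv0 : c.Bd 0 0 (c.p * (1 - c.p)) := c.bd_p.mul' c.bd_one_sub_p
  have hQv : c.Bd 7 0 (Q - c.p * (1 - c.p)) := hQ.sub' hv0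
  have hg : c.Bd 9 1 (g - n * (c.p * (1 - c.p))) := by
    have h1 : c.Bd 6 1 _ := (hG.mono le_rfl (le_refl _)).up (k' := 6) (m' := 1) (by norm_num)
        (by norm_num)
    have h2 : c.Bd 8 1 _ := h1.add' hμ
    refine (h2.add' hQv (k := 9) (m := 1)).of_eq (by ring)
  obtain ⟨hg0, hgi⟩ := hg.inv_near (by norm_num)
  refine ⟨hg0, hg, ?_⟩
  have hN0 : 0 < n * (c.p * (1 - c.p)) := mul_pos c.n_pos c.var_pos
  have hNi := c.bd_inv_vn
  set N := n * (c.p * (1 - c.p)) with hN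
  have d1 : c.Bd 10 (-3) (μ⁻¹ - N⁻¹) := by
    refine ((hμ.neg.mul' hμi (k := 9) (m := -1)).mul' hNi (k := 10) (m := -3)).of_eq ?_
    field_simp; ring
  have d2 : c.Bd 12 (-3) (g⁻¹ - N⁻¹) := by
    refine ((hg.neg.mul' hgi (k := 11) (m := -1)).mul' hNi (k := 12) (m := -3)).of_eq ?_
    field_simp; ring
  have e1 : c.Bd 169 (-5) ((g - μ - (Q - c.p * (1 - c.p))) * (g⁻¹ * μ⁻¹)) :=
    hG.mul' (hgi.mul' hμi (k := 4) (m := -4))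
  have e2 : c.Bd 14 (-5) ((g⁻¹ - N⁻¹) * μ⁻¹) := d2.mul' hμi
  have e3 : c.Bd 11 (-5) (N⁻¹ * (μ⁻¹ - N⁻¹)) := hNi.mul' d1
  have e4 : c.Bd 15 (-5) _ := e2.add' e3
  have e5 : c.Bd 22 (-5) _ := hQv.mul' e4
  have e6 : c.Bd 170 (-5) _ := e1.add' e5
  refine (hE.add' e6 (k := 190) (m := -5)).of_eq ?_
  have h9 : (n * N)⁻¹ = c.p * (1 - c.p) * N⁻¹ ^ 2 := by
    have h1 := c.n_pos.ne'; have h2 := c.var_pos.ne'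
    have h3 : c.p ≠ 0 := fun h => h2 (by simp [h])
    have h4 : 1 - c.p ≠ 0 := fun h => h2 (by simp [h])
    rw [hN]; field_simp
  have h10 : μ⁻¹ - g⁻¹ = (g - μ) * (g⁻¹ * μ⁻¹) := by field_simp
  rw [h9]
  linear_combination -h10

end Good

lemma sum_mv {n : ℕ} (d : Fin n → ℕ) {a b : Fin n} (hab : a ≠ b) (F : ℕ → ℝ) :
    ∑ v, F (mv d a b v) = ∑ v, F (d v) + (F (d a - 1) - F (d a)) + (F (d b + 1) - F (d b)) := by
  have h : ∀ v, F (mv d a b v) = F (d v) + (if v = a then F (d a - 1) - F (d a) else 0) +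
      (if v = b then F (d b + 1) - F (d b) else 0) := fun v => by
    unfold mv
    by_cases ha : v = a
    · subst ha; simp [hab]
    · by_cases hb : v = b
      · subst hb; simp [ha]
      · simp [ha, hb]
  simp only [h, sum_add_distrib, sum_ite_eq', mem_univ, if_true]

namespace Ctx

variable {n : ℕ} (c : Ctx n)

/-- Normalised square deviation of a degree sequence. -/
def qq (d : Fin n → ℕ) : ℝ := ∑ v, (((d v : ℝ) - c.p * (n - 1)) / n) ^ 2

/-- Logarithm of the main factor for unrestricted graphs. -/
def lg (d : Fin n → ℕ) : ℝ :=
  ∑ v, Real.log ((n - 1).choose (d v)) - c.qq d ^ 2 / (4 * (c.p * (1 - c.p)) ^ 2)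

lemma qq_mv (d : Fin n → ℕ) {a b : Fin n} (hab : a ≠ b) (ha : 1 ≤ d a) :
    c.qq (mv d a b) = c.qq d - 2 * ((d a : ℝ) - d b - 1) / n ^ 2 := by
  rw [qq, sum_mv d hab fun k => (((k : ℝ) - c.p * (n - 1)) / n) ^ 2, qq]
  push_cast [ha]
  have := c.n_pos.ne'
  field_simp
  ring

lemma log_choose_mv {d : Fin n → ℕ} {a b : Fin n} (hab : a ≠ b) (ha : 1 ≤ d a)
    (ha' : d a ≤ n - 1) (hb : d b + 1 ≤ n - 1) :
    ∑ v, Real.log ((n - 1).choose (mv d a b v)) = ∑ v, Real.log ((n - 1).choose (d v)) +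
      Real.log (d a * (n - 1 - d b) / ((n - d a) * (d b + 1))) := by
  rw [sum_mv d hab fun k => Real.log ((n - 1).choose k)]
  have hn : 1 ≤ n := by omega
  obtain ⟨e, he⟩ : ∃ e, d a = e + 1 := ⟨d a - 1, by omega⟩
  have c1 : ((n - 1).choose (d a) : ℝ) * d a = (n - 1).choose (d a - 1) * (n - d a) := by
    have := Nat.choose_succ_right_eq (n - 1) e
    have h2 : (((n - 1 - e : ℕ)) : ℝ) = n - d a := by
      rw [he, Nat.cast_sub (by omega)]; push_cast [hn]; ring
    rw [he, Nat.add_sub_cancel, ← he, ← h2]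
    rw [he]
    exact_mod_cast this
  have c2 : ((n - 1).choose (d b + 1) : ℝ) * (d b + 1) = (n - 1).choose (d b) * (n - 1 - d b) := by
    have := Nat.choose_succ_right_eq (n - 1) (d b)
    have h2 : (((n - 1 - d b : ℕ)) : ℝ) = n - 1 - d b := by
      rw [Nat.cast_sub (by omega)]; push_cast [hn]; ring
    rw [← h2]
    exact_mod_cast this
  have p1 : (0 : ℝ) < (n - 1).choose (d a) := by exact_mod_cast Nat.choose_pos ha'
  have p2 : (0 : ℝ) < (n - 1).choose (d a - 1) := by exact_mod_cast Nat.choose_pos (by omega)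
  have p3 : (0 : ℝ) < (n - 1).choose (d b) := by exact_mod_cast Nat.choose_pos (by omega)
  have p4 : (0 : ℝ) < (n - 1).choose (d b + 1) := by exact_mod_cast Nat.choose_pos hb
  have q1 : (0 : ℝ) < d a := by exact_mod_cast ha
  have q2 : (0 : ℝ) < n - d a := by
    have : d a < n := by omega
    exact sub_pos.2 (by exact_mod_cast this)
  have q3 : (0 : ℝ) < n - 1 - d b := by
    have : ((d b + 1 + 1 : ℕ) : ℝ) ≤ n := by exact_mod_cast (by omega : d b + 1 + 1 ≤ n)
    push_cast at this; linarith
  have l1 := congrArg Real.log c1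
  have l2 := congrArg Real.log c2
  rw [Real.log_mul p1.ne' q1.ne', Real.log_mul p2.ne' q2.ne'] at l1
  rw [Real.log_mul p4.ne' (by positivity), Real.log_mul p3.ne' q3.ne'] at l2
  rw [Real.log_div (by positivity) (by positivity), Real.log_mul q1.ne' q3.ne',
    Real.log_mul q2.ne' (by positivity)]
  linarith

end Ctx

namespace Good

variable {n : ℕ} {c : Ctx n} {s : ℕ} {d : Fin n → ℕ}

open Ctx

lemma bd_log_mv (h : Good c s ⟨d, ⊥⟩) (hs : s ≤ 27) {a b : Fin n} (hab : a ≠ b)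
    (h' : Good c s ⟨mv d a b, ⊥⟩) (hI : (⟨d, ⊥⟩ : Inst n).gs.Nonempty) :
    (⟨mv d a b, ⊥⟩ : Inst n).gs.Nonempty ∧
    c.Bd 210 (-4) (Real.log #(⟨mv d a b, ⊥⟩ : Inst n).gs - Real.log #(⟨d, ⊥⟩ : Inst n).gs -
      (c.lg (mv d a b) - c.lg d)) := by
  have hda : 2 ≤ d a := h.two_le_d (by omega) a
  have hcard := Inst.card_mv (d := d) hab (by omega)
  obtain ⟨hg0, hg, hE⟩ := h.bd_E_inv_gap hs hI hab
  have hQ : c.Bd 6 0 (c.qq d) := (h.bd_sum_q_sq hs).of_eq (by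
    simp only [Inst.q, Inst.dl, x_bot, mul_zero, add_zero]; rfl)
  have hQe : ∑ u, (⟨d, ⊥⟩ : Inst n).q c u ^ 2 = c.qq d := by
    simp only [Inst.q, Inst.dl, x_bot, mul_zero, add_zero]; rfl
  rw [hQe] at hE
  have hΔ : c.Bd 4 1 ((d a : ℝ) - d b - 1) :=
    (h.bd_deg_sub (by omega) a b).sub' (Bd.const (x := 1) (by norm_num))
  set EY := (⟨d, ⊥⟩ : Inst n).E fun H => (d b + 1 - cc H a b)⁻¹ with hEY
  have hgi := (hg.inv_near (by norm_num)).2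
  set g := gapM n d a b with hgdef
  set Δ := (d a : ℝ) - d b - 1 with hΔdef
  set N := n * (c.p * (1 - c.p)) with hN
  have hNi : c.Bd 1 (-2) N⁻¹ := c.bd_inv_vn
  have hz : c.Bd 12 (-3) (Δ * c.qq d * N⁻¹ ^ 2) :=
    (hΔ.mul' hQ (k := 10) (m := 1)).mul' hNi.pow_two
  set z := Δ * c.qq d * N⁻¹ ^ 2 with hzdef
  have hzx : c.Bd 24 (-6) _ := hz.exp_sub (by norm_num) (by norm_num)
  have hr : c.Bd 6 (-1) (Δ * g⁻¹) := hΔ.mul' hgi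
  have hr1 : c.Bd 7 0 (1 + Δ * g⁻¹) := (Bd.const (x := 1) (by norm_num)).add' hr
  have e1 : c.Bd 194 (-4) _ := hΔ.mul' hE
  have e2 : c.Bd 18 (-4) _ := hr.mul' hz
  have e3 : c.Bd 31 (-6) _ := hr1.mul' hzx
  have e4 : c.Bd 32 (-4) _ := e2.add' e3
  have huy : c.Bd 195 (-4) (1 + Δ * EY - (1 + Δ * g⁻¹) * Real.exp z) := by
    refine (e1.sub' e4 (k := 195) (m := -4)).of_eq ?_
    rw [hzdef]; ring
  have hEYb : c.Bd 3 (-2) EY := by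
    have h1 : c.Bd 1 (-2) _ := hE.up (by norm_num) (by norm_num)
    have h2 : c.Bd 1 (-2) (c.qq d * N⁻¹ ^ 2) :=
      (hQ.mul' hNi.pow_two (k := 8) (m := -4)).up (by norm_num) (by norm_num)
    have h3 : c.Bd 2 (-2) _ := h1.add' h2
    exact (h3.add' hgi (k := 3) (m := -2)).of_eq (by ring)
  have hu : 1 / c.L ^ 2 ≤ 1 + Δ * EY := by
    have h1 := (hΔ.mul' hEYb (k := 10) (m := -1)).le_pow (j := 1) le_rfl (by norm_num)
    rw [pow_one] at h1
    have h2 := c.hL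
    have h3 : 1 / c.L ≤ 1 / 2 := one_div_le_one_div_of_le (by norm_num) (by linarith)
    have h4 : 1 / c.L ^ 2 ≤ 1 / 2 := one_div_le_one_div_of_le (by norm_num) (by nlinarith)
    linarith [(abs_le.1 h1).1]
  obtain ⟨hy0, hlog⟩ := huy.log_sub hu (by norm_num) (by norm_num)
  have hu0 : 0 < 1 + Δ * EY := lt_of_lt_of_le (by have := c.L_pos; positivity) hu
  have hr0 : 0 < 1 + Δ * g⁻¹ := pos_of_mul_pos_left hy0 (Real.exp_pos z).le
  have hn := c.n_pos
  have hb1 : (0 : ℝ) < d b + 1 := by positivity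
  have hna : 0 < (n : ℝ) - d a := by
    by_contra hneg
    have : gapM n d a b ≤ 0 :=
      div_nonpos_of_nonpos_of_nonneg (mul_nonpos_of_nonpos_of_nonneg (not_lt.1 hneg) hb1.le) hn.le
    linarith
  have hratio : 1 + Δ * g⁻¹ = d a * (n - 1 - d b) / ((n - d a) * (d b + 1)) := by
    rw [hgdef, gapM, hΔdef]
    field_simp
    ring
  have hda0 : (0 : ℝ) < d a := by exact_mod_cast (by omega : 0 < d a)
  have hnb : 0 < (n : ℝ) - 1 - d b := by
    rw [hratio] at hr0
    have h1 := (div_pos_iff_of_pos_right (mul_pos hna hb1)).1 hr0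
    exact pos_of_mul_pos_right h1 hda0.le
  have hda' : d a ≤ n - 1 := by
    have : (d a : ℝ) < n := by linarith
    have : d a < n := by exact_mod_cast this
    omega
  have hdb' : d b + 1 ≤ n - 1 := by
    have : ((d b + 1 : ℕ) : ℝ) < n := by push_cast; linarith
    have : d b + 1 < n := by exact_mod_cast this
    omega
  set π := (⟨mv d a b, ⊥⟩ : Inst n).E fun H => if (d b + 1 : ℝ) = cc H a b then 1 else 0 with hπ
  have hπb : c.Bd 0 (-40) (1 - (1 - π)) := by
    refine (h'.bd_badCod (by omega) hab).of_abs_le ?_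
    rw [sub_sub_cancel, abs_of_nonneg (Inst.E_nonneg fun H _ => by split_ifs <;> norm_num)]
    refine le_trans (Inst.E_mono fun H hH => ?_) (le_abs_self _)
    split_ifs with h1 h2 h2
    · exact le_rfl
    · exfalso
      have h3 := h'.bd_switch_gap hs (b := b) h2
      have h4 : mv d a b b = d b + 1 := by simp [mv, hab.symm]
      rw [h4] at h3
      push_cast at h3
      rw [h1] at h3
      have h5 := (h3.inv_near (by norm_num)).2.le_pow (j := 1) (by norm_num) (by norm_num)
      rw [show cc H a b + 1 - cc H a b = 1 by ring, inv_one, abs_one, pow_one] at h5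
      have h6 := c.hL
      rw [le_div_iff₀ c.L_pos] at h5
      linarith
    · norm_num
    · exact le_rfl
  obtain ⟨hπ0, hπl⟩ := hπb.log_sub (by
    rw [div_le_one (by have := c.L_pos; positivity)]
    exact one_le_pow₀ c.one_le_L) (by norm_num) (by norm_num)
  have hNpos : (0 : ℝ) < #(⟨d, ⊥⟩ : Inst n).gs := by exact_mod_cast card_pos.2 hI
  have hN'pos : (0 : ℝ) < #(⟨mv d a b, ⊥⟩ : Inst n).gs :=
    pos_of_mul_pos_left (hcard ▸ mul_pos hNpos hu0) hπ0.le
  refine ⟨card_pos.1 (by exact_mod_cast hN'pos), ?_⟩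
  have hl := congrArg Real.log hcard
  rw [Real.log_mul hN'pos.ne' hπ0.ne', Real.log_mul hNpos.ne' hu0.ne'] at hl
  rw [Real.log_one, zero_sub] at hπl
  rw [Real.log_mul hr0.ne' (Real.exp_pos z).ne', Real.log_exp] at hlog
  have hsq : c.Bd 10 (-6) ((Δ * (n : ℝ)⁻¹ * N⁻¹) ^ 2) :=
    ((hΔ.mul' c.bd_inv_n (k := 4) (m := -1)).mul' hNi (k := 5) (m := -3)).pow_two.mono'
  have f1 : c.Bd 199 (-4) _ := hlog.add' hπl
  refine (f1.add' hsq (k := 210) (m := -4)).of_eq ?_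
  rw [lg, lg, log_choose_mv hab (by omega) hda' hdb', qq_mv c d hab (by omega), ← hratio]
  have hlg : Real.log #(⟨mv d a b, ⊥⟩ : Inst n).gs - Real.log #(⟨d, ⊥⟩ : Inst n).gs =
      Real.log (1 + Δ * EY) - Real.log (1 - π) := by linarith
  rw [hlg, hzdef, hN, ← hΔdef]
  have h1 := c.var_pos.ne'
  have h3 : c.p ≠ 0 := fun h => h1 (by simp [h])
  have h4 : 1 - c.p ≠ 0 := fun h => h1 (by simp [h])
  field_simp
  ring

end Good

lemma sum_mv_eq {n : ℕ} (d : Fin n → ℕ) {a b : Fin n} (hab : a ≠ b) (ha : 1 ≤ d a) :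
    ∑ v, (mv d a b v : ℝ) = ∑ v, (d v : ℝ) := by
  rw [sum_mv d hab fun k => (k : ℝ)]
  push_cast [ha]
  ring

namespace Good

variable {n : ℕ} {c : Ctx n}

open Ctx

lemma mv_good {d d' : Fin n → ℕ} (h : Good c 0 ⟨d, ⊥⟩) (h' : Good c 0 ⟨d', ⊥⟩) {a b : Fin n}
    (hab : a ≠ b) (ha : d' a < d a) (hb : d b < d' b) : Good c 0 ⟨mv d a b, ⊥⟩ := by
  refine ⟨fun v => ?_, h.xdeg, ?_, h.sumx⟩
  · have h1 := abs_le.1 (h.deg v)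
    have h2 := abs_le.1 (h'.deg v)
    have h3 : (min (d v) (d' v) : ℕ) ≤ mv d a b v ∧ mv d a b v ≤ max (d v) (d' v) := by
      unfold mv
      split_ifs with e1 e2
      · subst e1; omega
      · subst e2; omega
      · omega
    rcases le_total (d v) (d' v) with e | e
    · rw [min_eq_left e, max_eq_right e] at h3
      have g1 : (d v : ℝ) ≤ mv d a b v := by exact_mod_cast h3.1
      have g2 : (mv d a b v : ℝ) ≤ d' v := by exact_mod_cast h3.2
      exact abs_le.2 ⟨by linarith, by linarith⟩
    · rw [min_eq_right e, max_eq_left e] at h3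
      have g1 : (d' v : ℝ) ≤ mv d a b v := by exact_mod_cast h3.1
      have g2 : (mv d a b v : ℝ) ≤ d v := by exact_mod_cast h3.2
      exact abs_le.2 ⟨by linarith, by linarith⟩
  · have := h.sumd
    simp only [sum_sub_distrib] at this ⊢
    rwa [sum_mv_eq d hab (by omega)]

lemma log_path (m : ℕ) : ∀ {d d' : Fin n → ℕ}, Good c 0 ⟨d, ⊥⟩ → Good c 0 ⟨d', ⊥⟩ →
    ∑ v, (d v : ℝ) = ∑ v, (d' v : ℝ) → ∑ v, (d v - d' v) ≤ m → (⟨d, ⊥⟩ : Inst n).gs.Nonempty →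
    (⟨d', ⊥⟩ : Inst n).gs.Nonempty ∧
    |Real.log #(⟨d', ⊥⟩ : Inst n).gs - Real.log #(⟨d, ⊥⟩ : Inst n).gs - (c.lg d' - c.lg d)| ≤
      m * (c.L ^ 210 * c.σ ^ (-4 : ℤ)) := by
  induction m with
  | zero =>
    intro d d' h h' hs hm hI
    have h1 : ∀ v, d v ≤ d' v := fun v => by
      have := (sum_eq_zero_iff.1 (Nat.le_zero.1 hm)) v (mem_univ v); omega
    have h2 : d = d' := by
      funext v
      have := (sum_eq_sum_iff_of_le fun v _ => (h1 v)).1 (by exact_mod_cast hs) v (mem_univ v)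
      exact this
    subst h2
    exact ⟨hI, by simp⟩
  | succ m ih =>
    intro d d' h h' hs hm hI
    have hε := c.bd_nonneg 210 (-4)
    by_cases hm' : ∑ v, (d v - d' v) ≤ m
    · obtain ⟨i1, i2⟩ := ih h h' hs hm' hI
      exact ⟨i1, i2.trans (mul_le_mul_of_nonneg_right (by push_cast; linarith) hε)⟩
    have hsN : ∑ v, d v = ∑ v, d' v := by exact_mod_cast hs
    obtain ⟨a, ha⟩ : ∃ a, d' a < d a := by
      by_contra! hcon
      exact hm' (by rw [sum_eq_zero fun v _ => Nat.sub_eq_zero_of_le (hcon v)]; omega)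
    obtain ⟨b, hb⟩ : ∃ b, d b < d' b := by
      by_contra! hcon
      exact (sum_lt_sum (fun v _ => hcon v) ⟨a, mem_univ a, ha⟩).ne' hsN
    have hab : a ≠ b := by rintro rfl; omega
    have hg := h.mv_good h' hab ha hb
    obtain ⟨j1, j2⟩ := h.bd_log_mv (by omega) hab hg hI
    have hlt : ∑ v, (mv d a b v - d' v) < ∑ v, (d v - d' v) := by
      refine sum_lt_sum (fun v _ => ?_) ⟨a, mem_univ a, ?_⟩
      · unfold mv; split_ifs with e1 e2
        · subst e1; omega
        · subst e2; omega
        · exact le_rfl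
      · simp only [mv, if_true]; omega
    obtain ⟨i1, i2⟩ := ih hg h' (by rw [sum_mv_eq d hab (by omega), hs]) (by omega) j1
    refine ⟨i1, ?_⟩
    have := abs_add_le (Real.log #(⟨d', ⊥⟩ : Inst n).gs - Real.log #(⟨mv d a b, ⊥⟩ : Inst n).gs -
      (c.lg d' - c.lg (mv d a b))) (Real.log #(⟨mv d a b, ⊥⟩ : Inst n).gs -
      Real.log #(⟨d, ⊥⟩ : Inst n).gs - (c.lg (mv d a b) - c.lg d))
    rw [show (Real.log #(⟨d', ⊥⟩ : Inst n).gs - Real.log #(⟨mv d a b, ⊥⟩ : Inst n).gs -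
      (c.lg d' - c.lg (mv d a b))) + (Real.log #(⟨mv d a b, ⊥⟩ : Inst n).gs -
      Real.log #(⟨d, ⊥⟩ : Inst n).gs - (c.lg (mv d a b) - c.lg d)) =
      Real.log #(⟨d', ⊥⟩ : Inst n).gs - Real.log #(⟨d, ⊥⟩ : Inst n).gs - (c.lg d' - c.lg d) by
        ring] at this
    have j3 : _ ≤ _ := j2
    push_cast
    linarith

/-- The number of graphs with a given degree sequence is proportional to the predicted one. -/
lemma bd_log_sub_lg {d d' : Fin n → ℕ} (h : Good c 0 ⟨d, ⊥⟩) (h' : Good c 0 ⟨d', ⊥⟩)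
    (hs : ∑ v, (d v : ℝ) = ∑ v, (d' v : ℝ)) (hI : (⟨d, ⊥⟩ : Inst n).gs.Nonempty) :
    (⟨d', ⊥⟩ : Inst n).gs.Nonempty ∧
    c.Bd 213 (-1) (Real.log #(⟨d', ⊥⟩ : Inst n).gs - Real.log #(⟨d, ⊥⟩ : Inst n).gs -
      (c.lg d' - c.lg d)) := by
  obtain ⟨i1, i2⟩ := log_path _ h h' hs le_rfl hI
  refine ⟨i1, ?_⟩
  have h1 : c.Bd 3 3 ((∑ v, (d v - d' v) : ℕ) : ℝ) := by
    push_cast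
    refine Bd.sum_fin (m := 1) fun v _ => ?_
    have h2 := (h.bd_deg (by omega) v).sub (h'.bd_deg (by omega) v)
    refine h2.of_abs_le ?_
    rw [Nat.abs_cast]
    dsimp only
    rw [sub_sub_sub_cancel_right]
    rcases le_total (d v) (d' v) with e | e
    · rw [Nat.sub_eq_zero_of_le e]; simp
    · rw [Nat.cast_sub e]; exact le_abs_self _
  have h3 : c.Bd 210 (-4) (c.L ^ 210 * c.σ ^ (-4 : ℤ)) := by
    unfold Bd; rw [abs_of_nonneg (c.bd_nonneg _ _)]
  exact (h1.mul' h3 (k := 213) (m := -1)).of_abs_le (i2.trans (le_abs_self _))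

end Good

section

variable {n : ℕ}

/-- Sequences of `n` numbers below `n` with sum `t`. -/
def seqs (n t : ℕ) : Finset (Fin n → ℕ) :=
  (Fintype.piFinset fun _ : Fin n => range n).filter fun d => ∑ v, d v = t

lemma mem_seqs {n t : ℕ} {d : Fin n → ℕ} : d ∈ seqs n t ↔ (∀ v, d v < n) ∧ ∑ v, d v = t := by
  simp [seqs, Fintype.mem_piFinset]

lemma sum_prod_choose (n t : ℕ) (hn : 1 ≤ n) :
    ∑ d ∈ seqs n t, ∏ v, (n - 1).choose (d v) = (n * (n - 1)).choose t := by
  have h1 : ((1 + Polynomial.X : Polynomial ℕ) ^ (n - 1)) =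
      ∑ k ∈ range n, Polynomial.monomial k ((n - 1).choose k) := by
    rw [add_comm, add_pow, Nat.sub_add_cancel hn]
    refine sum_congr rfl fun k _ => ?_
    rw [one_pow, mul_one, ← Polynomial.C_mul_X_pow_eq_monomial, mul_comm]
    simp
  have h2 : (1 + Polynomial.X : Polynomial ℕ) ^ (n * (n - 1)) =
      ∏ _v : Fin n, ∑ k ∈ range n, Polynomial.monomial k ((n - 1).choose k) := by
    rw [prod_const, card_univ, Fintype.card_fin, ← h1, ← pow_mul, mul_comm]
  have h3 := congrArg (fun P => Polynomial.coeff P t) h2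
  simp only [Polynomial.coeff_one_add_X_pow, Nat.cast_id] at h3
  rw [h3, prod_univ_sum, Polynomial.finsetSum_coeff, seqs, sum_filter]
  refine sum_congr rfl fun d _ => ?_
  have h4 : ∀ s : Finset (Fin n), ∏ v ∈ s, Polynomial.monomial (d v) ((n - 1).choose (d v)) =
      Polynomial.monomial (∑ v ∈ s, d v) (∏ v ∈ s, (n - 1).choose (d v)) := fun s => by
    induction s using Finset.induction_on with
    | empty => simp
    | insert a s ha ih =>
      rw [prod_insert ha, prod_insert ha, sum_insert ha, ih, Polynomial.monomial_mul_monomial]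
  rw [h4, Polynomial.coeff_monomial]

/-- Binomial weights. -/
def bw (n : ℕ) (p : ℝ) (k : ℕ) : ℝ := (n - 1).choose k * p ^ k * (1 - p) ^ (n - 1 - k)

lemma bw_nonneg {p : ℝ} (h0 : 0 ≤ p) (h1 : p ≤ 1) (k : ℕ) : 0 ≤ bw n p k := by
  have : 0 ≤ 1 - p := by linarith
  unfold bw; positivity

lemma sum_bw (hn : 1 ≤ n) (p : ℝ) : ∑ k ∈ range n, bw n p k = 1 := by
  have h := add_pow p (1 - p) (n - 1)
  rw [Nat.sub_add_cancel hn, add_sub_cancel, one_pow] at h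
  rw [h]
  exact sum_congr rfl fun k _ => by unfold bw; ring

/-- Comparison of the multivariate hypergeometric law with a product of binomial laws. -/
lemma sum_seqs_le {t : ℕ} (ht : t ≤ n * (n - 1)) {h : Fin n → ℕ → ℝ} (hh : ∀ v k, 0 ≤ h v k)
    {p : ℝ} (hp : p = (t : ℝ) / (n * (n - 1) : ℕ)) :
    ∑ d ∈ seqs n t, (∏ v, ((n - 1).choose (d v) : ℝ)) * ∏ v, h v (d v) ≤
      ((n * (n - 1) : ℕ) + 1) * (n * (n - 1)).choose t *
        ∏ v, ∑ k ∈ range n, bw n p k * h v k := by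
  have hp0 : 0 ≤ p := by rw [hp]; positivity
  have hp1 : p ≤ 1 := by
    rw [hp]; exact div_le_one_of_le₀ (by exact_mod_cast ht) (by positivity)
  have hmode := binom_mode ht
  rw [← hp] at hmode
  set m := n * (n - 1) with hm
  set C : ℝ := (m + 1) * m.choose t with hC
  have hC0 : 0 ≤ C := by positivity
  have key : ∀ d ∈ seqs n t, (∏ v, ((n - 1).choose (d v) : ℝ)) * ∏ v, h v (d v) ≤
      C * ∏ v, (bw n p (d v) * h v (d v)) := fun d hd => by
    obtain ⟨h1, h2⟩ := mem_seqs.1 hd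
    have h3 : ∏ v, (bw n p (d v) * h v (d v)) =
        ((∏ v, ((n - 1).choose (d v) : ℝ)) * ∏ v, h v (d v)) * (p ^ t * (1 - p) ^ (m - t)) := by
      have h4 : ∑ v, (n - 1 - d v) = m - t := by
        have : ∑ v, (n - 1 - d v) + ∑ v, d v = m := by
          rw [← sum_add_distrib]
          calc _ = ∑ _v : Fin n, (n - 1) := sum_congr rfl fun v _ => by have := h1 v; omega
            _ = m := by simp [hm]
        omega
      simp only [bw, prod_mul_distrib]
      rw [prod_pow_eq_pow_sum, prod_pow_eq_pow_sum, h2, h4]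
      ring
    rw [h3]
    have h5 : 0 ≤ (∏ v, ((n - 1).choose (d v) : ℝ)) * ∏ v, h v (d v) :=
      mul_nonneg (prod_nonneg fun _ _ => by positivity) (prod_nonneg fun _ _ => hh _ _)
    have h6 : C * (p ^ t * (1 - p) ^ (m - t)) = (m + 1 : ℝ) *
        (m.choose t * p ^ t * (1 - p) ^ (m - t)) := by
      rw [hC]; ring
    rw [mul_left_comm, h6]
    exact le_mul_of_one_le_right h5 hmode
  calc _ ≤ ∑ d ∈ seqs n t, C * ∏ v, (bw n p (d v) * h v (d v)) := sum_le_sum key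
    _ ≤ ∑ d ∈ Fintype.piFinset fun _ : Fin n => range n, C * ∏ v, (bw n p (d v) * h v (d v)) :=
      sum_le_sum_of_subset_of_nonneg (filter_subset _ _) fun d _ _ =>
        mul_nonneg hC0 (prod_nonneg fun v _ => mul_nonneg (bw_nonneg hp0 hp1 _) (hh _ _))
    _ = _ := by rw [← mul_sum, prod_univ_sum]

lemma sum_bw_sq {p : ℝ} (hn : 1 ≤ n) :
    ∑ k ∈ range n, bw n p k * ((k : ℝ) - p * (n - 1)) ^ 2 = (n - 1) * (p * (1 - p)) := by
  have h := congrArg (Polynomial.eval p) (bernsteinPolynomial.variance ℝ (n - 1))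
  rw [Polynomial.eval_finsetSum, Nat.sub_add_cancel hn] at h
  have h2 : (((n - 1 : ℕ)) : ℝ) = n - 1 := by push_cast [hn]; ring
  simp only [bernsteinPolynomial, Polynomial.eval_mul, Polynomial.eval_pow, Polynomial.eval_sub,
    Polynomial.eval_X, Polynomial.eval_one, Polynomial.eval_natCast, nsmul_eq_mul, h2] at h
  rw [← mul_assoc, ← h]
  exact sum_congr rfl fun k _ => by unfold bw; ring

lemma bw_mgf {p : ℝ} (hn : 1 ≤ n) (h0 : 0 ≤ p) (h1 : p ≤ 1) {θ : ℝ} (hθ : |θ| ≤ 1) :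
    ∑ k ∈ range n, bw n p k * Real.exp (θ * (k - p * (n - 1))) ≤ Real.exp (n * θ ^ 2) := by
  have h2 : (((n - 1 : ℕ)) : ℝ) = n - 1 := by push_cast [hn]; ring
  have e1 : ∑ k ∈ range n, bw n p k * Real.exp (θ * (k - p * (n - 1))) =
      ((p * Real.exp θ + (1 - p)) * Real.exp (-(θ * p))) ^ (n - 1) := by
    rw [mul_pow, add_pow, Nat.sub_add_cancel hn, sum_mul]
    refine sum_congr rfl fun k _ => ?_
    have : Real.exp (θ * (k - p * (n - 1))) =
        Real.exp θ ^ k * Real.exp (-(θ * p)) ^ (n - 1) := by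
      rw [← Real.exp_nat_mul, ← Real.exp_nat_mul, ← Real.exp_add, h2]; congr 1; ring
    rw [this, bw, mul_pow]; ring
  have e2 : Real.exp θ ≤ 1 + θ + θ ^ 2 := by
    have := (abs_le.1 (Real.abs_exp_sub_one_sub_id_le hθ)).2; linarith
  have e3 : (p * Real.exp θ + (1 - p)) * Real.exp (-(θ * p)) ≤ Real.exp (θ ^ 2) := by
    have h3 : p * Real.exp θ + (1 - p) ≤ Real.exp (p * θ + θ ^ 2) := by
      refine le_trans ?_ (Real.add_one_le_exp _)
      nlinarith [sq_nonneg θ]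
    calc _ ≤ Real.exp (p * θ + θ ^ 2) * Real.exp (-(θ * p)) :=
          mul_le_mul_of_nonneg_right h3 (Real.exp_pos _).le
      _ = _ := by rw [← Real.exp_add]; congr 1; ring
  rw [e1]
  have h4 : 0 ≤ 1 - p := by linarith
  calc _ ≤ Real.exp (θ ^ 2) ^ (n - 1) := pow_le_pow_left₀ (by positivity) e3 _
    _ = Real.exp ((n - 1) * θ ^ 2) := by rw [← Real.exp_nat_mul, h2]
    _ ≤ _ := Real.exp_le_exp.2 (by nlinarith [sq_nonneg θ])

end

namespace Ctx

variable {n : ℕ} (c : Ctx n)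

lemma nat_pos (c : Ctx n) : 1 ≤ n := by exact_mod_cast c.one_le_n

lemma bw_nonneg (k : ℕ) : 0 ≤ bw n c.p k := _root_.bw_nonneg c.hp0.le c.hp1.le k

/-- The centre of the degrees. -/
def μ : ℝ := c.p * (n - 1)

lemma exp_one_le_three : Real.exp 1 ≤ 3 := by have := Real.exp_one_lt_d9; linarith

lemma bw_tail : ∑ k ∈ range n, bw n c.p k * (if c.L * c.σ < |(k : ℝ) - c.μ| then 1 else 0) ≤
    6 * Real.exp (-c.L) := by
  have hσ := c.σ_pos
  have hinv : |c.σ⁻¹| ≤ 1 := by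
    rw [abs_of_pos (inv_pos.2 hσ)]; exact inv_le_one_of_one_le₀ c.one_le_σ
  have hsq : (n : ℝ) * (c.σ⁻¹) ^ 2 = 1 := by
    rw [inv_pow, c.σ_sq]; exact mul_inv_cancel₀ c.n_pos.ne'
  have h1 := bw_mgf c.nat_pos c.hp0.le c.hp1.le (θ := c.σ⁻¹) hinv
  have h2 := bw_mgf c.nat_pos c.hp0.le c.hp1.le (θ := -c.σ⁻¹) (by rwa [abs_neg])
  rw [neg_sq] at h2
  rw [hsq] at h1 h2
  have key : ∀ k ∈ range n, bw n c.p k * (if c.L * c.σ < |(k : ℝ) - c.μ| then 1 else 0) ≤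
      Real.exp (-c.L) * (bw n c.p k * Real.exp (c.σ⁻¹ * (k - c.p * (n - 1))) +
        bw n c.p k * Real.exp (-c.σ⁻¹ * (k - c.p * (n - 1)))) := fun k _ => by
    rw [← mul_add, mul_left_comm]
    refine mul_le_mul_of_nonneg_left ?_ (c.bw_nonneg k)
    split_ifs with h
    · have e1 : c.L ≤ c.σ⁻¹ * |(k : ℝ) - c.μ| := by
        rw [← div_eq_inv_mul, le_div_iff₀ hσ]; exact h.le
      have e2 : Real.exp c.L ≤ Real.exp (c.σ⁻¹ * (k - c.p * (n - 1))) +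
          Real.exp (-c.σ⁻¹ * (k - c.p * (n - 1))) := by
        rcases abs_cases ((k : ℝ) - c.μ) with ⟨h', _⟩ | ⟨h', _⟩ <;> rw [h'] at e1 <;>
          unfold μ at e1
        · have := Real.exp_le_exp.2 e1
          have := Real.exp_pos (-c.σ⁻¹ * (k - c.p * (n - 1)))
          linarith
        · rw [mul_neg, ← neg_mul] at e1
          have := Real.exp_le_exp.2 e1
          have := Real.exp_pos (c.σ⁻¹ * (k - c.p * (n - 1)))
          linarith
      calc (1 : ℝ) = Real.exp (-c.L) * Real.exp c.L := by rw [← Real.exp_add]; simp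
        _ ≤ _ := mul_le_mul_of_nonneg_left e2 (Real.exp_pos _).le
    · positivity
  calc _ ≤ _ := sum_le_sum key
    _ = Real.exp (-c.L) * (_ + _) := by rw [← mul_sum, sum_add_distrib]
    _ ≤ Real.exp (-c.L) * (3 + 3) := by
      have := exp_one_le_three
      exact mul_le_mul_of_nonneg_left (add_le_add (h1.trans this) (h2.trans this))
        (Real.exp_pos _).le
    _ = _ := by ring

/-- Truncated squared deviation. -/
def tr (k : ℕ) : ℝ := if |(k : ℝ) - c.μ| ≤ c.L * c.σ then ((k : ℝ) - c.μ) ^ 2 else 0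

/-- Mean of the truncated squared deviation. -/
def mtr : ℝ := ∑ k ∈ range n, bw n c.p k * c.tr k

lemma tr_nonneg (k : ℕ) : 0 ≤ c.tr k := by unfold tr; split_ifs <;> positivity

lemma tr_le (k : ℕ) : c.tr k ≤ c.L ^ 2 * n := by
  unfold tr
  split_ifs with h
  · rw [← c.σ_sq, ← mul_pow, ← sq_abs]
    exact pow_le_pow_left₀ (abs_nonneg _) h 2
  · have := c.L_pos; positivity

lemma mtr_nonneg : 0 ≤ c.mtr := sum_nonneg fun k _ => mul_nonneg (c.bw_nonneg k) (c.tr_nonneg k)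

lemma mtr_le : c.mtr ≤ c.L ^ 2 * n := by
  calc c.mtr ≤ ∑ k ∈ range n, bw n c.p k * (c.L ^ 2 * n) :=
        sum_le_sum fun k _ => mul_le_mul_of_nonneg_left (c.tr_le k) (c.bw_nonneg k)
    _ = _ := by rw [← sum_mul, sum_bw c.nat_pos, one_mul]

lemma exp_neg_L_le : Real.exp (-c.L) ≤ 1 / (n : ℝ) ^ 20 := by
  rw [Real.exp_neg, ← one_div]
  exact one_div_le_one_div_of_le (pow_pos c.n_pos _) c.hexp

lemma thousand_le_n (c : Ctx n) : (1000 : ℝ) ≤ n := by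
  have : c.L ≤ c.L ^ 1000 := le_self_pow₀ c.one_le_L (by norm_num)
  linarith [c.hL, c.hn]

lemma mtr_near : |c.mtr - (n - 1) * (c.p * (1 - c.p))| ≤ 1 := by
  have hn := c.one_le_n
  have h1 : (n - 1) * (c.p * (1 - c.p)) - c.mtr = ∑ k ∈ range n, bw n c.p k *
      (((k : ℝ) - c.μ) ^ 2 - c.tr k) := by
    rw [← sum_bw_sq c.nat_pos, mtr, ← sum_sub_distrib]
    exact sum_congr rfl fun k _ => by unfold μ; ring
  have h2 : ∀ k ∈ range n, bw n c.p k * (((k : ℝ) - c.μ) ^ 2 - c.tr k) ≤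
      (n : ℝ) ^ 2 * (bw n c.p k * (if c.L * c.σ < |(k : ℝ) - c.μ| then 1 else 0)) := fun k hk => by
    rw [mul_left_comm]
    refine mul_le_mul_of_nonneg_left ?_ (c.bw_nonneg k)
    unfold tr
    split_ifs with h3 h4 h4
    · exact absurd h4 (not_lt.2 h3)
    · simp
    · have hk' : (k : ℝ) ≤ n - 1 := by
        have := Nat.succ_le_of_lt (mem_range.1 hk)
        have : ((k + 1 : ℕ) : ℝ) ≤ n := by exact_mod_cast this
        push_cast at this; linarith
      rw [sub_zero, mul_one, ← sq_abs]
      refine pow_le_pow_left₀ (abs_nonneg _) ?_ 2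
      have := c.hp0
      have := c.hp1
      have h0 : (0 : ℝ) ≤ k := by positivity
      rw [abs_le]; unfold μ; constructor <;> nlinarith
    · exact absurd (not_le.1 h3) h4
  have h3 : ∀ k ∈ range n, 0 ≤ bw n c.p k * (((k : ℝ) - c.μ) ^ 2 - c.tr k) := fun k _ => by
    refine mul_nonneg (c.bw_nonneg k) ?_
    unfold tr; split_ifs <;> nlinarith [sq_nonneg ((k : ℝ) - c.μ)]
  rw [abs_sub_comm, h1, abs_of_nonneg (sum_nonneg h3)]
  calc _ ≤ _ := sum_le_sum h2
    _ ≤ (n : ℝ) ^ 2 * (6 * (1 / (n : ℝ) ^ 20)) := by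
      rw [← mul_sum]
      have := c.bw_tail
      have := c.exp_neg_L_le
      gcongr
      linarith
    _ = 6 / (n : ℝ) ^ 18 := by field_simp
    _ ≤ 1 := by
      rw [div_le_one (by positivity)]
      have : (n : ℝ) ≤ (n : ℝ) ^ 18 := le_self_pow₀ hn (by norm_num)
      linarith [c.thousand_le_n]

lemma tr_mgf {θ : ℝ} (hθ : |θ| * (c.L ^ 2 * (n * c.σ)) = 1) :
    ∑ k ∈ range n, bw n c.p k * Real.exp (θ * (c.tr k - c.mtr)) ≤ Real.exp (1 / n) := by
  have hL := c.L_pos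
  have hn := c.n_pos
  have hσ := c.σ_pos
  have hab : ∀ k, |c.tr k - c.mtr| ≤ c.L ^ 2 * n := fun k => by
    rw [abs_le]
    constructor <;> linarith [c.tr_nonneg k, c.tr_le k, c.mtr_nonneg, c.mtr_le]
  have h1 : |θ| * (c.L ^ 2 * n) = 1 / c.σ := by
    rw [eq_div_iff hσ.ne']; rw [← hθ]; ring
  have h2 : ∀ k ∈ range n, bw n c.p k * Real.exp (θ * (c.tr k - c.mtr)) ≤
      bw n c.p k + θ * (bw n c.p k * c.tr k - bw n c.p k * c.mtr) + bw n c.p k * (1 / n) :=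
    fun k _ => by
    have e1 : |θ * (c.tr k - c.mtr)| ≤ 1 / c.σ := by
      rw [abs_mul, ← h1]
      exact mul_le_mul_of_nonneg_left (hab k) (abs_nonneg _)
    have e2 : 1 / c.σ ≤ 1 := by rw [div_le_one hσ]; exact c.one_le_σ
    have e3 := (abs_le.1 (Real.abs_exp_sub_one_sub_id_le (e1.trans e2))).2
    have e4 : (θ * (c.tr k - c.mtr)) ^ 2 ≤ 1 / n := by
      rw [← c.σ_sq, ← one_div_pow, ← sq_abs]
      exact pow_le_pow_left₀ (abs_nonneg _) e1 2
    have e5 : Real.exp (θ * (c.tr k - c.mtr)) ≤ 1 + θ * (c.tr k - c.mtr) + 1 / n := by linarith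
    have := mul_le_mul_of_nonneg_left e5 (c.bw_nonneg k)
    linarith
  calc _ ≤ _ := sum_le_sum h2
    _ = 1 + 1 / n := by
      rw [sum_add_distrib, sum_add_distrib, ← mul_sum, sum_sub_distrib, ← sum_mul, ← sum_mul,
        sum_bw c.nat_pos]
      unfold mtr; ring
    _ ≤ _ := by rw [add_comm]; exact Real.add_one_le_exp _

end Ctx

/-- The number of ways of choosing `d v` elements in each of `n` sets of size `n - 1`. -/
def wt {n : ℕ} (d : Fin n → ℕ) : ℝ := ∏ v, ((n - 1).choose (d v) : ℝ)

lemma wt_nonneg {n : ℕ} (d : Fin n → ℕ) : 0 ≤ wt d := prod_nonneg fun _ _ => by positivity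

namespace Ctx

variable {n : ℕ} (c : Ctx n)

/-- The sequences with all degrees near the mean. -/
def Box (d : Fin n → ℕ) : Prop := ∀ v, |(d v : ℝ) - c.μ| ≤ c.L * c.σ

/-- The sequences with all degrees near the mean and typical variance. -/
def Typ (d : Fin n → ℕ) : Prop :=
  c.Box d ∧ |∑ v, ((d v : ℝ) - c.μ) ^ 2 - n * c.mtr| ≤ c.L ^ 3 * (n * c.σ)

variable {c} {t : ℕ}

lemma sum_not_box (ht : t ≤ n * (n - 1)) (hp : c.p = (t : ℝ) / (n * (n - 1) : ℕ)) :
    ∑ d ∈ (seqs n t).filter (fun d => ¬ c.Box d), wt d ≤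
      n * (((n * (n - 1) : ℕ) + 1) * (n * (n - 1)).choose t * (6 * Real.exp (-c.L))) := by
  have h1 : ∀ u : Fin n, ∑ d ∈ seqs n t, wt d * (if c.L * c.σ < |(d u : ℝ) - c.μ| then 1 else 0) ≤
      ((n * (n - 1) : ℕ) + 1) * (n * (n - 1)).choose t * (6 * Real.exp (-c.L)) := fun u => by
    have h := sum_seqs_le ht (h := fun v k => if v = u then
      (if c.L * c.σ < |(k : ℝ) - c.μ| then 1 else 0) else 1)
      (fun v k => by split_ifs <;> norm_num) hp
    have e1 : ∀ d : Fin n → ℕ, ∏ v, (if v = u then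
        (if c.L * c.σ < |((d v : ℕ) : ℝ) - c.μ| then (1 : ℝ) else 0) else 1) =
        if c.L * c.σ < |(d u : ℝ) - c.μ| then 1 else 0 := fun d => by
      rw [prod_ite_eq']; simp
    simp only [e1] at h
    refine h.trans (mul_le_mul_of_nonneg_left ?_ (by positivity))
    refine le_trans (le_of_eq ?_) c.bw_tail
    rw [prod_eq_single u]
    · simp
    · intro v _ hv
      simp only [hv, if_false, mul_one]
      exact sum_bw c.nat_pos _
    · simp
  calc _ ≤ ∑ d ∈ seqs n t, wt d * ∑ u : Fin n,
          (if c.L * c.σ < |(d u : ℝ) - c.μ| then 1 else 0) := by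
        rw [sum_filter]
        refine sum_le_sum fun d _ => ?_
        have h0 : ∀ u : Fin n, (0 : ℝ) ≤ if c.L * c.σ < |(d u : ℝ) - c.μ| then 1 else 0 :=
          fun u => by split_ifs <;> norm_num
        split_ifs with hb
        · exact mul_nonneg (wt_nonneg d) (sum_nonneg fun u _ => h0 u)
        · unfold Ctx.Box at hb
          push Not at hb
          obtain ⟨u, hu⟩ := hb
          refine le_mul_of_one_le_right (wt_nonneg d) ?_
          refine le_trans ?_ (single_le_sum (fun u _ => h0 u) (mem_univ u))
          rw [if_pos hu]
    _ = ∑ u : Fin n, ∑ d ∈ seqs n t, wt d * (if c.L * c.σ < |(d u : ℝ) - c.μ| then 1 else 0) := by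
        rw [sum_comm]; exact sum_congr rfl fun d _ => mul_sum _ _ _
    _ ≤ ∑ _u : Fin n, _ := sum_le_sum fun u _ => h1 u
    _ = _ := by simp

lemma sum_mgf {θ : ℝ} (hθ : |θ| * (c.L ^ 2 * (n * c.σ)) = 1) (ht : t ≤ n * (n - 1))
    (hp : c.p = (t : ℝ) / (n * (n - 1) : ℕ)) :
    ∑ d ∈ seqs n t, wt d * Real.exp (θ * (∑ v, c.tr (d v) - n * c.mtr)) ≤
      ((n * (n - 1) : ℕ) + 1) * (n * (n - 1)).choose t * 3 := by
  have h := sum_seqs_le ht (h := fun _ k => Real.exp (θ * (c.tr k - c.mtr)))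
      (fun v k => (Real.exp_pos _).le) hp
  have e1 : ∀ d : Fin n → ℕ, ∏ v, Real.exp (θ * (c.tr (d v) - c.mtr)) =
      Real.exp (θ * (∑ v, c.tr (d v) - n * c.mtr)) := fun d => by
    rw [← Real.exp_sum, ← mul_sum, sum_sub_distrib]; simp
  simp only [e1] at h
  refine h.trans (mul_le_mul_of_nonneg_left ?_ (by positivity))
  calc _ ≤ ∏ _v : Fin n, Real.exp (1 / n) :=
        prod_le_prod (fun v _ => sum_nonneg fun k _ => mul_nonneg (c.bw_nonneg k)
            (Real.exp_pos _).le)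
          fun v _ => c.tr_mgf hθ
    _ = Real.exp 1 := by
      have := c.n_pos.ne'
      rw [← Real.exp_sum]; simp [this]
    _ ≤ 3 := exp_one_le_three

lemma sum_box_not_typ (ht : t ≤ n * (n - 1)) (hp : c.p = (t : ℝ) / (n * (n - 1) : ℕ)) :
    ∑ d ∈ (seqs n t).filter (fun d => c.Box d ∧ ¬ c.Typ d), wt d ≤
      ((n * (n - 1) : ℕ) + 1) * (n * (n - 1)).choose t * (6 * Real.exp (-c.L)) := by
  have hL := c.L_pos
  have hn := c.n_pos
  have hσ := c.σ_pos
  set θ : ℝ := (c.L ^ 2 * (n * c.σ))⁻¹ with hθd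
  have hθ0 : 0 < θ := by positivity
  have hθ1 : |θ| * (c.L ^ 2 * (n * c.σ)) = 1 := by
    rw [abs_of_pos hθ0]; exact inv_mul_cancel₀ (by positivity)
  have hθ2 : |-θ| * (c.L ^ 2 * (n * c.σ)) = 1 := by rwa [abs_neg]
  have hθL : θ * (c.L ^ 3 * (n * c.σ)) = c.L := by
    rw [hθd]; field_simp
  have g1 := sum_mgf hθ1 ht hp
  have g2 := sum_mgf hθ2 ht hp
  calc _ ≤ ∑ d ∈ seqs n t, Real.exp (-c.L) * (
          wt d * Real.exp (θ * (∑ v, c.tr (d v) - n * c.mtr)) +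
          wt d * Real.exp (-θ * (∑ v, c.tr (d v) - n * c.mtr))) := by
        rw [sum_filter]
        refine sum_le_sum fun d _ => ?_
        rw [← mul_add, mul_left_comm]
        split_ifs with hb
        · obtain ⟨hb, ht⟩ := hb
          have e0 : ∑ v, c.tr (d v) = ∑ v, ((d v : ℝ) - c.μ) ^ 2 :=
            sum_congr rfl fun v _ => by rw [tr, if_pos (hb v)]
          have e1 : c.L ^ 3 * (n * c.σ) < |∑ v, c.tr (d v) - n * c.mtr| := by
            rw [e0]
            exact not_le.1 fun h => ht ⟨hb, h⟩
          have e2 : c.L ≤ θ * |∑ v, c.tr (d v) - n * c.mtr| := by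
            calc c.L = _ := hθL.symm
              _ ≤ _ := mul_le_mul_of_nonneg_left e1.le hθ0.le
          refine le_mul_of_one_le_right (wt_nonneg d) ?_
          have e3 : Real.exp c.L ≤ Real.exp (θ * (∑ v, c.tr (d v) - n * c.mtr)) +
              Real.exp (-θ * (∑ v, c.tr (d v) - n * c.mtr)) := by
            rcases abs_cases (∑ v, c.tr (d v) - n * c.mtr) with ⟨h', _⟩ | ⟨h', _⟩ <;> rw [h'] at e2
            · have := Real.exp_le_exp.2 e2
              have := Real.exp_pos (-θ * (∑ v, c.tr (d v) - n * c.mtr))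
              linarith
            · rw [mul_neg, ← neg_mul] at e2
              have := Real.exp_le_exp.2 e2
              have := Real.exp_pos (θ * (∑ v, c.tr (d v) - n * c.mtr))
              linarith
          calc (1 : ℝ) = Real.exp (-c.L) * Real.exp c.L := by rw [← Real.exp_add]; simp
            _ ≤ _ := mul_le_mul_of_nonneg_left e3 (Real.exp_pos _).le
        · have := wt_nonneg d
          positivity
    _ = Real.exp (-c.L) * (_ + _) := by rw [← mul_sum, sum_add_distrib]
    _ ≤ Real.exp (-c.L) * (_ + _) :=
      mul_le_mul_of_nonneg_left (add_le_add g1 g2) (Real.exp_pos _).le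
    _ = _ := by ring

lemma sum_not_typ (ht : t ≤ n * (n - 1)) (hp : c.p = (t : ℝ) / (n * (n - 1) : ℕ)) :
    ∑ d ∈ (seqs n t).filter (fun d => ¬ c.Typ d), wt d ≤ (n * (n - 1)).choose t / n := by
  have hn := c.thousand_le_n
  have h1 := sum_not_box ht hp
  have h2 := sum_box_not_typ ht hp
  have h3 : ∑ d ∈ (seqs n t).filter (fun d => ¬ c.Typ d), wt d =
      ∑ d ∈ (seqs n t).filter (fun d => ¬ c.Box d), wt d +
      ∑ d ∈ (seqs n t).filter (fun d => c.Box d ∧ ¬ c.Typ d), wt d := by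
    rw [sum_filter, sum_filter, sum_filter, ← sum_add_distrib]
    refine sum_congr rfl fun d _ => ?_
    by_cases hb : c.Box d <;> by_cases hT : c.Typ d <;> simp [hb, hT]
    exact absurd hT.1 hb
  rw [h3]
  set C : ℝ := (((n * (n - 1)).choose t : ℕ) : ℝ) with hC
  have hC0 : 0 ≤ C := by positivity
  have h4 : (((n * (n - 1) : ℕ) : ℝ) + 1) ≤ (n : ℝ) ^ 2 := by
    rw [Nat.cast_mul, Nat.cast_sub c.nat_pos]; push_cast; nlinarith
  calc _ ≤ (n + 1) * ((((n * (n - 1) : ℕ) : ℝ) + 1) * C * (6 * Real.exp (-c.L))) := by linarith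
    _ ≤ (2 * n) * ((n : ℝ) ^ 2 * C * (6 * (1 / (n : ℝ) ^ 20))) := by
      have := c.exp_neg_L_le
      gcongr
      linarith
    _ = 12 * C / (n : ℝ) ^ 17 := by field_simp; ring
    _ ≤ C / n := by
      rw [div_le_div_iff₀ (by positivity) (by positivity)]
      have : (12 : ℝ) * n ≤ (n : ℝ) ^ 17 := by
        have : (n : ℝ) ^ 2 ≤ (n : ℝ) ^ 17 := pow_le_pow_right₀ (by linarith) (by norm_num)
        nlinarith
      nlinarith

lemma Typ.bd_qq {d : Fin n → ℕ} (h : c.Typ d) : c.Bd 4 (-1) (c.qq d - c.p * (1 - c.p)) := by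
  have hn := c.n_pos
  have e : c.qq d - c.p * (1 - c.p) =
      (∑ v, ((d v : ℝ) - c.μ) ^ 2 - n * c.mtr) / n / n +
      ((c.mtr - (n - 1) * (c.p * (1 - c.p))) - c.p * (1 - c.p)) / n := by
    have : c.qq d = (∑ v, ((d v : ℝ) - c.μ) ^ 2) / n ^ 2 := by
      rw [sum_div]; exact sum_congr rfl fun v _ => by rw [div_pow]; rfl
    rw [this]; field_simp; ring
  rw [e]
  have b1 : c.Bd 3 3 (∑ v, ((d v : ℝ) - c.μ) ^ 2 - n * c.mtr) := by
    refine h.2.trans (le_of_eq ?_)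
    rw [← c.σ_sq]; norm_cast
  have b2 : c.Bd 0 0 (c.mtr - (n - 1) * (c.p * (1 - c.p))) := Bd.one c.mtr_near
  have b3 : c.Bd 0 0 (c.p * (1 - c.p)) := by
    refine Bd.one ?_
    have := c.hp0
    have := c.hp1
    rw [abs_le]; constructor <;> nlinarith
  exact ((b1.div_n.div_n).mono (by norm_num) (by norm_num)).add
      (((b2.sub b3).div_n).mono (k' := 3) (by norm_num) (by norm_num))

lemma Typ.bd_exp {d : Fin n → ℕ} (h : c.Typ d) :
    c.Bd 12 (-1) (c.qq d ^ 2 / (4 * (c.p * (1 - c.p)) ^ 2) - 1 / 4) := by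
  have h1 := h.bd_qq
  have hv := c.var_pos
  have b3 : c.Bd 0 0 (c.p * (1 - c.p)) := by
    refine Bd.one ?_
    have := c.hp0
    have := c.hp1
    rw [abs_le]; constructor <;> nlinarith
  have hi := c.bd_inv_var
  have b4 : c.Bd 6 0 (c.qq d - c.p * (1 - c.p) + (c.p * (1 - c.p) + c.p * (1 - c.p))) :=
    (h1.mono (k' := 5) (m' := 0) (by norm_num) (by norm_num)).add
        ((b3.add b3).mono (by norm_num) le_rfl)
  have b5 := ((h1.mul b4).mul hi).mul hi
  have b6 : c.Bd 0 0 (1 / 4 : ℝ) := Bd.one (by norm_num [abs_le])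
  have e : c.qq d ^ 2 / (4 * (c.p * (1 - c.p)) ^ 2) - 1 / 4 = (c.qq d - c.p * (1 - c.p)) *
      (c.qq d - c.p * (1 - c.p) + (c.p * (1 - c.p) + c.p * (1 - c.p))) * (c.p * (1 - c.p))⁻¹ *
      (c.p * (1 - c.p))⁻¹ * (1 / 4) := by
    have := hv.ne'
    generalize c.p * (1 - c.p) = w at *
    field_simp
    ring
  rw [e]
  exact (b5.mul b6).mono (by norm_num) (by norm_num)

end Ctx

section

variable {n : ℕ}

lemma sum_ad_eq_degree (H : SimpleGraph (Fin n)) (v : Fin n) :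
    ∑ w, ad H v w = (H.degree v : ℝ) := by
  simp [ad, ← SimpleGraph.card_neighborFinset_eq_degree, SimpleGraph.neighborFinset_eq_filter]

/-- Graphs with `m` edges. -/
def graphs (n m : ℕ) : Finset (SimpleGraph (Fin n)) := univ.filter fun H => #H.edgeFinset = m

lemma sum_graphs (m : ℕ) (F : Finset (Sym2 (Fin n)) → ℝ) :
    ∑ H ∈ graphs n m, F H.edgeFinset =
      ∑ U ∈ powersetCard m (⊤ : SimpleGraph (Fin n)).edgeFinset, F U := by
  have hd : ∀ U ∈ powersetCard m (⊤ : SimpleGraph (Fin n)).edgeFinset,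
      (SimpleGraph.fromEdgeSet (U : Set (Sym2 (Fin n)))).edgeFinset = U := fun U hU => by
    ext e
    have h := (mem_powersetCard.1 hU).1
    simp only [SimpleGraph.mem_edgeFinset, SimpleGraph.edgeSet_fromEdgeSet, Set.mem_sdiff, mem_coe]
    constructor
    · exact fun h => h.1
    · intro he
      have := h he
      simp at this
      exact ⟨he, by simpa using this⟩
  refine sum_nbij' (fun H => H.edgeFinset)
      (fun U => SimpleGraph.fromEdgeSet (U : Set (Sym2 (Fin n))))
    ?_ ?_ ?_ ?_ ?_
  · intro H hH
    rw [mem_powersetCard]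
    refine ⟨?_, (mem_filter.1 hH).2⟩
    exact SimpleGraph.edgeFinset_mono le_top
  · intro U hU
    refine mem_filter.2 ⟨mem_univ _, ?_⟩
    convert (mem_powersetCard.1 hU).2
    convert hd U hU
  · intro H _
    simp
  · intro U hU; convert hd U hU
  · intro H _; rfl

lemma card_graphs (m : ℕ) : (#(graphs n m) : ℝ) = (n.choose 2).choose m := by
  have := sum_graphs (n := n) m fun _ => 1
  rw [sum_const, sum_const, card_powersetCard, SimpleGraph.card_edgeFinset_top_eq_card_choose_two]
    at this
  simpa using this

/-- The edges at a vertex of the complete graph. -/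
def edgesAt (v : Fin n) : Finset (Sym2 (Fin n)) :=
  (⊤ : SimpleGraph (Fin n)).edgeFinset.filter fun e => v ∈ e

lemma degree_eq_edgesAt (H : SimpleGraph (Fin n)) (v : Fin n) :
    H.degree v = #(H.edgeFinset ∩ edgesAt v) := by
  rw [← SimpleGraph.card_incidenceFinset_eq_degree, SimpleGraph.incidenceFinset_eq_filter]
  congr 1
  ext e
  simp only [edgesAt, mem_filter, mem_inter, SimpleGraph.mem_edgeFinset]
  constructor
  · exact fun h => ⟨h.1, SimpleGraph.edgeSet_mono le_top h.1, h.2⟩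
  · exact fun h => ⟨h.1, h.2.2⟩

lemma card_edgesAt (v : Fin n) : #((⊤ : SimpleGraph (Fin n)).edgeFinset ∩ edgesAt v) = n - 1 := by
  have h := degree_eq_edgesAt (⊤ : SimpleGraph (Fin n)) v
  have h' := SimpleGraph.complete_graph_degree v
  rw [Fintype.card_fin] at h'
  rw [← h']
  convert h.symm

lemma degree_mem_seqs {m : ℕ} {H : SimpleGraph (Fin n)} (hH : H ∈ graphs n m) :
    (fun v => H.degree v) ∈ seqs n (2 * m) := by
  refine mem_seqs.2 ⟨fun v => ?_, ?_⟩
  · simpa using H.degree_lt_card_verts v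
  · rw [SimpleGraph.sum_degrees_eq_twice_card_edges, (mem_filter.1 hH).2]

lemma gs_bot_eq {m : ℕ} {d : Fin n → ℕ} (hd : ∑ v, d v = 2 * m) :
    (⟨d, ⊥⟩ : Inst n).gs = (graphs n m).filter fun H => (fun v => H.degree v) = d := by
  ext H
  simp only [Inst.mem_gs, graphs, mem_filter, mem_univ, true_and, sum_ad_eq_degree, Nat.cast_inj]
  constructor
  · rintro ⟨h1, -⟩
    refine ⟨?_, funext h1⟩
    have := H.sum_degrees_eq_twice_card_edges
    simp only [h1, hd] at this
    omega
  · rintro ⟨-, h2⟩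
    exact ⟨fun v => congrFun h2 v, by simp⟩

lemma sum_card_gs (m : ℕ) :
    ∑ d ∈ seqs n (2 * m), (#(⟨d, ⊥⟩ : Inst n).gs : ℝ) = (n.choose 2).choose m := by
  rw [← card_graphs, card_eq_sum_card_fiberwise (f := fun H v => H.degree v) (t := seqs n (2 * m))
    fun H hH => degree_mem_seqs hH]
  push_cast
  exact sum_congr rfl fun d hd => by rw [gs_bot_eq (mem_seqs.1 hd).2]

end

namespace Ctx

variable {n : ℕ} {c : Ctx n} {m : ℕ}

lemma sum_card_gs_not_box (hm : m ≤ n.choose 2) (hp : c.p = (m : ℝ) / (n.choose 2 : ℕ)) :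
    ∑ d ∈ (seqs n (2 * m)).filter (fun d => ¬ c.Box d), (#(⟨d, ⊥⟩ : Inst n).gs : ℝ) ≤
      (n.choose 2).choose m / n := by
  have hn := c.thousand_le_n
  have hσ := c.σ_pos
  have hsub : (((n - 1 : ℕ)) : ℝ) = n - 1 := by push_cast [c.nat_pos]; ring
  set C : ℝ := (((n.choose 2).choose m : ℕ) : ℝ) with hC
  have hC0 : 0 ≤ C := by positivity
  have h1 : ∑ d ∈ (seqs n (2 * m)).filter (fun d => ¬ c.Box d), (#(⟨d, ⊥⟩ : Inst n).gs : ℝ) =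
      ∑ H ∈ graphs n m, if ¬ c.Box (fun v => H.degree v) then 1 else 0 := by
    rw [← sum_fiberwise_of_maps_to (g := fun H v => H.degree v) (t := seqs n (2 * m))
      fun H hH => degree_mem_seqs hH, sum_filter]
    refine sum_congr rfl fun d hd => ?_
    rw [gs_bot_eq (mem_seqs.1 hd).2, card_eq_sum_ones]
    push_cast
    split_ifs with hb
    · exact (sum_eq_zero fun H hH => by rw [(mem_filter.1 hH).2]; simp [hb]).symm
    · exact sum_congr rfl fun H hH => by rw [(mem_filter.1 hH).2]; simp [hb]
  have h2 : ∀ v : Fin n, ∑ H ∈ graphs n m,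
      (if c.L * c.σ < |(H.degree v : ℝ) - c.μ| then (1 : ℝ) else 0) ≤
      2 * ((n.choose 2 : ℕ) + 1) * C * (3 * Real.exp (-c.L)) := fun v => by
    have h := hyper_tail (⊤ : SimpleGraph (Fin n)).edgeFinset (edgesAt v) (u := m)
      (by rwa [SimpleGraph.card_edgeFinset_top_eq_card_choose_two, Fintype.card_fin])
      (θ := c.σ⁻¹) (s := c.L * c.σ) (by positivity)
      (inv_le_one_of_one_le₀ c.one_le_σ)
    rw [SimpleGraph.card_edgeFinset_top_eq_card_choose_two, Fintype.card_fin, card_edgesAt, ← hp,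
      hsub] at h
    have e := sum_graphs (n := n) m fun U =>
      if c.L * c.σ < |(#(U ∩ edgesAt v) : ℝ) - c.p * (n - 1)| then (1 : ℝ) else 0
    simp only [degree_eq_edgesAt]
    refine (le_of_eq e).trans (h.trans ?_)
    refine mul_le_mul_of_nonneg_left ?_ (by positivity)
    have e1 : ((n : ℝ) - 1) * c.σ⁻¹ ^ 2 ≤ 1 := by
      rw [inv_pow, c.σ_sq, ← div_eq_mul_inv, div_le_one c.n_pos]; linarith
    have e2 : c.σ⁻¹ * (c.L * c.σ) = c.L := by field_simp
    calc _ ≤ Real.exp (1 + -c.L) := Real.exp_le_exp.2 (by rw [e2]; linarith)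
      _ = Real.exp 1 * Real.exp (-c.L) := Real.exp_add _ _
      _ ≤ _ := mul_le_mul_of_nonneg_right exp_one_le_three (Real.exp_pos _).le
  have h4 : ((n.choose 2 : ℕ) : ℝ) + 1 ≤ (n : ℝ) ^ 2 := by
    rw [Nat.cast_choose_two]; nlinarith
  rw [h1]
  calc _ ≤ ∑ H ∈ graphs n m, ∑ v : Fin n,
          (if c.L * c.σ < |(H.degree v : ℝ) - c.μ| then (1 : ℝ) else 0) := by
        refine sum_le_sum fun H _ => ?_
        have h0 : ∀ u : Fin n, (0 : ℝ) ≤ if c.L * c.σ < |(H.degree u : ℝ) - c.μ| then 1 else 0 :=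
          fun u => by split_ifs <;> norm_num
        split_ifs with hb
        · exact sum_nonneg fun u _ => h0 u
        · unfold Ctx.Box at hb
          push Not at hb
          obtain ⟨u, hu⟩ := hb
          refine le_trans ?_ (single_le_sum (fun u _ => h0 u) (mem_univ u))
          rw [if_pos hu]
    _ ≤ ∑ _v : Fin n, 2 * ((n.choose 2 : ℕ) + 1) * C * (3 * Real.exp (-c.L)) := by
        rw [sum_comm]; exact sum_le_sum fun v _ => h2 v
    _ = n * (2 * ((n.choose 2 : ℕ) + 1) * C * (3 * Real.exp (-c.L))) := by simp
    _ ≤ n * (2 * (n : ℝ) ^ 2 * C * (3 * (1 / (n : ℝ) ^ 20))) := by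
      have := c.exp_neg_L_le
      gcongr
    _ = 6 * C / (n : ℝ) ^ 17 := by field_simp; ring
    _ ≤ C / n := by
      rw [div_le_div_iff₀ (by positivity) (by positivity)]
      have : (6 : ℝ) * n ≤ (n : ℝ) ^ 17 := by
        have : (n : ℝ) ^ 2 ≤ (n : ℝ) ^ 17 := pow_le_pow_right₀ (by linarith) (by norm_num)
        nlinarith
      nlinarith

end Ctx

namespace Ctx

variable {n : ℕ} {c : Ctx n} {m : ℕ}

lemma two_mul_choose_two (n : ℕ) : 2 * n.choose 2 = n * (n - 1) := by
  rw [Nat.choose_two_right]; exact Nat.mul_div_cancel' (Nat.even_mul_pred_self n).two_dvd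

lemma sum_sub_μ (hp : c.p = (m : ℝ) / (n.choose 2 : ℕ)) {d : Fin n → ℕ} (hd : ∑ v, d v = 2 * m) :
    ∑ v, ((d v : ℝ) - c.p * (n - 1)) = 0 := by
  have hn := c.thousand_le_n
  have h1 : ∑ v, (d v : ℝ) = 2 * m := by exact_mod_cast hd
  rw [sum_sub_distrib, h1, hp, Nat.cast_choose_two]
  have : (n : ℝ) - 1 ≠ 0 := by linarith
  simp
  field_simp
  ring

lemma Box.good (hp : c.p = (m : ℝ) / (n.choose 2 : ℕ)) {d : Fin n → ℕ} (hd : ∑ v, d v = 2 * m)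
    (h : c.Box d) : Good c 0 ⟨d, ⊥⟩ where
  deg v := by simpa [μ] using h v
  xdeg v := by
    rw [Good.x_bot]; have := c.L_pos; have := c.σ_pos; positivity
  sumd := by rw [sum_sub_μ hp hd]; simpa using c.L_pos.le
  sumx := by
    simp only [Good.x_bot]; have := c.L_pos; simp; positivity

lemma log_wt {d : Fin n → ℕ} (hd : d ∈ seqs n (2 * m)) :
    0 < wt d ∧ Real.log (wt d) = ∑ v, Real.log ((n - 1).choose (d v)) := by
  have h : ∀ v, (0 : ℝ) < (n - 1).choose (d v) := fun v => by
    have := (mem_seqs.1 hd).1 v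
    exact_mod_cast Nat.choose_pos (by omega)
  exact ⟨prod_pos fun v _ => h v, Real.log_prod fun v _ => (h v).ne'⟩

lemma bd_log_norm (hm : m ≤ n.choose 2) (hp : c.p = (m : ℝ) / (n.choose 2 : ℕ))
    {d₀ : Fin n → ℕ} (hg : Good c 0 ⟨d₀, ⊥⟩) (hs : ∑ v, d₀ v = 2 * m) :
    (⟨d₀, ⊥⟩ : Inst n).gs.Nonempty ∧ c.Bd 217 (-1) (Real.log #(⟨d₀, ⊥⟩ : Inst n).gs -
      (Real.log ((n.choose 2).choose m) - Real.log ((n * (n - 1)).choose (2 * m)) + 1 / 4 +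
        c.lg d₀)) := by
  have hn := c.thousand_le_n
  have hn0 := c.n_pos
  have ht : 2 * m ≤ n * (n - 1) := by rw [← two_mul_choose_two]; omega
  have hp2 : c.p = ((2 * m : ℕ) : ℝ) / (n * (n - 1) : ℕ) := by
    rw [hp, ← two_mul_choose_two]; push_cast
    rw [mul_div_mul_left _ _ two_ne_zero]
  set G : ℝ := (((n.choose 2).choose m : ℕ) : ℝ) with hG
  set V : ℝ := (((n * (n - 1)).choose (2 * m) : ℕ) : ℝ) with hV
  have hG0 : 0 < G := by rw [hG]; exact_mod_cast Nat.choose_pos hm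
  have hV0 : 0 < V := by rw [hV]; exact_mod_cast Nat.choose_pos ht
  set N : (Fin n → ℕ) → ℝ := fun d => #(⟨d, ⊥⟩ : Inst n).gs with hN
  have hN0 : ∀ d, 0 ≤ N d := fun d => by simp [hN]
  set S := seqs n (2 * m) with hS
  have sN : ∑ d ∈ S, N d = G := sum_card_gs m
  have sNb : ∑ d ∈ S.filter (fun d => ¬ c.Box d), N d ≤ G / n := sum_card_gs_not_box hm hp
  have sW : ∑ d ∈ S, wt d = V := by
    rw [hV, ← sum_prod_choose _ _ c.nat_pos]; push_cast; rfl
  have sWb : ∑ d ∈ S.filter (fun d => ¬ c.Typ d), wt d ≤ V / n := sum_not_typ ht hp2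
  have sN1 := sum_filter_add_sum_filter_not S (fun d => c.Box d) N
  have sW1 := sum_filter_add_sum_filter_not S (fun d => c.Typ d) wt
  rw [sN] at sN1
  rw [sW] at sW1
  have hGn : G / n ≤ G / 1000 := by gcongr
  have hpos : 0 < ∑ d ∈ S.filter (fun d => c.Box d), N d := by linarith
  obtain ⟨d₁, hd₁, hN1⟩ := exists_lt_of_sum_lt (s := S.filter fun d => c.Box d) (f := fun _ => 0)
    (g := N) (by simpa using hpos)
  obtain ⟨hd1S, hd1B⟩ := mem_filter.1 hd₁
  have hne : (⟨d₁, ⊥⟩ : Inst n).gs.Nonempty := by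
    rw [← card_pos]; simp only [hN] at hN1; exact_mod_cast hN1
  have sd1 := (mem_seqs.1 hd1S).2
  have main : ∀ d : Fin n → ℕ, Good c 0 ⟨d, ⊥⟩ → ∑ v, d v = 2 * m →
      (⟨d, ⊥⟩ : Inst n).gs.Nonempty ∧ c.Bd 213 (-1) (Real.log (N d) - Real.log (N d₁) -
        (c.lg d - c.lg d₁)) := fun d hd hsd =>
    (hd1B.good hp sd1).bd_log_sub_lg hd (by exact_mod_cast sd1.trans hsd.symm) hne
  set κ := Real.log (N d₁) - c.lg d₁ - 1 / 4 with hκ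
  set K := Real.exp κ with hK
  have hK0 : 0 < K := Real.exp_pos _
  set η := c.L ^ 214 * c.σ ^ (-1 : ℤ) with hη
  have hη0 : 0 ≤ η := c.bd_nonneg _ _
  have typ_bd : ∀ d ∈ S.filter (fun d => c.Typ d),
      K * Real.exp (-η) * wt d ≤ N d ∧ N d ≤ K * Real.exp η * wt d := fun d hd => by
    obtain ⟨hdS, hdT⟩ := mem_filter.1 hd
    have hsd := (mem_seqs.1 hdS).2
    obtain ⟨h1, h2⟩ := main d (hdT.1.good hp hsd) hsd
    obtain ⟨w0, w1⟩ := log_wt hdS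
    have h3 : c.Bd 214 (-1) (Real.log (N d) - κ - Real.log (wt d)) := by
      have e : Real.log (N d) - κ - Real.log (wt d) = (Real.log (N d) - Real.log (N d₁) -
          (c.lg d - c.lg d₁)) - (c.qq d ^ 2 / (4 * (c.p * (1 - c.p)) ^ 2) - 1 / 4) := by
        have e : c.lg d = Real.log (wt d) - c.qq d ^ 2 / (4 * (c.p * (1 - c.p)) ^ 2) := by
          rw [w1]; rfl
        rw [e, hκ]; ring
      rw [e]; exact h2.sub (hdT.bd_exp.mono (by norm_num) le_rfl)
    have h4 : N d = Real.exp (Real.log (N d)) :=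
      (Real.exp_log (by simp only [hN]; exact_mod_cast card_pos.2 h1)).symm
    have h5 : wt d = Real.exp (Real.log (wt d)) := (Real.exp_log w0).symm
    obtain ⟨h6, h7⟩ := abs_le.1 h3
    rw [h4, h5, hK, ← Real.exp_add, ← Real.exp_add, ← Real.exp_add, ← Real.exp_add]
    exact ⟨Real.exp_le_exp.2 (by linarith), Real.exp_le_exp.2 (by linarith)⟩
  have box_bd : ∀ d ∈ S.filter (fun d => c.Box d ∧ ¬ c.Typ d),
      N d ≤ 2 * (K * Real.exp η) * wt d := fun d hd => by
    obtain ⟨hdS, hdB, -⟩ := mem_filter.1 hd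
    have hsd := (mem_seqs.1 hdS).2
    obtain ⟨h1, h2⟩ := main d (hdB.good hp hsd) hsd
    obtain ⟨w0, w1⟩ := log_wt hdS
    have h2' := (abs_le.1 (h2.mono (k' := 214) (by norm_num) le_rfl)).2
    have h3 : Real.log (N d) ≤ 1 / 4 + (κ + η) + Real.log (wt d) := by
      have : 0 ≤ c.qq d ^ 2 / (4 * (c.p * (1 - c.p)) ^ 2) := by positivity
      have e : c.lg d = Real.log (wt d) - c.qq d ^ 2 / (4 * (c.p * (1 - c.p)) ^ 2) := by
        rw [w1]; rfl
      rw [hκ]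
      linarith
    have h4 : N d = Real.exp (Real.log (N d)) :=
      (Real.exp_log (by simp only [hN]; exact_mod_cast card_pos.2 h1)).symm
    have h6 : Real.exp (1 / 4) ≤ 2 := by
      have h7 : Real.exp (1 / 4) ^ 4 = Real.exp 1 := by rw [← Real.exp_nat_mul]; norm_num
      by_contra hcon
      have := pow_le_pow_left₀ (by norm_num) (not_le.1 hcon).le 4
      linarith [exp_one_le_three]
    calc N d = Real.exp (Real.log (N d)) := h4
      _ ≤ Real.exp (1 / 4 + (κ + η) + Real.log (wt d)) := Real.exp_le_exp.2 h3
      _ = Real.exp (1 / 4) * (K * Real.exp η) * wt d := by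
        rw [Real.exp_add, Real.exp_add, Real.exp_add, Real.exp_log w0]
      _ ≤ _ := by gcongr
  have sT : ∑ d ∈ S.filter (fun d => c.Box d), N d = ∑ d ∈ S.filter (fun d => c.Typ d), N d +
      ∑ d ∈ S.filter (fun d => c.Box d ∧ ¬ c.Typ d), N d := by
    rw [sum_filter, sum_filter, sum_filter, ← sum_add_distrib]
    refine sum_congr rfl fun d _ => ?_
    by_cases hb : c.Box d <;> by_cases hT : c.Typ d <;> simp [hb, hT]
    exact absurd hT.1 hb
  have hTN : ∑ d ∈ S.filter (fun d => c.Typ d), N d ≤ G := by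
    rw [← sN]; exact sum_le_sum_of_subset_of_nonneg (filter_subset _ _) fun d _ _ => hN0 d
  have hTW : ∑ d ∈ S.filter (fun d => c.Typ d), wt d ≤ V := by
    rw [← sW]; exact sum_le_sum_of_subset_of_nonneg (filter_subset _ _) fun d _ _ => wt_nonneg d
  have hBW : ∑ d ∈ S.filter (fun d => c.Box d ∧ ¬ c.Typ d), wt d ≤ V / n := by
    refine le_trans (sum_le_sum_of_subset_of_nonneg ?_ fun d _ _ => wt_nonneg d) sWb
    intro d hd
    obtain ⟨h1, -, h2⟩ := mem_filter.1 hd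
    exact mem_filter.2 ⟨h1, h2⟩
  have up : G * (1 - 1 / n) ≤ K * Real.exp η * V * (1 + 2 / n) := by
    have hKe : 0 ≤ K * Real.exp η := by positivity
    have h1 : ∑ d ∈ S.filter (fun d => c.Typ d), N d ≤ K * Real.exp η * V :=
      (sum_le_sum fun d hd => (typ_bd d hd).2).trans (by
        rw [← mul_sum]; exact mul_le_mul_of_nonneg_left hTW hKe)
    have h2 : ∑ d ∈ S.filter (fun d => c.Box d ∧ ¬ c.Typ d), N d ≤
        2 * (K * Real.exp η) * (V / n) :=
      (sum_le_sum fun d hd => box_bd d hd).trans (by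
        rw [← mul_sum]; exact mul_le_mul_of_nonneg_left hBW (by positivity))
    calc G * (1 - 1 / n) = G - G / n := by ring
      _ ≤ K * Real.exp η * V + 2 * (K * Real.exp η) * (V / n) := by linarith
      _ = _ := by ring
  have lo : K * Real.exp (-η) * V * (1 - 1 / n) ≤ G := by
    have h1 : K * Real.exp (-η) * ∑ d ∈ S.filter (fun d => c.Typ d), wt d ≤
        ∑ d ∈ S.filter (fun d => c.Typ d), N d := by
      rw [mul_sum]; exact sum_le_sum fun d hd => (typ_bd d hd).1
    refine le_trans ?_ (h1.trans hTN)
    rw [mul_assoc]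
    refine mul_le_mul_of_nonneg_left ?_ (by positivity)
    calc V * (1 - 1 / n) = V - V / n := by ring
      _ ≤ _ := by linarith
  have hn1 : (0 : ℝ) < 1 - 1 / n := by
    have : 1 / (n : ℝ) ≤ 1 / 1000 := by gcongr
    linarith
  have l1 : -(2 / (n : ℝ)) ≤ Real.log (1 - 1 / n) := by
    refine le_trans ?_ (Real.one_sub_inv_le_log_of_pos hn1)
    have e : 1 - (1 - 1 / (n : ℝ))⁻¹ = -(1 / (n - 1)) := by
      have : (n : ℝ) - 1 ≠ 0 := by linarith
      field_simp; ring
    rw [e, neg_le_neg_iff, div_le_div_iff₀ (by linarith) hn0]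
    linarith
  have l2 : Real.log (1 + 2 / (n : ℝ)) ≤ 2 / n := by
    have := Real.log_le_sub_one_of_pos (x := 1 + 2 / (n : ℝ)) (by positivity)
    linarith
  have up' := Real.log_le_log (by positivity) up
  have lo' := Real.log_le_log (by positivity) lo
  rw [Real.log_mul hG0.ne' hn1.ne', Real.log_mul (by positivity) (by positivity),
    Real.log_mul (by positivity) hV0.ne', Real.log_mul hK0.ne' (by positivity), Real.log_exp,
    Real.log_exp] at up'
  rw [Real.log_mul (by positivity) hn1.ne',
    Real.log_mul (by positivity) hV0.ne', Real.log_mul hK0.ne' (by positivity), Real.log_exp,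
    Real.log_exp] at lo'
  have hfin : c.Bd 215 (-1) (κ - (Real.log G - Real.log V)) := by
    have h1 : |κ - (Real.log G - Real.log V)| ≤ η + 4 * (n : ℝ)⁻¹ := by
      have e1 : 4 * (n : ℝ)⁻¹ = 2 * (2 / n) := by ring
      have e2 : 0 ≤ 2 / (n : ℝ) := by positivity
      rw [e1, abs_le]; constructor <;> linarith
    have h2 : c.Bd 214 (-1) η := by
      unfold Bd; rw [abs_of_nonneg hη0]
    have h3 : c.Bd 214 (-1) (4 * (n : ℝ)⁻¹) :=
      (((Bd.const (c := c) (x := 4) (by norm_num [abs_le])).mul c.bd_inv_n)).mono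
        (by norm_num) (by norm_num)
    exact (h2.add h3).of_abs_le (h1.trans (le_abs_self _))
  obtain ⟨g1, g2⟩ := main d₀ hg hs
  refine ⟨g1, ?_⟩
  have e : Real.log (N d₀) - (Real.log G - Real.log V + 1 / 4 + c.lg d₀) =
      (Real.log (N d₀) - Real.log (N d₁) - (c.lg d₀ - c.lg d₁)) +
        (κ - (Real.log G - Real.log V)) := by rw [hκ]; ring
  have := (g2.mono (k' := 215) (by norm_num) le_rfl).add hfin
  rw [← e] at this
  exact this.mono (by norm_num) le_rfl

end Ctx

section

open Stirling

lemma log_factorial_eq {k : ℕ} (hk : k ≠ 0) : Real.log (k.factorial : ℝ) =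
    Real.log (stirlingSeq k) + 1 / 2 * Real.log (2 * k) + (k * Real.log k - k) := by
  have h : (k : ℝ) ≠ 0 := by exact_mod_cast hk
  rw [log_stirlingSeq_formula, Real.log_div h (Real.exp_ne_zero _), Real.log_exp]
  ring

lemma log_stirlingSeq_sub_two_mul {k : ℕ} (hk : k ≠ 0) :
    |Real.log (stirlingSeq k) - Real.log (stirlingSeq (2 * k))| ≤ 1 / k := by
  have hk0 : (0 : ℝ) < k := by exact_mod_cast Nat.pos_of_ne_zero hk
  have h1 : Real.log (stirlingSeq (2 * k)) ≤ Real.log (stirlingSeq k) := by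
    obtain ⟨j, rfl⟩ := Nat.exists_eq_succ_of_ne_zero hk
    exact log_stirlingSeq'_antitone (show j ≤ 2 * j + 1 by omega)
  have h2 : ∀ i, Real.log (stirlingSeq k) - Real.log (stirlingSeq (k + i)) ≤ i * (1 / k ^ 2) := by
    intro i
    induction i with
    | zero => simp
    | succ i ih =>
      have h3 := log_stirlingSeq_sdiff_le (k + i)
      have h4 : 1 / (12 * ((k + i : ℕ) : ℝ) * ((k + i : ℕ) + 1)) ≤ 1 / k ^ 2 := by
        refine one_div_le_one_div_of_le (by positivity) ?_
        have hi : (0 : ℝ) ≤ i := Nat.cast_nonneg i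
        push_cast
        nlinarith [mul_nonneg hi hi, mul_nonneg hi hk0.le]
      push_cast at ih ⊢
      rw [← add_assoc]
      push_cast at h3 h4
      linarith
  rw [abs_of_nonneg (by linarith), two_mul]
  refine (h2 k).trans (le_of_eq ?_)
  field_simp

lemma abs_log_choose_sub_log_choose {m f : ℕ} (hm : m ≠ 0) (hf : f ≠ 0) :
    |Real.log ((m + f).choose m) - Real.log ((2 * (m + f)).choose (2 * m)) -
      (1 / 2 * Real.log 2 + m * Real.log (m / (m + f : ℝ)) + f * Real.log (f / (m + f : ℝ)))| ≤
      1 / (m + f : ℝ) + 1 / m + 1 / f := by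
  have hm0 : (m : ℝ) ≠ 0 := by exact_mod_cast hm
  have hf0 : (f : ℝ) ≠ 0 := by exact_mod_cast hf
  have hmf : (m + f : ℝ) ≠ 0 := by positivity
  have e : ∀ a b : ℕ, Real.log ((a + b).choose a) = Real.log ((a + b).factorial : ℝ) -
      Real.log (a.factorial : ℝ) - Real.log (b.factorial : ℝ) := fun a b => by
    rw [Nat.choose_symm_add, Nat.add_choose, Nat.cast_div
        (Nat.factorial_mul_factorial_dvd_factorial_add a b)
      (by positivity), Nat.cast_mul, Real.log_div (by positivity) (by positivity),
      Real.log_mul (by positivity) (by positivity)]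
    ring
  have a1 := abs_le.1 (log_stirlingSeq_sub_two_mul (k := m + f) (by omega))
  have a2 := abs_le.1 (log_stirlingSeq_sub_two_mul hm)
  have a3 := abs_le.1 (log_stirlingSeq_sub_two_mul hf)
  rw [e, mul_add, e, ← mul_add, log_factorial_eq (by omega), log_factorial_eq hm,
    log_factorial_eq hf, log_factorial_eq (by omega), log_factorial_eq (by omega),
    log_factorial_eq (k := 2 * f) (by omega), Real.log_div hm0 hmf, Real.log_div hf0 hmf]
  push_cast at a1 a2 a3 ⊢
  rw [Real.log_mul two_ne_zero hm0, Real.log_mul two_ne_zero hf0, Real.log_mul two_ne_zero hmf,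
    Real.log_mul two_ne_zero (mul_ne_zero two_ne_zero hm0),
    Real.log_mul two_ne_zero (mul_ne_zero two_ne_zero hf0),
    Real.log_mul two_ne_zero (mul_ne_zero two_ne_zero hmf), Real.log_mul two_ne_zero hm0,
    Real.log_mul two_ne_zero hf0, Real.log_mul two_ne_zero hmf, abs_le]
  constructor <;> linarith

end

namespace Ctx

variable {n : ℕ} {c : Ctx n} {m : ℕ}

lemma bd_log_stirling (hp : c.p = (m : ℝ) / (n.choose 2 : ℕ)) :
    c.Bd 4 (-1) (Real.log ((n.choose 2).choose m) - Real.log ((n * (n - 1)).choose (2 * m)) -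
      (1 / 2 * Real.log 2 +
        n.choose 2 * (c.p * Real.log c.p + (1 - c.p) * Real.log (1 - c.p)))) := by
  have hn := c.thousand_le_n
  have hn0 := c.n_pos
  have hp0 := c.hp0
  have hp1 := c.hp1
  have hM : (n : ℝ) ≤ ((n.choose 2 : ℕ) : ℝ) := by rw [Nat.cast_choose_two]; nlinarith
  have hM0 : (0 : ℝ) < ((n.choose 2 : ℕ) : ℝ) := by linarith
  have hmp : (m : ℝ) = c.p * (n.choose 2 : ℕ) := by rw [hp]; field_simp
  have hm0 : (0 : ℝ) < m := by rw [hmp]; positivity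
  have hmM : (m : ℝ) < (n.choose 2 : ℕ) := by rw [hmp]; nlinarith
  obtain ⟨f, hf⟩ := Nat.exists_eq_add_of_le (show m ≤ n.choose 2 by exact_mod_cast hmM.le)
  have hfc : ((n.choose 2 : ℕ) : ℝ) = m + f := by rw [hf]; push_cast; ring
  have hf0 : (0 : ℝ) < f := by linarith
  have hfp : (f : ℝ) = (1 - c.p) * (n.choose 2 : ℕ) := by rw [sub_mul, ← hmp, hfc]; ring
  have h := abs_log_choose_sub_log_choose (m := m) (f := f) (by rintro rfl; simp at hm0)
    (by rintro rfl; simp at hf0)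
  rw [← hfc, ← hp, ← hf, two_mul_choose_two] at h
  have e1 : (f : ℝ) / (n.choose 2 : ℕ) = 1 - c.p := by rw [hfp]; field_simp
  rw [e1] at h
  have e2 : 1 / 2 * Real.log 2 + m * Real.log c.p + f * Real.log (1 - c.p) = 1 / 2 * Real.log 2 +
        n.choose 2 * (c.p * Real.log c.p + (1 - c.p) * Real.log (1 - c.p)) := by
    rw [hmp, hfp]; ring
  rw [e2] at h
  have b0 : c.Bd 0 (-2) (1 / (n.choose 2 : ℕ) : ℝ) := by
    refine c.bd_inv_n.of_abs_le ?_
    rw [abs_of_pos (by positivity), abs_of_pos (by positivity), ← one_div]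
    exact one_div_le_one_div_of_le hn0 hM
  have b1 : c.Bd 1 (-2) (1 / m : ℝ) := by
    have e : (1 / m : ℝ) = c.p⁻¹ * (1 / (n.choose 2 : ℕ)) := by rw [hmp]; field_simp
    rw [e]; exact (c.bd_inv_p.mul b0).mono (by norm_num) (by norm_num)
  have b2 : c.Bd 1 (-2) (1 / f : ℝ) := by
    have : 1 - c.p ≠ 0 := by linarith
    have e : (1 / f : ℝ) = (1 - c.p)⁻¹ * (1 / (n.choose 2 : ℕ)) := by rw [hfp]; field_simp
    rw [e]; exact (c.bd_inv_one_sub_p.mul b0).mono (by norm_num) (by norm_num)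
  have b3 := ((b0.mono (k' := 1) (by norm_num) le_rfl).add b1).add
      (b2.mono (k' := 2) (by norm_num) le_rfl)
  exact (b3.of_abs_le (h.trans (le_abs_self _))).mono (by norm_num) (by norm_num)

/-- Logarithmic form of the asymptotic formula. -/
lemma bd_log_main (hp : c.p = (m : ℝ) / (n.choose 2 : ℕ)) {d : Fin n → ℕ}
    {X : SimpleGraph (Fin n)} (hg : Good c 0 ⟨d, X⟩) (hs : ∑ v, d v = 2 * m) :
    (⟨d, X⟩ : Inst n).gs.Nonempty ∧ c.Bd 219 (-1) (Real.log #(⟨d, X⟩ : Inst n).gs -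
      (1 / 2 * Real.log 2 +
        n.choose 2 * (c.p * Real.log c.p + (1 - c.p) * Real.log (1 - c.p)) + 1 / 4 -
        c.qq d ^ 2 / (4 * (c.p * (1 - c.p)) ^ 2) + Inst.lw c ⟨d, X⟩)) := by
  have hm : m ≤ n.choose 2 := by
    have h1 := c.hp1
    have hn := c.thousand_le_n
    rw [hp, div_lt_one (by rw [Nat.cast_choose_two]; nlinarith)] at h1
    exact_mod_cast h1.le
  have hb : Good c 0 ⟨d, ⊥⟩ :=
    Box.good hp hs fun v => by have := hg.deg v; simpa [μ] using this
  obtain ⟨h1, h2⟩ := bd_log_norm hm hp hb hs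
  obtain ⟨h3, h4⟩ := Good.bd_log_sub_lw h1 hg
  refine ⟨h3, ?_⟩
  have h5 := bd_log_stirling hp
  have e0 : Inst.lw c ⟨d, ⊥⟩ = ∑ v, Real.log ((n - 1).choose (d v)) := by
    have hne : Inst.ne ⟨d, (⊥ : SimpleGraph (Fin n))⟩ = 0 := by simp [Inst.ne, Good.x_bot]
    have hdd : Inst.dd ⟨d, (⊥ : SimpleGraph (Fin n))⟩ c = 0 := by
      simp [Inst.dd, Inst.nb, ad]
    have hx : ∀ v, xDeg (⊥ : SimpleGraph (Fin n)) v = 0 := fun v => by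
      have := Inst.x_eq_xDeg ⟨d, ⊥⟩ v
      rw [Good.x_bot] at this
      exact_mod_cast this.symm
    simp [Inst.lw, hne, hdd, hx]
  have h6 := (h2.add (h4.mono (k' := 217) (by norm_num) le_rfl)).add
    (h5.mono (k' := 218) (by norm_num) le_rfl)
  refine h6.of_eq ?_
  rw [e0, lg]; ring

end Ctx

section

variable {n : ℕ} (d : Fin n → ℕ) (X : SimpleGraph (Fin n))

lemma gCount_eq : gCount d X = #(⟨d, X⟩ : Inst n).gs := by
  unfold gCount
  rw [Nat.card_eq_fintype_card, Fintype.card_subtype]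
  congr 1
  ext H
  simp only [mem_filter, mem_univ, true_and, Inst.mem_gs]
  refine and_congr (forall_congr' fun v => ?_) ?_
  · have := Inst.x_eq_xDeg ⟨d, H⟩ v
    unfold Inst.x xDeg at this
    rw [this]
    exact Nat.cast_inj.symm
  · rw [SimpleGraph.disjoint_edgeSet, disjoint_comm, SimpleGraph.disjoint_left]

lemma ne_eq_xEdges : Inst.ne ⟨d, X⟩ = xEdges X := by
  have h : ∑ v, Inst.x ⟨d, X⟩ v = 2 * (xEdges X : ℝ) := by
    have h1 := X.sum_degrees_eq_twice_card_edges
    have h2 : xEdges X = #X.edgeFinset := by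
      rw [xEdges, Nat.card_eq_fintype_card, SimpleGraph.edgeFinset_card]
    rw [h2]
    unfold Inst.x
    simp only [sum_ad_eq_degree]
    exact_mod_cast h1
  rw [Inst.ne, h]; ring

variable {d X} {c : Ctx n}

lemma dBar_eq (hp : c.p = lamb d) : dBar d = c.p * (n - 1) := by
  have := c.thousand_le_n
  rw [hp, lamb, div_mul_cancel₀]
  linarith

lemma dl_eq_deltaPar (hp : c.p = lamb d) : Inst.dl ⟨d, X⟩ c = deltaPar d X := by
  funext v
  rw [Inst.dl, deltaPar, dBar_eq hp, Inst.x_eq_xDeg, hp]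

lemma dd_eq_pairSum (hp : c.p = lamb d) :
    Inst.dd ⟨d, X⟩ c = pairSum X (deltaPar d X) := by
  rw [Inst.dd, dl_eq_deltaPar hp, pairSum]
  congr 1
  refine sum_congr rfl fun v _ => ?_
  rw [Inst.nb, mul_sum]
  refine sum_congr rfl fun w _ => ?_
  simp only [ad]
  split_ifs <;> ring

lemma qq_eq_rPar (hp : c.p = lamb d) : c.qq d = rPar d / n ^ 2 := by
  rw [Ctx.qq, rPar, sum_div, dBar_eq hp]
  exact sum_congr rfl fun v _ => div_pow _ _ _

lemma lamb_eq {m : ℕ} (hn : 2 ≤ n) (hm : ∑ v, d v = 2 * m) : lamb d = m / (n.choose 2 : ℕ) := by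
  have h1 : ∑ v, (d v : ℝ) = 2 * m := by exact_mod_cast hm
  have h2 : (2 : ℝ) ≤ n := by exact_mod_cast hn
  have : (n : ℝ) - 1 ≠ 0 := by linarith
  rw [lamb, dBar, h1, Nat.cast_choose_two]
  field_simp

/-- The asymptotic formula in a fixed context. -/
lemma gCount_formula (hp : c.p = lamb d) (hg : Good c 0 ⟨d, X⟩) (he : Even (∑ v, d v)) :
    ∃ err : ℝ, |err| ≤ c.L ^ 219 * c.σ ^ (-1 : ℤ) ∧
      (gCount d X : ℝ) = Real.sqrt 2 * gHat d X *
        Real.exp (1/4 - rPar d ^ 2 / (16 * aPar d ^ 2 * (n : ℝ) ^ 4)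
          + lamb d * (xEdges X : ℝ) ^ 2 / ((1 - lamb d) * (n : ℝ) ^ 2)
          - pairSum X (deltaPar d X) / (2 * aPar d * (n : ℝ) ^ 2) + err) := by
  obtain ⟨m, hm⟩ := he
  have hs : ∑ v, d v = 2 * m := by omega
  have hn2 : 2 ≤ n := by
    have := c.thousand_le_n
    have : (2 : ℝ) ≤ n := by linarith
    exact_mod_cast this
  obtain ⟨h1, h2⟩ := Ctx.bd_log_main (hp.trans (lamb_eq hn2 hs)) hg hs
  refine ⟨_, h2, ?_⟩
  have hN : (0 : ℝ) < #(⟨d, X⟩ : Inst n).gs := by exact_mod_cast card_pos.2 h1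
  have hp0 := c.hp0
  have hp1 : 0 < 1 - c.p := by linarith [c.hp1]
  have hch : ∀ v, (0 : ℝ) < (n - 1 - xDeg X v).choose (d v) := fun v => by
    have hr := hg.ratio_pos (by norm_num) v
    have hx := Inst.xDeg_lt ⟨d, X⟩ v
    have h4 : ((n - 1 - xDeg X v : ℕ) : ℝ) = n - 1 - Inst.x ⟨d, X⟩ v := by
      have hx' : xDeg X v < n := hx
      rw [Inst.x_eq_xDeg, Nat.cast_sub (by omega), Nat.cast_sub (by omega)]; simp
    rw [div_pos_iff_of_pos_right (hg.card_Vn_pos (by norm_num) v), ← h4, sub_pos] at hr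
    exact_mod_cast Nat.choose_pos (by exact_mod_cast hr.le)
  have hG : Real.sqrt 2 * gHat d X = Real.exp (1 / 2 * Real.log 2 +
      (-(xEdges X : ℝ) * Real.log (1 - c.p) +
      n.choose 2 * (c.p * Real.log c.p + (1 - c.p) * Real.log (1 - c.p)) +
      ∑ v, Real.log ((n - 1 - xDeg X v).choose (d v)))) := by
    rw [gHat, ← hp, Real.exp_add, Real.exp_add, Real.exp_add, Real.exp_sum, Real.sqrt_eq_rpow,
      Real.rpow_def_of_pos two_pos, Real.rpow_def_of_pos hp1, Real.rpow_def_of_pos hp0,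
      Real.rpow_def_of_pos hp1, ← Real.exp_add, ← Real.exp_nat_mul,
      prod_congr rfl fun v _ => Real.exp_log (hch v)]
    congr 1
    · congr 1; ring
    · congr 3
      · ring
      · ring
  have hA : aPar d = c.p * (1 - c.p) / 2 := by rw [aPar, hp]
  rw [gCount_eq, hG, ← Real.exp_add]
  conv_lhs => rw [← Real.exp_log hN]
  congr 1
  rw [Inst.lw, ne_eq_xEdges, dd_eq_pairSum hp, qq_eq_rPar hp, hA, ← hp]
  have hv := c.var_pos.ne'
  have hn0 := c.n_pos.ne'
  have e1 : (rPar d / n ^ 2) ^ 2 / (4 * (c.p * (1 - c.p)) ^ 2) =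
      rPar d ^ 2 / (16 * (c.p * (1 - c.p) / 2) ^ 2 * n ^ 4) := by
    generalize c.p * (1 - c.p) = w at *
    field_simp
    ring
  have e2 : 2 * (c.p * (1 - c.p) / 2) = c.p * (1 - c.p) := by ring
  rw [e1, e2]
  ring

end

lemma eventually_log_le_rpow (K : ℝ) {e : ℝ} (he : 0 < e) :
    ∀ᶠ n : ℕ in atTop, K * Real.log n ≤ (n : ℝ) ^ e := by
  have h := ((isLittleO_log_rpow_atTop he).comp_tendsto tendsto_natCast_atTop_atTop).bound
    (c := 1 / (|K| + 1)) (by positivity)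
  filter_upwards [h, eventually_ge_atTop 1] with n hn h1
  have h1' : (1 : ℝ) ≤ n := by exact_mod_cast h1
  have hl := Real.log_nonneg h1'
  have hr : (0 : ℝ) ≤ (n : ℝ) ^ e := by positivity
  simp only [Function.comp_apply, Real.norm_eq_abs, abs_of_nonneg hl, abs_of_nonneg hr] at hn
  rw [div_mul_eq_mul_div, le_div_iff₀ (by positivity)] at hn
  nlinarith [mul_le_mul_of_nonneg_right (le_abs_self K) hl]

lemma eventually_const_le_rpow (K : ℝ) {e : ℝ} (he : 0 < e) :
    ∀ᶠ n : ℕ in atTop, K ≤ (n : ℝ) ^ e :=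
  ((tendsto_rpow_atTop he).comp tendsto_natCast_atTop_atTop).eventually_ge_atTop K

lemma inv_le_density_mul {n : ℕ} {p K L : ℝ} (hn : 2 ≤ n) (hK : 0 < K) (hL : 2 * K ≤ L)
    (h : (n : ℝ) / K ≤ min (p * (n - 1)) (n - p * (n - 1) - 1)) :
    0 < p ∧ p < 1 ∧ 1 / L ≤ p * (1 - p) := by
  have hn' : (2 : ℝ) ≤ n := by exact_mod_cast hn
  have hn1 : (0 : ℝ) < n - 1 := by linarith
  have hK' : 0 < 1 / K := by positivity
  have h0 : 1 / K * (n - 1) ≤ n / K := by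
    rw [div_mul_eq_mul_div, one_mul]; gcongr; linarith
  have h1 : 1 / K ≤ p :=
    le_of_mul_le_mul_right (h0.trans (h.trans (min_le_left _ _))) hn1
  have h2 : 1 / K ≤ 1 - p :=
    le_of_mul_le_mul_right (h0.trans (h.trans ((min_le_right _ _).trans_eq (by ring)))) hn1
  have h3 : 1 / L ≤ 1 / K / 2 := by
    rw [div_div, mul_comm]; exact one_div_le_one_div_of_le (by positivity) hL
  refine ⟨by linarith, by linarith, h3.trans ?_⟩
  rcases le_total p (1 / 2) with hp | hp <;> nlinarith

lemma const_mul_rpow_le {n : ℕ} {C s e f : ℝ} (hn : 1 ≤ n) (hC : C ≤ (n : ℝ) ^ (e - f)) :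
    C * (n : ℝ) ^ (s + f) ≤ (n : ℝ) ^ e * (n : ℝ) ^ s := by
  have hn' : (0 : ℝ) < n := by exact_mod_cast hn
  calc _ ≤ (n : ℝ) ^ (e - f) * (n : ℝ) ^ (s + f) := by gcongr
    _ = _ := by rw [← Real.rpow_add hn', ← Real.rpow_add hn']; ring_nf

/-- Theorem 1.3 (main theorem): asymptotic enumeration of graphs with given degrees
avoiding a given graph `X`, in the dense range. -/
theorem stmt2 (a b : ℝ) (ha : 0 < a) (hb : 0 < b) (hab : a + b < 1/2) :
    ∃ ε : ℝ, 0 < ε ∧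
      ∀ (d : (n : ℕ) → Fin n → ℕ) (X : (n : ℕ) → SimpleGraph (Fin n)),
        (∀ n, Even (∑ j, d n j)) →
        (∃ C : ℝ, ∀ (n : ℕ) (j : Fin n),
            |(d n j : ℝ) - dBar (d n)| ≤ C * (n : ℝ) ^ ((1:ℝ)/2 + ε)) →
        (∃ C : ℝ, ∀ (n : ℕ) (j : Fin n),
            (xDeg (X n) j : ℝ) ≤ C * (n : ℝ) ^ ((1:ℝ)/2 + ε)) →
        (∃ C : ℝ, ∀ n : ℕ, (xEdges (X n) : ℝ) ≤ C * (n : ℝ) ^ ((1:ℝ) + 2*ε)) →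
        (∀ᶠ n : ℕ in atTop,
            (n : ℝ) / (3 * a * Real.log n) ≤ min (dBar (d n)) ((n : ℝ) - dBar (d n) - 1)) →
        ∃ C : ℝ, ∀ᶠ n : ℕ in atTop, ∃ err : ℝ, |err| ≤ C * (n : ℝ) ^ (-b) ∧
          (gCount (d n) (X n) : ℝ) = Real.sqrt 2 * gHat (d n) (X n) *
            Real.exp (1/4 - rPar (d n)^2 / (16 * aPar (d n)^2 * (n : ℝ)^4)
              + lamb (d n) * (xEdges (X n) : ℝ)^2 / ((1 - lamb (d n)) * (n : ℝ)^2)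
              - pairSum (X n) (deltaPar (d n) (X n)) / (2 * aPar (d n) * (n : ℝ)^2)
              + err) := by
  obtain ⟨e, he⟩ : ∃ e : ℝ, e = (1 / 2 - b) / 1000 := ⟨_, rfl⟩
  have he0 : 0 < e := by rw [he]; apply div_pos <;> linarith
  refine ⟨e / 4, by positivity, fun d X hev ⟨C₁, h₁⟩ ⟨C₂, h₂⟩ ⟨C₃, h₃⟩ hmin => ⟨1, ?_⟩⟩
  filter_upwards [hmin, eventually_ge_atTop 2, eventually_const_le_rpow 1000 he0,
    eventually_log_le_rpow 20 he0, eventually_log_le_rpow (2 * (3 * a)) he0,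
    eventually_const_le_rpow C₁ (show 0 < e - e / 4 by linarith),
    eventually_const_le_rpow C₂ (show 0 < e - e / 4 by linarith),
    eventually_const_le_rpow (2 * C₃) (show 0 < e - 2 * (e / 4) by linarith)]
    with n hmin hn hL hlog hlog' hC₁ hC₂ hC₃
  have hn1 : 1 ≤ n := by omega
  have hn2 : (2 : ℝ) ≤ n := by exact_mod_cast hn
  have hn0 : (0 : ℝ) < n := by linarith
  obtain ⟨m, hm⟩ := hev n
  have hm' : ∑ v, d n v = 2 * m := by omega
  have hd : dBar (d n) = lamb (d n) * (n - 1) := by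
    rw [lamb, div_mul_cancel₀ _ (by linarith)]
  rw [hd] at hmin
  obtain ⟨hp0, hp1, hp⟩ := inv_le_density_mul hn
    (mul_pos (by positivity) (Real.log_pos (by linarith))) ((mul_assoc _ _ _).symm.trans_le hlog')
    hmin
  let c : Ctx n :=
    { L := (n : ℝ) ^ e
      p := lamb (d n)
      hL := hL
      hn := by
        rw [← Real.rpow_mul_natCast hn0.le]
        calc (n : ℝ) ^ (e * (1000 : ℕ)) ≤ (n : ℝ) ^ (1 : ℝ) :=
              Real.rpow_le_rpow_of_exponent_le (by linarith) (by rw [he]; push_cast; linarith)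
          _ = n := Real.rpow_one _
      hexp := by
        rw [← Real.exp_log hn0, ← Real.exp_nat_mul, Real.exp_log hn0]
        exact Real.exp_le_exp.2 (by exact_mod_cast hlog)
      hp := hp
      hp0 := hp0
      hp1 := hp1 }
  have hcp : c.p = lamb (d n) := rfl
  have hcL : c.L = (n : ℝ) ^ e := rfl
  have hσ : c.σ = (n : ℝ) ^ ((1 : ℝ) / 2) := Real.sqrt_eq_rpow _
  have hg : Good c 0 ⟨d n, X n⟩ :=
    { deg := fun v => by
        rw [Nat.cast_zero, add_zero, hcL, hσ, hcp, ← hd]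
        exact (h₁ n v).trans (const_mul_rpow_le hn1 hC₁)
      xdeg := fun v => by
        rw [Nat.cast_zero, add_zero, hcL, hσ, Inst.x_eq_xDeg]
        exact (h₂ n v).trans (const_mul_rpow_le hn1 hC₂)
      sumd := by
        rw [Ctx.sum_sub_μ (hcp.trans (lamb_eq hn hm')) hm', abs_zero]
        linarith [c.L_pos]
      sumx := by
        have h := const_mul_rpow_le (s := 1) hn1 hC₃
        have h' := h₃ n
        rw [← ne_eq_xEdges (d n), Inst.ne] at h'
        rw [Real.rpow_one] at h
        rw [hcL]
        linarith }
  obtain ⟨err, h, h'⟩ := gCount_formula hcp hg (hev n)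
  refine ⟨err, h.trans ?_, h'⟩
  rw [hcL, hσ, ← Real.rpow_mul_natCast hn0.le, ← Real.rpow_intCast, ← Real.rpow_mul hn0.le,
    ← Real.rpow_add hn0, one_mul]
  refine Real.rpow_le_rpow_of_exponent_le (by linarith) ?_
  push_cast
  linarith
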